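/- Let Ω ⊂ ℝ² be a bounded connected open set with boundary of class C², and let a > 1. Then there exists ε₀ > 0 such that for every ε ∈ (0, ε₀) the Neumann problem −εΔu = e^u − 1 − a·u in Ω, u > 0 in Ω, ∂_ν u = 0 on ∂Ω, admits at least one nonconstant classical solution. -/

import Mathlib

open MeasureTheory Bornology
open scoped RealInnerProductSpace

/-- The Laplacian of `u : ℝ^N → ℝ`, as the sum of the pure second derivatives along the
standard orthonormal basis of `EuclideanSpace ℝ (Fin N)`. -/
noncomputable def lap {N : ℕ} (u : EuclideanSpace ℝ (Fin N) → ℝ)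
    (x : EuclideanSpace ℝ (Fin N)) : ℝ :=
  ∑ i : Fin N, fderiv ℝ (fun y => fderiv ℝ u y (EuclideanSpace.single i (1 : ℝ))) x
    (EuclideanSpace.single i (1 : ℝ))

/-- `g` is a local `C²` defining function for `Ω` near the boundary point `x`:
`g` is `C²` on the open neighborhood `U` of `x`, with nonvanishing gradient, and
`Ω ∩ U = {g < 0} ∩ U`.  A bounded open set has boundary of class `C²` if such a defining
function exists near every boundary point; at a boundary point `x`, the gradient of `g`
points in the outward normal direction `ν(x)`. -/
def IsC2LocalDefining {N : ℕ} (Ω : Set (EuclideanSpace ℝ (Fin N)))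
    (x : EuclideanSpace ℝ (Fin N)) (U : Set (EuclideanSpace ℝ (Fin N)))
    (g : EuclideanSpace ℝ (Fin N) → ℝ) : Prop :=
  IsOpen U ∧ x ∈ U ∧ ContDiffOn ℝ 2 g U ∧ (∀ y ∈ U, gradient g y ≠ 0) ∧
    Ω ∩ U = {y ∈ U | g y < 0}

section Grp1
open MeasureTheory Bornology
open scoped RealInnerProductSpace

abbrev E2 := EuclideanSpace ℝ (Fin 2)

noncomputable section Kernels

def nn (d : ℝ) (z : E2) : ℝ := ‖z‖ ^ 2 + d ^ 2
def Lg (d : ℝ) (z : E2) : ℝ := 1 / 2 * Real.log (nn d z)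
def pk (d : ℝ) (z : E2) : E2 := (nn d z)⁻¹ • z
def rho (d : ℝ) (z : E2) : ℝ := 2 * d ^ 2 * ((nn d z)⁻¹) ^ 2
def Dpk (d : ℝ) (z : E2) : E2 →L[ℝ] E2 :=
  (nn d z)⁻¹ • ContinuousLinearMap.id ℝ E2 - (2 * ((nn d z)⁻¹) ^ 2) • (innerSL ℝ z).smulRight z

lemma nn_pos {d : ℝ} (hd : 0 < d) (z : E2) : 0 < nn d z := by unfold nn; positivity
lemma nn_pos' (d : ℝ) {z : E2} (hz : z ≠ 0) : 0 < nn d z := by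
  have := norm_pos_iff.2 hz
  unfold nn; positivity

lemma nn_contDiff (d : ℝ) {n : WithTop ℕ∞} : ContDiff ℝ n (nn d) := by
  unfold nn
  exact (contDiff_norm_sq ℝ).add contDiff_const

lemma nn_hasFDerivAt (d : ℝ) (z : E2) : HasFDerivAt (nn d) ((2 : ℝ) • innerSL ℝ z) z := by
  unfold nn
  have := (hasStrictFDerivAt_norm_sq z).hasFDerivAt.add_const (d ^ 2)
  exact this.congr_fderiv (by ext w; simp [two_smul])

lemma Lg_contDiff {d : ℝ} (hd : 0 < d) {n : WithTop ℕ∞} : ContDiff ℝ n (Lg d) := by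
  unfold Lg
  exact contDiff_const.mul ((nn_contDiff d).log (fun z => (nn_pos hd z).ne'))

lemma pk_contDiff {d : ℝ} (hd : 0 < d) {n : WithTop ℕ∞} : ContDiff ℝ n (pk d) := by
  unfold pk
  exact ((nn_contDiff d).inv (fun z => (nn_pos hd z).ne')).smul contDiff_id

lemma rho_contDiff {d : ℝ} (hd : 0 < d) {n : WithTop ℕ∞} : ContDiff ℝ n (rho d) := by
  unfold rho
  exact contDiff_const.mul (((nn_contDiff d).inv (fun z => (nn_pos hd z).ne')).pow 2)

lemma Lg_hasFDerivAt' {d : ℝ} {z : E2} (h : 0 < nn d z) :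
    HasFDerivAt (Lg d) (innerSL ℝ (pk d z)) z := by
  have := ((nn_hasFDerivAt d z).log h.ne').const_mul (1 / 2 : ℝ)
  unfold Lg
  exact this.congr_fderiv (by ext w; simp [pk, inner_smul_left]; ring)

lemma Lg_hasFDerivAt {d : ℝ} (hd : 0 < d) (z : E2) :
    HasFDerivAt (Lg d) (innerSL ℝ (pk d z)) z := Lg_hasFDerivAt' (nn_pos hd z)

lemma pk_hasFDerivAt' {d : ℝ} {z : E2} (h : 0 < nn d z) :
    HasFDerivAt (pk d) (Dpk d z) z := by
  have h1 : HasFDerivAt (fun z => (nn d z)⁻¹) _ z := (hasDerivAt_inv h.ne').comp_hasFDerivAt z (nn_hasFDerivAt d z)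
  have := h1.smul (hasFDerivAt_id z)
  unfold pk
  refine this.congr_fderiv ?_
  ext w i
  simp [Dpk, inner_smul_left]; ring

lemma pk_hasFDerivAt {d : ℝ} (hd : 0 < d) (z : E2) :
    HasFDerivAt (pk d) (Dpk d z) z := pk_hasFDerivAt' (nn_pos hd z)

lemma Dpk_apply (d : ℝ) (z w : E2) :
    Dpk d z w = (nn d z)⁻¹ • w - (2 * ((nn d z)⁻¹) ^ 2 * inner ℝ z w) • z := by
  simp [Dpk, smul_smul]

lemma Dpk_trace (d : ℝ) (z : E2) (hz : 0 < nn d z) :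
    ∑ i : Fin 2, (Dpk d z (EuclideanSpace.single i 1)) i = rho d z := by
  have h : nn d z = z 0 ^ 2 + z 1 ^ 2 + d ^ 2 := by
    unfold nn; rw [EuclideanSpace.norm_sq_eq]; simp
  have h2 : nn d z ≠ 0 := hz.ne'
  simp [Fin.sum_univ_two, Dpk_apply, rho, EuclideanSpace.inner_single_right]
  field_simp
  rw [h]; ring

lemma Dpk_symm (d : ℝ) (z v w : E2) : inner ℝ (Dpk d z v) w = inner ℝ v (Dpk d z w) := by
  simp [Dpk_apply, inner_sub_left, inner_sub_right, inner_smul_left, inner_smul_right]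
  rw [real_inner_comm z v]; ring

/-- basic scalar inequality -/
lemma frac_le_sqrt {d r : ℝ} (hd : 0 ≤ d) (hr : 0 < r) :
    d ^ 2 * (r ^ 2 + d ^ 2)⁻¹ ≤ √d * r ^ (-(1 / 2) : ℝ) := by
  obtain ⟨s, hs, rfl⟩ : ∃ s, 0 ≤ s ∧ d = s ^ 2 := ⟨√d, Real.sqrt_nonneg _, (Real.sq_sqrt hd).symm⟩
  obtain ⟨t, ht, rfl⟩ : ∃ t, 0 < t ∧ r = t ^ 2 := ⟨√r, Real.sqrt_pos.2 hr, (Real.sq_sqrt hr.le).symm⟩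
  have e : (t ^ 2) ^ (-(1 / 2) : ℝ) = t⁻¹ := by
    rw [Real.rpow_neg (by positivity), ← Real.sqrt_eq_rpow, Real.sqrt_sq ht.le]
  rw [Real.sqrt_sq hs, e]
  rw [← div_eq_mul_inv, ← div_eq_mul_inv, div_le_div_iff₀ (by positivity) ht]
  -- s^4 t ≤ s (t^4+s^4)
  have : s ^ 3 * t ≤ t ^ 4 + s ^ 4 := by
    nlinarith [sq_nonneg (s ^ 2 - t ^ 2), sq_nonneg (s * (s - t)), sq_nonneg (s - t), sq_nonneg (s*t), mul_nonneg hs ht.le, sq_nonneg (s^2 - s*t), sq_nonneg (s*t - t^2)]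
  nlinarith [mul_le_mul_of_nonneg_left this hs]

lemma frac_le_lin {d r : ℝ} (hd : 0 ≤ d) (hr : 0 < r) :
    d ^ 2 * (r ^ 2 + d ^ 2)⁻¹ ≤ d / r := by
  rw [← div_eq_mul_inv, div_le_div_iff₀ (by positivity) hr]
  nlinarith [mul_nonneg hd (sq_nonneg (r - d)), mul_nonneg hd (mul_nonneg hd hr.le), mul_nonneg hd (sq_nonneg d), mul_nonneg hd (sq_nonneg r)]

lemma nn_inv_le (d : ℝ) {z : E2} (hz : z ≠ 0) : (nn d z)⁻¹ ≤ (‖z‖ ^ 2)⁻¹ := by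
  have := norm_pos_iff.2 hz
  apply inv_anti₀ (by positivity)
  unfold nn; nlinarith [sq_nonneg d]

lemma pk_norm_le (d : ℝ) (z : E2) : ‖pk d z‖ ≤ ‖z‖⁻¹ := by
  by_cases hz : z = 0
  · simp [pk, hz]
  have h0 := norm_pos_iff.2 hz
  rw [pk, norm_smul, Real.norm_of_nonneg (inv_nonneg.2 (nn_pos' d hz).le)]
  calc _ ≤ (‖z‖ ^ 2)⁻¹ * ‖z‖ := mul_le_mul_of_nonneg_right (nn_inv_le d hz) h0.le
    _ = _ := by field_simp

lemma pk_norm_le_const {d : ℝ} (hd : 0 < d) (z : E2) : ‖pk d z‖ ≤ d⁻¹ := by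
  rw [pk, norm_smul, Real.norm_of_nonneg (inv_nonneg.2 (nn_pos hd z).le), inv_mul_eq_div,
    div_le_iff₀ (nn_pos hd z), nn]
  rw [← div_eq_inv_mul, le_div_iff₀ hd]
  nlinarith [sq_nonneg (‖z‖ - d), norm_nonneg z, sq_nonneg ‖z‖, mul_nonneg (norm_nonneg z) hd.le]

lemma Dpk_norm_le_nn {d : ℝ} {z : E2} (h : 0 < nn d z) : ‖Dpk d z‖ ≤ 3 * (nn d z)⁻¹ := by
  refine ContinuousLinearMap.opNorm_le_bound _ (by positivity) (fun w => ?_)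
  rw [Dpk_apply]
  have h1 : ‖(nn d z)⁻¹ • w‖ = (nn d z)⁻¹ * ‖w‖ := by
    rw [norm_smul, Real.norm_of_nonneg (by positivity)]
  have h2 : ‖(2 * ((nn d z)⁻¹) ^ 2 * inner ℝ z w) • z‖ ≤ 2 * (nn d z)⁻¹ * ‖w‖ := by
    rw [norm_smul, norm_mul, Real.norm_of_nonneg (by positivity)]
    have h3 : ‖inner ℝ z w‖ ≤ ‖z‖ * ‖w‖ := norm_inner_le_norm z w
    have h4 : ‖z‖ ^ 2 * (nn d z)⁻¹ ≤ 1 := by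
      rw [← div_eq_mul_inv, div_le_one h, nn]; nlinarith [sq_nonneg d]
    calc _ ≤ 2 * (nn d z)⁻¹ ^ 2 * (‖z‖ * ‖w‖) * ‖z‖ := by gcongr
      _ = 2 * (nn d z)⁻¹ * ‖w‖ * (‖z‖ ^ 2 * (nn d z)⁻¹) := by ring
      _ ≤ 2 * (nn d z)⁻¹ * ‖w‖ * 1 := by gcongr
      _ = _ := by ring
  calc _ ≤ _ := norm_sub_le _ _
    _ ≤ (nn d z)⁻¹ * ‖w‖ + 2 * (nn d z)⁻¹ * ‖w‖ := by rw [h1]; gcongr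
    _ = _ := by ring

lemma Dpk_norm_le (d : ℝ) (z : E2) (hz : z ≠ 0) : ‖Dpk d z‖ ≤ 3 * (‖z‖ ^ 2)⁻¹ := by
  refine (Dpk_norm_le_nn (nn_pos' d hz)).trans ?_
  exact mul_le_mul_of_nonneg_left (nn_inv_le d hz) (by norm_num)

lemma Dpk_norm_le_const {d : ℝ} (hd : 0 < d) (z : E2) : ‖Dpk d z‖ ≤ 3 * (d ^ 2)⁻¹ := by
  refine (Dpk_norm_le_nn (nn_pos hd z)).trans ?_
  gcongr; unfold nn; nlinarith [sq_nonneg ‖z‖]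

lemma nn_zero (z : E2) : nn 0 z = ‖z‖ ^ 2 := by simp [nn]

lemma nn_inv_diff (d : ℝ) {z : E2} (hz : z ≠ 0) :
    (nn 0 z)⁻¹ - (nn d z)⁻¹ = (d ^ 2 * (nn d z)⁻¹) * (‖z‖ ^ 2)⁻¹ := by
  have h0 := norm_pos_iff.2 hz
  have := nn_pos' d hz
  rw [nn_zero]
  field_simp
  unfold nn
  ring

lemma pk_diff_eq (d : ℝ) {z : E2} (hz : z ≠ 0) :
    ‖pk d z - pk 0 z‖ = (d ^ 2 * (nn d z)⁻¹) * ‖z‖⁻¹ := by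
  have h0 := norm_pos_iff.2 hz
  have h1 := nn_pos' d hz
  rw [pk, pk, ← sub_smul, norm_smul, norm_sub_rev, nn_inv_diff d hz,
    Real.norm_of_nonneg (by positivity)]
  field_simp

lemma pk_diff_le {d : ℝ} (hd : 0 ≤ d) (z : E2) :
    ‖pk d z - pk 0 z‖ ≤ √d * ‖z‖ ^ (-(3 / 2) : ℝ) := by
  by_cases hz : z = 0
  · simp [hz, pk]
  have h0 := norm_pos_iff.2 hz
  rw [pk_diff_eq d hz]
  have : ‖z‖ ^ (-(3 / 2) : ℝ) = ‖z‖ ^ (-(1 / 2) : ℝ) * ‖z‖⁻¹ := by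
    rw [← Real.rpow_neg_one, ← Real.rpow_add h0]; norm_num
  rw [this, ← mul_assoc]
  exact mul_le_mul_of_nonneg_right (frac_le_sqrt hd h0) (by positivity)

lemma pk_diff_le' {d : ℝ} (hd : 0 ≤ d) (z : E2) :
    ‖z‖ * ‖pk d z - pk 0 z‖ ≤ d * ‖z‖⁻¹ := by
  by_cases hz : z = 0
  · simp [hz]
  have h0 := norm_pos_iff.2 hz
  rw [pk_diff_eq d hz]
  have := frac_le_lin hd h0
  rw [div_eq_mul_inv] at this
  calc _ = d ^ 2 * (nn d z)⁻¹ := by field_simp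
    _ ≤ _ := this

lemma Dpk_diff_le {d : ℝ} (hd : 0 ≤ d) (z : E2) (hz : z ≠ 0) :
    ‖z‖ * ‖Dpk d z - Dpk 0 z‖ ≤ 5 * (√d * ‖z‖ ^ (-(3 / 2) : ℝ)) := by
  have h0 := norm_pos_iff.2 hz
  have h1 := nn_pos' d hz
  have h2 := nn_inv_le d hz
  have hA : ‖Dpk d z - Dpk 0 z‖ ≤ 5 * ((d ^ 2 * (nn d z)⁻¹) * (‖z‖ ^ 2)⁻¹) := by
    refine ContinuousLinearMap.opNorm_le_bound _ (by positivity) (fun w => ?_)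
    set D := (d ^ 2 * (nn d z)⁻¹) * (‖z‖ ^ 2)⁻¹ with hD
    have hDpos : 0 ≤ D := by positivity
    have e : (Dpk d z - Dpk 0 z) w = (-D) • w +
        (2 * (D * ((nn 0 z)⁻¹ + (nn d z)⁻¹)) * inner ℝ z w) • z := by
      have := nn_inv_diff d hz
      rw [← hD] at this
      rw [_root_.sub_apply, Dpk_apply, Dpk_apply, ← this]
      module
    rw [e]
    have h3 : ‖inner ℝ z w‖ ≤ ‖z‖ * ‖w‖ := norm_inner_le_norm z w
    have h4 : (nn 0 z)⁻¹ + (nn d z)⁻¹ ≤ 2 * (‖z‖ ^ 2)⁻¹ := by rw [nn_zero]; linarith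
    have h5 : 0 < (nn 0 z)⁻¹ + (nn d z)⁻¹ := by rw [nn_zero]; positivity
    calc _ ≤ ‖(-D) • w‖ + ‖(2 * (D * ((nn 0 z)⁻¹ + (nn d z)⁻¹)) * inner ℝ z w) • z‖ :=
          norm_add_le _ _
      _ = D * ‖w‖ + 2 * (D * ((nn 0 z)⁻¹ + (nn d z)⁻¹)) * ‖inner ℝ z w‖ * ‖z‖ := by
          rw [norm_smul, norm_smul, norm_neg, norm_mul (2 * (D * _)), Real.norm_of_nonneg hDpos,
            Real.norm_of_nonneg (show 0 ≤ 2 * (D * ((nn 0 z)⁻¹ + (nn d z)⁻¹)) by positivity)]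
      _ ≤ D * ‖w‖ + 2 * (D * (2 * (‖z‖ ^ 2)⁻¹)) * (‖z‖ * ‖w‖) * ‖z‖ := by gcongr
      _ = _ := by field_simp; ring
  have : ‖z‖ ^ (-(3 / 2) : ℝ) = ‖z‖ ^ (-(1 / 2) : ℝ) * ‖z‖⁻¹ := by
    rw [← Real.rpow_neg_one, ← Real.rpow_add h0]; norm_num
  rw [this]
  calc _ ≤ ‖z‖ * (5 * ((d ^ 2 * (nn d z)⁻¹) * (‖z‖ ^ 2)⁻¹)) := by gcongr
    _ = 5 * ((d ^ 2 * (nn d z)⁻¹) * ‖z‖⁻¹) := by field_simp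
    _ ≤ 5 * ((√d * ‖z‖ ^ (-(1 / 2) : ℝ)) * ‖z‖⁻¹) := by
        exact mul_le_mul_of_nonneg_left (mul_le_mul_of_nonneg_right (frac_le_sqrt hd h0) (by positivity)) (by norm_num)
    _ = _ := by ring

lemma Lg_diff_le {d : ℝ} (hd : 0 ≤ d) (z : E2) (hz : z ≠ 0) :
    |Lg d z - Lg 0 z| ≤ d * ‖z‖⁻¹ := by
  have h0 := norm_pos_iff.2 hz
  have h1 := nn_pos' d hz
  have h2 := nn_pos' 0 hz
  have e : Lg d z - Lg 0 z = 1 / 2 * Real.log (1 + (d * ‖z‖⁻¹) ^ 2) := by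
    rw [Lg, Lg, ← mul_sub, ← Real.log_div h1.ne' h2.ne', nn_zero, nn]
    congr 2; field_simp
  have ht : 0 ≤ d * ‖z‖⁻¹ := by positivity
  set t := d * ‖z‖⁻¹
  rw [e, abs_of_nonneg (by have := Real.log_nonneg (show (1:ℝ) ≤ 1 + t ^ 2 by nlinarith); positivity)]
  have : Real.log (1 + t ^ 2) ≤ Real.log ((1 + t) ^ 2) := by
    apply Real.log_le_log (by positivity); nlinarith
  rw [Real.log_pow] at this
  have h3 := Real.log_le_sub_one_of_pos (show 0 < 1 + t by linarith)
  push_cast at this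
  linarith

end Kernels

end Grp1

section Grp2
open MeasureTheory Bornology
open scoped RealInnerProductSpace ENNReal Topology

noncomputable section Potentials

def kk (s : ℝ) (x y : E2) : ℝ≥0∞ := ENNReal.ofReal (‖x - y‖ ^ (-s))

lemma kk_symm (s : ℝ) (x y : E2) : kk s x y = kk s y x := by
  unfold kk; rw [norm_sub_rev]

lemma kk_mul {s t : ℝ} (hs : 0 < s) (ht : 0 < t) (x y : E2) : kk s x y * kk t x y = kk (s + t) x y := by
  unfold kk
  rw [← ENNReal.ofReal_mul (by positivity)]
  congr 1
  by_cases h : ‖x - y‖ = 0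
  · rw [h, Real.zero_rpow (by linarith), Real.zero_rpow (by linarith), mul_zero,
      Real.zero_rpow (by linarith)]
  · rw [← Real.rpow_add (lt_of_le_of_ne (norm_nonneg _) (Ne.symm h))]; congr 1; ring

lemma kk_meas (s : ℝ) : Measurable (fun p : E2 × E2 => kk s p.1 p.2) := by
  unfold kk; fun_prop

lemma kk_meas1 (s : ℝ) (y : E2) : Measurable (fun x : E2 => kk s x y) := by
  unfold kk; fun_prop

lemma kk_meas2 (s : ℝ) (x : E2) : Measurable (fun y : E2 => kk s x y) := by
  unfold kk; fun_prop

lemma cs_lintegral {α : Type*} [MeasurableSpace α] {μ : Measure α} {f g : α → ℝ≥0∞}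
    (hf : AEMeasurable f μ) (hg : AEMeasurable g μ) :
    (∫⁻ x, f x * g x ∂μ) ^ 2 ≤ (∫⁻ x, f x ^ 2 ∂μ) * ∫⁻ x, g x ^ 2 ∂μ := by
  have h := ENNReal.lintegral_mul_le_Lp_mul_Lq μ Real.HolderConjugate.two_two hf hg
  have e : ∀ a : ℝ≥0∞, (a ^ (1 / 2 : ℝ)) ^ 2 = a := fun a => by
    rw [← ENNReal.rpow_natCast, ← ENNReal.rpow_mul]; norm_num
  calc _ ≤ ((∫⁻ x, f x ^ (2:ℝ) ∂μ) ^ (1 / 2 : ℝ) * (∫⁻ x, g x ^ (2:ℝ) ∂μ) ^ (1 / 2 : ℝ)) ^ 2 := by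
        gcongr; exact h
    _ = _ := by
        rw [mul_pow, e, e]; simp

lemma kk_near (s : ℝ) (hs : s < 2) (h0 : 0 < s) :
    ∫⁻ z in Metric.ball (0 : E2) 1, ENNReal.ofReal (‖z‖ ^ (-s)) < ⊤ := by
  have hm : Measurable (fun z : E2 => ‖z‖ ^ (-s)) := by fun_prop
  have : Integrable (fun z : E2 => (Set.Ioo (0:ℝ) 1).indicator (fun t => t ^ (-s)) ‖z‖) := by
    rw [integrable_fun_norm_addHaar (E := E2) volume (f := (Set.Ioo (0:ℝ) 1).indicator (fun t => t ^ (-s)))]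
    have h1 : IntegrableOn (fun t : ℝ => t ^ (1 - s)) (Set.Ioo 0 1) := by
      have := intervalIntegral.intervalIntegrable_rpow' (a := 0) (b := 1) (r := 1 - s) (by linarith)
      rw [intervalIntegrable_iff_integrableOn_Ioo_of_le (by norm_num)] at this
      exact this
    have h2 : IntegrableOn (fun y : ℝ => y ^ (Module.finrank ℝ E2 - 1) • (Set.Ioo (0:ℝ) 1).indicator (fun t => t ^ (-s)) y) (Set.Ioo 0 1) := by
      refine h1.congr_fun (fun t ht => ?_) measurableSet_Ioo
      simp [Set.indicator_of_mem ht]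
      rw [sub_eq_add_neg, Real.rpow_add ht.1, Real.rpow_one]
    refine (integrableOn_iff_integrable_of_support_subset ?_).1 h2 |>.integrableOn
    intro t ht
    by_contra h
    rw [Function.mem_support, Set.indicator_of_notMem h] at ht
    simp at ht
  have h3 := this.lintegral_lt_top
  refine lt_of_le_of_lt ?_ h3
  rw [← lintegral_indicator measurableSet_ball]
  apply lintegral_mono
  intro z
  by_cases hz : z ∈ Metric.ball (0:E2) 1
  · rw [Set.indicator_of_mem hz]
    by_cases hz0 : z = 0
    · simp [hz0, Real.zero_rpow (show -s ≠ 0 by linarith)]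
    · have : ‖z‖ ∈ Set.Ioo (0:ℝ) 1 := ⟨norm_pos_iff.2 hz0, by simpa using hz⟩
      simp only [Set.indicator_of_mem this]; rfl
  · rw [Set.indicator_of_notMem hz]; simp

lemma kk_bound {Ω : Set E2} (hb : IsBounded Ω) {s : ℝ} (h0 : 0 < s) (hs : s < 2) :
    ∃ K : ℝ≥0∞, K ≠ ⊤ ∧ ∀ y, ∫⁻ x in Ω, kk s x y ≤ K := by
  refine ⟨(∫⁻ z in Metric.ball (0 : E2) 1, ENNReal.ofReal (‖z‖ ^ (-s))) + volume Ω,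
    ENNReal.add_ne_top.2 ⟨(kk_near s hs h0).ne, hb.measure_lt_top.ne⟩, fun y => ?_⟩
  have h1 : ∀ x, kk s x y ≤ (Metric.ball y 1).indicator (fun x => kk s x y) x + 1 := by
    intro x
    by_cases hx : x ∈ Metric.ball y 1
    · rw [Set.indicator_of_mem hx]; exact le_self_add
    · rw [Set.indicator_of_notMem hx, zero_add]
      unfold kk
      rw [← ENNReal.ofReal_one]
      apply ENNReal.ofReal_le_ofReal
      apply Real.rpow_le_one_of_one_le_of_nonpos _ (by linarith)
      simpa [dist_eq_norm] using hx
  calc _ ≤ ∫⁻ x in Ω, ((Metric.ball y 1).indicator (fun x => kk s x y) x + 1) := lintegral_mono h1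
    _ = (∫⁻ x in Ω, (Metric.ball y 1).indicator (fun x => kk s x y) x) + volume Ω := by
        rw [lintegral_add_right _ measurable_const]; simp
    _ ≤ (∫⁻ x, (Metric.ball y 1).indicator (fun x => kk s x y) x) + volume Ω := by
        gcongr; exact Measure.restrict_le_self
    _ = _ := by
        congr 1
        rw [← lintegral_indicator measurableSet_ball]
        rw [← lintegral_sub_right_eq_self ((Metric.ball (0:E2) 1).indicator _) y]
        apply lintegral_congr
        intro x
        by_cases hx : x ∈ Metric.ball y 1
        · rw [Set.indicator_of_mem hx, Set.indicator_of_mem (by simpa [dist_eq_norm] using hx)]; rfl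
        · rw [Set.indicator_of_notMem hx, Set.indicator_of_notMem (by simpa [dist_eq_norm] using hx)]

section
variable {μ : Measure E2} [SFinite μ] {g : E2 → ℝ≥0∞} {K : ℝ≥0∞} {s : ℝ}

lemma kk_cs (hs : 0 < s) (hg : AEMeasurable g μ) (y : E2) :
    (∫⁻ x, kk s x y * g x ∂μ) ^ 2 ≤ (∫⁻ x, kk s x y ∂μ) * ∫⁻ x, kk s x y * g x ^ 2 ∂μ := by
  have h := cs_lintegral (μ := μ) (f := fun x => kk (s/2) x y) (g := fun x => kk (s/2) x y * g x)
    (kk_meas1 _ _).aemeasurable ((kk_meas1 _ _).aemeasurable.mul hg)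
  have e : ∀ x, kk (s/2) x y ^ 2 = kk s x y := fun x => by
    rw [sq, kk_mul (by linarith) (by linarith)]; congr 1; ring
  simp only [mul_pow, e, ← mul_assoc] at h
  simp only [← sq, e] at h
  exact h

lemma kk_fubini (hg : AEMeasurable g μ) (hK : ∀ y, ∫⁻ x, kk s x y ∂μ ≤ K) :
    ∫⁻ y, ∫⁻ x, kk s x y * g x ∂μ ∂μ ≤ K * ∫⁻ x, g x ∂μ := by
  rw [lintegral_lintegral_swap]
  · calc _ = ∫⁻ x, (∫⁻ y, kk s x y ∂μ) * g x ∂μ := by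
          congr 1; ext x; rw [lintegral_mul_const _ (kk_meas2 _ _)]
      _ ≤ ∫⁻ x, K * g x ∂μ := by
          gcongr with x
          simp_rw [kk_symm s x]; exact hK x
      _ = _ := lintegral_const_mul'' _ hg
  · exact ((kk_meas s).comp measurable_swap).aemeasurable.mul (hg.comp_snd)

lemma pot_schur (hs : 0 < s) (hg : AEMeasurable g μ) (hK : ∀ y, ∫⁻ x, kk s x y ∂μ ≤ K) :
    ∫⁻ y, (∫⁻ x, kk s x y * g x ∂μ) ^ 2 ∂μ ≤ K ^ 2 * ∫⁻ x, g x ^ 2 ∂μ := by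
  calc _ ≤ ∫⁻ y, K * ∫⁻ x, kk s x y * g x ^ 2 ∂μ ∂μ := by
        gcongr with y
        exact (kk_cs hs hg y).trans (by gcongr; exact hK y)
    _ ≤ K * ∫⁻ y, ∫⁻ x, kk s x y * g x ^ 2 ∂μ ∂μ := by
        rw [lintegral_const_mul'']
        exact (((kk_meas s).comp measurable_swap).aemeasurable.mul ((hg.pow_const 2).comp_snd)).lintegral_prod_right'
    _ ≤ K * (K * ∫⁻ x, g x ^ 2 ∂μ) := by gcongr; exact kk_fubini (hg.pow_const 2) hK
    _ = _ := by ring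

lemma pot_cs2 (hg : AEMeasurable g μ) (y : E2) :
    (∫⁻ x, kk 1 x y * g x ∂μ) ^ 2 ≤ (∫⁻ x, kk (4/3) x y ∂μ) * ∫⁻ x, kk (2/3) x y * g x ^ 2 ∂μ := by
  have h := cs_lintegral (μ := μ) (f := fun x => kk (2/3) x y) (g := fun x => kk (1/3) x y * g x)
    (kk_meas1 _ _).aemeasurable ((kk_meas1 _ _).aemeasurable.mul hg)
  have e1 : ∀ x, kk (2/3) x y ^ 2 = kk (4/3) x y := fun x => by
    rw [sq, kk_mul (by norm_num) (by norm_num)]; congr 1; ring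
  have e2 : ∀ x, kk (1/3) x y ^ 2 = kk (2/3) x y := fun x => by
    rw [sq, kk_mul (by norm_num) (by norm_num)]; congr 1; ring
  have e3 : ∀ x, kk (2/3) x y * kk (1/3) x y = kk 1 x y := fun x => by
    rw [kk_mul (by norm_num) (by norm_num)]; congr 1; norm_num
  simp only [mul_pow, e1, e2, ← mul_assoc, e3] at h
  exact h

lemma pot_L2L4 (hg : AEMeasurable g μ) (hK : ∀ y, ∫⁻ x, kk (4/3) x y ∂μ ≤ K) :
    ∫⁻ y, (∫⁻ x, kk 1 x y * g x ∂μ) ^ 4 ∂μ ≤ K ^ 3 * (∫⁻ x, g x ^ 2 ∂μ) ^ 2 := by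
  have e1 : ∀ x y, kk (2/3) x y ^ 2 = kk (4/3) x y := fun x y => by
    rw [sq, kk_mul (by norm_num) (by norm_num)]; congr 1; ring
  have h : ∀ y, (∫⁻ x, kk 1 x y * g x ∂μ) ^ 4 ≤
      K ^ 2 * (∫⁻ x, g x ^ 2 ∂μ) * ∫⁻ x, kk (4/3) x y * g x ^ 2 ∂μ := by
    intro y
    have h1 := pot_cs2 (μ := μ) hg y
    have h2 := cs_lintegral (μ := μ) (f := fun x => kk (2/3) x y * g x) (g := g)
      ((kk_meas1 _ _).aemeasurable.mul hg) hg
    simp only [mul_pow, e1, mul_assoc, ← sq] at h2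
    calc _ = ((∫⁻ x, kk 1 x y * g x ∂μ) ^ 2) ^ 2 := by ring
      _ ≤ (K * ∫⁻ x, kk (2/3) x y * g x ^ 2 ∂μ) ^ 2 := by
          gcongr; exact h1.trans (by gcongr; exact hK y)
      _ = K ^ 2 * (∫⁻ x, kk (2/3) x y * g x ^ 2 ∂μ) ^ 2 := by ring
      _ ≤ K ^ 2 * _ := mul_le_mul_right h2 _
      _ = _ := by ring
  calc _ ≤ ∫⁻ y, K ^ 2 * (∫⁻ x, g x ^ 2 ∂μ) * ∫⁻ x, kk (4/3) x y * g x ^ 2 ∂μ ∂μ := lintegral_mono h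
    _ = K ^ 2 * (∫⁻ x, g x ^ 2 ∂μ) * ∫⁻ y, ∫⁻ x, kk (4/3) x y * g x ^ 2 ∂μ ∂μ := by
        rw [lintegral_const_mul'']
        exact (((kk_meas _).comp measurable_swap).aemeasurable.mul ((hg.pow_const 2).comp_snd)).lintegral_prod_right'
    _ ≤ K ^ 2 * (∫⁻ x, g x ^ 2 ∂μ) * (K * ∫⁻ x, g x ^ 2 ∂μ) := by
        gcongr; exact kk_fubini (hg.pow_const 2) hK
    _ = _ := by ring

lemma pot_L4Linf (hg : AEMeasurable g μ) (hK : ∀ y, ∫⁻ x, kk (4/3) x y ∂μ ≤ K) (y : E2) :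
    (∫⁻ x, kk 1 x y * g x ∂μ) ^ 4 ≤ K ^ 3 * ∫⁻ x, g x ^ 4 ∂μ := by
  have e1 : ∀ x y, kk (2/3) x y ^ 2 = kk (4/3) x y := fun x y => by
    rw [sq, kk_mul (by norm_num) (by norm_num)]; congr 1; ring
  have h1 := pot_cs2 (μ := μ) hg y
  have h2 := cs_lintegral (μ := μ) (f := fun x => kk (2/3) x y) (g := fun x => g x ^ 2)
      (kk_meas1 _ _).aemeasurable (hg.pow_const 2)
  simp only [e1, ← pow_mul] at h2
  calc _ = ((∫⁻ x, kk 1 x y * g x ∂μ) ^ 2) ^ 2 := by ring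
      _ ≤ (K * ∫⁻ x, kk (2/3) x y * g x ^ 2 ∂μ) ^ 2 := by
          gcongr; exact h1.trans (by gcongr; exact hK y)
      _ = K ^ 2 * (∫⁻ x, kk (2/3) x y * g x ^ 2 ∂μ) ^ 2 := by ring
      _ ≤ K ^ 2 * (K * ∫⁻ x, g x ^ 4 ∂μ) := by
          gcongr; exact h2.trans (by gcongr; exact hK y)
      _ = _ := by ring

lemma pot_L2Linf (hg : AEMeasurable g μ) (hK : ∀ y, ∫⁻ x, kk 1 x y ∂μ ≤ K) (y : E2) :
    (∫⁻ x, kk (1/2) x y * g x ∂μ) ^ 2 ≤ K * ∫⁻ x, g x ^ 2 ∂μ := by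
  have e1 : ∀ x y, kk (1/2) x y ^ 2 = kk 1 x y := fun x y => by
    rw [sq, kk_mul (by norm_num) (by norm_num)]; congr 1; norm_num
  have h2 := cs_lintegral (μ := μ) (f := fun x => kk (1/2) x y) (g := g)
      (kk_meas1 _ _).aemeasurable hg
  simp only [e1] at h2
  exact h2.trans (by gcongr; exact hK y)

end

/-! ### the approximate identity -/

def c0 : ℝ := ∫ z : E2, rho 1 z

lemma rho_nonneg (d : ℝ) (z : E2) : 0 ≤ rho d z := by
  unfold rho; positivity

lemma rho_integrable : Integrable (rho 1) := by
  have := integrable_rpow_neg_one_add_norm_sq (E := E2) (μ := volume) (r := 4) (by simp; norm_num)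
  refine (this.const_mul 2).congr (Filter.Eventually.of_forall fun z => ?_)
  simp only [rho, nn]
  have h : (0:ℝ) < 1 + ‖z‖ ^ 2 := by positivity
  have : (1 + ‖z‖ ^ 2) ^ (-(4:ℝ) / 2) = ((1 + ‖z‖ ^ 2)⁻¹) ^ 2 := by
    rw [show (-(4:ℝ)/2) = -(2:ℕ) by norm_num, Real.rpow_neg h.le, Real.rpow_natCast, inv_pow]
  rw [this]; ring_nf

lemma c0_pos : 0 < c0 := by
  unfold c0
  rw [integral_pos_iff_support_of_nonneg (rho_nonneg 1) rho_integrable]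
  have : Function.support (rho 1) = Set.univ := by
    ext z; simp [rho, (nn_pos one_pos z).ne']
  rw [this]; simp

lemma rho_scale {d : ℝ} (hd : 0 < d) (z : E2) : rho d (d • z) = (d ^ 2)⁻¹ * rho 1 z := by
  have h := nn_pos one_pos z
  have : nn d (d • z) = d ^ 2 * nn 1 z := by
    simp only [nn, norm_smul, Real.norm_of_nonneg hd.le]; ring
  rw [rho, this, rho]
  field_simp

lemma rho_conv {d : ℝ} (hd : 0 < d) (ψ : E2 → ℝ) (x : E2) :
    ∫ y, ψ y * rho d (x - y) = ∫ z, ψ (x - d • z) * rho 1 z := by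
  rw [← integral_sub_left_eq_self _ volume x]
  have := Measure.integral_comp_smul (volume : Measure E2) (fun y => ψ (x - y) * rho d y) d
  simp only [rho_scale hd] at this
  simp only [sub_sub_cancel]
  have h2 : Module.finrank ℝ E2 = 2 := by simp
  rw [h2, abs_of_pos (by positivity), smul_eq_mul] at this
  have h3 : ∫ x_1, ψ (x - d • x_1) * ((d ^ 2)⁻¹ * rho 1 x_1) = (d^2)⁻¹ * ∫ z, ψ (x - d • z) * rho 1 z := by
    rw [← integral_const_mul]; congr 1; ext z; ring
  rw [h3] at this
  have h4 : (d ^ 2)⁻¹ ≠ 0 := by positivity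
  exact (mul_left_cancel₀ h4 this).symm

lemma rho_conv_bound {d : ℝ} (hd : 0 < d) {ψ : E2 → ℝ} {B : ℝ} (hB : ∀ x, |ψ x| ≤ B) (x : E2) :
    |∫ y, ψ y * rho d (x - y)| ≤ B * c0 := by
  rw [rho_conv hd, c0, ← integral_const_mul]
  refine norm_integral_le_of_norm_le (f := fun z => ψ (x - d • z) * rho 1 z) (rho_integrable.const_mul B) (Filter.Eventually.of_forall fun z => ?_)
  rw [norm_mul, Real.norm_of_nonneg (rho_nonneg 1 z)]
  exact mul_le_mul_of_nonneg_right (hB _) (rho_nonneg 1 z)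

lemma rho_conv_tendsto {ψ : E2 → ℝ} (hψ : Continuous ψ) {B : ℝ} (hB : ∀ x, |ψ x| ≤ B)
    {δ : ℕ → ℝ} (hδ : ∀ n, 0 < δ n) (hδ0 : Filter.Tendsto δ Filter.atTop (𝓝 0)) (x : E2) :
    Filter.Tendsto (fun n => ∫ y, ψ y * rho (δ n) (x - y)) Filter.atTop (𝓝 (c0 * ψ x)) := by
  have e : c0 * ψ x = ∫ z, ψ x * rho 1 z := by rw [integral_const_mul, c0, mul_comm]
  rw [e]
  simp_rw [rho_conv (hδ _)]
  refine tendsto_integral_of_dominated_convergence (fun z => B * rho 1 z) (fun n => ?_)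
    (rho_integrable.const_mul B) (fun n => Filter.Eventually.of_forall fun z => ?_)
    (Filter.Eventually.of_forall fun z => ?_)
  · have := (rho_contDiff one_pos (n := 0)).continuous
    exact (by fun_prop : Continuous _).aestronglyMeasurable
  · rw [norm_mul, Real.norm_of_nonneg (rho_nonneg 1 z)]
    exact mul_le_mul_of_nonneg_right (hB _) (rho_nonneg 1 z)
  · apply Filter.Tendsto.mul_const
    have h1 : Filter.Tendsto (fun n => x - δ n • z) Filter.atTop (𝓝 (x - (0:ℝ) • z)) :=
      (hδ0.smul_const z).const_sub x
    simp only [zero_smul, sub_zero] at h1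
    exact (hψ.tendsto x).comp h1

end Potentials

end Grp2

section Grp3
open MeasureTheory Bornology
open scoped RealInnerProductSpace ENNReal Topology ContDiff

noncomputable section Chart

abbrev ee (i : Fin 2) : E2 := EuclideanSpace.single i 1

/-- globalisation of a locally `C^n` map -/
lemma globalize {E F : Type*} [NormedAddCommGroup E] [NormedSpace ℝ E] [FiniteDimensional ℝ E]
    [NormedAddCommGroup F] [NormedSpace ℝ F] {f : E → F} {x : E} (hf : ContDiffAt ℝ 2 f x) :
    ∃ h : E → F, ContDiff ℝ 2 h ∧ HasCompactSupport h ∧ h =ᶠ[𝓝 x] f := by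
  obtain ⟨u, hu, hfu⟩ := hf.contDiffOn le_rfl (by simp)
  obtain ⟨V, hVu, hVo, hxV⟩ := mem_nhds_iff.1 (show u ∈ 𝓝 x by simpa using hu)
  have hfV := hfu.mono hVu
  obtain ⟨R, hR, hRV⟩ := Metric.isOpen_iff.1 hVo x hxV
  haveI : HasContDiffBump E := inferInstance
  let χ : ContDiffBump x := ⟨R / 4, R / 2, by positivity, by linarith⟩
  refine ⟨fun y => χ y • f y, ?_, ?_, ?_⟩
  · rw [contDiff_iff_contDiffAt]
    intro y
    by_cases hy : y ∈ V
    · exact (χ.contDiff.contDiffAt).smul (hfV.contDiffAt (hVo.mem_nhds hy))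
    · have h1 : y ∉ tsupport χ := by
        rw [χ.tsupport_eq]
        intro h; apply hy; apply hRV
        simp only [Metric.mem_closedBall, Metric.mem_ball] at h ⊢
        have : χ.rOut = R / 2 := rfl
        linarith
      have h2 : (fun y => χ y • f y) =ᶠ[𝓝 y] fun _ => 0 := by
        have := (isClosed_tsupport χ).isOpen_compl.mem_nhds h1
        filter_upwards [this] with z hz
        rw [image_eq_zero_of_notMem_tsupport hz, zero_smul]
      exact contDiffAt_const.congr_of_eventuallyEq h2
  · exact χ.hasCompactSupport.smul_right
  · filter_upwards [χ.eventuallyEq_one] with y hy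
    rw [hy]; simp

lemma inv_fn {f : E2 → E2} {x : E2} (hf : ContDiffAt ℝ 2 f x)
    (hinj : Function.Injective (fderiv ℝ f x)) :
    ∃ g : E2 → E2, ContDiffAt ℝ 2 g (f x) ∧ g (f x) = x ∧ (∀ᶠ p in 𝓝 x, g (f p) = p) ∧
      (∀ᶠ y in 𝓝 (f x), f (g y) = y) := by
  let e : E2 ≃L[ℝ] E2 :=
    (LinearEquiv.ofInjectiveEndo (fderiv ℝ f x : E2 →ₗ[ℝ] E2) hinj).toContinuousLinearEquiv
  have he : (e : E2 →L[ℝ] E2) = fderiv ℝ f x := by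
    ext1 w; rfl
  have hd : HasFDerivAt f (e : E2 →L[ℝ] E2) x := by
    rw [he]; exact (hf.differentiableAt (by norm_num)).hasFDerivAt
  have hst : HasStrictFDerivAt f (e : E2 →L[ℝ] E2) x := hf.hasStrictFDerivAt' hd (by norm_num)
  refine ⟨hf.localInverse hd (by norm_num), hf.to_localInverse hd (by norm_num),
    hst.localInverse_apply_image, hst.eventually_left_inverse, hst.eventually_right_inverse⟩

def JJ : E2 →L[ℝ] E2 :=
  -((EuclideanSpace.proj (1 : Fin 2) : E2 →L[ℝ] ℝ).smulRight (ee 0)) +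
  (EuclideanSpace.proj (0 : Fin 2) : E2 →L[ℝ] ℝ).smulRight (ee 1)

@[simp] lemma JJ_0 (x : E2) : JJ x 0 = - x 1 := by simp [JJ]
@[simp] lemma JJ_1 (x : E2) : JJ x 1 = x 0 := by simp [JJ]

lemma inner2 (x y : E2) : inner ℝ x y = x 0 * y 0 + x 1 * y 1 := by
  rw [PiLp.inner_apply]; simp [Fin.sum_univ_two]; ring

lemma ext2 {x y : E2} (h0 : x 0 = y 0) (h1 : x 1 = y 1) : x = y := by
  ext i; fin_cases i <;> assumption

lemma eq2 (x : E2) : x = x 0 • ee 0 + x 1 • ee 1 := by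
  apply ext2 <;> simp

/-- curve parametrising the boundary -/
lemma curve {g : E2 → ℝ} {x0 : E2} (hg : ContDiffAt ℝ 2 g x0) (h0 : g x0 = 0)
    (hn : gradient g x0 ≠ 0) :
    ∃ γ : ℝ → E2, ContDiff ℝ 2 γ ∧ γ 0 = x0 ∧ (∀ᶠ s in 𝓝 0, g (γ s) = 0) ∧
      0 < fderiv ℝ g x0 (JJ (deriv γ 0)) := by
  set n := gradient g x0
  have hDg : ∀ w, fderiv ℝ g x0 w = inner ℝ n w := fun w => by
    rw [show n = gradient g x0 from rfl, gradient, InnerProductSpace.toDual_symm_apply]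
  have hgd : HasFDerivAt g (fderiv ℝ g x0) x0 := (hg.differentiableAt (by norm_num)).hasFDerivAt
  have hnn : 0 < n 0 ^ 2 + n 1 ^ 2 := by
    have : 0 < ‖n‖ ^ 2 := by have := norm_pos_iff.2 hn; positivity
    rwa [EuclideanSpace.norm_sq_eq, Fin.sum_univ_two, Real.norm_eq_abs, Real.norm_eq_abs, sq_abs, sq_abs] at this
  -- the straightening map
  let Φ : E2 → E2 := fun x => (n 1 * (x - x0) 0 - n 0 * (x - x0) 1) • ee 0 + g x • ee 1
  have hΦ : ContDiffAt ℝ 2 Φ x0 := by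
    have : ContDiff ℝ 2 (fun x : E2 => (n 1 * (x - x0) 0 - n 0 * (x - x0) 1) • ee 0) := by
      simp only [PiLp.sub_apply]
      fun_prop
    exact this.contDiffAt.add (hg.smul contDiffAt_const)
  have hΦ0 : Φ x0 = 0 := by simp [Φ, h0]
  have hΦd : HasFDerivAt Φ (((n 1 • (EuclideanSpace.proj (0 : Fin 2) : E2 →L[ℝ] ℝ) - n 0 • (EuclideanSpace.proj (1 : Fin 2) : E2 →L[ℝ] ℝ)).smulRight (ee 0)) + (fderiv ℝ g x0).smulRight (ee 1)) x0 := by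
    apply HasFDerivAt.add
    · apply HasFDerivAt.smul_const
      have h := ((n 1 • (EuclideanSpace.proj (0 : Fin 2) : E2 →L[ℝ] ℝ) - n 0 • (EuclideanSpace.proj (1 : Fin 2) : E2 →L[ℝ] ℝ)).hasFDerivAt (x := x0)).sub_const ((n 1 • (EuclideanSpace.proj (0 : Fin 2) : E2 →L[ℝ] ℝ) - n 0 • (EuclideanSpace.proj (1 : Fin 2) : E2 →L[ℝ] ℝ)) x0)
      refine h.congr_of_eventuallyEq (Filter.Eventually.of_forall fun x => ?_)
      simp; ring
    · exact hgd.smul_const _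
  have hinj : Function.Injective (fderiv ℝ Φ x0) := by
    rw [hΦd.fderiv, injective_iff_map_eq_zero]
    intro w hw
    have a0 := congrArg (fun v : E2 => v 0) hw
    have a1 := congrArg (fun v : E2 => v 1) hw
    simp [hDg, inner2] at a0 a1
    apply ext2
    · have : (n 0 ^ 2 + n 1 ^ 2) * w 0 = 0 := by linear_combination n 1 * a0 + n 0 * a1
      simpa [hnn.ne'] using this
    · have : (n 0 ^ 2 + n 1 ^ 2) * w 1 = 0 := by linear_combination -n 0 * a0 + n 1 * a1
      simpa [hnn.ne'] using this
  obtain ⟨G, hG, hG0, -, hGr⟩ := inv_fn hΦ hinj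
  rw [hΦ0] at hG hG0 hGr
  have hline : Continuous (fun s : ℝ => s • ee 0) := by fun_prop
  have hγ1 : ContDiffAt ℝ 2 (fun s : ℝ => G (s • ee 0)) 0 := by
    apply ContDiffAt.comp
    · simpa using hG
    · fun_prop
  obtain ⟨γ, hγ, -, hγe⟩ := globalize hγ1
  have hev : ∀ᶠ s in 𝓝 (0:ℝ), Φ (γ s) = s • ee 0 := by
    have : Filter.Tendsto (fun s : ℝ => s • ee 0) (𝓝 0) (𝓝 0) := by
      have := hline.tendsto 0; simpa using this
    filter_upwards [this.eventually hGr, hγe] with s hs hs2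
    rw [hs2]; exact hs
  have hγ0 : γ 0 = x0 := by rw [hγe.self_of_nhds]; simpa using hG0
  refine ⟨γ, hγ, hγ0, ?_, ?_⟩
  · filter_upwards [hev] with s hs
    have := congrArg (fun v : E2 => v 1) hs
    simpa [Φ] using this
  · have hγd : HasDerivAt γ (deriv γ 0) 0 := (hγ.differentiable (by norm_num) 0).hasDerivAt
    have h1 : HasDerivAt (fun s => Φ (γ s)) (fderiv ℝ Φ x0 (deriv γ 0)) 0 := by
      have : HasFDerivAt Φ (fderiv ℝ Φ x0) (γ 0) := by
        rw [hγ0]; exact (hΦ.differentiableAt (by norm_num)).hasFDerivAt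
      exact this.comp_hasDerivAt 0 hγd
    have h2 : HasDerivAt (fun s : ℝ => s • ee 0) ((1:ℝ) • ee 0) 0 := (hasDerivAt_id (0:ℝ)).smul_const _
    have h3 := h1.unique (h2.congr_of_eventuallyEq hev)
    rw [hΦd.fderiv] at h3
    set τ := deriv γ 0
    have a0 := congrArg (fun v : E2 => v 0) h3
    have a1 := congrArg (fun v : E2 => v 1) h3
    simp [hDg, inner2] at a0 a1
    rw [hDg, inner2, JJ_0, JJ_1]
    linarith

end Chart


noncomputable section Chart2

lemma defining_zero {Ω : Set E2} (ho : IsOpen Ω) {x0 : E2} (hx : x0 ∈ frontier Ω) {U g}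
    (h : IsC2LocalDefining Ω x0 U g) : g x0 = 0 := by
  obtain ⟨hU, hxU, hg, hgr, hΩ⟩ := h
  have hx1 : x0 ∉ Ω := by
    rw [ho.frontier_eq] at hx; exact hx.2
  have hx2 : x0 ∈ closure Ω := frontier_subset_closure hx
  apply le_antisymm
  · by_contra hpos
    push Not at hpos
    have hc : ContinuousAt g x0 := (hg.continuousOn).continuousAt (hU.mem_nhds hxU)
    have : ∀ᶠ y in 𝓝 x0, 0 < g y ∧ y ∈ U := (hc.eventually (lt_mem_nhds hpos)).and (hU.mem_nhds hxU)
    rw [mem_closure_iff_frequently] at hx2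
    obtain ⟨y, hy1, hy2, hy3⟩ := (hx2.and_eventually this).exists
    have : y ∈ Ω ∩ U := ⟨hy1, hy3⟩
    rw [hΩ] at this
    linarith [this.2]
  · by_contra hneg
    push Not at hneg
    have : x0 ∈ Ω ∩ U := by rw [hΩ]; exact ⟨hxU, hneg⟩
    exact hx1 this.1

def psi (γ : ℝ → E2) (p : E2) : E2 :=
  (1/2 : ℝ) • (γ (p 0 + p 1) + γ (p 0 - p 1)) + (1/2 : ℝ) • JJ (γ (p 0 + p 1) - γ (p 0 - p 1))

lemma psi_contDiff {γ : ℝ → E2} (hγ : ContDiff ℝ 2 γ) : ContDiff ℝ 2 (psi γ) := by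
  unfold psi
  have h1 : ContDiff ℝ 2 (fun p : E2 => γ (p 0 + p 1)) := hγ.comp (by fun_prop)
  have h2 : ContDiff ℝ 2 (fun p : E2 => γ (p 0 - p 1)) := hγ.comp (by fun_prop)
  exact ((h1.add h2).const_smul (1/2:ℝ)).add ((JJ.contDiff.comp (h1.sub h2)).const_smul (1/2:ℝ))

lemma psi_fderiv {γ : ℝ → E2} (hγ : ContDiff ℝ 2 γ) {p : E2} (hp : p 1 = 0) (w : E2) :
    fderiv ℝ (psi γ) p w = w 0 • deriv γ (p 0) + w 1 • JJ (deriv γ (p 0)) := by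
  have hd : ∀ s, HasDerivAt γ (deriv γ s) s := fun s => (hγ.differentiable (by norm_num) s).hasDerivAt
  have hP0 : HasFDerivAt (fun p : E2 => p 0) (EuclideanSpace.proj (0 : Fin 2) : E2 →L[ℝ] ℝ) p :=
    (EuclideanSpace.proj (0 : Fin 2) : E2 →L[ℝ] ℝ).hasFDerivAt
  have hP1 : HasFDerivAt (fun p : E2 => p 1) (EuclideanSpace.proj (1 : Fin 2) : E2 →L[ℝ] ℝ) p :=
    (EuclideanSpace.proj (1 : Fin 2) : E2 →L[ℝ] ℝ).hasFDerivAt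
  have h1 : HasFDerivAt (fun p : E2 => γ (p 0 + p 1)) _ p :=
    (hd (p 0 + p 1)).hasFDerivAt.comp p (hP0.add hP1)
  have h2 : HasFDerivAt (fun p : E2 => γ (p 0 - p 1)) _ p :=
    (hd (p 0 - p 1)).hasFDerivAt.comp p (hP0.sub hP1)
  have h3 : HasFDerivAt (psi γ) _ p := ((h1.add h2).const_smul (1/2 : ℝ)).add
    ((JJ.hasFDerivAt.comp p (h1.sub h2)).const_smul (1/2 : ℝ))
  rw [h3.fderiv]
  simp [hp]
  module

structure Chart (Ω : Set E2) (x0 : E2) where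
  Ψ : E2 → E2
  Θ : E2 → E2
  ρ : ℝ
  K : NNReal
  hΨ : ContDiff ℝ 2 Ψ
  hΘ : ContDiff ℝ 2 Θ
  hρ : 0 < ρ
  lΨ : LipschitzWith K Ψ
  lΘ : LipschitzWith K Θ
  Θ0 : Θ x0 = 0
  left : ∀ p ∈ Metric.ball (0:E2) ρ, Θ (Ψ p) = p
  right : ∀ x ∈ Metric.ball x0 ρ, Ψ (Θ x) = x
  mem : ∀ p ∈ Metric.ball (0:E2) ρ, (Ψ p ∈ Ω ↔ p 1 < 0)
  conf : ∀ p ∈ Metric.ball (0:E2) ρ, p 1 = 0 → fderiv ℝ Ψ p (ee 1) = JJ (fderiv ℝ Ψ p (ee 0))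

lemma exists_chart {Ω : Set E2} (ho : IsOpen Ω) {x0 : E2} (hx : x0 ∈ frontier Ω) {U g}
    (h : IsC2LocalDefining Ω x0 U g) : Nonempty (Chart Ω x0) := by
  have hg0 := defining_zero ho hx h
  obtain ⟨hU, hxU, hg, hgr, hΩ⟩ := h
  have hgA : ContDiffAt ℝ 2 g x0 := hg.contDiffAt (hU.mem_nhds hxU)
  obtain ⟨γ, hγ, hγ0, hgγ, hpos⟩ := curve hgA hg0 (hgr x0 hxU)
  have hΨ' := psi_contDiff hγ
  have hΨ0 : psi γ 0 = x0 := by simp [psi, hγ0, ← two_smul ℝ x0]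
  set τ := deriv γ 0 with hτdef
  have hτ : τ ≠ 0 := by
    intro h0; rw [h0] at hpos; simp at hpos
  have hinj : Function.Injective (fderiv ℝ (psi γ) 0) := by
    rw [injective_iff_map_eq_zero]
    intro w hw
    rw [psi_fderiv hγ (by simp)] at hw
    have a0 := congrArg (fun v : E2 => v 0) hw
    have a1 := congrArg (fun v : E2 => v 1) hw
    have hnn : 0 < τ 0 ^ 2 + τ 1 ^ 2 := by
      have : 0 < ‖τ‖ ^ 2 := by have := norm_pos_iff.2 hτ; positivity
      rwa [EuclideanSpace.norm_sq_eq, Fin.sum_univ_two, Real.norm_eq_abs, Real.norm_eq_abs, sq_abs, sq_abs] at this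
    simp [← hτdef] at a0 a1
    apply ext2
    · have : (τ 0 ^ 2 + τ 1 ^ 2) * w 0 = 0 := by linear_combination τ 0 * a0 + τ 1 * a1
      simpa [hnn.ne'] using this
    · have : (τ 0 ^ 2 + τ 1 ^ 2) * w 1 = 0 := by linear_combination -τ 1 * a0 + τ 0 * a1
      simpa [hnn.ne'] using this
  obtain ⟨G, hG, hG0, hGl, hGr⟩ := inv_fn hΨ'.contDiffAt hinj
  rw [hΨ0] at hG hG0 hGr
  obtain ⟨Θ, hΘ, hΘc, hΘG⟩ := globalize hG
  obtain ⟨Ψ, hΨ, hΨc, hΨp⟩ := globalize (hΨ'.contDiffAt (x := (0:E2)))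
  obtain ⟨K1, hK1⟩ := hΘ.lipschitzWith_of_hasCompactSupport hΘc (by norm_num)
  obtain ⟨K2, hK2⟩ := hΨ.lipschitzWith_of_hasCompactSupport hΨc (by norm_num)
  have hΘ0 : Θ x0 = 0 := by rw [hΘG.self_of_nhds, hG0]
  have hΨz : Ψ 0 = x0 := by rw [hΨp.self_of_nhds, hΨ0]
  -- events near 0
  have e1 : ∀ᶠ p in 𝓝 (0:E2), Θ (Ψ p) = p := by
    have : ∀ᶠ p in 𝓝 (0:E2), Θ (Ψ p) = G (Ψ p) := by
      have : Filter.Tendsto Ψ (𝓝 0) (𝓝 x0) := by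
        have := hΨ.continuous.tendsto 0; rwa [hΨz] at this
      exact this.eventually hΘG
    filter_upwards [this, hΨp, hGl] with p h1 h2 h3
    rw [h1, h2, h3]
  have e2 : ∀ᶠ x in 𝓝 x0, Ψ (Θ x) = x := by
    have : ∀ᶠ x in 𝓝 x0, Ψ (Θ x) = psi γ (Θ x) := by
      have : Filter.Tendsto Θ (𝓝 x0) (𝓝 0) := by
        have := hΘ.continuous.tendsto x0; rwa [hΘ0] at this
      exact this.eventually hΨp
    filter_upwards [this, hΘG, hGr] with p h1 h2 h3
    rw [h1, h2, h3]
  have e3 : ∀ᶠ p in 𝓝 (0:E2), Ψ p ∈ U := by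
    have : Filter.Tendsto Ψ (𝓝 0) (𝓝 x0) := by
      have := hΨ.continuous.tendsto 0; rwa [hΨz] at this
    exact this.eventually (hU.mem_nhds hxU)
  have hk : ContDiffAt ℝ 2 (fun p => g (Ψ p)) 0 := by
    apply ContDiffAt.comp
    · rw [hΨz]; exact hgA
    · exact hΨ.contDiffAt
  have e4 : ∀ᶠ p in 𝓝 (0:E2), 0 < fderiv ℝ (fun p => g (Ψ p)) p (ee 1) := by
    have hc : ContinuousAt (fun p => fderiv ℝ (fun p => g (Ψ p)) p (ee 1)) 0 :=
      ((hk.fderiv_right (m := 1) (by norm_num)).continuousAt).clm_apply continuousAt_const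
    refine hc.eventually (lt_mem_nhds ?_)
    have c1 : HasFDerivAt (fun p => g (Ψ p)) ((fderiv ℝ g x0).comp (fderiv ℝ Ψ 0)) 0 := by
      apply HasFDerivAt.comp
      · rw [hΨz]; exact (hgA.differentiableAt (by norm_num)).hasFDerivAt
      · exact (hΨ.differentiable (by norm_num) 0).hasFDerivAt
    show 0 < (fderiv ℝ (fun p => g (Ψ p)) 0) (ee 1)
    rw [c1.fderiv, ContinuousLinearMap.comp_apply, hΨp.fderiv_eq, psi_fderiv hγ (by simp)]
    simpa using hpos
  have e5 : ∀ᶠ p in 𝓝 (0:E2), g (γ (p 0)) = 0 := by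
    have : Filter.Tendsto (fun p : E2 => p 0) (𝓝 0) (𝓝 0) := by
      have : Continuous (fun p : E2 => p 0) := by fun_prop
      simpa using this.tendsto 0
    exact this.eventually hgγ
  have e6 : ∀ᶠ p in 𝓝 (0:E2), DifferentiableAt ℝ (fun p => g (Ψ p)) p := by
    filter_upwards [e3] with p hp
    exact ((hg.contDiffAt (hU.mem_nhds hp)).differentiableAt (by norm_num)).comp p (hΨ.differentiable (by norm_num) p)
  have e7 := hΨp.eventually_nhds
  obtain ⟨ρ1, hρ1, H1⟩ := Metric.eventually_nhds_iff_ball.1 (e1.and (e3.and (e4.and (e5.and (e6.and e7)))))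
  obtain ⟨ρ2, hρ2, H2⟩ := Metric.eventually_nhds_iff_ball.1 e2
  refine ⟨⟨Ψ, Θ, min ρ1 ρ2, max K1 K2, hΨ, hΘ, lt_min hρ1 hρ2, hK2.weaken (le_max_right _ _),
    hK1.weaken (le_max_left _ _), hΘ0, ?_, ?_, ?_, ?_⟩⟩
  · intro p hp
    exact (H1 p (Metric.ball_subset_ball (min_le_left _ _) hp)).1
  · intro x hx
    exact H2 x (Metric.ball_subset_ball (min_le_right _ _) hx)
  · intro p hp
    replace hp := Metric.ball_subset_ball (min_le_left _ _) hp
    have hpU := (H1 p hp).2.1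
    have key : ∃ c > 0, g (Ψ p) = c * p 1 := by
      -- mean value along the vertical segment
      let q : ℝ → E2 := fun t => p 0 • ee 0 + t • ee 1
      have hq : ∀ t, |t| ≤ |p 1| → q t ∈ Metric.ball (0:E2) ρ1 := by
        intro t ht
        rw [mem_ball_zero_iff] at hp ⊢
        refine lt_of_le_of_lt ?_ hp
        rw [EuclideanSpace.norm_eq, EuclideanSpace.norm_eq]
        apply Real.sqrt_le_sqrt
        have := sq_le_sq.2 ht
        simp [Fin.sum_univ_two, q]
        exact this
      have hq0 : g (Ψ (q 0)) = 0 := by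
        have h1 := H1 _ (hq 0 (by simp))
        have h2 := h1.2.2.2.2.2.self_of_nhds
        have h3 := h1.2.2.2.1
        rw [h2]
        simpa [psi, q, ← two_smul ℝ] using h3
      have hqp : q (p 1) = p := (eq2 p).symm
      have hqd : ∀ t, |t| ≤ |p 1| → HasDerivAt (fun t => g (Ψ (q t))) (fderiv ℝ (fun p => g (Ψ p)) (q t) (ee 1)) t := by
        intro t ht
        have h1 := (H1 _ (hq t ht)).2.2.2.2.1.hasFDerivAt
        have h2 : HasDerivAt q (ee 1) t := by
          have := ((hasDerivAt_id t).smul_const (ee 1)).const_add (p 0 • ee 0)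
          rw [one_smul] at this
          exact this
        exact h1.comp_hasDerivAt t h2
      rcases lt_trichotomy (p 1) 0 with h | h | h
      · obtain ⟨c, hc, hc2⟩ := exists_hasDerivAt_eq_slope (fun t => g (Ψ (q t))) (fun t => fderiv ℝ (fun p => g (Ψ p)) (q t) (ee 1)) h
          (fun t ht => (hqd t (by rw [abs_of_nonpos ht.2, abs_of_neg h]; linarith [ht.1])).continuousAt.continuousWithinAt)
          (fun t ht => hqd t (by rw [abs_of_nonpos ht.2.le, abs_of_neg h]; linarith [ht.1]))
        simp only [hq0, hqp] at hc2
        refine ⟨_, (H1 _ (hq c (by rw [abs_of_nonpos hc.2.le, abs_of_neg h]; linarith [hc.1]))).2.2.1, ?_⟩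
        rw [hc2]; field_simp; ring
      · refine ⟨1, one_pos, ?_⟩
        rw [h, mul_zero, ← hqp, h, hq0]
      · obtain ⟨c, hc, hc2⟩ := exists_hasDerivAt_eq_slope (fun t => g (Ψ (q t))) (fun t => fderiv ℝ (fun p => g (Ψ p)) (q t) (ee 1)) h
          (fun t ht => (hqd t (by rw [abs_of_nonneg ht.1, abs_of_pos h]; linarith [ht.2])).continuousAt.continuousWithinAt)
          (fun t ht => hqd t (by rw [abs_of_nonneg ht.1.le, abs_of_pos h]; linarith [ht.2]))
        simp only [hq0, hqp] at hc2
        refine ⟨_, (H1 _ (hq c (by rw [abs_of_nonneg hc.1.le, abs_of_pos h]; linarith [hc.2]))).2.2.1, ?_⟩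
        rw [hc2]; field_simp; ring
    obtain ⟨c, hc, hgc⟩ := key
    have : Ψ p ∈ Ω ↔ g (Ψ p) < 0 := by
      constructor
      · intro h
        have : Ψ p ∈ Ω ∩ U := ⟨h, hpU⟩
        rw [hΩ] at this; exact this.2
      · intro h
        have : Ψ p ∈ Ω ∩ U := by rw [hΩ]; exact ⟨hpU, h⟩
        exact this.1
    rw [this, hgc]
    constructor
    · intro h; by_contra h2; push Not at h2; nlinarith [mul_nonneg hc.le h2]
    · intro h; exact mul_neg_of_pos_of_neg hc h
  · intro p hp hp1
    replace hp := Metric.ball_subset_ball (min_le_left _ _) hp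
    have h7 := (H1 p hp).2.2.2.2.2
    have h8 : Ψ =ᶠ[𝓝 p] psi γ := h7
    rw [h8.fderiv_eq, psi_fderiv hγ hp1, psi_fderiv hγ hp1]
    simp

end Chart2


noncomputable section Flux

def dv (X : E2 → E2) (x : E2) : ℝ := (fderiv ℝ X x (ee 0)) 0 + (fderiv ℝ X x (ee 1)) 1

lemma int_fderiv_zero {ψ : E2 → ℝ} (hψ : ContDiff ℝ 1 ψ) (hc : HasCompactSupport ψ) (v : E2) :
    ∫ x, fderiv ℝ ψ x v = 0 := by
  obtain ⟨K, hK⟩ := hψ.lipschitzWith_of_hasCompactSupport hc (by norm_num)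
  have h := LipschitzWith.integral_lineDeriv_mul_eq (μ := (volume : Measure E2))
    (LipschitzWith.const (1:ℝ) : LipschitzWith 0 (fun _ : E2 => (1:ℝ))) hK hc (-v)
  have h2 : ∀ x, lineDeriv ℝ ψ x v = fderiv ℝ ψ x v := fun x =>
    (hψ.differentiable (by norm_num) x).lineDeriv_eq_fderiv
  have h3 : ∀ x, lineDeriv ℝ (fun _ : E2 => (1:ℝ)) x (-v) = 0 := fun x => by
    simp [lineDeriv]
  simp only [neg_neg, h2, h3, mul_one, zero_mul, integral_zero] at h
  exact h.symm

lemma fderiv_apply_eq {a : E2 → ℝ} (x w : E2) :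
    fderiv ℝ a x w = w 0 * fderiv ℝ a x (ee 0) + w 1 * fderiv ℝ a x (ee 1) := by
  conv_lhs => rw [eq2 w]
  simp

lemma comp_contDiff {X : E2 → E2} (hX : ContDiff ℝ 1 X) (i : Fin 2) : ContDiff ℝ 1 (fun x => X x i) :=
  (EuclideanSpace.proj i : E2 →L[ℝ] ℝ).contDiff.comp hX

lemma comp_fderiv {X : E2 → E2} {x : E2} (hX : DifferentiableAt ℝ X x) (i : Fin 2) (w : E2) :
    fderiv ℝ (fun x => X x i) x w = (fderiv ℝ X x w) i := by
  have : HasFDerivAt (fun x => X x i) ((EuclideanSpace.proj i : E2 →L[ℝ] ℝ).comp (fderiv ℝ X x)) x :=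
    (EuclideanSpace.proj i : E2 →L[ℝ] ℝ).hasFDerivAt.comp x hX.hasFDerivAt
  rw [this.fderiv]; rfl

lemma int_div_zero {a : E2 → ℝ} {X : E2 → E2} (ha : ContDiff ℝ 1 a) (hc : HasCompactSupport a)
    (hX : ContDiff ℝ 1 X) : ∫ x, (fderiv ℝ a x (X x) + a x * dv X x) = 0 := by
  have key : ∀ i, ∫ x, fderiv ℝ (fun x => a x * X x i) x (ee i) = 0 := fun i =>
    int_fderiv_zero (ha.mul (comp_contDiff hX i)) hc.mul_right _
  have hitg : ∀ i, Integrable (fun x => fderiv ℝ (fun x => a x * X x i) x (ee i)) := fun i => by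
    have h1 : ContDiff ℝ 1 (fun x => a x * X x i) := ha.mul (comp_contDiff hX i)
    have h2 : HasCompactSupport (fun x => a x * X x i) := hc.mul_right
    exact ((h1.continuous_fderiv (by norm_num)).clm_apply continuous_const).integrable_of_hasCompactSupport
      (h2.fderiv_apply ℝ (ee i))
  have e : ∀ x, fderiv ℝ a x (X x) + a x * dv X x =
      fderiv ℝ (fun x => a x * X x 0) x (ee 0) + fderiv ℝ (fun x => a x * X x 1) x (ee 1) := by
    intro x
    have hXd := hX.differentiable (by norm_num) x
    have had := ha.differentiable (by norm_num) x
    have hp : ∀ i, fderiv ℝ (fun x => a x * X x i) x (ee i) = a x * (fderiv ℝ X x (ee i)) i + X x i * fderiv ℝ a x (ee i) := by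
      intro i
      rw [fderiv_fun_mul had ((comp_contDiff hX i).differentiable (by norm_num) x)]
      simp [comp_fderiv hXd]
    rw [hp, hp, fderiv_apply_eq, dv]; ring
  simp_rw [e]
  rw [integral_add (hitg 0) (hitg 1), key, key, add_zero]

lemma st_deriv_zero {t : ℝ} (ht : t < 0 ∨ 1 < t) : deriv Real.smoothTransition t = 0 := by
  rcases ht with h | h
  · have : Real.smoothTransition =ᶠ[𝓝 t] fun _ => 0 := by
      filter_upwards [gt_mem_nhds h] with s hs using Real.smoothTransition.zero_of_nonpos hs.le
    rw [this.deriv_eq]; simp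
  · have : Real.smoothTransition =ᶠ[𝓝 t] fun _ => 1 := by
      filter_upwards [lt_mem_nhds h] with s hs using Real.smoothTransition.one_of_one_le hs.le
    rw [this.deriv_eq]; simp

lemma st_deriv_bound : ∃ M, ∀ t, |deriv Real.smoothTransition t| ≤ M := by
  have hc : Continuous (deriv Real.smoothTransition) :=
    (Real.smoothTransition.contDiff (n := 1)).continuous_deriv (by norm_num)
  have hs : HasCompactSupport (deriv Real.smoothTransition) := by
    refine HasCompactSupport.intro (isCompact_Icc (a := (0:ℝ)) (b := 1)) (fun t ht => st_deriv_zero ?_)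
    by_contra h; push Not at h; exact ht ⟨h.1, h.2⟩
  obtain ⟨M, hM⟩ := hs.exists_bound_of_continuous hc
  exact ⟨M, fun t => by simpa using hM t⟩

lemma vanish_lip {V : Type*} [NormedAddCommGroup V] [NormedSpace ℝ V] {F : E2 → V}
    (hF : ContDiff ℝ 1 F) {ρ : ℝ} (h0 : ∀ p ∈ Metric.ball (0:E2) ρ, p 1 = 0 → F p = 0) :
    ∃ K, 0 ≤ K ∧ ∀ p ∈ Metric.ball (0:E2) ρ, ‖F p‖ ≤ K * |p 1| := by
  obtain ⟨K, hK⟩ := (isCompact_closedBall (0:E2) ρ).exists_bound_of_continuousOn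
    (hF.continuous_fderiv (by norm_num)).continuousOn
  refine ⟨max K 0, le_max_right _ _, fun p hp => ?_⟩
  set q : E2 := p 0 • ee 0 with hq
  have hqb : q ∈ Metric.ball (0:E2) ρ := by
    rw [mem_ball_zero_iff] at hp ⊢
    refine lt_of_le_of_lt ?_ hp
    rw [EuclideanSpace.norm_eq, EuclideanSpace.norm_eq]
    apply Real.sqrt_le_sqrt
    simp [Fin.sum_univ_two, q, sq_nonneg]
  have h1 := (convex_ball (0:E2) ρ).norm_image_sub_le_of_norm_fderiv_le (f := F) (C := max K 0) (𝕜 := ℝ)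
    (fun x _ => hF.differentiable (by norm_num) x)
    (fun x hx => (hK x (Metric.ball_subset_closedBall hx)).trans (le_max_left _ _)) hqb hp
  rw [h0 q hqb (by simp [q]), sub_zero] at h1
  have h2 : p - q = p 1 • ee 1 := by
    rw [hq]; nth_rewrite 1 [eq2 p]; abel
  rw [h2, norm_smul] at h1
  simpa using h1

variable {Ω : Set E2} {x0 : E2}

lemma flux_zero (hΩm : MeasurableSet Ω) (hb : IsBounded Ω) (ch : Chart Ω x0) {R : ℝ} (hR : R ≤ ch.ρ)
    (hΘR : ∀ x ∈ Metric.ball x0 R, ch.Θ x ∈ Metric.ball (0:E2) ch.ρ)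
    {X : E2 → E2} (hX : ContDiff ℝ 1 X)
    (hXt : ∀ p ∈ Metric.ball (0:E2) ch.ρ, p 1 = 0 → (fderiv ℝ ch.Θ (ch.Ψ p) (X (ch.Ψ p))) 1 = 0)
    {v : E2 → ℝ} (hv : ContDiff ℝ 1 v) (hvc : HasCompactSupport v) (hvs : tsupport v ⊆ Metric.ball x0 R) :
    ∫ x in Ω, (fderiv ℝ v x (X x) + v x * dv X x) = 0 := by
  have hmem : ∀ x ∈ Metric.ball x0 R, (x ∈ Ω ↔ (ch.Θ x) 1 < 0) := by
    intro x hx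
    rw [← ch.mem _ (hΘR x hx), ch.right x (Metric.ball_subset_ball hR hx)]
  let G : E2 → ℝ := fun x => (ch.Θ x) 1
  have hG : ContDiff ℝ 1 G := comp_contDiff (ch.hΘ.of_le (by norm_num)) 1
  obtain ⟨M, hM⟩ := st_deriv_bound
  have hM0 : 0 ≤ M := (abs_nonneg _).trans (hM 0)
  obtain ⟨K, hK0, hK⟩ := vanish_lip (F := fun p => (fderiv ℝ ch.Θ (ch.Ψ p) (X (ch.Ψ p))) 1) (ρ := ch.ρ) (by
    have hΨ1 : ContDiff ℝ 1 ch.Ψ := ch.hΨ.of_le (by norm_num)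
    have h1 : ContDiff ℝ 1 (fun p => fderiv ℝ ch.Θ (ch.Ψ p)) :=
      (ch.hΘ.fderiv_right (m := 1) (by norm_num)).comp hΨ1
    exact comp_contDiff (h1.clm_apply (hX.comp hΨ1)) 1) hXt
  have hKG : ∀ x ∈ Metric.ball x0 R, |fderiv ℝ G x (X x)| ≤ K * |G x| := by
    intro x hx
    have := hK _ (hΘR x hx)
    rw [ch.right x (Metric.ball_subset_ball hR hx)] at this
    rw [show fderiv ℝ G x (X x) = _ from comp_fderiv (ch.hΘ.differentiable (by norm_num) x) 1 _]
    exact this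
  let χ : ℕ → E2 → ℝ := fun n x => Real.smoothTransition (- G x * (n + 1) - 1)
  have hχ : ∀ n, ContDiff ℝ 1 (χ n) := fun n =>
    (Real.smoothTransition.contDiff (n := 1)).comp ((hG.neg.mul contDiff_const).sub contDiff_const)
  have hχd : ∀ n x w, fderiv ℝ (χ n) x w = deriv Real.smoothTransition (- G x * (n + 1) - 1) * (-(n + 1) * fderiv ℝ G x w) := by
    intro n x w
    have h1 : HasFDerivAt (fun x => - G x * ((n:ℝ) + 1) - 1) _ x :=
      (((hG.differentiable (by norm_num) x).hasFDerivAt.neg).mul_const ((n:ℝ) + 1)).sub_const 1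
    have h2 := ((Real.smoothTransition.contDiff (n := 1)).differentiable (by norm_num) (- G x * (n + 1) - 1)).hasDerivAt.comp_hasFDerivAt x h1
    rw [show χ n = Real.smoothTransition ∘ (fun x => - G x * ((n:ℝ) + 1) - 1) from rfl, h2.fderiv]
    simp
    ring
  -- integral identity for the truncated functions
  have hzero : ∀ x ∉ Metric.ball x0 R, v x = 0 ∧ fderiv ℝ v x = 0 := by
    intro x hx
    have hx' : x ∉ tsupport v := fun h => hx (hvs h)
    refine ⟨image_eq_zero_of_notMem_tsupport hx', ?_⟩
    exact image_eq_zero_of_notMem_tsupport (fun h => hx' (tsupport_fderiv_subset ℝ h))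
  let f : ℕ → E2 → ℝ := fun n x => χ n x * (fderiv ℝ v x (X x) + v x * dv X x) + v x * fderiv ℝ (χ n) x (X x)
  have hid : ∀ n, ∫ x in Ω, f n x = 0 := by
    intro n
    have h1 := int_div_zero ((hχ n).mul hv) hvc.mul_left hX
    have h2 : ∀ x, fderiv ℝ (fun x => χ n x * v x) x (X x) + (χ n x * v x) * dv X x = f n x := by
      intro x
      rw [fderiv_fun_mul ((hχ n).differentiable (by norm_num) x) (hv.differentiable (by norm_num) x)]
      simp [f]; ring
    simp_rw [h2] at h1
    rw [← h1]
    apply setIntegral_eq_integral_of_forall_compl_eq_zero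
    intro x hx
    by_cases hxb : x ∈ Metric.ball x0 R
    · have hGx : 0 ≤ G x := by
        by_contra h; push Not at h; exact hx ((hmem x hxb).2 h)
      have hn : (0:ℝ) ≤ n + 1 := by positivity
      have hneg : - G x * ((n:ℝ) + 1) - 1 < 0 := by nlinarith [mul_nonneg hGx hn]
      simp only [f, hχd, st_deriv_zero (Or.inl hneg)]
      simp only [χ, Real.smoothTransition.zero_of_nonpos hneg.le]
      simp
    · simp [f, hzero x hxb]
  -- limit
  have hcont : Continuous (fun x => fderiv ℝ v x (X x) + v x * dv X x) := by
    have := (hv.continuous_fderiv (by norm_num)).clm_apply hX.continuous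
    have h2 : Continuous (dv X) := by
      unfold dv
      have h3 := fun i => (hX.continuous_fderiv (by norm_num)).clm_apply (continuous_const (y := ee i))
      have h4 := h3 0; have h5 := h3 1
      fun_prop
    exact this.add (hv.continuous.mul h2)
  have hfin : IsFiniteMeasure (volume.restrict Ω) := ⟨by simpa using hb.measure_lt_top⟩
  have hcs : HasCompactSupport (fun x => fderiv ℝ v x (X x) + v x * dv X x) := by
    refine HasCompactSupport.intro hvc (fun x hx => ?_)
    have h1 : v x = 0 := image_eq_zero_of_notMem_tsupport hx
    have h2 : fderiv ℝ v x = 0 := image_eq_zero_of_notMem_tsupport (fun h => hx (tsupport_fderiv_subset ℝ h))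
    simp [h1, h2]
  obtain ⟨B1, hB1⟩ := hcs.exists_bound_of_continuous hcont
  obtain ⟨B2, hB2⟩ := hvc.exists_bound_of_continuous hv.continuous
  have hlim : Filter.Tendsto (fun n => ∫ x in Ω, f n x) Filter.atTop
      (𝓝 (∫ x in Ω, (fderiv ℝ v x (X x) + v x * dv X x))) := by
    refine tendsto_integral_of_dominated_convergence (fun _ => B1 + B2 * (M * (2 * K))) (fun n => ?_)
      (integrable_const _) (fun n => ?_) ?_
    · have h1 := (hχ n).continuous
      have h2 := ((hχ n).continuous_fderiv (by norm_num)).clm_apply hX.continuous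
      exact ((h1.mul hcont).add (hv.continuous.mul h2)).aestronglyMeasurable
    · refine Filter.Eventually.of_forall (fun x => ?_)
      have a1 : ‖χ n x‖ ≤ 1 := by
        rw [Real.norm_eq_abs, abs_of_nonneg (Real.smoothTransition.nonneg _)]
        exact Real.smoothTransition.le_one _
      have a2 : ‖v x * fderiv ℝ (χ n) x (X x)‖ ≤ B2 * (M * (2 * K)) := by
        have hB20 := (norm_nonneg _).trans (hB2 x)
        by_cases hxb : x ∈ Metric.ball x0 R
        · rw [norm_mul]
          refine mul_le_mul (hB2 x) ?_ (norm_nonneg _) hB20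
          rw [hχd, norm_mul]
          by_cases hτ : - G x * ((n:ℝ) + 1) - 1 < 0 ∨ 1 < - G x * ((n:ℝ) + 1) - 1
          · rw [st_deriv_zero hτ]; simp; positivity
          · push Not at hτ
            have hn : (0:ℝ) < n + 1 := by positivity
            refine mul_le_mul (hM _) ?_ (norm_nonneg _) hM0
            rw [norm_mul, norm_neg, Real.norm_of_nonneg hn.le, Real.norm_eq_abs]
            have h3 := hKG x hxb
            have h4 : |G x| * (n + 1) ≤ 2 := by
              have : G x ≤ 0 := by by_contra h; push Not at h; nlinarith
              rw [abs_of_nonpos this]; linarith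
            calc _ ≤ ((n:ℝ) + 1) * (K * |G x|) := by gcongr
              _ = K * (|G x| * (n + 1)) := by ring
              _ ≤ K * 2 := by gcongr
              _ = _ := by ring
        · rw [(hzero x hxb).1, zero_mul, norm_zero]; positivity
      refine (norm_add_le _ _).trans (add_le_add ?_ a2)
      rw [norm_mul]
      calc _ ≤ 1 * B1 := mul_le_mul a1 (hB1 x) (norm_nonneg _) zero_le_one
        _ = B1 := one_mul _
    · rw [ae_restrict_iff' hΩm]
      refine Filter.Eventually.of_forall (fun x hx => ?_)
      by_cases hxb : x ∈ Metric.ball x0 R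
      · have hGx : G x < 0 := (hmem x hxb).1 hx
        apply tendsto_const_nhds.congr'
        have : ∀ᶠ n : ℕ in Filter.atTop, 1 < - G x * ((n:ℝ) + 1) - 1 := by
          obtain ⟨N, hN⟩ := exists_nat_gt (2 / (- G x))
          filter_upwards [Filter.eventually_ge_atTop N] with n hn
          have h1 : 2 / (- G x) < n := lt_of_lt_of_le hN (by exact_mod_cast hn)
          rw [div_lt_iff₀ (by linarith)] at h1
          nlinarith
        filter_upwards [this] with n hn
        simp only [f, hχd, st_deriv_zero (Or.inr hn)]
        simp only [χ, Real.smoothTransition.one_of_one_le hn.le]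
        simp
      · simp only [f, hzero x hxb]; simp
  simp only [hid] at hlim
  exact tendsto_nhds_unique hlim tendsto_const_nhds

end Flux


noncomputable section PatchSec

def trc (A : E2 →L[ℝ] E2) : ℝ := (A (ee 0)) 0 + (A (ee 1)) 1
def dtm (A : E2 →L[ℝ] E2) : ℝ := (A (ee 0)) 0 * (A (ee 1)) 1 - (A (ee 1)) 0 * (A (ee 0)) 1
/-- minus the adjugate -/
def tf (A : E2 →L[ℝ] E2) : E2 →L[ℝ] E2 := A - trc A • ContinuousLinearMap.id ℝ E2
def Cm (A : E2 →L[ℝ] E2) : E2 →L[ℝ] E2 := A - ContinuousLinearMap.adjoint A - trc A • ContinuousLinearMap.id ℝ E2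

lemma clm_apply2 (A : E2 →L[ℝ] E2) (w : E2) (i : Fin 2) :
    (A w) i = w 0 * (A (ee 0)) i + w 1 * (A (ee 1)) i := by
  conv_lhs => rw [eq2 w]
  simp

lemma tf_0 (A : E2 →L[ℝ] E2) (w : E2) : (tf A w) 0 = - (A (ee 1)) 1 * w 0 + (A (ee 1)) 0 * w 1 := by
  simp only [tf, _root_.sub_apply, PiLp.sub_apply, clm_apply2 A w, _root_.smul_apply, trc]
  simp; ring
lemma tf_1 (A : E2 →L[ℝ] E2) (w : E2) : (tf A w) 1 = (A (ee 0)) 1 * w 0 - (A (ee 0)) 0 * w 1 := by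
  simp only [tf, _root_.sub_apply, PiLp.sub_apply, clm_apply2 A w, _root_.smul_apply, trc]
  simp; ring

lemma adj_apply2 (A : E2 →L[ℝ] E2) (w : E2) (i : Fin 2) :
    (ContinuousLinearMap.adjoint A w) i = (A (ee i)) 0 * w 0 + (A (ee i)) 1 * w 1 := by
  have h1 : inner ℝ (ee i) (ContinuousLinearMap.adjoint A w) = inner ℝ (A (ee i)) w :=
    ContinuousLinearMap.adjoint_inner_right A (ee i) w
  rw [inner2 (A (ee i))] at h1
  rw [← h1, EuclideanSpace.inner_single_left]; simp

lemma Cm_zero {A : E2 →L[ℝ] E2} (h1 : trc A = 0) (h2 : (A (ee 0)) 1 = (A (ee 1)) 0) : Cm A = 0 := by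
  ext w i
  simp only [Cm, _root_.sub_apply, PiLp.sub_apply, h1, clm_apply2 A w, adj_apply2]
  fin_cases i <;> simp [h2] <;> ring

lemma trc_continuous : Continuous trc := by
  unfold trc
  have h := fun i : Fin 2 => (ContinuousLinearMap.apply ℝ E2 (ee i)).continuous
  have h0 : Continuous (fun A : E2 →L[ℝ] E2 => A (ee 0)) := h 0
  have h1 : Continuous (fun A : E2 →L[ℝ] E2 => A (ee 1)) := h 1
  fun_prop

lemma trc_contDiff {A : E2 → E2 →L[ℝ] E2} (hA : ContDiff ℝ 1 A) : ContDiff ℝ 1 (fun x => trc (A x)) := by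
  unfold trc
  exact (comp_contDiff (hA.clm_apply contDiff_const) 0).add (comp_contDiff (hA.clm_apply contDiff_const) 1)

lemma tf_contDiff {A : E2 → E2 →L[ℝ] E2} (hA : ContDiff ℝ 1 A) : ContDiff ℝ 1 (fun x => tf (A x)) := by
  unfold tf
  exact hA.sub ((trc_contDiff hA).smul contDiff_const)

lemma Cm_contDiff {A : E2 → E2 →L[ℝ] E2} (hA : ContDiff ℝ 1 A) : ContDiff ℝ 1 (fun x => Cm (A x)) := by
  unfold Cm
  refine (hA.sub ?_).sub ((trc_contDiff hA).smul contDiff_const)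
  exact (ContinuousLinearMap.adjoint (𝕜 := ℝ) (E := E2) (F := E2)).toContinuousLinearEquiv.toContinuousLinearMap.contDiff.comp hA

/-- Piola identity in dimension two -/
lemma piola {S : E2 → E2} (hS : ContDiff ℝ 2 S) {p : E2 → E2} (hp : ContDiff ℝ 1 p) (x : E2) :
    dv (fun x => tf (fderiv ℝ S x) (p (S x))) x = - dtm (fderiv ℝ S x) * dv p (S x) := by
  have hS1 : ContDiff ℝ 1 S := hS.of_le (by norm_num)
  have hA : ContDiff ℝ 1 (fderiv ℝ S) := hS.fderiv_right (m := 1) (by norm_num)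
  have hq : ContDiff ℝ 1 (fun x => p (S x)) := hp.comp hS1
  have hX : ContDiff ℝ 1 (fun x => tf (fderiv ℝ S x) (p (S x))) := (tf_contDiff hA).clm_apply hq
  have hAi : ∀ i j, DifferentiableAt ℝ (fun x => (fderiv ℝ S x (ee j)) i) x := fun i j =>
    (comp_contDiff (hA.clm_apply contDiff_const) i).differentiable (by norm_num) x
  have hqi : ∀ i, DifferentiableAt ℝ (fun x => (p (S x)) i) x := fun i =>
    (comp_contDiff hq i).differentiable (by norm_num) x
  have dA : ∀ i j k, fderiv ℝ (fun x => (fderiv ℝ S x (ee j)) i) x (ee k) =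
      (fderiv ℝ (fderiv ℝ S) x (ee k) (ee j)) i := by
    intro i j k
    rw [comp_fderiv ((hA.clm_apply contDiff_const).differentiable (by norm_num) x)]
    rw [fderiv_clm_apply (hA.differentiable (by norm_num) x) (differentiableAt_const _)]
    simp
  have sym : ∀ j k, fderiv ℝ (fderiv ℝ S) x (ee k) (ee j) = fderiv ℝ (fderiv ℝ S) x (ee j) (ee k) := by
    intro j k
    exact (hS.contDiffAt.isSymmSndFDerivAt (by simp)) (ee k) (ee j)
  have dq : ∀ i k, fderiv ℝ (fun x => (p (S x)) i) x (ee k) =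
      (fderiv ℝ S x (ee k)) 0 * (fderiv ℝ p (S x) (ee 0)) i + (fderiv ℝ S x (ee k)) 1 * (fderiv ℝ p (S x) (ee 1)) i := by
    intro i k
    rw [comp_fderiv (hq.differentiable (by norm_num) x)]
    rw [show fderiv ℝ (fun x => p (S x)) x = (fderiv ℝ p (S x)).comp (fderiv ℝ S x) from
      fderiv_comp x (hp.differentiable (by norm_num) _) (hS1.differentiable (by norm_num) _)]
    rw [ContinuousLinearMap.comp_apply, clm_apply2]
  have c0 : fderiv ℝ (fun x => (tf (fderiv ℝ S x) (p (S x))) 0) x (ee 0) =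
      (-(fderiv ℝ (fderiv ℝ S) x (ee 0) (ee 1)) 1 * (p (S x)) 0 - (fderiv ℝ S x (ee 1)) 1 * fderiv ℝ (fun x => (p (S x)) 0) x (ee 0))
      + ((fderiv ℝ (fderiv ℝ S) x (ee 0) (ee 1)) 0 * (p (S x)) 1 + (fderiv ℝ S x (ee 1)) 0 * fderiv ℝ (fun x => (p (S x)) 1) x (ee 0)) := by
    simp only [tf_0]
    rw [fderiv_fun_add (((hAi _ _).fun_neg).fun_mul (hqi _)) ((hAi _ _).fun_mul (hqi _)),
      fderiv_fun_mul ((hAi _ _).fun_neg) (hqi _), fderiv_fun_mul (hAi _ _) (hqi _), fderiv_fun_neg]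
    simp only [_root_.add_apply, _root_.smul_apply, _root_.neg_apply, dA, smul_eq_mul]
    ring
  have c1 : fderiv ℝ (fun x => (tf (fderiv ℝ S x) (p (S x))) 1) x (ee 1) =
      ((fderiv ℝ (fderiv ℝ S) x (ee 1) (ee 0)) 1 * (p (S x)) 0 + (fderiv ℝ S x (ee 0)) 1 * fderiv ℝ (fun x => (p (S x)) 0) x (ee 1))
      - ((fderiv ℝ (fderiv ℝ S) x (ee 1) (ee 0)) 0 * (p (S x)) 1 + (fderiv ℝ S x (ee 0)) 0 * fderiv ℝ (fun x => (p (S x)) 1) x (ee 1)) := by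
    simp only [tf_1]
    rw [fderiv_fun_sub ((hAi _ _).fun_mul (hqi _)) ((hAi _ _).fun_mul (hqi _)),
      fderiv_fun_mul (hAi _ _) (hqi _), fderiv_fun_mul (hAi _ _) (hqi _)]
    simp only [_root_.add_apply, _root_.sub_apply, _root_.smul_apply, dA, smul_eq_mul]
    ring
  rw [dv, ← comp_fderiv (hX.differentiable (by norm_num) x), ← comp_fderiv (hX.differentiable (by norm_num) x),
    c0, c1, sym 0 1, dq, dq, dq, dq, dtm, dv]
  ring

lemma dv_pk {d : ℝ} (hd : 0 < d) (y x : E2) : dv (fun z => pk d (z - y)) x = rho d (x - y) := by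
  have h0 : HasFDerivAt (fun z : E2 => z - y) (ContinuousLinearMap.id ℝ E2) x := (hasFDerivAt_id x).sub_const y
  have : HasFDerivAt (fun z => pk d (z - y)) ((Dpk d (x - y)).comp (ContinuousLinearMap.id ℝ E2)) x :=
    HasFDerivAt.comp (g := pk d) (f := fun z => z - y) x (pk_hasFDerivAt hd (x - y)) h0
  have h := Dpk_trace d (x - y) (nn_pos hd _)
  rw [Fin.sum_univ_two] at h
  rw [dv, this.fderiv, ← h]; rfl

/-- the vector field of the patch -/
def Xf (σ : ℝ) (S : E2 → E2) (d : ℝ) (y x : E2) : E2 :=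
  pk d (x - y) + σ • tf (fderiv ℝ S x) (pk d (S x - y))

def rh (σ : ℝ) (S : E2 → E2) (d : ℝ) (y x : E2) : ℝ :=
  rho d (x - y) - σ * dtm (fderiv ℝ S x) * rho d (S x - y)

lemma Xf_contDiff (σ : ℝ) {S : E2 → E2} (hS : ContDiff ℝ 2 S) {d : ℝ} (hd : 0 < d) (y : E2) :
    ContDiff ℝ 1 (Xf σ S d y) := by
  unfold Xf
  have hA : ContDiff ℝ 1 (fderiv ℝ S) := hS.fderiv_right (m := 1) (by norm_num)
  have hS1 : ContDiff ℝ 1 S := hS.of_le (by norm_num)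
  refine ((pk_contDiff hd).comp (contDiff_id.sub contDiff_const)).add (((tf_contDiff hA).clm_apply ((pk_contDiff hd).comp (hS1.sub contDiff_const))).const_smul σ)

lemma dv_Xf (σ : ℝ) {S : E2 → E2} (hS : ContDiff ℝ 2 S) {d : ℝ} (hd : 0 < d) (y x : E2) :
    dv (Xf σ S d y) x = rh σ S d y x := by
  have hA : ContDiff ℝ 1 (fderiv ℝ S) := hS.fderiv_right (m := 1) (by norm_num)
  have hS1 : ContDiff ℝ 1 S := hS.of_le (by norm_num)
  have hp : ContDiff ℝ 1 (fun z => pk d (z - y)) := (pk_contDiff hd).comp (contDiff_id.sub contDiff_const)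
  have h2 : ContDiff ℝ 1 (fun x => tf (fderiv ℝ S x) (pk d (S x - y))) :=
    (tf_contDiff hA).clm_apply ((pk_contDiff hd).comp (hS1.sub contDiff_const))
  have e : fderiv ℝ (Xf σ S d y) x = fderiv ℝ (fun z => pk d (z - y)) x + σ • fderiv ℝ (fun x => tf (fderiv ℝ S x) (pk d (S x - y))) x := by
    have := ((hp.differentiable (by norm_num) x).hasFDerivAt).add
      (((h2.differentiable (by norm_num) x).hasFDerivAt).const_smul σ)
    exact this.fderiv
  have h3 := piola hS hp x
  have h4 := dv_pk hd y x
  have h5 := dv_pk hd y (S x)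
  rw [h5] at h3
  rw [rh, ← h4]
  unfold dv at h3 ⊢
  rw [e]
  simp only [_root_.add_apply, _root_.smul_apply, PiLp.add_apply, PiLp.smul_apply, smul_eq_mul]
  linear_combination σ * h3

structure Patch (Ω : Set E2) (x0 : E2) where
  r : ℝ
  r' : ℝ
  η : E2 → ℝ
  σ : ℝ
  S : E2 → E2
  L : ℝ
  hr' : 0 < r'
  hrr : r' ≤ r
  hη : ContDiff ℝ 1 η
  hηc : HasCompactSupport η
  hη1 : ∀ x ∈ Metric.ball x0 (2 * r), η x = 1
  hσ : |σ| ≤ 1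
  hS2 : ContDiff ℝ 2 S
  hL1 : 1 ≤ L
  hL : ∀ x ∈ Ω, x ∈ tsupport η → ∀ y ∈ closure Ω, y ∈ Metric.ball x0 r → ‖x - y‖ ≤ L * ‖S x - y‖
  hC : ∀ x ∈ Ω, x ∈ tsupport η → ∀ y ∈ closure Ω, y ∈ Metric.ball x0 r →
    |σ| * ‖Cm (fderiv ℝ S x)‖ ≤ L * ‖S x - y‖
  hSout : σ ≠ 0 → ∀ x ∈ Ω, x ∈ tsupport η → S x ∉ Ω
  star : ∀ φ : E2 → ℝ, ContDiff ℝ 1 φ → ∀ y, ∀ d > 0,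
    ∫ x in Ω, (fderiv ℝ (fun x => η x * φ x) x (Xf σ S d y x) + (η x * φ x) * rh σ S d y x) = 0
  qc : ∀ F : E2 → ℝ, ContDiff ℝ 1 F → ∀ b, (∀ x ∈ closure Ω, x ∈ Metric.ball x0 r → ‖fderiv ℝ F x‖ ≤ b) →
    ∀ x ∈ closure Ω, x ∈ Metric.ball x0 r' → ∀ y ∈ closure Ω, y ∈ Metric.ball x0 r' →
      |F x - F y| ≤ L * b * ‖x - y‖
  /-- interior patches are trivial -/
  int_tsupp : x0 ∈ Ω → σ = 0 ∧ tsupport η ⊆ Ω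

end PatchSec


noncomputable section PatchBuild

/-- reflection across the horizontal axis -/
def flp : E2 →L[ℝ] E2 :=
  ContinuousLinearMap.id ℝ E2 - (2:ℝ) • (ContinuousLinearMap.smulRight (EuclideanSpace.proj (1 : Fin 2) : E2 →L[ℝ] ℝ) (ee 1))

lemma flp_0 (p : E2) : (flp p) 0 = p 0 := by simp [flp]
lemma flp_1 (p : E2) : (flp p) 1 = - p 1 := by simp [flp]; ring

lemma nsq2 (p : E2) : ‖p‖ ^ 2 = p 0 ^ 2 + p 1 ^ 2 := by
  rw [EuclideanSpace.norm_sq_eq, Fin.sum_univ_two]; simp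

lemma flp_norm (p : E2) : ‖flp p‖ = ‖p‖ := by
  have := nsq2 (flp p)
  rw [flp_0, flp_1, neg_sq, ← nsq2] at this
  exact (sq_eq_sq₀ (norm_nonneg _) (norm_nonneg _)).1 this

lemma flp_dist {p q : E2} (hp : p 1 ≤ 0) (hq : q 1 ≤ 0) : ‖p - q‖ ≤ ‖flp p - q‖ := by
  refine abs_le_of_sq_le_sq' ?_ (norm_nonneg _) |>.2
  rw [nsq2, nsq2]
  simp only [PiLp.sub_apply, flp_0, flp_1]
  nlinarith [mul_nonneg_of_nonpos_of_nonpos hp hq]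

lemma abs1_le (p : E2) : |p 1| ≤ ‖p‖ := by
  refine abs_le_of_sq_le_sq ?_ (norm_nonneg _)
  rw [nsq2]; nlinarith [sq_nonneg (p 0)]

lemma flp_abs {p q : E2} (hp : p 1 ≤ 0) (hq : q 1 ≤ 0) : |p 1| ≤ ‖flp p - q‖ := by
  refine le_trans ?_ (abs1_le _)
  simp only [PiLp.sub_apply, flp_1]
  rw [abs_of_nonpos hp, abs_of_nonneg (by linarith)]; linarith

lemma flp_fix {p : E2} (hp : p 1 = 0) : flp p = p := ext2 (flp_0 p) (by rw [flp_1, hp, neg_zero])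

/-- algebra at boundary points -/
lemma refl_alg {A : E2 →L[ℝ] E2} {a : E2} (ha : a ≠ 0) (h1 : A a = a) (h2 : A (JJ a) = - JJ a) :
    trc A = 0 ∧ (A (ee 0)) 1 = (A (ee 1)) 0 ∧ ∀ w, ‖a‖ ^ 2 • (w + A w) = (2 * inner ℝ w a) • a := by
  have e0 := congrArg (fun v : E2 => v 0) h1
  have e1 := congrArg (fun v : E2 => v 1) h1
  have f0 := congrArg (fun v : E2 => v 0) h2
  have f1 := congrArg (fun v : E2 => v 1) h2
  simp only [clm_apply2 A a, clm_apply2 A (JJ a), JJ_0, JJ_1, PiLp.neg_apply] at e0 e1 f0 f1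
  have hn : 0 < a 0 ^ 2 + a 1 ^ 2 := by rw [← nsq2]; positivity
  set n := a 0 ^ 2 + a 1 ^ 2 with hnd
  have A00 : n * (A (ee 0)) 0 = a 0 ^ 2 - a 1 ^ 2 := by rw [hnd]; linear_combination a 0 * e0 - a 1 * f0
  have A01 : n * (A (ee 0)) 1 = 2 * a 0 * a 1 := by rw [hnd]; linear_combination a 0 * e1 - a 1 * f1
  have A10 : n * (A (ee 1)) 0 = 2 * a 0 * a 1 := by rw [hnd]; linear_combination a 1 * e0 + a 0 * f0
  have A11 : n * (A (ee 1)) 1 = a 1 ^ 2 - a 0 ^ 2 := by rw [hnd]; linear_combination a 1 * e1 + a 0 * f1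
  refine ⟨?_, ?_, ?_⟩
  · have : n * trc A = 0 := by rw [trc, mul_add, A00, A11]; ring
    rcases mul_eq_zero.1 this with h | h
    · exact absurd h hn.ne'
    · exact h
  · exact mul_left_cancel₀ hn.ne' (A01.trans A10.symm)
  · intro w
    rw [nsq2, ← hnd]
    refine ext2 ?_ ?_
    · simp only [PiLp.smul_apply, PiLp.add_apply, clm_apply2 A w, smul_eq_mul, inner2]
      rw [mul_add, mul_add]
      linear_combination w 0 * A00 + w 1 * A10 + w 0 * hnd
    · simp only [PiLp.smul_apply, PiLp.add_apply, clm_apply2 A w, smul_eq_mul, inner2]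
      rw [mul_add, mul_add]
      linear_combination w 0 * A01 + w 1 * A11 + w 1 * hnd

lemma bdry_patch {Ω : Set E2} (ho : IsOpen Ω) (hb : IsBounded Ω) {x0 : E2} (hx0 : x0 ∉ Ω) (ch : Chart Ω x0) :
    Nonempty (Patch Ω x0) := by
  obtain ⟨K, hK⟩ : ∃ K : ℝ, K = (ch.K : ℝ) := ⟨_, rfl⟩
  have hK0 : 0 ≤ K := hK ▸ ch.K.2
  set R : ℝ := ch.ρ / (K + 1) with hR
  have hρ := ch.hρ
  have hR0 : 0 < R := by positivity
  have hKR : (K + 1) * R = ch.ρ := by rw [hR]; field_simp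
  have hRρ : R ≤ ch.ρ := by nlinarith
  have lΨ : ∀ p q, ‖ch.Ψ p - ch.Ψ q‖ ≤ K * ‖p - q‖ := fun p q => by
    simpa [dist_eq_norm, hK] using ch.lΨ.dist_le_mul p q
  have lΘ : ∀ p q, ‖ch.Θ p - ch.Θ q‖ ≤ K * ‖p - q‖ := fun p q => by
    simpa [dist_eq_norm, hK] using ch.lΘ.dist_le_mul p q
  have hΘn : ∀ x, ‖ch.Θ x‖ ≤ K * ‖x - x0‖ := fun x => by
    have := lΘ x x0; rwa [ch.Θ0, sub_zero] at this
  have hΨ0 : ch.Ψ 0 = x0 := by rw [← ch.Θ0]; exact ch.right x0 (Metric.mem_ball_self hρ)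
  have hΨn : ∀ p, ‖ch.Ψ p - x0‖ ≤ K * ‖p‖ := fun x => by
    have := lΨ x 0; rwa [hΨ0, sub_zero] at this
  have hΘR : ∀ x ∈ Metric.ball x0 R, ch.Θ x ∈ Metric.ball (0:E2) ch.ρ := by
    intro x hx
    rw [mem_ball_iff_norm] at hx
    rw [mem_ball_zero_iff]
    have := hΘn x
    nlinarith [norm_nonneg (x - x0)]
  have hΨΘ : ∀ x ∈ Metric.ball x0 R, ch.Ψ (ch.Θ x) = x := fun x hx =>
    ch.right x (Metric.ball_subset_ball hRρ hx)
  have hmem : ∀ x ∈ Metric.ball x0 R, (x ∈ Ω ↔ (ch.Θ x) 1 < 0) := by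
    intro x hx
    rw [← ch.mem _ (hΘR x hx), hΨΘ x hx]
  have hΘc : Continuous (fun x => (ch.Θ x) 1) := (comp_contDiff (ch.hΘ.of_le (by norm_num)) 1).continuous
  have hcl : ∀ x ∈ Metric.ball x0 R, x ∈ closure Ω → (ch.Θ x) 1 ≤ 0 := by
    intro x hx hxc
    by_contra hne
    push Not at hne
    obtain ⟨z, hz1, hz2⟩ := mem_closure_iff.1 hxc _ ((isOpen_lt continuous_const hΘc).inter Metric.isOpen_ball) ⟨hne, hx⟩
    have := (hmem z hz1.2).1 hz2
    exact absurd hz1.1 (not_lt.2 this.le)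
  have hcl2 : ∀ p ∈ Metric.ball (0:E2) ch.ρ, p 1 ≤ 0 → ch.Ψ p ∈ closure Ω := by
    intro p hp hp1
    have hc : Filter.Tendsto (fun t : ℝ => p - t • ee 1) (𝓝[>] 0) (𝓝 p) := by
      have : Continuous (fun t : ℝ => p - t • ee 1) := by fun_prop
      have := this.tendsto 0
      simp only [zero_smul, sub_zero] at this
      exact this.mono_left nhdsWithin_le_nhds
    refine mem_closure_of_tendsto ((ch.hΨ.continuous.tendsto p).comp hc) ?_
    filter_upwards [hc.eventually (Metric.isOpen_ball.mem_nhds hp), self_mem_nhdsWithin] with t ht ht0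
    refine (ch.mem _ ht).2 ?_
    simp only [PiLp.sub_apply, PiLp.smul_apply, smul_eq_mul]
    have : (ee 1) 1 = (1:ℝ) := by simp
    rw [this]; simp at ht0; linarith
  let S : E2 → E2 := fun x => ch.Ψ (flp (ch.Θ x))
  have hS : ContDiff ℝ 2 S := ch.hΨ.comp (flp.contDiff.comp ch.hΘ)
  have hflb : ∀ p ∈ Metric.ball (0:E2) ch.ρ, flp p ∈ Metric.ball (0:E2) ch.ρ := by
    intro p hp; rw [mem_ball_zero_iff, flp_norm]; simpa using hp
  have hSΨ : ∀ p ∈ Metric.ball (0:E2) ch.ρ, S (ch.Ψ p) = ch.Ψ (flp p) := by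
    intro p hp; simp only [S, ch.left p hp]
  -- boundary facts
  have hbd : ∀ p ∈ Metric.ball (0:E2) ch.ρ, p 1 = 0 → ∃ a : E2, a ≠ 0 ∧ fderiv ℝ S (ch.Ψ p) a = a ∧
      fderiv ℝ S (ch.Ψ p) (JJ a) = - JJ a ∧ fderiv ℝ ch.Θ (ch.Ψ p) a = ee 0 ∧ S (ch.Ψ p) = ch.Ψ p := by
    intro p hp hp1
    have dΨ : HasFDerivAt ch.Ψ (fderiv ℝ ch.Ψ p) p := (ch.hΨ.differentiable (by norm_num) p).hasFDerivAt
    have dΘ : HasFDerivAt ch.Θ (fderiv ℝ ch.Θ (ch.Ψ p)) (ch.Ψ p) := (ch.hΘ.differentiable (by norm_num) _).hasFDerivAt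
    have dS : HasFDerivAt S (fderiv ℝ S (ch.Ψ p)) (ch.Ψ p) := (hS.differentiable (by norm_num) _).hasFDerivAt
    have hn : ∀ᶠ z in 𝓝 p, z ∈ Metric.ball (0:E2) ch.ρ := Metric.isOpen_ball.mem_nhds hp
    have h1 : (fderiv ℝ ch.Θ (ch.Ψ p)).comp (fderiv ℝ ch.Ψ p) = ContinuousLinearMap.id ℝ E2 :=
      (dΘ.comp p dΨ).unique ((hasFDerivAt_id p).congr_of_eventuallyEq (hn.mono fun z hz => ch.left z hz))
    have h2 : (fderiv ℝ S (ch.Ψ p)).comp (fderiv ℝ ch.Ψ p) = (fderiv ℝ ch.Ψ p).comp flp := by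
      have h3 : HasFDerivAt (fun z => ch.Ψ (flp z)) ((fderiv ℝ ch.Ψ p).comp flp) p := by
        have dΨ' : HasFDerivAt ch.Ψ (fderiv ℝ ch.Ψ p) (flp p) := by rw [flp_fix hp1]; exact dΨ
        exact dΨ'.comp p flp.hasFDerivAt
      exact (dS.comp p dΨ).unique (h3.congr_of_eventuallyEq (hn.mono fun z hz => hSΨ z hz))
    have h1' := fun w => congrArg (fun T : E2 →L[ℝ] E2 => T w) h1
    have h2' := fun w => congrArg (fun T : E2 →L[ℝ] E2 => T w) h2
    simp only [ContinuousLinearMap.comp_apply, ContinuousLinearMap.id_apply] at h1' h2'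
    have fe0 : flp (ee 0) = ee 0 := flp_fix (by simp)
    have fe1 : flp (ee 1) = - ee 1 := ext2 (by rw [flp_0]; simp) (by rw [flp_1]; simp)
    refine ⟨fderiv ℝ ch.Ψ p (ee 0), ?_, ?_, ?_, h1' _, ?_⟩
    · intro h0
      have := h1' (ee 0)
      rw [h0, map_zero] at this
      have := congrArg (fun v : E2 => v 0) this
      simp at this
    · rw [h2', fe0]
    · rw [← ch.conf p hp hp1, h2', fe1, map_neg]
    · rw [hSΨ p hp, flp_fix hp1]
  have hF : ContDiff ℝ 1 (fun p => Cm (fderiv ℝ S (ch.Ψ p))) :=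
    (Cm_contDiff (hS.fderiv_right (m := 1) (by norm_num))).comp (ch.hΨ.of_le (by norm_num))
  obtain ⟨K2, hK2, hFK⟩ := vanish_lip hF (ρ := ch.ρ) (by
    intro p hp hp1
    obtain ⟨a, ha, h1, h2, -, -⟩ := hbd p hp hp1
    obtain ⟨t1, t2, -⟩ := refl_alg ha h1 h2
    exact Cm_zero t1 t2)
  let bmp : ContDiffBump x0 := ⟨R / 4, R / 2, by positivity, by linarith⟩
  have hts : tsupport (bmp : E2 → ℝ) ⊆ Metric.ball x0 R := by
    rw [bmp.tsupport_eq]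
    exact Metric.closedBall_subset_ball (by show R / 2 < R; linarith)
  have hrr : R / 8 / (K + 1) ^ 2 ≤ R / 8 := div_le_self (by positivity) (by nlinarith)
  have hbr : Metric.ball x0 (R / 8) ⊆ Metric.ball x0 R := Metric.ball_subset_ball (by linarith)
  have key : ∀ x ∈ Ω, x ∈ tsupport (bmp : E2 → ℝ) → ∀ y ∈ closure Ω, y ∈ Metric.ball x0 (R / 8) →
      ‖flp (ch.Θ x) - ch.Θ y‖ ≤ K * ‖S x - y‖ := by
    intro x hx hxt y hy hyb
    have := lΘ (S x) y
    rwa [show ch.Θ (S x) = flp (ch.Θ x) from ch.left _ (hflb _ (hΘR x (hts hxt)))] at this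
  refine ⟨{
    r := R / 8, r' := R / 8 / (K + 1) ^ 2, η := bmp, σ := 1, S := S, L := 1 + K ^ 2 + K2 * K,
    hr' := by positivity,
    hrr := hrr,
    hη := bmp.contDiff,
    hηc := bmp.hasCompactSupport,
    hη1 := fun x hx => bmp.one_of_mem_closedBall (Metric.ball_subset_closedBall (by
      have h : 2 * (R / 8) = R / 4 := by ring
      rw [h] at hx; exact hx)),
    hσ := by simp,
    hS2 := hS,
    hL1 := by nlinarith [mul_nonneg hK2 hK0, sq_nonneg K],
    hL := ?_, hC := ?_, hSout := ?_, star := ?_, qc := ?_, int_tsupp := fun h => absurd h hx0 }⟩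
  · intro x hx hxt y hy hyb
    have hxR := hts hxt
    have hyR := hbr hyb
    have h1 := lΨ (ch.Θ x) (ch.Θ y)
    rw [hΨΘ x hxR, hΨΘ y hyR] at h1
    have h2 := flp_dist ((hmem x hxR).1 hx).le (hcl y hyR hy)
    have h3 := key x hx hxt y hy hyb
    have h4 : K * ‖ch.Θ x - ch.Θ y‖ ≤ K * (K * ‖S x - y‖) := mul_le_mul_of_nonneg_left (h2.trans h3) hK0
    nlinarith [mul_nonneg (mul_nonneg hK2 hK0) (norm_nonneg (S x - y)), norm_nonneg (S x - y)]
  · intro x hx hxt y hy hyb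
    have hxR := hts hxt
    have hyR := hbr hyb
    have h1 := hFK (ch.Θ x) (hΘR x hxR)
    rw [hΨΘ x hxR] at h1
    have h2 := flp_abs ((hmem x hxR).1 hx).le (hcl y hyR hy)
    have h3 := key x hx hxt y hy hyb
    have h4 : K2 * |(ch.Θ x) 1| ≤ K2 * (K * ‖S x - y‖) := mul_le_mul_of_nonneg_left (h2.trans h3) hK2
    rw [abs_one, one_mul]
    nlinarith [norm_nonneg (S x - y), mul_nonneg (sq_nonneg K) (norm_nonneg (S x - y))]
  · intro _ x hx hxt
    have hxR := hts hxt
    intro hSx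
    have h1 := (ch.mem _ (hflb _ (hΘR x hxR))).1 hSx
    rw [flp_1] at h1
    have := (hmem x hxR).1 hx
    linarith
  · intro φ hφ y d hd
    have hη1 : ContDiff ℝ 1 (bmp : E2 → ℝ) := bmp.contDiff
    have h := flux_zero ho.measurableSet hb ch hRρ hΘR (Xf_contDiff 1 hS hd y) ?_
      (v := fun x => bmp x * φ x) (hη1.mul hφ) (bmp.hasCompactSupport.mul_right)
      ((tsupport_mul_subset_left).trans hts)
    · simpa only [dv_Xf 1 hS hd] using h
    · intro p hp hp1
      obtain ⟨a, ha, h1, h2, h3, h4⟩ := hbd p hp hp1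
      obtain ⟨t1, -, t2⟩ := refl_alg ha h1 h2
      have e : Xf 1 S d y (ch.Ψ p) = pk d (ch.Ψ p - y) + fderiv ℝ S (ch.Ψ p) (pk d (ch.Ψ p - y)) := by
        simp [Xf, h4, tf, t1]
      have h5 := t2 (pk d (ch.Ψ p - y))
      rw [← e] at h5
      have h6 := congrArg (fun v => (fderiv ℝ ch.Θ (ch.Ψ p) v) 1) h5
      simp only [map_smul, h3, PiLp.smul_apply, smul_eq_mul] at h6
      have h7 : (ee 0) 1 = (0:ℝ) := by simp
      rw [h7, mul_zero] at h6
      rcases mul_eq_zero.1 h6 with h | h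
      · exact absurd h (by positivity)
      · exact h
  · intro F hF b hFb x hx hxb y hy hyb
    have hb0 : 0 ≤ b := (norm_nonneg _).trans (hFb x hx (Metric.ball_subset_ball hrr hxb))
    have hxR := hbr (Metric.ball_subset_ball hrr hxb)
    have hyR := hbr (Metric.ball_subset_ball hrr hyb)
    set r' := R / 8 / (K + 1) ^ 2 with hr'
    have hr'0 : 0 < r' := by positivity
    have hr'e : (K + 1) ^ 2 * r' = R / 8 := by rw [hr']; field_simp
    let C : Set E2 := Metric.ball (0:E2) ((K + 1) * r') ∩ {p | p 1 ≤ 0}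
    have hC : Convex ℝ C := (convex_ball _ _).inter
      (convex_halfSpace_le (EuclideanSpace.proj (1 : Fin 2) : E2 →L[ℝ] ℝ).isLinear 0)
    have hin : ∀ x ∈ Metric.ball x0 r', x ∈ Metric.ball x0 R → x ∈ closure Ω → ch.Θ x ∈ C := by
      intro x hx hxR hxc
      refine ⟨?_, hcl x hxR hxc⟩
      rw [mem_ball_iff_norm] at hx
      rw [mem_ball_zero_iff]
      have := hΘn x
      nlinarith [norm_nonneg (x - x0)]
    have hCρ : ∀ p ∈ C, p ∈ Metric.ball (0:E2) ch.ρ ∧ ch.Ψ p ∈ Metric.ball x0 (R / 8) := by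
      intro p hp
      have h1 := hp.1
      rw [mem_ball_zero_iff] at h1
      have h2 : ‖ch.Ψ p - x0‖ < R / 8 := by
        have := hΨn p
        nlinarith [norm_nonneg p]
      refine ⟨?_, by rwa [mem_ball_iff_norm]⟩
      rw [mem_ball_zero_iff]
      nlinarith [norm_nonneg p]
    have hd : ∀ p ∈ C, HasFDerivWithinAt (fun p => F (ch.Ψ p)) ((fderiv ℝ F (ch.Ψ p)).comp (fderiv ℝ ch.Ψ p)) C p := by
      intro p hp
      exact (((hF.differentiable (by norm_num) _).hasFDerivAt).comp p
        ((ch.hΨ.differentiable (by norm_num) p).hasFDerivAt)).hasFDerivWithinAt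
    have hbound : ∀ p ∈ C, ‖(fderiv ℝ F (ch.Ψ p)).comp (fderiv ℝ ch.Ψ p)‖ ≤ b * K := by
      intro p hp
      refine (ContinuousLinearMap.opNorm_comp_le _ _).trans ?_
      refine mul_le_mul (hFb _ (hcl2 p (hCρ p hp).1 hp.2) (hCρ p hp).2) ?_ (norm_nonneg _) hb0
      rw [hK]; exact norm_fderiv_le_of_lipschitz ℝ ch.lΨ
    have h1 := hC.norm_image_sub_le_of_norm_hasFDerivWithin_le hd hbound (hin y hyb hyR hy) (hin x hxb hxR hx)
    simp only [hΨΘ x hxR, hΨΘ y hyR, Real.norm_eq_abs] at h1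
    have h2 := lΘ x y
    have h3 : b * K * ‖ch.Θ x - ch.Θ y‖ ≤ b * K * (K * ‖x - y‖) := mul_le_mul_of_nonneg_left h2 (by positivity)
    have h4 : 0 ≤ b * ‖x - y‖ := by positivity
    nlinarith [mul_nonneg (mul_nonneg hK2 hK0) h4]

lemma int_patch {Ω : Set E2} (ho : IsOpen Ω) {x0 : E2} (hx0 : x0 ∈ Ω) : Nonempty (Patch Ω x0) := by
  obtain ⟨R, hR, hRΩ⟩ := Metric.isOpen_iff.1 ho x0 hx0
  let bmp : ContDiffBump x0 := ⟨R / 4, R / 2, by positivity, by linarith⟩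
  have hts : tsupport (bmp : E2 → ℝ) ⊆ Ω := by
    rw [bmp.tsupport_eq]
    exact (Metric.closedBall_subset_ball (by show R / 2 < R; linarith)).trans hRΩ
  have hbr : Metric.ball x0 (R / 8) ⊆ Ω := (Metric.ball_subset_ball (by linarith)).trans hRΩ
  refine ⟨{
    r := R / 8, r' := R / 8, η := bmp, σ := 0, S := id, L := 1,
    hr' := by positivity,
    hrr := le_rfl,
    hη := bmp.contDiff,
    hηc := bmp.hasCompactSupport,
    hη1 := fun x hx => bmp.one_of_mem_closedBall (Metric.ball_subset_closedBall (by
      have h : 2 * (R / 8) = R / 4 := by ring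
      rw [h] at hx; exact hx)),
    hσ := by simp,
    hS2 := contDiff_id,
    hL1 := le_rfl,
    hL := fun x _ _ y _ _ => by simp,
    hC := fun x _ _ y _ _ => by simp,
    hSout := fun h => absurd rfl h,
    star := ?_, qc := ?_, int_tsupp := fun _ => ⟨rfl, hts⟩ }⟩
  · intro φ hφ y d hd
    have hη1 : ContDiff ℝ 1 (bmp : E2 → ℝ) := bmp.contDiff
    have h := int_div_zero (a := fun x => bmp x * φ x) (hη1.mul hφ) (bmp.hasCompactSupport.mul_right)
      (Xf_contDiff 0 (S := id) contDiff_id hd y)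
    simp only [dv_Xf 0 (S := id) contDiff_id hd] at h
    refine Eq.trans ?_ h
    apply setIntegral_eq_integral_of_forall_compl_eq_zero
    intro x hx
    have hx' : x ∉ tsupport (fun x => bmp x * φ x) := fun h => hx (hts (tsupport_mul_subset_left h))
    have h1 : fderiv ℝ (fun x => bmp x * φ x) x = 0 := by
      by_contra hne
      exact hx' (support_fderiv_subset ℝ (f := fun x => bmp x * φ x) hne)
    have h2 : bmp x * φ x = 0 := image_eq_zero_of_notMem_tsupport (f := fun x => bmp x * φ x) hx'
    rw [h1, h2]; simp
  · intro F hF b hFb x hx hxb y hy hyb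
    have h1 := (convex_ball x0 (R / 8)).norm_image_sub_le_of_norm_hasFDerivWithin_le
      (f := F) (f' := fderiv ℝ F) (C := b)
      (fun p _ => ((hF.differentiable (by norm_num) p).hasFDerivAt).hasFDerivWithinAt)
      (fun p hp => hFb p (subset_closure (hbr hp)) hp) hyb hxb
    simpa using h1

theorem exists_patch {Ω : Set E2} (ho : IsOpen Ω) (hb : IsBounded Ω)
    (hbdy : ∀ x ∈ frontier Ω, ∃ U g, IsC2LocalDefining Ω x U g) {x0 : E2} (hx0 : x0 ∈ closure Ω) :
    Nonempty (Patch Ω x0) := by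
  by_cases h : x0 ∈ Ω
  · exact int_patch ho h
  · have hf : x0 ∈ frontier Ω := by rw [ho.frontier_eq]; exact ⟨hx0, h⟩
    obtain ⟨U, g, hg⟩ := hbdy x0 hf
    obtain ⟨ch⟩ := exists_chart ho hf hg
    exact bdry_patch ho hb h ch

end PatchBuild

end Grp3

section Grp8
open MeasureTheory Bornology Filter
open scoped RealInnerProductSpace ENNReal Topology ContDiff

noncomputable section RepSec

variable {Ω : Set E2} {x0 : E2}

lemma fin_meas (hb : IsBounded Ω) : IsFiniteMeasure (volume.restrict Ω) :=
  ⟨by rw [Measure.restrict_apply_univ]; exact hb.measure_lt_top⟩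

lemma kk_integrable (hb : IsBounded Ω) {s : ℝ} (h0 : 0 < s) (hs : s < 2) (y : E2) :
    Integrable (fun x => ‖x - y‖ ^ (-s)) (volume.restrict Ω) := by
  obtain ⟨K, hK, h⟩ := kk_bound hb h0 hs
  refine ⟨((measurable_id.sub_const y).norm.pow_const (-s)).aestronglyMeasurable, ?_⟩
  rw [hasFiniteIntegral_iff_ofReal (Eventually.of_forall fun x => by positivity)]
  exact (h y).trans_lt (lt_top_iff_ne_top.2 hK)

lemma cont_integrable (hb : IsBounded Ω) {V : Type*} [NormedAddCommGroup V] {f : E2 → V}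
    (hf : Continuous f) : Integrable f (volume.restrict Ω) := by
  have h : IsCompact (closure Ω) := hb.isCompact_closure
  exact (hf.continuousOn.integrableOn_compact h).mono_set subset_closure

lemma rho_conv_tendsto' {ψ : E2 → ℝ} (hψm : Measurable ψ) {x : E2} (hψ : ContinuousAt ψ x) {B : ℝ} (hB : ∀ x, |ψ x| ≤ B)
    {δ : ℕ → ℝ} (hδ : ∀ n, 0 < δ n) (hδ0 : Filter.Tendsto δ Filter.atTop (𝓝 0)) :
    Filter.Tendsto (fun n => ∫ y, ψ y * rho (δ n) (x - y)) Filter.atTop (𝓝 (c0 * ψ x)) := by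
  have e : c0 * ψ x = ∫ z, ψ x * rho 1 z := by rw [integral_const_mul, c0, mul_comm]
  rw [e]
  simp_rw [rho_conv (hδ _)]
  refine tendsto_integral_of_dominated_convergence (fun z => B * rho 1 z) (fun n => ?_)
    (rho_integrable.const_mul B) (fun n => Filter.Eventually.of_forall fun z => ?_)
    (Filter.Eventually.of_forall fun z => ?_)
  · have h1 := (rho_contDiff one_pos (n := 0)).continuous.measurable
    have h2 : Measurable (fun z : E2 => ψ (x - δ n • z)) := hψm.comp (by fun_prop)
    exact (h2.mul h1).aestronglyMeasurable
  · rw [norm_mul, Real.norm_of_nonneg (rho_nonneg 1 z)]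
    exact mul_le_mul_of_nonneg_right (hB _) (rho_nonneg 1 z)
  · apply Filter.Tendsto.mul_const
    have h1 : Filter.Tendsto (fun n => x - δ n • z) Filter.atTop (𝓝 (x - (0:ℝ) • z)) :=
      (hδ0.smul_const z).const_sub x
    simp only [zero_smul, sub_zero] at h1
    exact hψ.tendsto.comp h1

lemma rho_small {d δ : ℝ} (hδ : 0 < δ) {z : E2} (hz : δ ≤ ‖z‖) : rho d z ≤ 2 * d ^ 2 * (δ ^ 2)⁻¹ ^ 2 := by
  unfold rho nn
  have : (‖z‖ ^ 2 + d ^ 2)⁻¹ ≤ (δ ^ 2)⁻¹ := by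
    apply inv_anti₀ (by positivity)
    nlinarith
  gcongr

namespace Patch
variable (P : Patch Ω x0)

lemma hr : 0 < P.r := P.hr'.trans_le P.hrr
lemma hL0 : 0 < P.L := one_pos.trans_le P.hL1
lemma hA : ContDiff ℝ 1 (fderiv ℝ P.S) := P.hS2.fderiv_right (m := 1) (by norm_num)
lemma hS1 : ContDiff ℝ 1 P.S := P.hS2.of_le (by norm_num)

lemma inv_S {s : ℝ} (hs : 0 ≤ s) {x y : E2} (hx : x ∈ Ω) (hxt : x ∈ tsupport P.η) (hy : y ∈ closure Ω)
    (hyb : y ∈ Metric.ball x0 P.r) (hxy : x ≠ y) : ‖P.S x - y‖ ^ (-s) ≤ P.L ^ s * ‖x - y‖ ^ (-s) := by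
  have h := P.hL x hx hxt y hy hyb
  have hL := P.hL0
  have h1 : 0 < ‖x - y‖ := norm_pos_iff.2 (sub_ne_zero.2 hxy)
  have h2 : 0 < ‖P.S x - y‖ := by
    by_contra hne
    have : ‖P.S x - y‖ = 0 := le_antisymm (not_lt.1 hne) (norm_nonneg _)
    rw [this, mul_zero] at h; linarith
  rw [Real.rpow_neg h1.le, Real.rpow_neg h2.le, ← div_eq_mul_inv, inv_eq_one_div, div_le_div_iff₀ (by positivity) (by positivity),
    one_mul, ← Real.mul_rpow hL.le h2.le]
  exact Real.rpow_le_rpow h1.le h hs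

/-- uniform bound on tf A on the support of η -/
lemma tf_bound : ∃ M, 0 ≤ M ∧ ∀ x ∈ tsupport P.η, ‖tf (fderiv ℝ P.S x)‖ ≤ M := by
  obtain ⟨M, hM⟩ := P.hηc.isCompact.exists_bound_of_continuousOn (tf_contDiff P.hA).continuous.continuousOn
  exact ⟨max M 0, le_max_right _ _, fun x hx => (hM x hx).trans (le_max_left _ _)⟩

lemma Xf_bounds : ∃ C, 0 ≤ C ∧ ∀ x ∈ Ω, x ∈ tsupport P.η → ∀ y ∈ closure Ω, y ∈ Metric.ball x0 P.r → x ≠ y →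
    ∀ d : ℝ, 0 ≤ d → ‖Xf P.σ P.S d y x‖ ≤ C * ‖x - y‖ ^ (-(1:ℝ)) ∧
      ‖Xf P.σ P.S d y x - Xf P.σ P.S 0 y x‖ ≤ C * √d * ‖x - y‖ ^ (-(3/2:ℝ)) := by
  obtain ⟨M, hM0, hM⟩ := P.tf_bound
  have hL := P.hL0
  refine ⟨1 + M * P.L ^ (1:ℝ) + M * P.L ^ (3/2:ℝ), by positivity, fun x hx hxt y hy hyb hxy d hd => ?_⟩
  have h1 := P.inv_S (s := 1) (by norm_num) hx hxt hy hyb hxy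
  have h2 := P.inv_S (s := 3/2) (by norm_num) hx hxt hy hyb hxy
  have hs := P.hσ
  have e : ∀ w : E2, ‖P.σ • tf (fderiv ℝ P.S x) w‖ ≤ M * ‖w‖ := fun w => by
    rw [norm_smul, Real.norm_eq_abs]
    have := (tf (fderiv ℝ P.S x)).le_of_opNorm_le (hM x hxt) w
    nlinarith [norm_nonneg (tf (fderiv ℝ P.S x) w), abs_nonneg P.σ]
  constructor
  · have a1 := pk_norm_le d (x - y)
    have a2 := pk_norm_le d (P.S x - y)
    rw [← Real.rpow_neg_one] at a1 a2
    have := norm_add_le (pk d (x - y)) (P.σ • tf (fderiv ℝ P.S x) (pk d (P.S x - y)))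
    have e1 := e (pk d (P.S x - y))
    have e2 : M * ‖pk d (P.S x - y)‖ ≤ M * (P.L ^ (1:ℝ) * ‖x - y‖ ^ (-(1:ℝ))) := mul_le_mul_of_nonneg_left (a2.trans h1) hM0
    unfold Xf
    have p1 : 0 ≤ M * P.L ^ (3/2:ℝ) * ‖x - y‖ ^ (-(1:ℝ)) := by positivity
    nlinarith
  · have a1 := pk_diff_le hd (x - y)
    have a2 := pk_diff_le hd (P.S x - y)
    have := norm_add_le (pk d (x - y) - pk 0 (x - y)) (P.σ • tf (fderiv ℝ P.S x) (pk d (P.S x - y) - pk 0 (P.S x - y)))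
    have e1 := e (pk d (P.S x - y) - pk 0 (P.S x - y))
    have h3 : √d * ‖P.S x - y‖ ^ (-(3/2:ℝ)) ≤ √d * (P.L ^ (3/2:ℝ) * ‖x - y‖ ^ (-(3/2:ℝ))) :=
      mul_le_mul_of_nonneg_left h2 (by positivity)
    have e2 : M * ‖pk d (P.S x - y) - pk 0 (P.S x - y)‖ ≤ M * (√d * (P.L ^ (3/2:ℝ) * ‖x - y‖ ^ (-(3/2:ℝ)))) :=
      mul_le_mul_of_nonneg_left (a2.trans h3) hM0
    have e3 : Xf P.σ P.S d y x - Xf P.σ P.S 0 y x = (pk d (x - y) - pk 0 (x - y)) + P.σ • tf (fderiv ℝ P.S x) (pk d (P.S x - y) - pk 0 (P.S x - y)) := by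
      unfold Xf; rw [map_sub, smul_sub]; abel
    rw [e3]
    have p1 : 0 ≤ M * P.L ^ (1:ℝ) * √d * ‖x - y‖ ^ (-(3/2:ℝ)) := by positivity
    nlinarith

lemma Xf_meas (d : ℝ) : Measurable (fun p : E2 × E2 => Xf P.σ P.S d p.2 p.1) := by
  have h1 : Measurable (pk d) := by
    unfold pk
    exact ((nn_contDiff d (n := 0)).continuous.measurable.inv).smul measurable_id
  have hS := P.hS1.continuous
  have hT : Continuous (fun p : (E2 →L[ℝ] E2) × E2 => p.1 p.2) := by fun_prop
  have h2 : Measurable (fun p : E2 × E2 => tf (fderiv ℝ P.S p.1) (pk d (P.S p.1 - p.2))) := by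
    refine hT.measurable.comp (Measurable.prodMk ?_ (h1.comp ?_))
    · exact ((tf_contDiff P.hA).continuous.comp continuous_fst).measurable
    · exact ((hS.comp continuous_fst).sub continuous_snd).measurable
  exact (h1.comp (by fun_prop)).add (h2.const_smul P.σ)

lemma pk_meas (d : ℝ) : Measurable (pk d) := by
  unfold pk
  exact ((nn_contDiff d (n := 0)).continuous.measurable.inv).smul measurable_id

lemma Xf_meas1 (d : ℝ) (y : E2) : Measurable (fun x : E2 => Xf P.σ P.S d y x) := by
  have h1 : Measurable (pk d) := pk_meas d
  have hS := P.hS1.continuous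
  have hT : Continuous (fun p : (E2 →L[ℝ] E2) × E2 => p.1 p.2) := by fun_prop
  have h2 : Measurable (fun x : E2 => tf (fderiv ℝ P.S x) (pk d (P.S x - y))) := by
    refine hT.measurable.comp (Measurable.prodMk ?_ (h1.comp ?_))
    · exact (tf_contDiff P.hA).continuous.measurable
    · exact (hS.sub continuous_const).measurable
  have h3 : Measurable (fun x : E2 => pk d (x - y)) := h1.comp (by fun_prop)
  have h4 := h3.add (h2.const_smul P.σ)
  unfold Xf
  exact h4

lemma ae_ne (y : E2) : ∀ᵐ x ∂(volume.restrict Ω), x ≠ y :=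
  ae_restrict_of_ae (compl_mem_ae_iff.2 (by simp : volume ({y} : Set E2) = 0))

lemma rep_C1 (ho : IsOpen Ω) (hb : IsBounded Ω) {φ : E2 → ℝ} (hφ : ContDiff ℝ 1 φ) {y : E2} (hy : y ∈ Ω)
    (hyb : y ∈ Metric.ball x0 P.r) :
    c0 * φ y = - ∫ x in Ω, fderiv ℝ (fun x => P.η x * φ x) x (Xf P.σ P.S 0 y x) := by
  set v : E2 → ℝ := fun x => P.η x * φ x with hvdef
  have hv : ContDiff ℝ 1 v := P.hη.mul hφ
  have hvc : HasCompactSupport v := P.hηc.mul_right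
  have hvD : Continuous (fderiv ℝ v) := hv.continuous_fderiv (by norm_num)
  have hvz : ∀ x, x ∉ tsupport P.η → fderiv ℝ v x = 0 ∧ v x = 0 := by
    intro x hx
    have h1 : x ∉ tsupport v := fun h => hx (tsupport_mul_subset_left h)
    refine ⟨?_, image_eq_zero_of_notMem_tsupport (f := v) h1⟩
    by_contra hne
    exact h1 (support_fderiv_subset ℝ (f := v) hne)
  obtain ⟨B1, hB1⟩ := hvc.exists_bound_of_continuous hv.continuous
  have hvDc : HasCompactSupport (fderiv ℝ v) := hvc.fderiv ℝ
  obtain ⟨B2, hB2⟩ := hvDc.exists_bound_of_continuous hvD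
  have hB20 : 0 ≤ B2 := (norm_nonneg _).trans (hB2 0)
  have hB10 : 0 ≤ B1 := (norm_nonneg _).trans (hB1 0)
  let δ : ℕ → ℝ := fun n => 1 / ((n:ℝ) + 1)
  have hδ : ∀ n, 0 < δ n := fun n => by positivity
  have hδ0 : Tendsto δ atTop (𝓝 0) := tendsto_one_div_add_atTop_nhds_zero_nat
  have hyc := subset_closure hy
  haveI := fin_meas hb
  -- left limit
  obtain ⟨C, hC0, hC⟩ := P.Xf_bounds
  have l1 : Tendsto (fun n => ∫ x in Ω, fderiv ℝ v x (Xf P.σ P.S (δ n) y x)) atTop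
      (𝓝 (∫ x in Ω, fderiv ℝ v x (Xf P.σ P.S 0 y x))) := by
    have hcomb : Continuous (fun p : (E2 →L[ℝ] ℝ) × E2 => p.1 p.2) := by fun_prop
    refine tendsto_integral_of_dominated_convergence (fun x => B2 * (C * ‖x - y‖ ^ (-(1:ℝ))))
      (fun n => ?_) (((kk_integrable hb one_pos (by norm_num) y).const_mul C).const_mul B2) (fun n => ?_) ?_
    · exact (hcomb.measurable.comp (hvD.measurable.prodMk (P.Xf_meas1 _ y))).aestronglyMeasurable
    · filter_upwards [ae_restrict_mem ho.measurableSet, ae_ne y] with x hx hxy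
      by_cases hxt : x ∈ tsupport P.η
      · exact ((fderiv ℝ v x).le_opNorm _).trans (mul_le_mul (hB2 x) (hC x hx hxt y hyc hyb hxy _ (hδ n).le).1 (norm_nonneg _) hB20)
      · rw [(hvz x hxt).1]; simp; positivity
    · filter_upwards [ae_restrict_mem ho.measurableSet, ae_ne y] with x hx hxy
      by_cases hxt : x ∈ tsupport P.η
      · refine ((fderiv ℝ v x).continuous.tendsto _).comp ?_
        rw [tendsto_iff_norm_sub_tendsto_zero]
        refine squeeze_zero (fun _ => norm_nonneg _) (fun n => (hC x hx hxt y hyc hyb hxy _ (hδ n).le).2) ?_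
        have : Tendsto (fun n => √(δ n)) atTop (𝓝 0) := by
          have := (Real.continuous_sqrt.tendsto 0).comp hδ0
          simpa [Function.comp_def] using this
        simpa using (this.const_mul C).mul_const (‖x - y‖ ^ (-(3/2:ℝ)))
      · rw [(hvz x hxt).1]; simp
  have l2 : Tendsto (fun n => ∫ x in Ω, v x * rho (δ n) (x - y)) atTop (𝓝 (c0 * φ y)) := by
    have h1 := rho_conv_tendsto' (ψ := Ω.indicator v) (hv.continuous.measurable.indicator ho.measurableSet) (x := y)
      (by
        refine hv.continuous.continuousAt.congr ?_
        filter_upwards [ho.mem_nhds hy] with z hz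
        rw [Set.indicator_of_mem hz]) (B := B1)
      (fun x => by
        by_cases hx : x ∈ Ω
        · rw [Set.indicator_of_mem hx]; exact hB1 x
        · rw [Set.indicator_of_notMem hx]; simpa using hB10) hδ hδ0
    rw [Set.indicator_of_mem hy, show v y = φ y by
      simp only [hvdef]; rw [P.hη1 y (Metric.ball_subset_ball (by linarith [P.hr]) hyb), one_mul]] at h1
    refine h1.congr fun n => ?_
    rw [← integral_indicator ho.measurableSet]
    refine integral_congr_ae (Eventually.of_forall fun x => ?_)
    have hsym : rho (δ n) (y - x) = rho (δ n) (x - y) := by simp only [rho, nn, norm_sub_rev]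
    by_cases hx : x ∈ Ω
    · simp [hx, hsym]
    · simp [hx]
  have hdt : Continuous (fun x => dtm (fderiv ℝ P.S x)) := by
    unfold dtm
    have h := fun i j : Fin 2 => (comp_contDiff (P.hA.clm_apply (contDiff_const (c := ee j))) i).continuous
    exact ((h 0 0).mul (h 1 1)).sub ((h 0 1).mul (h 1 0))
  have l3 : Tendsto (fun n => ∫ x in Ω, v x * (P.σ * dtm (fderiv ℝ P.S x) * rho (δ n) (P.S x - y))) atTop (𝓝 0) := by
    by_cases hσ : P.σ = 0
    · simp [hσ]
    obtain ⟨δ0, hδ00, hball⟩ := Metric.isOpen_iff.1 ho y hy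
    obtain ⟨M, hM⟩ := P.hηc.isCompact.exists_bound_of_continuousOn hdt.continuousOn
    have hb1 : ∀ n, ∀ᵐ x ∂(volume.restrict Ω), ‖v x * (P.σ * dtm (fderiv ℝ P.S x) * rho (δ n) (P.S x - y))‖ ≤
        B1 * (1 * (max M 0) * (2 * (δ n) ^ 2 * (δ0 ^ 2)⁻¹ ^ 2)) := by
      intro n
      filter_upwards [ae_restrict_mem ho.measurableSet] with x hx
      by_cases hxt : x ∈ tsupport P.η
      · have hn : δ0 ≤ ‖P.S x - y‖ := by
          by_contra hne
          exact P.hSout hσ x hx hxt (hball (by rw [mem_ball_iff_norm]; exact not_le.1 hne))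
        have q1 := rho_small (d := δ n) hδ00 hn
        have q2 := rho_nonneg (δ n) (P.S x - y)
        have q3 := (hM x hxt).trans (le_max_left _ (0:ℝ))
        rw [norm_mul (v x), norm_mul (P.σ * _), norm_mul P.σ, Real.norm_of_nonneg q2]
        refine mul_le_mul (hB1 x) (mul_le_mul (mul_le_mul P.hσ q3 (norm_nonneg _) zero_le_one) q1 q2 (by positivity)) (by positivity) hB10
      · rw [(hvz x hxt).2]; simp; positivity
    have hlim : Tendsto (fun n => B1 * (1 * (max M 0) * (2 * (δ n) ^ 2 * (δ0 ^ 2)⁻¹ ^ 2)) * (volume.restrict Ω).real Set.univ) atTop (𝓝 0) := by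
      have : Tendsto (fun n => B1 * (1 * (max M 0) * (2 * (δ n) ^ 2 * (δ0 ^ 2)⁻¹ ^ 2)) * (volume.restrict Ω).real Set.univ) atTop
        (𝓝 (B1 * (1 * (max M 0) * (2 * 0 ^ 2 * (δ0 ^ 2)⁻¹ ^ 2)) * (volume.restrict Ω).real Set.univ)) :=
        (((((hδ0.pow 2).const_mul 2).mul_const _).const_mul _).const_mul _).mul_const _
      simpa using this
    exact squeeze_zero_norm (fun n => norm_integral_le_of_norm_le_const (hb1 n)) hlim
  have hst : ∀ n, ∫ x in Ω, v x * rho (δ n) (x - y) = - (∫ x in Ω, fderiv ℝ v x (Xf P.σ P.S (δ n) y x))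
      + ∫ x in Ω, v x * (P.σ * dtm (fderiv ℝ P.S x) * rho (δ n) (P.S x - y)) := by
    intro n
    have h := P.star φ hφ y (δ n) (hδ n)
    have c1 : Continuous (fun x => fderiv ℝ v x (Xf P.σ P.S (δ n) y x)) :=
      hvD.clm_apply (Xf_contDiff P.σ P.hS2 (hδ n) y).continuous
    have hrho := (rho_contDiff (hδ n) (n := 0)).continuous
    have hS := P.hS1.continuous
    have c2 : Continuous (fun x => v x * rho (δ n) (x - y)) := hv.continuous.mul (hrho.comp (by fun_prop))
    have c3 : Continuous (fun x => v x * (P.σ * dtm (fderiv ℝ P.S x) * rho (δ n) (P.S x - y))) :=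
      hv.continuous.mul ((continuous_const.mul hdt).mul (hrho.comp (by fun_prop)))
    have e : ∀ x, fderiv ℝ v x (Xf P.σ P.S (δ n) y x) + v x * rh P.σ P.S (δ n) y x =
      (fderiv ℝ v x (Xf P.σ P.S (δ n) y x) + v x * rho (δ n) (x - y)) - v x * (P.σ * dtm (fderiv ℝ P.S x) * rho (δ n) (P.S x - y)) := by
      intro x; unfold rh; ring
    have h' : ∫ x in Ω, (fderiv ℝ v x (Xf P.σ P.S (δ n) y x) + v x * rh P.σ P.S (δ n) y x) = 0 := h
    simp_rw [e] at h'
    have i12 : Integrable (fun x => fderiv ℝ v x (Xf P.σ P.S (δ n) y x) + v x * rho (δ n) (x - y)) (volume.restrict Ω) :=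
      cont_integrable hb (c1.add c2)
    rw [integral_sub i12 (cont_integrable hb c3),
      integral_add (cont_integrable hb c1) (cont_integrable hb c2)] at h'
    linarith
  have l4 := l1.neg.add l3
  simp_rw [← hst, add_zero] at l4
  exact tendsto_nhds_unique l2 l4

end Patch
end RepSec


noncomputable section H1Sec

variable {Ω : Set E2} {x0 : E2}

abbrev mu (Ω : Set E2) : Measure E2 := volume.restrict Ω
abbrev HH (Ω : Set E2) := WithLp 2 (Lp ℝ 2 (mu Ω) × Lp E2 2 (mu Ω))

/-- the function component -/
def uu (U : HH Ω) : E2 → ℝ := U.fst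
/-- the gradient component -/
def GG (U : HH Ω) : E2 → E2 := U.snd

lemma uu_sm (U : HH Ω) : StronglyMeasurable (uu U) := Lp.stronglyMeasurable _
lemma GG_sm (U : HH Ω) : StronglyMeasurable (GG U) := Lp.stronglyMeasurable _
lemma uu_memLp (U : HH Ω) : MemLp (uu U) 2 (mu Ω) := Lp.memLp _
lemma GG_memLp (U : HH Ω) : MemLp (GG U) 2 (mu Ω) := Lp.memLp _

lemma uu_add (U V : HH Ω) : uu (U + V) =ᵐ[mu Ω] fun x => uu U x + uu V x := Lp.coeFn_add _ _
lemma GG_add (U V : HH Ω) : GG (U + V) =ᵐ[mu Ω] fun x => GG U x + GG V x := Lp.coeFn_add _ _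
lemma uu_sub (U V : HH Ω) : uu (U - V) =ᵐ[mu Ω] fun x => uu U x - uu V x := Lp.coeFn_sub _ _
lemma GG_sub (U V : HH Ω) : GG (U - V) =ᵐ[mu Ω] fun x => GG U x - GG V x := Lp.coeFn_sub _ _
lemma uu_smul (c : ℝ) (U : HH Ω) : uu (c • U) =ᵐ[mu Ω] fun x => c * uu U x := Lp.coeFn_smul _ _
lemma GG_smul (c : ℝ) (U : HH Ω) : GG (c • U) =ᵐ[mu Ω] fun x => c • GG U x := Lp.coeFn_smul _ _

structure IsRep (U : HH Ω) (φ : E2 → ℝ) : Prop where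
  c1 : ContDiff ℝ 1 φ
  hu : uu U =ᵐ[mu Ω] φ
  hG : GG U =ᵐ[mu Ω] gradient φ

lemma gradient_add' {φ ψ : E2 → ℝ} (hφ : ContDiff ℝ 1 φ) (hψ : ContDiff ℝ 1 ψ) (x : E2) :
    gradient (fun x => φ x + ψ x) x = gradient φ x + gradient ψ x := by
  unfold gradient
  rw [← map_add]; congr 1
  exact fderiv_add (hφ.differentiable (by norm_num) x) (hψ.differentiable (by norm_num) x)

lemma gradient_const_mul' {φ : E2 → ℝ} (hφ : ContDiff ℝ 1 φ) (c : ℝ) (x : E2) :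
    gradient (fun x => c * φ x) x = c • gradient φ x := by
  unfold gradient
  rw [← map_smul]; congr 1
  exact fderiv_const_mul (hφ.differentiable (by norm_num) x) c

lemma gradient_mul' {φ ψ : E2 → ℝ} (hφ : ContDiff ℝ 1 φ) (hψ : ContDiff ℝ 1 ψ) (x : E2) :
    gradient (fun x => φ x * ψ x) x = φ x • gradient ψ x + ψ x • gradient φ x := by
  unfold gradient
  rw [← map_smul, ← map_smul, ← map_add]; congr 1
  exact fderiv_mul (hφ.differentiable (by norm_num) x) (hψ.differentiable (by norm_num) x)

lemma gradient_cont {φ : E2 → ℝ} (hφ : ContDiff ℝ 1 φ) : Continuous (gradient φ) :=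
  (LinearIsometryEquiv.continuous _).comp (hφ.continuous_fderiv (by norm_num))

lemma gr_inner (φ : E2 → ℝ) (x w : E2) : ⟪gradient φ x, w⟫ = fderiv ℝ φ x w := inner_gradient_left

lemma IsRep.add {U V : HH Ω} {φ ψ : E2 → ℝ} (h : IsRep U φ) (h' : IsRep V ψ) : IsRep (U + V) (fun x => φ x + ψ x) := by
  refine ⟨h.c1.add h'.c1, ?_, ?_⟩
  · filter_upwards [uu_add U V, h.hu, h'.hu] with x a b c; rw [a, b, c]
  · filter_upwards [GG_add U V, h.hG, h'.hG] with x a b c; rw [a, b, c, gradient_add' h.c1 h'.c1]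

lemma IsRep.smul {U : HH Ω} {φ : E2 → ℝ} (h : IsRep U φ) (c : ℝ) : IsRep (c • U) (fun x => c * φ x) := by
  refine ⟨contDiff_const.mul h.c1, ?_, ?_⟩
  · filter_upwards [uu_smul c U, h.hu] with x a b; rw [a, b]
  · filter_upwards [GG_smul c U, h.hG] with x a b; rw [a, b, gradient_const_mul' h.c1]

lemma IsRep.zero : IsRep (0 : HH Ω) (fun _ => 0) := by
  refine ⟨contDiff_const, Lp.coeFn_zero _ _ _, ?_⟩
  have : gradient (fun _ : E2 => (0:ℝ)) = 0 := by ext x; simp [gradient]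
  rw [this]; exact Lp.coeFn_zero _ _ _

def C1sub (Ω : Set E2) : Submodule ℝ (HH Ω) where
  carrier := {U | ∃ φ, IsRep U φ}
  add_mem' := fun ⟨_, h⟩ ⟨_, h'⟩ => ⟨_, h.add h'⟩
  zero_mem' := ⟨_, IsRep.zero⟩
  smul_mem' := fun c _ ⟨_, h⟩ => ⟨_, h.smul c⟩

def H1 (Ω : Set E2) : Submodule ℝ (HH Ω) := (C1sub Ω).topologicalClosure

lemma H1_closed : IsClosed (H1 Ω : Set (HH Ω)) := (C1sub Ω).isClosed_topologicalClosure

lemma IsRep.mem {U : HH Ω} {φ : E2 → ℝ} (h : IsRep U φ) : U ∈ H1 Ω :=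
  (C1sub Ω).le_topologicalClosure ⟨φ, h⟩

lemma cont_memLp (hb : IsBounded Ω) {V : Type*} [NormedAddCommGroup V] [SecondCountableTopology V] {f : E2 → V}
    (hf : Continuous f) : MemLp f 2 (mu Ω) := by
  haveI := fin_meas hb
  obtain ⟨C, hC⟩ := hb.isCompact_closure.exists_bound_of_continuousOn hf.continuousOn
  have h1 : MemLp f 2 (volume.restrict (closure Ω)) := by
    haveI : IsFiniteMeasure (volume.restrict (closure Ω)) := fin_meas hb.closure
    refine MemLp.of_bound hf.aestronglyMeasurable C ?_
    filter_upwards [ae_restrict_mem isClosed_closure.measurableSet] with x hx using hC x hx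
  exact h1.mono_measure (Measure.restrict_mono subset_closure le_rfl)

lemma exists_HH {f : E2 → ℝ} {g : E2 → E2} (hf : MemLp f 2 (mu Ω)) (hg : MemLp g 2 (mu Ω)) :
    ∃ U : HH Ω, uu U =ᵐ[mu Ω] f ∧ GG U =ᵐ[mu Ω] g :=
  ⟨WithLp.toLp 2 (hf.toLp f, hg.toLp g), hf.coeFn_toLp, hg.coeFn_toLp⟩

lemma exists_rep (hb : IsBounded Ω) {φ : E2 → ℝ} (hφ : ContDiff ℝ 1 φ) : ∃ U : HH Ω, IsRep U φ := by
  obtain ⟨U, h1, h2⟩ := exists_HH (cont_memLp hb hφ.continuous) (cont_memLp hb (gradient_cont hφ))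
  exact ⟨U, hφ, h1, h2⟩

lemma H1_approx {U : HH Ω} (hU : U ∈ H1 Ω) : ∃ (V : ℕ → HH Ω) (φ : ℕ → E2 → ℝ), (∀ n, IsRep (V n) (φ n)) ∧
    Tendsto V atTop (𝓝 U) := by
  obtain ⟨V, hV, h⟩ := mem_closure_iff_seq_limit.1 (show U ∈ closure (C1sub Ω : Set (HH Ω)) from hU)
  choose φ hφ using hV
  exact ⟨V, φ, hφ, h⟩

lemma HH_norm_sq (U : HH Ω) : ‖U‖ ^ 2 = ‖U.fst‖ ^ 2 + ‖U.snd‖ ^ 2 := WithLp.prod_norm_sq_eq_of_L2 U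

lemma Lp_norm_sq {V : Type*} [NormedAddCommGroup V] [InnerProductSpace ℝ V] (f : Lp V 2 (mu Ω)) :
    ‖f‖ ^ 2 = ∫ x in Ω, ‖f x‖ ^ 2 := by
  rw [← real_inner_self_eq_norm_sq, L2.inner_def]
  simp only [real_inner_self_eq_norm_sq]

lemma HH_inner (U V : HH Ω) : ⟪U, V⟫ = (∫ x in Ω, uu U x * uu V x) + ∫ x in Ω, ⟪GG U x, GG V x⟫ := by
  rw [WithLp.prod_inner_apply, L2.inner_def, L2.inner_def]
  simp only [real_inner_eq_re_inner, RCLike.inner_apply, conj_trivial]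
  simp only [mul_comm (uu U _)]
  rfl

lemma Lp_sq {V : Type*} [NormedAddCommGroup V] (f : Lp V 2 (mu Ω)) : ∫⁻ x in Ω, ‖f x‖ₑ ^ 2 = ‖f‖ₑ ^ 2 := by
  rw [Lp.enorm_def, eLpNorm_eq_lintegral_rpow_enorm_toReal (by norm_num) (by norm_num), ← ENNReal.rpow_natCast, ← ENNReal.rpow_mul]
  norm_num

lemma uu_sq (U : HH Ω) : ∫⁻ x in Ω, ‖uu U x‖ₑ ^ 2 ≤ ‖U‖ₑ ^ 2 := by
  rw [show ∫⁻ x in Ω, ‖uu U x‖ₑ ^ 2 = ‖U.fst‖ₑ ^ 2 from Lp_sq _]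
  have : ‖U.fst‖ ≤ ‖U‖ := by
    have := HH_norm_sq U
    nlinarith [sq_nonneg ‖U.snd‖, norm_nonneg U, norm_nonneg U.fst]
  gcongr
  exact enorm_le_iff_norm_le.2 this

lemma GG_sq (U : HH Ω) : ∫⁻ x in Ω, ‖GG U x‖ₑ ^ 2 ≤ ‖U‖ₑ ^ 2 := by
  rw [show ∫⁻ x in Ω, ‖GG U x‖ₑ ^ 2 = ‖U.snd‖ₑ ^ 2 from Lp_sq _]
  have : ‖U.snd‖ ≤ ‖U‖ := by
    have := HH_norm_sq U
    nlinarith [sq_nonneg ‖U.fst‖, norm_nonneg U, norm_nonneg U.snd]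
  gcongr
  exact enorm_le_iff_norm_le.2 this

def gg (U : HH Ω) (x : E2) : ℝ≥0∞ := ‖GG U x‖ₑ + ‖uu U x‖ₑ

lemma gg_meas (U : HH Ω) : Measurable (gg U) :=
  (GG_sm U).measurable.enorm.add (uu_sm U).measurable.enorm

lemma add_sq_le' (a b : ℝ≥0∞) : (a + b) ^ 2 ≤ 2 * (a ^ 2 + b ^ 2) := by
  have := ENNReal.rpow_add_le_mul_rpow_add_rpow a b (p := 2) (by norm_num)
  norm_num at this
  exact this

lemma gg_sq (U : HH Ω) : ∫⁻ x in Ω, gg U x ^ 2 ≤ 4 * ‖U‖ₑ ^ 2 := by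
  calc ∫⁻ x in Ω, gg U x ^ 2 ≤ ∫⁻ x in Ω, 2 * (‖GG U x‖ₑ ^ 2 + ‖uu U x‖ₑ ^ 2) := lintegral_mono fun x => add_sq_le' _ _
    _ = 2 * ((∫⁻ x in Ω, ‖GG U x‖ₑ ^ 2) + ∫⁻ x in Ω, ‖uu U x‖ₑ ^ 2) := by
        rw [lintegral_const_mul' _ _ (by norm_num), lintegral_add_left ((GG_sm U).measurable.enorm.pow_const 2)]
    _ ≤ 2 * (‖U‖ₑ ^ 2 + ‖U‖ₑ ^ 2) := by gcongr; exacts [GG_sq U, uu_sq U]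
    _ = 4 * ‖U‖ₑ ^ 2 := by ring

lemma ae_zero_of_le {α : Type*} [MeasurableSpace α] {μ : Measure α} {F : α → ℝ≥0∞} {b : ℕ → α → ℝ≥0∞}
    (hm : ∀ n, Measurable (b n)) (h : ∀ n, ∀ᵐ x ∂μ, F x ≤ b n x)
    (h0 : Tendsto (fun n => ∫⁻ x, b n x ^ 2 ∂μ) atTop (𝓝 0)) : ∀ᵐ x ∂μ, F x = 0 := by
  have h1 : ∫⁻ x, (⨅ n, b n x) ^ 2 ∂μ = 0 := by
    refine le_antisymm (ge_of_tendsto' h0 fun n => ?_) (zero_le)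
    exact lintegral_mono fun x => by gcongr; exact iInf_le _ n
  rw [lintegral_eq_zero_iff ((Measurable.iInf hm).pow_const 2)] at h1
  filter_upwards [h1, ae_all_iff.2 h] with x hx hx2
  have : (⨅ n, b n x) = 0 := by simpa using hx
  exact le_antisymm ((le_iInf hx2).trans this.le) (zero_le)

end H1Sec


noncomputable section TSec

variable {Ω : Set E2} {x0 : E2}

lemma kk_eq (s : ℝ) (x y : E2) : kk s x y = ‖‖x - y‖ ^ (-s)‖ₑ := by
  rw [kk, Real.enorm_eq_ofReal (by positivity)]

namespace Patch
variable (P : Patch Ω x0)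

def Tv (A : E2) (b : ℝ) (x : E2) : E2 := P.η x • A + b • gradient P.η x

lemma Tv_sub (A A' : E2) (b b' : ℝ) (x : E2) : P.Tv (A - A') (b - b') x = P.Tv A b x - P.Tv A' b' x := by
  unfold Tv; rw [smul_sub, sub_smul]; abel

lemma Tv_zero (A : E2) (b : ℝ) {x : E2} (hx : x ∉ tsupport P.η) : P.Tv A b x = 0 := by
  unfold Tv
  have h1 : P.η x = 0 := image_eq_zero_of_notMem_tsupport hx
  have h2 : gradient P.η x = 0 := by
    unfold gradient
    have : fderiv ℝ P.η x = 0 := by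
      by_contra hne
      exact hx (support_fderiv_subset ℝ (f := P.η) hne)
    rw [this, map_zero]
  simp [h1, h2]

lemma Tv_bound : ∃ B : ℝ, 0 ≤ B ∧ ∀ A b x, ‖P.Tv A b x‖ ≤ B * (‖A‖ + ‖b‖) := by
  obtain ⟨B1, hB1⟩ := P.hηc.exists_bound_of_continuous P.hη.continuous
  have hc : HasCompactSupport (gradient P.η) := by
    refine P.hηc.mono' ?_
    intro x hx
    by_contra h
    apply hx
    have := P.Tv_zero 0 1 h
    simpa [Tv] using this
  obtain ⟨B2, hB2⟩ := hc.exists_bound_of_continuous (gradient_cont P.hη)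
  refine ⟨max B1 B2, le_max_of_le_left ((norm_nonneg _).trans (hB1 0)), fun A b x => ?_⟩
  unfold Tv
  refine (norm_add_le _ _).trans ?_
  rw [norm_smul, norm_smul]
  have h1 := (hB1 x).trans (le_max_left B1 B2)
  have h2 := (hB2 x).trans (le_max_right B1 B2)
  nlinarith [norm_nonneg A, norm_nonneg b, mul_le_mul_of_nonneg_right h1 (norm_nonneg A), mul_le_mul_of_nonneg_left h2 (norm_nonneg b)]

/-- the representation operator -/
def TT (d : ℝ) (U : HH Ω) (y : E2) : ℝ := - ∫ x in Ω, ⟪P.Tv (GG U x) (uu U x) x, Xf P.σ P.S d y x⟫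

lemma Ti_bound : ∃ C : ℝ≥0∞, C ≠ ⊤ ∧ ∀ y ∈ closure Ω, y ∈ Metric.ball x0 P.r → ∀ x ∈ Ω, x ≠ y → ∀ d : ℝ, 0 ≤ d →
    ∀ A b, ‖⟪P.Tv A b x, Xf P.σ P.S d y x⟫‖ₑ ≤ C * (kk 1 x y * (‖A‖ₑ + ‖b‖ₑ)) ∧
      ‖⟪P.Tv A b x, Xf P.σ P.S d y x⟫ - ⟪P.Tv A b x, Xf P.σ P.S 0 y x⟫‖ₑ
        ≤ C * ENNReal.ofReal (√d) * (kk (3/2) x y * (‖A‖ₑ + ‖b‖ₑ)) := by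
  obtain ⟨C, hC0, hC⟩ := P.Xf_bounds
  obtain ⟨B, hB0, hB⟩ := P.Tv_bound
  refine ⟨ENNReal.ofReal (B * C), ENNReal.ofReal_ne_top, fun y hy hyb x hx hxy d hd A b => ?_⟩
  by_cases hxt : x ∈ tsupport P.η
  swap
  · simp [P.Tv_zero A b hxt]
  obtain ⟨h1, h2⟩ := hC x hx hxt y hy hyb hxy d hd
  have hb := hB A b x
  have e : ‖A‖ₑ + ‖b‖ₑ = ENNReal.ofReal (‖A‖ + ‖b‖) := by
    rw [ENNReal.ofReal_add (norm_nonneg _) (norm_nonneg _), ofReal_norm, ofReal_norm]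
  constructor
  · rw [e, kk, ← ENNReal.ofReal_mul (by positivity), ← ENNReal.ofReal_mul (by positivity), ← ofReal_norm]
    apply ENNReal.ofReal_le_ofReal
    calc _ ≤ ‖P.Tv A b x‖ * ‖Xf P.σ P.S d y x‖ := norm_inner_le_norm _ _
      _ ≤ (B * (‖A‖ + ‖b‖)) * (C * ‖x - y‖ ^ (-(1:ℝ))) := by gcongr
      _ = _ := by ring
  · rw [e, kk, ← ENNReal.ofReal_mul (by positivity), ← ENNReal.ofReal_mul (by positivity), ← ENNReal.ofReal_mul (by positivity), ← ofReal_norm,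
      ← inner_sub_right]
    apply ENNReal.ofReal_le_ofReal
    calc _ ≤ ‖P.Tv A b x‖ * ‖Xf P.σ P.S d y x - Xf P.σ P.S 0 y x‖ := norm_inner_le_norm _ _
      _ ≤ (B * (‖A‖ + ‖b‖)) * (C * √d * ‖x - y‖ ^ (-(3/2:ℝ))) := by gcongr
      _ = _ := by ring

lemma Tv_meas (U : HH Ω) : Measurable (fun x => P.Tv (GG U x) (uu U x) x) :=
  (P.hη.continuous.measurable.smul (GG_sm U).measurable).add ((uu_sm U).measurable.smul (gradient_cont P.hη).measurable)

lemma Ti_meas (d : ℝ) (U : HH Ω) (y : E2) : Measurable (fun x => ⟪P.Tv (GG U x) (uu U x) x, Xf P.σ P.S d y x⟫) :=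
  (P.Tv_meas U).inner (P.Xf_meas1 d y)

lemma Ti_int (ho : IsOpen Ω) {U : HH Ω} {y : E2} (hy : y ∈ closure Ω) (hyb : y ∈ Metric.ball x0 P.r)
    (hg : ∫⁻ x in Ω, kk 1 x y * gg U x ≠ ⊤) {d : ℝ} (hd : 0 ≤ d) :
    Integrable (fun x => ⟪P.Tv (GG U x) (uu U x) x, Xf P.σ P.S d y x⟫) (mu Ω) := by
  obtain ⟨C, hC0, hC⟩ := P.Ti_bound
  refine ⟨(P.Ti_meas d U y).aestronglyMeasurable, ?_⟩
  refine lt_of_le_of_lt (lintegral_mono_ae (g := fun x => C * (kk 1 x y * gg U x)) ?_) ?_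
  · filter_upwards [ae_restrict_mem ho.measurableSet, ae_ne y] with x hx hxy
    exact (hC y hy hyb x hx hxy d hd _ _).1
  · rw [lintegral_const_mul' _ _ hC0]
    exact ENNReal.mul_lt_top hC0.lt_top hg.lt_top

lemma TT_bound (ho : IsOpen Ω) : ∃ C : ℝ≥0∞, C ≠ ⊤ ∧ ∀ y ∈ closure Ω, y ∈ Metric.ball x0 P.r → ∀ d : ℝ, 0 ≤ d → ∀ U V : HH Ω,
    ∫⁻ x in Ω, kk 1 x y * gg U x ≠ ⊤ →
    ‖P.TT d U y‖ₑ ≤ C * ∫⁻ x in Ω, kk 1 x y * gg U x ∧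
    ‖P.TT d U y - P.TT 0 U y‖ₑ ≤ C * ENNReal.ofReal (√d) * ∫⁻ x in Ω, kk (3/2) x y * gg U x ∧
    (∫⁻ x in Ω, kk 1 x y * gg V x ≠ ⊤ → ‖P.TT d U y - P.TT d V y‖ₑ ≤ C * ∫⁻ x in Ω, kk 1 x y * gg (U - V) x) := by
  obtain ⟨C, hC0, hC⟩ := P.Ti_bound
  refine ⟨C, hC0, fun y hy hyb d hd U V hU => ⟨?_, ?_, fun hV => ?_⟩⟩
  · rw [TT, enorm_neg, ← lintegral_const_mul' _ _ hC0]
    refine (enorm_integral_le_lintegral_enorm _).trans (lintegral_mono_ae ?_)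
    filter_upwards [ae_restrict_mem ho.measurableSet, ae_ne y] with x hx hxy
    exact (hC y hy hyb x hx hxy d hd _ _).1
  · rw [TT, TT, ← neg_sub_neg, neg_neg, neg_neg, ← integral_sub (P.Ti_int ho hy hyb hU le_rfl) (P.Ti_int ho hy hyb hU hd),
      ← lintegral_const_mul' _ _ (ENNReal.mul_ne_top hC0 ENNReal.ofReal_ne_top)]
    refine (enorm_integral_le_lintegral_enorm _).trans (lintegral_mono_ae ?_)
    filter_upwards [ae_restrict_mem ho.measurableSet, ae_ne y] with x hx hxy
    rw [enorm_sub_rev]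
    exact (hC y hy hyb x hx hxy d hd _ _).2
  · rw [TT, TT, ← neg_sub_neg, neg_neg, neg_neg, ← integral_sub (P.Ti_int ho hy hyb hV hd) (P.Ti_int ho hy hyb hU hd),
      ← lintegral_const_mul' _ _ hC0]
    refine (enorm_integral_le_lintegral_enorm _).trans (lintegral_mono_ae ?_)
    filter_upwards [ae_restrict_mem ho.measurableSet, ae_ne y, uu_sub U V, GG_sub U V] with x hx hxy e1 e2
    rw [enorm_sub_rev, ← inner_sub_left, ← Tv_sub]
    simp only [gg]
    rw [e1, e2]
    exact (hC y hy hyb x hx hxy d hd _ _).1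

lemma good_ae (hb : IsBounded Ω) {s : ℝ} (h0 : 0 < s) (hs : s < 2) (U : HH Ω) : ∀ᵐ y ∂(mu Ω), ∫⁻ x in Ω, kk s x y * gg U x ≠ ⊤ := by
  obtain ⟨K, hK, hk⟩ := kk_bound hb h0 hs
  have h := pot_schur (μ := mu Ω) h0 (gg_meas U).aemeasurable hk
  have hm : Measurable (fun y => ∫⁻ x in Ω, kk s x y * gg U x) :=
    Measurable.lintegral_prod_left' (f := fun p : E2 × E2 => kk s p.1 p.2 * gg U p.1)
      ((kk_meas s).mul ((gg_meas U).comp measurable_fst))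
  have h2 : ∫⁻ y in Ω, (∫⁻ x in Ω, kk s x y * gg U x) ^ 2 ≠ ⊤ := by
    refine ne_top_of_le_ne_top ?_ h
    refine ENNReal.mul_ne_top (by finiteness) (ne_top_of_le_ne_top ?_ (gg_sq U))
    exact ENNReal.mul_ne_top (by norm_num) (by finiteness)
  filter_upwards [ae_lt_top (hm.pow_const 2) h2] with y hy
  intro h
  rw [h] at hy
  simp at hy

lemma pot_meas (s : ℝ) (U : HH Ω) : Measurable (fun y => ∫⁻ x in Ω, kk s x y * gg U x) :=
    Measurable.lintegral_prod_left' (f := fun p : E2 × E2 => kk s p.1 p.2 * gg U p.1)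
      ((kk_meas s).mul ((gg_meas U).comp measurable_fst))

lemma TT_C1 (ho : IsOpen Ω) (hb : IsBounded Ω) {U : HH Ω} {φ : E2 → ℝ} (h : IsRep U φ) {y : E2} (hy : y ∈ Ω)
    (hyb : y ∈ Metric.ball x0 P.r) : c0 * φ y = P.TT 0 U y := by
  rw [P.rep_C1 ho hb h.c1 hy hyb, TT]
  congr 1
  apply integral_congr_ae
  filter_upwards [h.hu, h.hG] with x e1 e2
  rw [e1, e2, Tv, ← gr_inner, gradient_mul' P.hη h.c1]

lemma rep (ho : IsOpen Ω) (hb : IsBounded Ω) {U : HH Ω} (hU : U ∈ H1 Ω) :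
    ∀ᵐ y ∂(mu Ω), y ∈ Metric.ball x0 P.r → c0 * uu U y = P.TT 0 U y := by
  obtain ⟨V, φ, hφ, hV⟩ := H1_approx hU
  obtain ⟨C, hC0, hC⟩ := P.TT_bound ho
  obtain ⟨K, hK, hk⟩ := kk_bound hb one_pos (by norm_num : (1:ℝ) < 2)
  let b : ℕ → E2 → ℝ≥0∞ := fun n y => ‖c0‖ₑ * ‖uu (U - V n) y‖ₑ + C * ∫⁻ x in Ω, kk 1 x y * gg (U - V n) x
  have hm : ∀ n, Measurable (b n) := fun n =>
    ((uu_sm _).measurable.enorm.const_mul _).add ((pot_meas 1 _).const_mul _)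
  have hb0 : Tendsto (fun n => ∫⁻ x in Ω, b n x ^ 2) atTop (𝓝 0) := by
    have h1 : ∀ n, ∫⁻ x in Ω, b n x ^ 2 ≤ (2 * ‖c0‖ₑ ^ 2 + 2 * C ^ 2 * (K ^ 2 * 4)) * ‖U - V n‖ₑ ^ 2 := by
      intro n
      calc ∫⁻ x in Ω, b n x ^ 2 ≤ ∫⁻ y in Ω, 2 * ((‖c0‖ₑ * ‖uu (U - V n) y‖ₑ) ^ 2 + (C * ∫⁻ x in Ω, kk 1 x y * gg (U - V n) x) ^ 2) :=
            lintegral_mono fun y => add_sq_le' _ _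
        _ = 2 * ((‖c0‖ₑ ^ 2 * ∫⁻ y in Ω, ‖uu (U - V n) y‖ₑ ^ 2) + C ^ 2 * ∫⁻ y in Ω, (∫⁻ x in Ω, kk 1 x y * gg (U - V n) x) ^ 2) := by
            simp_rw [mul_pow]
            rw [lintegral_const_mul' _ _ (by norm_num), lintegral_add_left (((uu_sm _).measurable.enorm.pow_const 2).const_mul _),
              lintegral_const_mul' _ _ (by finiteness), lintegral_const_mul' _ _ (by finiteness)]
        _ ≤ 2 * ((‖c0‖ₑ ^ 2 * ‖U - V n‖ₑ ^ 2) + C ^ 2 * (K ^ 2 * (4 * ‖U - V n‖ₑ ^ 2))) := by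
            gcongr
            · exact uu_sq _
            · exact (pot_schur one_pos (gg_meas _).aemeasurable hk).trans (by gcongr; exact gg_sq _)
        _ = _ := by ring
    have h2 : Tendsto (fun n => (2 * ‖c0‖ₑ ^ 2 + 2 * C ^ 2 * (K ^ 2 * 4)) * ‖U - V n‖ₑ ^ 2) atTop (𝓝 0) := by
      have h3 : Tendsto (fun n => ‖U - V n‖ₑ) atTop (𝓝 0) := by
        have := (tendsto_const_nhds (x := U)).sub hV
        simpa using this.enorm
      have h4 := ENNReal.Tendsto.const_mul (a := (2 * ‖c0‖ₑ ^ 2 + 2 * C ^ 2 * (K ^ 2 * 4))) (ENNReal.Tendsto.pow (n := 2) h3) (Or.inr (by finiteness))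
      simpa using h4
    exact tendsto_of_tendsto_of_tendsto_of_le_of_le tendsto_const_nhds h2 (fun _ => zero_le) h1
  have key := ae_zero_of_le (μ := mu Ω) (F := (Metric.ball x0 P.r).indicator (fun y => ‖c0 * uu U y - P.TT 0 U y‖ₑ)) hm (fun n => ?_) hb0
  · filter_upwards [key] with y hy hyb
    rw [Set.indicator_of_mem hyb] at hy
    exact sub_eq_zero.1 (enorm_eq_zero.1 hy)
  · filter_upwards [ae_restrict_mem ho.measurableSet, good_ae hb one_pos (by norm_num) U, good_ae hb one_pos (by norm_num) (V n), (hφ n).hu, uu_sub U (V n)] with y hy hg1 hg2 e1 e2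
    by_cases hyb : y ∈ Metric.ball x0 P.r
    · rw [Set.indicator_of_mem hyb]
      have h1 := P.TT_C1 ho hb (hφ n) hy hyb
      have h2 := (hC y (subset_closure hy) hyb 0 le_rfl U (V n) hg1).2.2 hg2
      have h3 : c0 * uu U y - P.TT 0 U y = c0 * uu (U - V n) y - (P.TT 0 U y - P.TT 0 (V n) y) := by
        rw [e2, ← h1, e1]; ring
      rw [h3]
      refine (enorm_sub_le).trans ?_
      rw [enorm_mul]
      exact add_le_add le_rfl h2
    · rw [Set.indicator_of_notMem hyb]; exact zero_le

end Patch
end TSec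


noncomputable section RelSec

variable {Ω : Set E2} {x0 : E2}

structure Dom (Ω : Set E2) : Prop where
  o : IsOpen Ω
  b : IsBounded Ω
  bd : ∀ x ∈ frontier Ω, ∃ U g, IsC2LocalDefining Ω x U g

namespace Dom

lemma cover (D : Dom Ω) : ∃ (Pt : ∀ x : closure Ω, Patch Ω (x : E2)) (t : Finset (closure Ω)),
    ∀ y ∈ closure Ω, ∃ x ∈ t, y ∈ Metric.ball (x : E2) (Pt x).r' := by
  have h := fun x : closure Ω => exists_patch D.o D.b D.bd x.2
  let Pt : ∀ x : closure Ω, Patch Ω (x : E2) := fun x => Classical.choice (h x)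
  have hc : IsCompact (closure Ω) := D.b.isCompact_closure
  obtain ⟨t, ht⟩ := hc.elim_finite_subcover (fun x : closure Ω => Metric.ball (x : E2) (Pt x).r') (fun _ => Metric.isOpen_ball)
    (fun y hy => Set.mem_iUnion.2 ⟨⟨y, hy⟩, Metric.mem_ball_self (Pt _).hr'⟩)
  refine ⟨Pt, t, fun y hy => ?_⟩
  simpa using ht hy

lemma pt_bound (D : Dom Ω) : ∃ K : ℝ≥0∞, K ≠ ⊤ ∧ ∀ U ∈ H1 Ω, ∀ᵐ y ∂(mu Ω), ‖uu U y‖ₑ ≤ K * ∫⁻ x in Ω, kk 1 x y * gg U x := by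
  obtain ⟨Pt, t, ht⟩ := D.cover
  choose C hC0 hC using fun x => (Pt x).TT_bound D.o
  have hc := c0_pos
  refine ⟨∑ x ∈ t, ‖c0⁻¹‖ₑ * C x, ?_, fun U hU => ?_⟩
  · exact (ENNReal.sum_lt_top.2 fun x _ => ENNReal.mul_lt_top (by finiteness) (hC0 x).lt_top).ne
  · have h1 : ∀ᵐ y ∂(mu Ω), ∀ x ∈ t, y ∈ Metric.ball (x : E2) (Pt x).r → c0 * uu U y = (Pt x).TT 0 U y :=
      (t.eventually_all).2 fun x _ => (Pt x).rep D.o D.b hU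
    filter_upwards [h1, ae_restrict_mem D.o.measurableSet, Patch.good_ae D.b one_pos (by norm_num) U] with y h hy hg
    obtain ⟨x, hxt, hyx⟩ := ht y (subset_closure hy)
    have hyr : y ∈ Metric.ball (x : E2) (Pt x).r := Metric.ball_subset_ball (Pt x).hrr hyx
    have e : uu U y = c0⁻¹ * (Pt x).TT 0 U y := by rw [← h x hxt hyr]; field_simp
    rw [e, enorm_mul]
    calc _ ≤ ‖c0⁻¹‖ₑ * (C x * ∫⁻ x in Ω, kk 1 x y * gg U x) := by
          gcongr; exact (hC x y (subset_closure hy) hyr 0 le_rfl U U hg).1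
      _ = (‖c0⁻¹‖ₑ * C x) * ∫⁻ x in Ω, kk 1 x y * gg U x := by ring
      _ ≤ _ := by
          gcongr
          exact Finset.single_le_sum (f := fun x => ‖c0⁻¹‖ₑ * C x) (fun _ _ => zero_le) hxt

lemma L4_bound (D : Dom Ω) : ∃ K : ℝ≥0∞, K ≠ ⊤ ∧ ∀ U ∈ H1 Ω, ∫⁻ x in Ω, ‖uu U x‖ₑ ^ 4 ≤ K * ‖U‖ₑ ^ 4 := by
  obtain ⟨K1, hK1, h1⟩ := D.pt_bound
  obtain ⟨K, hK, hk⟩ := kk_bound D.b (by norm_num : (0:ℝ) < 4/3) (by norm_num : (4/3:ℝ) < 2)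
  refine ⟨K1 ^ 4 * (K ^ 3 * 16), by finiteness, fun U hU => ?_⟩
  calc _ ≤ ∫⁻ y in Ω, K1 ^ 4 * (∫⁻ x in Ω, kk 1 x y * gg U x) ^ 4 := by
        refine lintegral_mono_ae ?_
        filter_upwards [h1 U hU] with y hy
        rw [← mul_pow]; gcongr
    _ = K1 ^ 4 * ∫⁻ y in Ω, (∫⁻ x in Ω, kk 1 x y * gg U x) ^ 4 := lintegral_const_mul' _ _ (by finiteness)
    _ ≤ K1 ^ 4 * (K ^ 3 * (4 * ‖U‖ₑ ^ 2) ^ 2) := by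
        gcongr
        exact (pot_L2L4 (gg_meas U).aemeasurable hk).trans (by gcongr; exact gg_sq U)
    _ = _ := by ring
end Dom

namespace Patch
variable (P : Patch Ω x0)

lemma Xf_cont {d : ℝ} (hd : 0 < d) : Continuous (fun p : E2 × E2 => Xf P.σ P.S d p.2 p.1) := by
  have h1 : Continuous (pk d) := (pk_contDiff hd (n := 0)).continuous
  have hS := P.hS1.continuous
  have h3 : Continuous (fun p : E2 × E2 => tf (fderiv ℝ P.S p.1)) := (tf_contDiff P.hA).continuous.comp continuous_fst
  have h4 : Continuous (fun p : E2 × E2 => pk d (P.S p.1 - p.2)) := h1.comp (by fun_prop)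
  have h5 : Continuous (fun p : E2 × E2 => pk d (p.1 - p.2)) := h1.comp (by fun_prop)
  unfold Xf
  exact h5.add ((h3.clm_apply h4).const_smul P.σ)

lemma TT_weak (hb : IsBounded Ω) {d : ℝ} (hd : 0 < d) (y : E2) : ∃ V : HH Ω, ∀ W : HH Ω, P.TT d W y = - ⟪V, W⟫ := by
  have h1 : Continuous (fun x => Xf P.σ P.S d y x) := (Xf_contDiff P.σ P.hS2 hd y).continuous
  obtain ⟨V, hV1, hV2⟩ := exists_HH (Ω := Ω) (cont_memLp hb ((gradient_cont P.hη).inner (𝕜 := ℝ) h1))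
    (cont_memLp hb (P.hη.continuous.smul h1))
  refine ⟨V, fun W => ?_⟩
  have i1 : Integrable (fun x => uu V x * uu W x) (mu Ω) := (uu_memLp V).integrable_mul (uu_memLp W)
  have i2 : Integrable (fun x => ⟪GG V x, GG W x⟫) (mu Ω) := L2.integrable_inner (𝕜 := ℝ) V.snd W.snd
  rw [TT, HH_inner, ← integral_add i1 i2]
  congr 1
  apply integral_congr_ae
  filter_upwards [hV1, hV2] with x e1 e2
  rw [e1, e2, Tv, inner_add_left, inner_smul_left, inner_smul_left]
  simp only [Pi.smul_apply', real_inner_comm (GG W x), inner_smul_right, conj_trivial]; ring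

lemma TT_bdd (hb : IsBounded Ω) {d : ℝ} (hd : 0 < d) : ∃ C : ℝ≥0∞, C ≠ ⊤ ∧ ∀ y ∈ closure Ω, ∀ W : HH Ω, ‖P.TT d W y‖ₑ ^ 2 ≤ C * ‖W‖ₑ ^ 2 := by
  obtain ⟨M, hM⟩ := (P.hηc.isCompact.prod hb.isCompact_closure).exists_bound_of_continuousOn (P.Xf_cont hd).continuousOn
  obtain ⟨B, hB0, hB⟩ := P.Tv_bound
  set N := ENNReal.ofReal (B * max M 0)
  have hv := hb.measure_lt_top (μ := volume)
  refine ⟨N ^ 2 * (4 * volume Ω), by finiteness, fun y hy W => ?_⟩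
  have h1 : ‖P.TT d W y‖ₑ ≤ N * ∫⁻ x in Ω, gg W x := by
    rw [TT, enorm_neg, ← lintegral_const_mul' _ _ (by finiteness)]
    refine (enorm_integral_le_lintegral_enorm _).trans (lintegral_mono fun x => ?_)
    by_cases hxt : x ∈ tsupport P.η
    · have e : gg W x = ENNReal.ofReal (‖GG W x‖ + ‖uu W x‖) := by
        rw [ENNReal.ofReal_add (norm_nonneg _) (norm_nonneg _), ofReal_norm, ofReal_norm, gg]
      rw [e, ← ENNReal.ofReal_mul (by positivity), ← ofReal_norm]
      apply ENNReal.ofReal_le_ofReal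
      have h3 : ‖Xf P.σ P.S d y x‖ ≤ max M 0 := (hM (x, y) ⟨hxt, hy⟩).trans (le_max_left _ _)
      calc _ ≤ ‖P.Tv (GG W x) (uu W x) x‖ * ‖Xf P.σ P.S d y x‖ := norm_inner_le_norm _ _
        _ ≤ (B * (‖GG W x‖ + ‖uu W x‖)) * max M 0 := by gcongr; exact hB _ _ _
        _ = _ := by ring
    · simp [P.Tv_zero _ _ hxt]
  have h2 : (∫⁻ x in Ω, gg W x) ^ 2 ≤ (4 * ‖W‖ₑ ^ 2) * volume Ω := by
    have := cs_lintegral (μ := mu Ω) (gg_meas W).aemeasurable (aemeasurable_const (b := (1:ℝ≥0∞)))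
    simp only [mul_one, one_pow, lintegral_const, Measure.restrict_apply_univ, one_mul] at this
    exact this.trans (by gcongr; exact gg_sq W)
  calc _ ≤ (N * ∫⁻ x in Ω, gg W x) ^ 2 := by gcongr
    _ = N ^ 2 * (∫⁻ x in Ω, gg W x) ^ 2 := by ring
    _ ≤ N ^ 2 * ((4 * ‖W‖ₑ ^ 2) * volume Ω) := by gcongr
    _ = _ := by ring

lemma Xf_meas' (d : ℝ) : Measurable (fun p : E2 × E2 => Xf P.σ P.S d p.1 p.2) := by
  have h1 : Measurable (pk d) := pk_meas d
  have hS := P.hS1.continuous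
  have hT : Continuous (fun p : (E2 →L[ℝ] E2) × E2 => p.1 p.2) := by fun_prop
  have h2 : Measurable (fun p : E2 × E2 => tf (fderiv ℝ P.S p.2) (pk d (P.S p.2 - p.1))) := by
    refine hT.measurable.comp (Measurable.prodMk ?_ (h1.comp ?_))
    · exact ((tf_contDiff P.hA).continuous.comp continuous_snd).measurable
    · exact ((hS.comp continuous_snd).sub continuous_fst).measurable
  exact (h1.comp (by fun_prop)).add (h2.const_smul P.σ)

lemma TT_meas (d : ℝ) (W : HH Ω) : Measurable (P.TT d W) := by
  have h : Measurable (fun p : E2 × E2 => ⟪P.Tv (GG W p.2) (uu W p.2) p.2, Xf P.σ P.S d p.1 p.2⟫) := by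
    have h1 : Measurable (fun p : E2 × E2 => P.Tv (GG W p.2) (uu W p.2) p.2) := (P.Tv_meas W).comp measurable_snd
    have h2 : Measurable (fun p : E2 × E2 => Xf P.σ P.S d p.1 p.2) := P.Xf_meas' d
    exact h1.inner h2
  have h3 : StronglyMeasurable (fun y => ∫ x in Ω, ⟪P.Tv (GG W x) (uu W x) x, Xf P.σ P.S d y x⟫) :=
    StronglyMeasurable.integral_prod_right' (f := fun p : E2 × E2 => ⟪P.Tv (GG W p.2) (uu W p.2) p.2, Xf P.σ P.S d p.1 p.2⟫) h.stronglyMeasurable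
  exact h3.measurable.neg

lemma rel_loc (ho : IsOpen Ω) (hb : IsBounded Ω) {W : ℕ → HH Ω} (hW : ∀ n, W n ∈ H1 Ω) {B : ℝ≥0∞} (hBt : B ≠ ⊤) (hB : ∀ n, ‖W n‖ₑ ^ 2 ≤ B)
    (hw : ∀ V : HH Ω, Tendsto (fun n => ⟪V, W n⟫) atTop (𝓝 0)) :
    Tendsto (fun n => ∫⁻ y in Ω ∩ Metric.ball x0 P.r, ‖uu (W n) y‖ₑ ^ 2) atTop (𝓝 0) := by
  obtain ⟨C, hC0, hC⟩ := P.TT_bound ho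
  obtain ⟨K, hK, hk⟩ := kk_bound hb (by norm_num : (0:ℝ) < 3/2) (by norm_num : (3/2:ℝ) < 2)
  have hc := c0_pos
  have hms : MeasurableSet (Ω ∩ Metric.ball x0 P.r) := ho.measurableSet.inter Metric.isOpen_ball.measurableSet
  have hsub : volume.restrict (Ω ∩ Metric.ball x0 P.r) ≤ mu Ω := Measure.restrict_mono Set.inter_subset_left le_rfl
  -- fixed d
  have l1 : ∀ d : ℝ, 0 < d → Tendsto (fun n => ∫⁻ y in Ω ∩ Metric.ball x0 P.r, ‖P.TT d (W n) y‖ₑ ^ 2) atTop (𝓝 0) := by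
    intro d hd
    obtain ⟨C', hC'0, hC'⟩ := P.TT_bdd hb hd
    have := tendsto_lintegral_of_dominated_convergence (μ := volume.restrict (Ω ∩ Metric.ball x0 P.r))
      (F := fun n y => ‖P.TT d (W n) y‖ₑ ^ 2) (f := fun _ => 0) (fun _ => C' * B)
      (fun n => (P.TT_meas d (W n)).enorm.pow_const 2) (fun n => ?_) ?_ ?_
    · simpa using this
    · filter_upwards [ae_restrict_mem hms] with y hy
      exact (hC' y (subset_closure hy.1) (W n)).trans (by gcongr; exact hB n)
    · have : volume (Ω ∩ Metric.ball x0 P.r) < ⊤ := (hb.subset Set.inter_subset_left).measure_lt_top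
      simp only [lintegral_const, Measure.restrict_apply_univ]
      finiteness
    · refine Eventually.of_forall fun y => ?_
      obtain ⟨V, hV⟩ := P.TT_weak hb hd y
      have h1 : Tendsto (fun n => P.TT d (W n) y) atTop (𝓝 0) := by
        simp_rw [hV]
        simpa using (hw V).neg
      simpa using ENNReal.Tendsto.pow (n := 2) h1.enorm
  have l2 : ∀ d : ℝ, 0 < d → ∀ n, ‖c0‖ₑ ^ 2 * ∫⁻ y in Ω ∩ Metric.ball x0 P.r, ‖uu (W n) y‖ₑ ^ 2 ≤
      2 * (∫⁻ y in Ω ∩ Metric.ball x0 P.r, ‖P.TT d (W n) y‖ₑ ^ 2) + 2 * (C ^ 2 * (K ^ 2 * (4 * B))) * ENNReal.ofReal d := by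
    intro d hd n
    have hsq : ENNReal.ofReal (√d) ^ 2 = ENNReal.ofReal d := by
      rw [← ENNReal.ofReal_pow (by positivity), Real.sq_sqrt hd.le]
    rw [← lintegral_const_mul' _ _ (by finiteness)]
    calc _ ≤ ∫⁻ y in Ω ∩ Metric.ball x0 P.r, 2 * (‖P.TT d (W n) y‖ₑ ^ 2 + (C * ENNReal.ofReal (√d)) ^ 2 * (∫⁻ x in Ω, kk (3/2) x y * gg (W n) x) ^ 2) := by
          refine lintegral_mono_ae ?_
          filter_upwards [ae_restrict_mem hms, hsub.absolutelyContinuous.ae_le (P.rep ho hb (hW n)),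
            hsub.absolutelyContinuous.ae_le (good_ae hb one_pos (by norm_num) (W n))] with y hy h1 h2
          have h3 := (hC y (subset_closure hy.1) hy.2 d hd.le (W n) (W n) h2).2.1
          rw [← mul_pow, ← enorm_mul, h1 hy.2, ← mul_pow]
          refine le_trans ?_ (add_sq_le' _ _)
          gcongr
          calc ‖P.TT 0 (W n) y‖ₑ = ‖P.TT d (W n) y - (P.TT d (W n) y - P.TT 0 (W n) y)‖ₑ := by congr 1; ring
            _ ≤ _ := enorm_sub_le.trans (by gcongr)
      _ = 2 * ((∫⁻ y in Ω ∩ Metric.ball x0 P.r, ‖P.TT d (W n) y‖ₑ ^ 2) + (C * ENNReal.ofReal (√d)) ^ 2 *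
            ∫⁻ y in Ω ∩ Metric.ball x0 P.r, (∫⁻ x in Ω, kk (3/2) x y * gg (W n) x) ^ 2) := by
          rw [lintegral_const_mul' _ _ (by norm_num), lintegral_add_left ((P.TT_meas d (W n)).enorm.pow_const 2),
            lintegral_const_mul' _ _ (by finiteness)]
      _ ≤ 2 * ((∫⁻ y in Ω ∩ Metric.ball x0 P.r, ‖P.TT d (W n) y‖ₑ ^ 2) + (C * ENNReal.ofReal (√d)) ^ 2 * (K ^ 2 * (4 * B))) := by
          gcongr
          refine (lintegral_mono' hsub le_rfl).trans ((pot_schur (by norm_num) (gg_meas _).aemeasurable hk).trans ?_)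
          gcongr
          exact (gg_sq _).trans (by gcongr; exact hB n)
      _ = _ := by rw [mul_pow, hsq]; ring
  have hc0 : ‖c0‖ₑ ^ 2 ≠ 0 := by simp [hc.ne']
  suffices h : Tendsto (fun n => ‖c0‖ₑ ^ 2 * ∫⁻ y in Ω ∩ Metric.ball x0 P.r, ‖uu (W n) y‖ₑ ^ 2) atTop (𝓝 0) by
    have h2 := ENNReal.Tendsto.const_mul (a := (‖c0‖ₑ ^ 2)⁻¹) h (Or.inr (ENNReal.inv_ne_top.2 hc0))
    simp only [mul_zero] at h2
    refine h2.congr fun n => ?_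
    rw [← mul_assoc, ENNReal.inv_mul_cancel hc0 (by finiteness), one_mul]
  rw [ENNReal.tendsto_nhds_zero]
  intro ε hε
  set M := 2 * (C ^ 2 * (K ^ 2 * (4 * B)))
  have hM : M ≠ ⊤ := by finiteness
  obtain ⟨d, hd, hd2⟩ : ∃ d : ℝ, 0 < d ∧ M * ENNReal.ofReal d ≤ ε / 2 := by
    have h1 : Tendsto (fun d : ℝ => M * ENNReal.ofReal d) (𝓝[>] 0) (𝓝 0) := by
      have h2 : Tendsto (fun d : ℝ => ENNReal.ofReal d) (𝓝[>] 0) (𝓝 0) := by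
        have := (ENNReal.continuous_ofReal.tendsto 0).mono_left (nhdsWithin_le_nhds (s := Set.Ioi 0))
        simpa using this
      simpa using ENNReal.Tendsto.const_mul (a := M) h2 (Or.inr hM)
    have h3 := (ENNReal.tendsto_nhds_zero.1 h1) (ε / 2) (ENNReal.half_pos hε.ne')
    obtain ⟨d, hd⟩ := (h3.and self_mem_nhdsWithin).exists
    exact ⟨d, hd.2, hd.1⟩
  have h4 : Tendsto (fun n => 2 * ∫⁻ y in Ω ∩ Metric.ball x0 P.r, ‖P.TT d (W n) y‖ₑ ^ 2) atTop (𝓝 0) := by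
    simpa using ENNReal.Tendsto.const_mul (a := 2) (l1 d hd) (Or.inr (by norm_num))
  filter_upwards [(ENNReal.tendsto_nhds_zero.1 h4) (ε / 2) (ENNReal.half_pos hε.ne')] with n hn
  calc _ ≤ _ := l2 d hd n
    _ ≤ ε / 2 + ε / 2 := add_le_add hn hd2
    _ = ε := ENNReal.add_halves ε

end Patch

lemma lint_bUnion {ι α : Type*} [MeasurableSpace α] {μ : Measure α} (t : Finset ι) (s : ι → Set α) (f : α → ℝ≥0∞) :
    ∫⁻ x in ⋃ i ∈ t, s i, f x ∂μ ≤ ∑ i ∈ t, ∫⁻ x in s i, f x ∂μ := by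
  classical
  induction t using Finset.induction_on with
  | empty => simp
  | insert a t ha ih =>
    rw [Finset.sum_insert ha, Finset.set_biUnion_insert]
    exact (lintegral_union_le _ _ _).trans (add_le_add le_rfl ih)

lemma Dom.rellich0 (D : Dom Ω) {W : ℕ → HH Ω} (hW : ∀ n, W n ∈ H1 Ω) {B : ℝ} (hB : ∀ n, ‖W n‖ ≤ B)
    (hw : ∀ V : HH Ω, Tendsto (fun n => ⟪V, W n⟫) atTop (𝓝 0)) :
    Tendsto (fun n => (W n).fst) atTop (𝓝 0) := by
  obtain ⟨Pt, t, ht⟩ := D.cover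
  have hBe : ∀ n, ‖W n‖ₑ ^ 2 ≤ ENNReal.ofReal B ^ 2 := fun n => by
    gcongr; rw [← ofReal_norm]; exact ENNReal.ofReal_le_ofReal (hB n)
  have h1 := fun x : closure Ω => (Pt x).rel_loc D.o D.b hW (by finiteness) hBe hw
  have h2 : Tendsto (fun n => ∑ x ∈ t, ∫⁻ y in Ω ∩ Metric.ball (x : E2) (Pt x).r, ‖uu (W n) y‖ₑ ^ 2) atTop (𝓝 0) := by
    have := tendsto_finsetSum t (fun x _ => h1 x)
    simpa using this
  have h3 : ∀ n, ‖(W n).fst‖ₑ ^ 2 ≤ ∑ x ∈ t, ∫⁻ y in Ω ∩ Metric.ball (x : E2) (Pt x).r, ‖uu (W n) y‖ₑ ^ 2 := by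
    intro n
    rw [← Lp_sq]
    refine (lintegral_mono_set (t := ⋃ x ∈ t, Ω ∩ Metric.ball (x : E2) (Pt x).r) ?_).trans (lint_bUnion _ _ _)
    intro y hy
    obtain ⟨x, hx, hyx⟩ := ht y (subset_closure hy)
    simp only [Set.mem_iUnion]
    exact ⟨x, hx, hy, Metric.ball_subset_ball (Pt x).hrr hyx⟩
  have h4 : Tendsto (fun n => ‖(W n).fst‖ₑ ^ 2) atTop (𝓝 0) :=
    tendsto_of_tendsto_of_tendsto_of_le_of_le tendsto_const_nhds h2 (fun _ => zero_le) h3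
  have h5 : Tendsto (fun n => ‖(W n).fst‖ ^ 2) atTop (𝓝 0) := by
    have := (ENNReal.tendsto_toReal ENNReal.zero_ne_top).comp h4
    simpa [Function.comp_def] using this
  rw [tendsto_zero_iff_norm_tendsto_zero]
  have h6 := (Real.continuous_sqrt.tendsto 0).comp h5
  simpa [Function.comp_def, Real.sqrt_sq] using h6

lemma weak_cpt {E : Type*} [NormedAddCommGroup E] [InnerProductSpace ℝ E] [CompleteSpace E] [TopologicalSpace.SeparableSpace E]
    {x : ℕ → E} {B : ℝ} (hB : ∀ n, ‖x n‖ ≤ B) : ∃ (z : E) (k : ℕ → ℕ), StrictMono k ∧ ∀ v, Tendsto (fun n => ⟪v, x (k n)⟫) atTop (𝓝 ⟪v, z⟫) := by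
  let T := InnerProductSpace.toDual ℝ E
  have h := WeakDual.isSeqCompact_closedBall (𝕜 := ℝ) (E := E) 0 B
  obtain ⟨f, _, k, hk, hf⟩ := h (x := fun n => WeakDual.toStrongDual.symm (T (x n))) (fun n => by
    simp only [Set.mem_preimage, LinearEquiv.apply_symm_apply, mem_closedBall_zero_iff, LinearIsometryEquiv.norm_map]; exact hB n)
  refine ⟨T.symm (WeakDual.toStrongDual f), k, hk, fun v => ?_⟩
  have h1 := (WeakDual.eval_continuous (𝕜 := ℝ) v).tendsto f |>.comp hf
  have e : ∀ w : E, ⟪v, w⟫ = T w v := fun w => by rw [real_inner_comm]; rfl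
  simp_rw [e]
  rw [LinearIsometryEquiv.apply_symm_apply]
  exact h1

lemma Dom.compact (D : Dom Ω) {W : ℕ → HH Ω} (hW : ∀ n, W n ∈ H1 Ω) {B : ℝ} (hB : ∀ n, ‖W n‖ ≤ B) :
    ∃ Z ∈ H1 Ω, ∃ k : ℕ → ℕ, StrictMono k ∧ (∀ V : HH Ω, Tendsto (fun n => ⟪V, W (k n)⟫) atTop (𝓝 ⟪V, Z⟫)) ∧
      Tendsto (fun n => (W (k n)).fst) atTop (𝓝 Z.fst) := by
  haveI : CompleteSpace (H1 Ω) := H1_closed.completeSpace_coe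
  haveI : Fact ((2:ℝ≥0∞) ≠ ⊤) := ⟨by norm_num⟩
  haveI : SecondCountableTopology (HH Ω) := by
    haveI : SecondCountableTopology (Lp ℝ 2 (mu Ω)) := inferInstance
    haveI : SecondCountableTopology (Lp E2 2 (mu Ω)) := inferInstance
    haveI : SecondCountableTopology (Lp ℝ 2 (mu Ω) × Lp E2 2 (mu Ω)) := TopologicalSpace.instSecondCountableTopologyProd
    exact (WithLp.homeomorphProd 2 (Lp ℝ 2 (mu Ω)) (Lp E2 2 (mu Ω))).secondCountableTopology
  obtain ⟨z, k, hk, h⟩ := weak_cpt (x := fun n => (⟨W n, hW n⟩ : H1 Ω)) (B := B) hB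
  have hweak : ∀ V : HH Ω, Tendsto (fun n => ⟪V, W (k n)⟫) atTop (𝓝 ⟪V, (z : HH Ω)⟫) := by
    intro V
    let f : StrongDual ℝ (H1 Ω) := (innerSL ℝ V).comp (H1 Ω).subtypeL
    let v := (InnerProductSpace.toDual ℝ (H1 Ω)).symm f
    have e : ∀ w : H1 Ω, ⟪v, w⟫ = ⟪V, (w : HH Ω)⟫ := fun w => InnerProductSpace.toDual_symm_apply
    have := h v
    simp_rw [e] at this
    exact this
  refine ⟨z, z.2, k, hk, hweak, ?_⟩
  have h0 := D.rellich0 (W := fun n => W (k n) - z) (fun n => (H1 Ω).sub_mem (hW _) z.2) (B := B + ‖z‖)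
    (fun n => (norm_sub_le _ _).trans (add_le_add (hB _) le_rfl))
    (fun V => by
      have := (hweak V).sub_const ⟪V, (z : HH Ω)⟫
      simp_rw [inner_sub_right]
      simpa using this)
  have : Tendsto (fun n => (W (k n)).fst - (z : HH Ω).fst) atTop (𝓝 0) := h0
  simpa using this.add_const (z : HH Ω).fst

end RelSec


noncomputable section NonlinSec

/-- `k s = (e^s - 1 - s)/s²` -/
def kf (s : ℝ) : ℝ := ∫ θ in (0:ℝ)..1, (1 - θ) * Real.exp (θ * s)

lemma kf_mono : Monotone kf := by
  intro a b hab
  refine intervalIntegral.integral_mono_on (by norm_num) (Continuous.intervalIntegrable (by fun_prop) _ _)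
    (Continuous.intervalIntegrable (by fun_prop) _ _) (fun θ hθ => ?_)
  have : 0 ≤ 1 - θ := by linarith [hθ.2]
  have := hθ.1
  gcongr

lemma kf_cont : Continuous kf := by
  unfold kf
  exact intervalIntegral.continuous_parametric_intervalIntegral_of_continuous' (by fun_prop) 0 1

lemma kf_zero : kf 0 = 1 / 2 := by
  simp only [kf, mul_zero, Real.exp_zero, mul_one]
  have : ∀ θ : ℝ, HasDerivAt (fun θ : ℝ => θ - θ ^ 2 / 2) (1 - θ) θ := fun θ => by
    have := (hasDerivAt_id θ).sub (((hasDerivAt_id θ).pow 2).div_const 2)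
    exact this.congr_deriv (by simp)
  rw [intervalIntegral.integral_eq_sub_of_hasDerivAt (fun θ _ => this θ) (Continuous.intervalIntegrable (by fun_prop) _ _)]
  norm_num

lemma kf_half {s : ℝ} (hs : 0 ≤ s) : 1 / 2 ≤ kf s := kf_zero ▸ kf_mono hs

lemma kf_eq (s : ℝ) : s ^ 2 * kf s = Real.exp s - 1 - s := by
  unfold kf
  rw [← intervalIntegral.integral_const_mul]
  have : ∀ θ : ℝ, HasDerivAt (fun θ : ℝ => s * (1 - θ) * Real.exp (θ * s) + Real.exp (θ * s)) (s ^ 2 * ((1 - θ) * Real.exp (θ * s))) θ := fun θ => by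
    have he : HasDerivAt (fun θ : ℝ => Real.exp (θ * s)) (Real.exp (θ * s) * (1 * s)) θ := ((hasDerivAt_id θ).mul_const s).exp
    have h1 : HasDerivAt (fun θ : ℝ => s * (1 - θ)) (s * (0 - 1)) θ := ((hasDerivAt_const θ (1:ℝ)).sub (hasDerivAt_id θ)).const_mul s
    exact ((h1.mul he).add he).congr_deriv (by ring)
  rw [intervalIntegral.integral_eq_sub_of_hasDerivAt (fun θ _ => this θ) (Continuous.intervalIntegrable (by fun_prop) _ _)]
  simp; ring

variable (M : ℝ)

/-- `h(t)/t` -/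
def ka (t : ℝ) : ℝ := max t 0 * kf (min (max t 0) M)
def hM (t : ℝ) : ℝ := max t 0 * ka M t
def HM (t : ℝ) : ℝ := ∫ s in (0:ℝ)..t, hM M s

lemma ka_cont : Continuous (ka M) := by
  unfold ka
  exact (by fun_prop : Continuous fun t : ℝ => max t 0).mul (kf_cont.comp (by fun_prop))
lemma hM_cont : Continuous (hM M) := (by fun_prop : Continuous fun t : ℝ => max t 0).mul (ka_cont M)

variable {M}

lemma kmin_half (hM0 : 0 ≤ M) (t : ℝ) : 1 / 2 ≤ kf (min (max t 0) M) := kf_half (le_min (le_max_right _ _) hM0)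

lemma ka_mono (hM0 : 0 ≤ M) : Monotone (ka M) := by
  intro a b hab
  unfold ka
  have h1 : max a 0 ≤ max b 0 := max_le_max hab le_rfl
  have h2 := kmin_half hM0 a
  exact mul_le_mul h1 (kf_mono (min_le_min h1 le_rfl)) (by linarith) (le_max_right _ _)

lemma ka_nonneg (hM0 : 0 ≤ M) (t : ℝ) : 0 ≤ ka M t := mul_nonneg (le_max_right _ _) (by linarith [kmin_half hM0 t])

lemma hM_mono (hM0 : 0 ≤ M) : Monotone (hM M) := by
  intro a b hab
  exact mul_le_mul (max_le_max hab le_rfl) (ka_mono hM0 hab) (ka_nonneg hM0 _) (le_max_right _ _)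

lemma hM_nonneg (hM0 : 0 ≤ M) (t : ℝ) : 0 ≤ hM M t := mul_nonneg (le_max_right _ _) (ka_nonneg hM0 t)

lemma hM_neg {t : ℝ} (ht : t ≤ 0) : hM M t = 0 := by simp [hM, max_eq_right ht]

lemma hM_eq {t : ℝ} (h0 : 0 ≤ t) (h1 : t ≤ M) : hM M t = Real.exp t - 1 - t := by
  rw [← kf_eq, hM, ka, max_eq_left h0, min_eq_left h1]; ring

lemma hM_le_sq (hM0 : 0 ≤ M) (t : ℝ) : hM M t ≤ kf M * t ^ 2 := by
  unfold hM ka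
  have h1 : kf (min (max t 0) M) ≤ kf M := kf_mono (min_le_right _ _)
  have h2 : max t 0 ^ 2 ≤ t ^ 2 := by
    rcases le_total t 0 with h | h
    · rw [max_eq_right h]; nlinarith
    · rw [max_eq_left h]
  have h3 := kmin_half hM0 t
  nlinarith [mul_le_mul h2 h1 (by linarith) (sq_nonneg t)]

lemma hM_ge_sq (hM0 : 0 ≤ M) (t : ℝ) : max t 0 ^ 2 / 2 ≤ hM M t := by
  unfold hM ka
  nlinarith [kmin_half hM0 t, sq_nonneg (max t 0), mul_le_mul_of_nonneg_left (kmin_half hM0 t) (sq_nonneg (max t 0))]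

lemma hM_le_exp (hM0 : 0 ≤ M) {t : ℝ} (ht : 0 ≤ t) : hM M t ≤ Real.exp t - 1 := by
  have : hM M t ≤ t ^ 2 * kf t := by
    rw [hM, ka, max_eq_left ht]
    have : kf (min t M) ≤ kf t := kf_mono (min_le_left _ _)
    nlinarith [mul_le_mul_of_nonneg_left this (sq_nonneg t)]
  rw [kf_eq] at this; linarith

lemma hM_log (hM0 : 0 ≤ M) {t : ℝ} (ht : 0 ≤ t) : Real.log (1 + hM M t) ≤ t := by
  rw [Real.log_le_iff_le_exp (by linarith [hM_nonneg hM0 t])]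
  linarith [hM_le_exp hM0 ht]

lemma HM_sub (a b : ℝ) : HM M b - HM M a = ∫ s in a..b, hM M s := by
  unfold HM
  rw [intervalIntegral.integral_interval_sub_left] <;> exact (hM_cont M).intervalIntegrable _ _

lemma HM_cont : Continuous (HM M) := by
  have h : ∀ t, HasDerivAt (HM M) (hM M t) t := fun t => intervalIntegral.integral_hasDerivAt_right
    ((hM_cont M).intervalIntegrable _ _) ((hM_cont M).stronglyMeasurableAtFilter _ _) (hM_cont M).continuousAt
  exact continuous_iff_continuousAt.2 fun t => (h t).continuousAt

lemma HM_convex (hM0 : 0 ≤ M) (a b : ℝ) : hM M a * (b - a) ≤ HM M b - HM M a := by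
  rw [HM_sub]
  rcases le_total a b with h | h
  · have := intervalIntegral.integral_mono_on (μ := volume) (f := fun _ => hM M a) (g := hM M) h (continuous_const.intervalIntegrable _ _) ((hM_cont M).intervalIntegrable _ _) (fun x hx => hM_mono hM0 hx.1)
    simpa [mul_comm] using this
  · have := intervalIntegral.integral_mono_on (μ := volume) (g := fun _ => hM M a) (f := hM M) h ((hM_cont M).intervalIntegrable _ _) (continuous_const.intervalIntegrable _ _) (fun x hx => hM_mono hM0 hx.2)
    rw [intervalIntegral.integral_symm]
    simp at this; nlinarith

lemma HM_lip (hM0 : 0 ≤ M) (a b : ℝ) : |HM M b - HM M a| ≤ kf M * ((a ^ 2 + b ^ 2) * |b - a|) := by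
  have h1 := HM_convex hM0 a b
  have h2 := HM_convex hM0 b a
  have a1 := hM_le_sq hM0 a
  have a2 := hM_le_sq hM0 b
  have a3 := hM_nonneg hM0 a
  have a4 := hM_nonneg hM0 b
  have hk := kf_half hM0
  have p1 : 0 ≤ kf M * a ^ 2 := by positivity
  have p2 : 0 ≤ kf M * b ^ 2 := by positivity
  have hab := neg_abs_le (b - a)
  have hab2 := le_abs_self (b - a)
  have hn := abs_nonneg (b - a)
  rw [abs_le]
  constructor
  · have : -(hM M a * |b - a|) ≤ hM M a * (b - a) := by nlinarith
    nlinarith [mul_le_mul_of_nonneg_right a1 hn, mul_nonneg p2 hn]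
  · have : hM M b * (b - a) ≤ hM M b * |b - a| := by nlinarith
    nlinarith [mul_le_mul_of_nonneg_right a2 hn, mul_nonneg p1 hn]

lemma HM_zero : HM M 0 = 0 := by simp [HM]

lemma HM_neg {t : ℝ} (ht : t ≤ 0) : HM M t = 0 := by
  unfold HM
  rw [intervalIntegral.integral_symm]
  have : ∫ s in t..0, hM M s = ∫ s in t..0, (0:ℝ) := by
    apply intervalIntegral.integral_congr
    intro x hx
    rw [Set.uIcc_of_le ht] at hx
    exact hM_neg hx.2
  rw [this]; simp

lemma HM_scale0 (hM0 : 0 ≤ M) {a b : ℝ} (ha : 0 ≤ a) (hb : 0 ≤ b) : ka M a * (b ^ 2 - a ^ 2) / 2 ≤ HM M b - HM M a := by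
  rw [HM_sub]
  have e : ∀ x, 0 ≤ x → hM M x = x * ka M x := fun x hx => by rw [hM, max_eq_left hx]
  have hitg : ∀ p q : ℝ, ∫ s in p..q, s * ka M a = ka M a * (q ^ 2 - p ^ 2) / 2 := fun p q => by
    rw [intervalIntegral.integral_mul_const, integral_id]; ring
  rcases le_total a b with h | h
  · rw [← hitg]
    refine intervalIntegral.integral_mono_on h (Continuous.intervalIntegrable (by fun_prop) _ _) ((hM_cont M).intervalIntegrable _ _) (fun x hx => ?_)
    rw [e x (ha.trans hx.1)]
    exact mul_le_mul_of_nonneg_left (ka_mono hM0 hx.1) (ha.trans hx.1)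
  · rw [intervalIntegral.integral_symm]
    have : ∫ s in b..a, hM M s ≤ ∫ s in b..a, s * ka M a := by
      refine intervalIntegral.integral_mono_on h ((hM_cont M).intervalIntegrable _ _) (Continuous.intervalIntegrable (by fun_prop) _ _) (fun x hx => ?_)
      rw [e x (hb.trans hx.1)]
      exact mul_le_mul_of_nonneg_left (ka_mono hM0 hx.2) (hb.trans hx.1)
    rw [hitg] at this; linarith

lemma HM_scale (hM0 : 0 ≤ M) {t : ℝ} (ht : 0 ≤ t) (s : ℝ) : (t ^ 2 - 1) / 2 * (hM M s * s) ≤ HM M (t * s) - HM M s := by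
  rcases le_total s 0 with h | h
  · rw [hM_neg h, HM_neg h, HM_neg (by nlinarith)]; simp
  · have := HM_scale0 hM0 h (mul_nonneg ht h)
    rw [hM, max_eq_left h]
    nlinarith

lemma HM_nonneg (hM0 : 0 ≤ M) (t : ℝ) : 0 ≤ HM M t := by
  have := HM_convex hM0 0 t
  rw [hM_neg le_rfl, HM_zero] at this; linarith

/-- `3 H ≤ t h` -/
lemma HM_AR (hM0 : 0 ≤ M) (t : ℝ) : 3 * HM M t ≤ hM M t * t := by
  rcases le_total t 0 with h | h
  · rw [HM_neg h, hM_neg h]; simp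
  have e : ∫ s in (0:ℝ)..t, s ^ 2 * kf (min t M) = t ^ 3 / 3 * kf (min t M) := by
    rw [intervalIntegral.integral_mul_const, integral_pow]; norm_num
  have : HM M t ≤ ∫ s in (0:ℝ)..t, s ^ 2 * kf (min t M) := by
    refine intervalIntegral.integral_mono_on h ((hM_cont M).intervalIntegrable _ _) (Continuous.intervalIntegrable (by fun_prop) _ _) (fun x hx => ?_)
    rw [hM, ka, max_eq_left hx.1]
    have : kf (min x M) ≤ kf (min t M) := kf_mono (min_le_min hx.2 le_rfl)
    nlinarith [mul_le_mul_of_nonneg_left this (sq_nonneg x)]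
  rw [e] at this
  rw [hM, ka, max_eq_left h]; nlinarith

lemma HM_ge (hM0 : 0 ≤ M) (t : ℝ) : max t 0 ^ 3 / 6 ≤ HM M t := by
  rcases le_total t 0 with h | h
  · rw [HM_neg h, max_eq_right h]; norm_num
  rw [max_eq_left h]
  have e : ∫ s in (0:ℝ)..t, s ^ 2 * (1/2) = t ^ 3 / 6 := by
    rw [intervalIntegral.integral_mul_const, integral_pow]; ring
  rw [← e]
  refine intervalIntegral.integral_mono_on h (Continuous.intervalIntegrable (by fun_prop) _ _) ((hM_cont M).intervalIntegrable _ _) (fun x hx => ?_)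
  have := hM_ge_sq hM0 x
  rw [max_eq_left hx.1] at this; linarith

/-- scaling of `h(t)t` -/
lemma hM_scale_up (hM0 : 0 ≤ M) {t : ℝ} (ht : 1 ≤ t) (s : ℝ) : t ^ 3 * (hM M s * s) ≤ hM M (t * s) * (t * s) := by
  rcases le_total s 0 with h | h
  · rw [hM_neg h, hM_neg (by nlinarith)]; simp
  have h0 : 0 ≤ t * s := by positivity
  rw [hM, hM, ka, ka, max_eq_left h, max_eq_left h0]
  have : kf (min s M) ≤ kf (min (t * s) M) := kf_mono (min_le_min (by nlinarith) le_rfl)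
  have p : 0 ≤ t ^ 3 * s ^ 3 := by positivity
  nlinarith [mul_le_mul_of_nonneg_left this p]

lemma hM_scale_down (hM0 : 0 ≤ M) {t : ℝ} (ht0 : 0 ≤ t) (ht : t ≤ 1) (s : ℝ) : hM M (t * s) * (t * s) ≤ t ^ 3 * (hM M s * s) := by
  rcases le_total s 0 with h | h
  · rw [hM_neg h, hM_neg (by nlinarith)]; simp
  have h0 : 0 ≤ t * s := by positivity
  rw [hM, hM, ka, ka, max_eq_left h, max_eq_left h0]
  have : kf (min (t * s) M) ≤ kf (min s M) := kf_mono (min_le_min (by nlinarith) le_rfl)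
  have p : 0 ≤ t ^ 3 * s ^ 3 := by positivity
  nlinarith [mul_le_mul_of_nonneg_left this p]

lemma hM_mul_nonneg (hM0 : 0 ≤ M) (t : ℝ) : 0 ≤ hM M t * t := by
  rcases le_total t 0 with h | h
  · rw [hM_neg h]; simp
  · exact mul_nonneg (hM_nonneg hM0 t) h

lemma hM_mul_le (hM0 : 0 ≤ M) (t : ℝ) : hM M t * t ≤ kf M * (t ^ 2 * |t|) := by
  have := hM_le_sq hM0 t
  have h2 := hM_nonneg hM0 t
  have h3 := le_abs_self t
  have h4 := abs_nonneg t
  nlinarith [mul_le_mul_of_nonneg_right this h4, mul_le_mul_of_nonneg_left h3 h2]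

end NonlinSec


noncomputable section VarSec

variable {Ω : Set E2}

lemma Dom.tri (D : Dom Ω) : ∃ K : ℝ, 0 ≤ K ∧ ∀ U ∈ H1 Ω, ∀ V : HH Ω, Integrable (fun x => uu U x ^ 2 * |uu V x|) (mu Ω) ∧
    ∫ x in Ω, uu U x ^ 2 * |uu V x| ≤ K * (‖U‖ ^ 2 * ‖V.fst‖) := by
  obtain ⟨K, hK, h⟩ := D.L4_bound
  refine ⟨(K ^ (1/2:ℝ)).toReal, by positivity, fun U hU V => ?_⟩
  have hm : Measurable (fun x => uu U x ^ 2 * |uu V x|) := ((uu_sm U).measurable.pow_const 2).mul (uu_sm V).measurable.abs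
  have hl : ∫⁻ x in Ω, ‖uu U x ^ 2 * |uu V x|‖ₑ ≤ K ^ (1/2:ℝ) * (‖U‖ₑ ^ 2 * ‖V.fst‖ₑ) := by
    have h1 : ∀ x, ‖uu U x ^ 2 * |uu V x|‖ₑ = ‖uu U x‖ₑ ^ 2 * ‖uu V x‖ₑ := fun x => by
      rw [enorm_mul, enorm_pow, ← Real.norm_eq_abs, enorm_norm]
    simp only [h1]
    have := ENNReal.lintegral_mul_le_Lp_mul_Lq (mu Ω) Real.HolderConjugate.two_two
      ((uu_sm U).measurable.enorm.pow_const 2).aemeasurable (uu_sm V).measurable.enorm.aemeasurable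
    refine this.trans ?_
    have e1 : ∫⁻ x in Ω, (‖uu U x‖ₑ ^ 2) ^ (2:ℝ) ≤ K * ‖U‖ₑ ^ 4 := by
      refine le_trans (le_of_eq ?_) (h U hU)
      congr 1; ext x
      rw [ENNReal.rpow_ofNat, ← pow_mul]
    have e2 : ∫⁻ x in Ω, ‖uu V x‖ₑ ^ (2:ℝ) = ‖V.fst‖ₑ ^ 2 := by
      rw [← Lp_sq]
      congr 1; ext x
      rw [ENNReal.rpow_ofNat]; rfl
    rw [e2]
    calc _ ≤ (K * ‖U‖ₑ ^ 4) ^ (1/2:ℝ) * (‖V.fst‖ₑ ^ 2) ^ (1/2:ℝ) := by gcongr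
      _ = _ := by
        rw [ENNReal.mul_rpow_of_nonneg _ _ (by norm_num), ← ENNReal.rpow_natCast, ← ENNReal.rpow_natCast, ← ENNReal.rpow_mul, ← ENNReal.rpow_mul]
        norm_num
        rw [mul_assoc]
  have hf : K ^ (1/2:ℝ) * (‖U‖ₑ ^ 2 * ‖V.fst‖ₑ) ≠ ⊤ := by
    have : K ^ (1/2:ℝ) ≠ ⊤ := ENNReal.rpow_ne_top_of_nonneg (by norm_num) hK
    finiteness
  refine ⟨⟨hm.aestronglyMeasurable, lt_of_le_of_lt hl hf.lt_top⟩, ?_⟩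
  rw [integral_eq_lintegral_of_nonneg_ae (Eventually.of_forall fun x => by positivity) hm.aestronglyMeasurable]
  have : ∀ x, ENNReal.ofReal (uu U x ^ 2 * |uu V x|) = ‖uu U x ^ 2 * |uu V x|‖ₑ := fun x => (Real.enorm_of_nonneg (by positivity)).symm
  simp only [this]
  refine (ENNReal.toReal_mono hf hl).trans (le_of_eq ?_)
  simp [ENNReal.toReal_mul]

variable {M : ℝ} (hM0 : 0 ≤ M)

def Jh (M : ℝ) (U V : HH Ω) : ℝ := ∫ x in Ω, hM M (uu U x) * uu V x
def JH (M : ℝ) (U : HH Ω) : ℝ := ∫ x in Ω, HM M (uu U x)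

lemma hM_bd (hM0 : 0 ≤ M) (s t : ℝ) : |hM M s * t| ≤ kf M * (s ^ 2 * |t|) := by
  rw [abs_mul, abs_of_nonneg (hM_nonneg hM0 s), ← mul_assoc]
  exact mul_le_mul_of_nonneg_right (hM_le_sq hM0 s) (abs_nonneg t)

lemma Dom.Jh_int (D : Dom Ω) (hM0 : 0 ≤ M) {U : HH Ω} (hU : U ∈ H1 Ω) (V : HH Ω) : Integrable (fun x => hM M (uu U x) * uu V x) (mu Ω) := by
  obtain ⟨K, hK, h⟩ := D.tri
  refine ((h U hU V).1.const_mul (kf M)).mono' ?_ ?_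
  · exact (((hM_cont M).measurable.comp (uu_sm U).measurable).mul (uu_sm V).measurable).aestronglyMeasurable
  · exact Eventually.of_forall fun x => hM_bd hM0 _ _

lemma Dom.JH_int (D : Dom Ω) (hM0 : 0 ≤ M) {U : HH Ω} (hU : U ∈ H1 Ω) : Integrable (fun x => HM M (uu U x)) (mu Ω) := by
  refine (D.Jh_int hM0 hU U).mono' ?_ (Eventually.of_forall fun x => ?_)
  · exact ((HM_cont).measurable.comp (uu_sm U).measurable).aestronglyMeasurable
  · rw [Real.norm_eq_abs, abs_of_nonneg (HM_nonneg hM0 _)]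
    linarith [HM_AR hM0 (uu U x), HM_nonneg hM0 (uu U x)]

lemma Dom.Jh_bound (D : Dom Ω) (hM0 : 0 ≤ M) : ∃ K : ℝ, 0 ≤ K ∧ ∀ U ∈ H1 Ω, ∀ V : HH Ω, |Jh M U V| ≤ K * (‖U‖ ^ 2 * ‖V.fst‖) := by
  obtain ⟨K, hK, h⟩ := D.tri
  have hk := kf_half hM0
  refine ⟨kf M * K, by positivity, fun U hU V => ?_⟩
  have h1 : |Jh M U V| ≤ ∫ x in Ω, kf M * (uu U x ^ 2 * |uu V x|) :=
    by
      rw [Jh, ← Real.norm_eq_abs]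
      exact norm_integral_le_of_norm_le ((h U hU V).1.const_mul (kf M)) (Eventually.of_forall fun x => hM_bd hM0 _ _)
  rw [integral_const_mul] at h1
  refine h1.trans ?_
  rw [mul_assoc]
  exact mul_le_mul_of_nonneg_left (h U hU V).2 (by linarith)

lemma Dom.JH_lip (D : Dom Ω) (hM0 : 0 ≤ M) : ∃ K : ℝ, 0 ≤ K ∧ ∀ U ∈ H1 Ω, ∀ V ∈ H1 Ω, |JH M V - JH M U| ≤ K * ((‖U‖ ^ 2 + ‖V‖ ^ 2) * ‖V.fst - U.fst‖) := by
  obtain ⟨K, hK, h⟩ := D.tri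
  have hk := kf_half hM0
  refine ⟨kf M * K, by positivity, fun U hU V hV => ?_⟩
  have h2 := h U hU (V - U)
  have h3 := h V hV (V - U)
  rw [JH, JH, ← integral_sub (D.JH_int hM0 hV) (D.JH_int hM0 hU)]
  have h1 : |∫ x in Ω, (HM M (uu V x) - HM M (uu U x))| ≤ ∫ x in Ω, kf M * (uu U x ^ 2 * |uu (V - U) x| + uu V x ^ 2 * |uu (V - U) x|) := by
    rw [← Real.norm_eq_abs]
    refine norm_integral_le_of_norm_le ((h2.1.add h3.1).const_mul (kf M)) ?_
    filter_upwards [uu_sub V U] with x hx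
    rw [hx, ← add_mul]; exact HM_lip hM0 _ _
  rw [integral_const_mul, integral_add h2.1 h3.1] at h1
  refine h1.trans ?_
  rw [mul_assoc]
  refine mul_le_mul_of_nonneg_left ?_ (by linarith)
  have : (V - U).fst = V.fst - U.fst := rfl
  rw [this] at h2 h3
  nlinarith [h2.2, h3.2]

lemma Dom.Jh_add (D : Dom Ω) (hM0 : 0 ≤ M) {U : HH Ω} (hU : U ∈ H1 Ω) (V W : HH Ω) : Jh M U (V + W) = Jh M U V + Jh M U W := by
  rw [Jh, Jh, Jh, ← integral_add (D.Jh_int hM0 hU V) (D.Jh_int hM0 hU W)]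
  refine integral_congr_ae ?_
  filter_upwards [uu_add V W] with x hx
  rw [hx]; ring

lemma Jh_smul (U V : HH Ω) (c : ℝ) : Jh M U (c • V) = c * Jh M U V := by
  rw [Jh, Jh, ← integral_const_mul]
  refine integral_congr_ae ?_
  filter_upwards [uu_smul c V] with x hx
  rw [hx]; ring

lemma Dom.JH_convex (D : Dom Ω) (hM0 : 0 ≤ M) {U V : HH Ω} (hU : U ∈ H1 Ω) (hV : V ∈ H1 Ω) : Jh M U (V - U) ≤ JH M V - JH M U := by
  rw [JH, JH, ← integral_sub (D.JH_int hM0 hV) (D.JH_int hM0 hU)]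
  refine integral_mono_ae (D.Jh_int hM0 hU _) ((D.JH_int hM0 hV).sub (D.JH_int hM0 hU)) ?_
  filter_upwards [uu_sub V U] with x hx
  rw [hx]; exact HM_convex hM0 _ _

lemma Dom.JH_scale (D : Dom Ω) (hM0 : 0 ≤ M) {U : HH Ω} (hU : U ∈ H1 Ω) {t : ℝ} (ht : 0 ≤ t) : (t ^ 2 - 1) / 2 * Jh M U U ≤ JH M (t • U) - JH M U := by
  rw [JH, JH, ← integral_sub (D.JH_int hM0 ((H1 Ω).smul_mem t hU)) (D.JH_int hM0 hU), Jh, ← integral_const_mul]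
  refine integral_mono_ae ((D.Jh_int hM0 hU _).const_mul _) ((D.JH_int hM0 ((H1 Ω).smul_mem t hU)).sub (D.JH_int hM0 hU)) ?_
  filter_upwards [uu_smul t U] with x hx
  rw [hx]; exact HM_scale hM0 ht _

lemma Dom.JH_AR (D : Dom Ω) (hM0 : 0 ≤ M) {U : HH Ω} (hU : U ∈ H1 Ω) : 3 * JH M U ≤ Jh M U U := by
  rw [JH, Jh, ← integral_const_mul]
  exact integral_mono ((D.JH_int hM0 hU).const_mul 3) (D.Jh_int hM0 hU U) fun x => HM_AR hM0 _

lemma JH_nonneg (hM0 : 0 ≤ M) (U : HH Ω) : 0 ≤ JH M U := integral_nonneg fun x => HM_nonneg hM0 _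
lemma Jd_nonneg (hM0 : 0 ≤ M) (U : HH Ω) : 0 ≤ Jh M U U := integral_nonneg fun x => hM_mul_nonneg hM0 _

lemma Dom.Jd_up (D : Dom Ω) (hM0 : 0 ≤ M) {U : HH Ω} (hU : U ∈ H1 Ω) {t : ℝ} (ht : 1 ≤ t) : t ^ 3 * Jh M U U ≤ Jh M (t • U) (t • U) := by
  rw [Jh, Jh, ← integral_const_mul]
  refine integral_mono_ae ((D.Jh_int hM0 hU _).const_mul _) (D.Jh_int hM0 ((H1 Ω).smul_mem t hU) _) ?_
  filter_upwards [uu_smul t U] with x hx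
  rw [hx]; exact hM_scale_up hM0 ht _

lemma Dom.Jd_down (D : Dom Ω) (hM0 : 0 ≤ M) {U : HH Ω} (hU : U ∈ H1 Ω) {t : ℝ} (ht0 : 0 ≤ t) (ht : t ≤ 1) : Jh M (t • U) (t • U) ≤ t ^ 3 * Jh M U U := by
  rw [Jh, Jh, ← integral_const_mul]
  refine integral_mono_ae (D.Jh_int hM0 ((H1 Ω).smul_mem t hU) _) ((D.Jh_int hM0 hU _).const_mul _) ?_
  filter_upwards [uu_smul t U] with x hx
  rw [hx]; exact hM_scale_down hM0 ht0 ht _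

lemma Dom.Jd_zero (D : Dom Ω) (hM0 : 0 ≤ M) {U : HH Ω} (hU : U ∈ H1 Ω) (h : Jh M U U = 0) {t : ℝ} (ht : 0 ≤ t) : JH M (t • U) = 0 := by
  rw [Jh, integral_eq_zero_iff_of_nonneg (fun x => hM_mul_nonneg hM0 _) (D.Jh_int hM0 hU U)] at h
  rw [JH]
  refine integral_eq_zero_of_ae ?_
  filter_upwards [uu_smul t U, h] with x hx h
  have h : hM M (uu U x) * uu U x = 0 := h
  have : uu U x ≤ 0 := by
    by_contra hc
    push Not at hc
    have := hM_ge_sq hM0 (uu U x)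
    rw [max_eq_left hc.le] at this
    have : 0 < hM M (uu U x) := by have : 0 < uu U x ^ 2 := by positivity
                                   linarith
    have := mul_pos this hc
    linarith
  rw [hx, HM_neg (mul_nonpos_of_nonneg_of_nonpos ht this)]; rfl

lemma Dom.Jh_cont (D : Dom Ω) (hM0 : 0 ≤ M) {U Φ : HH Ω} (hU : U ∈ H1 Ω) (hΦ : Φ ∈ H1 Ω) (V : HH Ω) :
    Continuous (fun p : ℝ × ℝ => Jh M (p.1 • U + p.2 • Φ) V) := by
  obtain ⟨K, hK, h⟩ := D.tri
  have hk := kf_half hM0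
  have e : ∀ p : ℝ × ℝ, Jh M (p.1 • U + p.2 • Φ) V = ∫ x in Ω, hM M (p.1 * uu U x + p.2 * uu Φ x) * uu V x := fun p => by
    refine integral_congr_ae ?_
    filter_upwards [uu_add (p.1 • U) (p.2 • Φ), uu_smul p.1 U, uu_smul p.2 Φ] with x h1 h2 h3
    rw [h1, h2, h3]
  simp only [e]
  refine continuous_iff_continuousAt.2 fun p => ?_
  refine continuousAt_of_dominated (bound := fun x => kf M * (2 * (‖p‖ + 1) ^ 2 * (uu U x ^ 2 * |uu V x| + uu Φ x ^ 2 * |uu V x|))) ?_ ?_ ?_ ?_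
  · refine Eventually.of_forall fun q => Measurable.aestronglyMeasurable ?_
    exact ((hM_cont M).measurable.comp (((uu_sm U).measurable.const_mul _).add ((uu_sm Φ).measurable.const_mul _))).mul (uu_sm V).measurable
  · have : ∀ᶠ q in 𝓝 p, ‖q‖ < ‖p‖ + 1 := continuous_norm.continuousAt.eventually_lt_const (by linarith)
    filter_upwards [this] with q hq
    refine Eventually.of_forall fun x => (hM_bd hM0 _ _).trans ?_
    refine mul_le_mul_of_nonneg_left ?_ (by linarith)
    rw [← add_mul, ← mul_assoc]
    refine mul_le_mul_of_nonneg_right ?_ (abs_nonneg _)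
    have h1 : |q.1| ≤ ‖p‖ + 1 := (norm_fst_le q).trans hq.le
    have h2 : |q.2| ≤ ‖p‖ + 1 := (norm_snd_le q).trans hq.le
    have h1' : q.1 ^ 2 ≤ (‖p‖ + 1) ^ 2 := by rw [← sq_abs]; gcongr
    have h2' : q.2 ^ 2 ≤ (‖p‖ + 1) ^ 2 := by rw [← sq_abs]; gcongr
    nlinarith [sq_nonneg (q.1 * uu U x - q.2 * uu Φ x), mul_le_mul_of_nonneg_right h1' (sq_nonneg (uu U x)), mul_le_mul_of_nonneg_right h2' (sq_nonneg (uu Φ x))]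
  · exact (((h U hU V).1.add (h Φ hΦ V).1).const_mul _).const_mul _
  · refine Eventually.of_forall fun x => Continuous.continuousAt ?_
    exact ((hM_cont M).comp (by fun_prop)).mul continuous_const

end VarSec


noncomputable section NehSec

variable {Ω : Set E2} {ε b M : ℝ}

def BB (ε b : ℝ) (U V : HH Ω) : ℝ := ε * ⟪U.snd, V.snd⟫ + b * ⟪U.fst, V.fst⟫
def qq (ε b : ℝ) (U : HH Ω) : ℝ := BB ε b U U
def II (ε b M : ℝ) (U : HH Ω) : ℝ := qq ε b U / 2 - JH M U
def Neh (Ω : Set E2) (ε b M : ℝ) : Set (HH Ω) := {U | U ∈ H1 Ω ∧ 0 < qq ε b U ∧ qq ε b U = Jh M U U}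

lemma BB_add_right (U V W : HH Ω) : BB ε b U (V + W) = BB ε b U V + BB ε b U W := by
  simp only [BB, WithLp.add_snd, WithLp.add_fst, inner_add_right]; ring
lemma BB_add_left (U V W : HH Ω) : BB ε b (U + V) W = BB ε b U W + BB ε b V W := by
  simp only [BB, WithLp.add_snd, WithLp.add_fst, inner_add_left]; ring
lemma BB_smul_right (U V : HH Ω) (c : ℝ) : BB ε b U (c • V) = c * BB ε b U V := by
  simp only [BB, WithLp.smul_snd, WithLp.smul_fst, inner_smul_right]; ring
lemma BB_smul_left (U V : HH Ω) (c : ℝ) : BB ε b (c • U) V = c * BB ε b U V := by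
  simp only [BB, WithLp.smul_snd, WithLp.smul_fst, real_inner_smul_left]; ring
lemma BB_symm (U V : HH Ω) : BB ε b U V = BB ε b V U := by
  rw [BB, BB, real_inner_comm, real_inner_comm V.fst]
lemma qq_smul (U : HH Ω) (t : ℝ) : qq ε b (t • U) = t ^ 2 * qq ε b U := by
  rw [qq, BB_smul_left, BB_smul_right, qq]; ring
lemma qq_add (U V : HH Ω) : qq ε b (U + V) = qq ε b U + 2 * BB ε b U V + qq ε b V := by
  rw [qq, BB_add_left, BB_add_right, BB_add_right, BB_symm V U, qq, qq]; ring
lemma qq_eq (U : HH Ω) : qq ε b U = ε * ‖U.snd‖ ^ 2 + b * ‖U.fst‖ ^ 2 := by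
  rw [qq, BB, real_inner_self_eq_norm_sq, real_inner_self_eq_norm_sq]
lemma qq_lower (U : HH Ω) : min ε b * ‖U‖ ^ 2 ≤ qq ε b U := by
  rw [qq_eq, HH_norm_sq]
  nlinarith [mul_le_mul_of_nonneg_right (min_le_left ε b) (sq_nonneg ‖U.snd‖), mul_le_mul_of_nonneg_right (min_le_right ε b) (sq_nonneg ‖U.fst‖)]
lemma qq_nonneg (hε : 0 < ε) (hb : 0 < b) (U : HH Ω) : 0 ≤ qq ε b U := by rw [qq_eq]; positivity
lemma BB_rep (Z : HH Ω) : ∃ Z' : HH Ω, ∀ W, BB ε b Z W = ⟪Z', W⟫ := by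
  refine ⟨WithLp.toLp 2 (b • Z.fst, ε • Z.snd), fun W => ?_⟩
  rw [WithLp.prod_inner_apply, BB]
  simp only [real_inner_smul_left]
  exact add_comm _ _

lemma Dom.Jh_cont1 (D : Dom Ω) (hM0 : 0 ≤ M) {U : HH Ω} (hU : U ∈ H1 Ω) (Φ : HH Ω) : Continuous (fun t : ℝ => Jh M (t • U) Φ) := by
  have := (D.Jh_cont hM0 hU hU Φ).comp (by fun_prop : Continuous fun t : ℝ => (t, (0:ℝ)))
  simpa [Function.comp_def] using this

lemma Dom.Neh_lower (D : Dom Ω) (hε : 0 < ε) (hb : 0 < b) (hM0 : 0 ≤ M) : ∃ c > 0, ∀ U ∈ Neh Ω ε b M, c ≤ qq ε b U := by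
  obtain ⟨K, hK, h⟩ := D.Jh_bound hM0
  have hα : 0 < min ε b := lt_min hε hb
  refine ⟨min ε b * (min ε b / (K + 1)) ^ 2, by positivity, fun U ⟨hU, hq, he⟩ => ?_⟩
  have h1 := qq_lower (ε := ε) (b := b) U
  have hne : 0 < ‖U‖ := by
    rw [norm_pos_iff]
    rintro rfl
    rw [qq_eq] at hq; simp at hq
  have h2 : ‖U.fst‖ ≤ ‖U‖ := by
    have := HH_norm_sq U
    nlinarith [sq_nonneg ‖U.snd‖, norm_nonneg U, norm_nonneg U.fst]
  have h3 := (le_abs_self _).trans (h U hU U)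
  rw [← he] at h3
  have h4 : min ε b ≤ (K + 1) * ‖U‖ := by
    have : min ε b * ‖U‖ ^ 2 ≤ ((K + 1) * ‖U‖) * ‖U‖ ^ 2 := by
      have : K * (‖U‖ ^ 2 * ‖U.fst‖) ≤ (K + 1) * (‖U‖ ^ 2 * ‖U‖) := by gcongr; linarith
      nlinarith
    exact le_of_mul_le_mul_right this (by positivity)
  have h5 : min ε b / (K + 1) ≤ ‖U‖ := by rw [div_le_iff₀ (by positivity)]; linarith
  calc _ ≤ min ε b * ‖U‖ ^ 2 := by gcongr
    _ ≤ _ := h1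

lemma Dom.Jd_cont (D : Dom Ω) (hM0 : 0 ≤ M) {U Φ : HH Ω} (hU : U ∈ H1 Ω) (hΦ : Φ ∈ H1 Ω) :
    Continuous (fun p : ℝ × ℝ => Jh M (p.1 • U + p.2 • Φ) (p.1 • U + p.2 • Φ)) := by
  have : ∀ p : ℝ × ℝ, Jh M (p.1 • U + p.2 • Φ) (p.1 • U + p.2 • Φ) = p.1 * Jh M (p.1 • U + p.2 • Φ) U + p.2 * Jh M (p.1 • U + p.2 • Φ) Φ := fun p => by
    rw [D.Jh_add hM0 ((H1 Ω).add_mem ((H1 Ω).smul_mem _ hU) ((H1 Ω).smul_mem _ hΦ)), Jh_smul, Jh_smul]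
  simp only [this]
  exact (continuous_fst.mul (D.Jh_cont hM0 hU hΦ U)).add (continuous_snd.mul (D.Jh_cont hM0 hU hΦ Φ))

lemma Dom.Jd_cont1 (D : Dom Ω) (hM0 : 0 ≤ M) {U : HH Ω} (hU : U ∈ H1 Ω) : Continuous (fun t : ℝ => Jh M (t • U) (t • U)) := by
  have := (D.Jd_cont hM0 hU hU).comp (by fun_prop : Continuous fun t : ℝ => (t, (0:ℝ)))
  simpa [Function.comp_def] using this

lemma Dom.Jd_pos_q (D : Dom Ω) (hε : 0 < ε) (hb : 0 < b) (hM0 : 0 ≤ M) {U : HH Ω} (hU : U ∈ H1 Ω) (h : 0 < Jh M U U) : 0 < qq ε b U := by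
  have hne : 0 < ‖U‖ := by
    rw [norm_pos_iff]
    rintro rfl
    have := Jh_smul (M := M) (0 : HH Ω) 0 0
    simp at this; linarith
  have := qq_lower (ε := ε) (b := b) U
  have hα : 0 < min ε b := lt_min hε hb
  have : 0 < min ε b * ‖U‖ ^ 2 := by positivity
  linarith

lemma Dom.fiber (D : Dom Ω) (hε : 0 < ε) (hb : 0 < b) (hM0 : 0 ≤ M) {U : HH Ω} (hU : U ∈ H1 Ω) (h : 0 < Jh M U U) :
    ∃ t : ℝ, 0 < t ∧ t • U ∈ Neh Ω ε b M := by
  have hq := D.Jd_pos_q hε hb hM0 hU h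
  set q := qq ε b U
  set J := Jh M U U with hJ
  set t0 := min 1 (q / (2 * J))
  set t1 := max 1 (2 * q / J)
  have ht0 : 0 < t0 := lt_min one_pos (by positivity)
  have ht01 : t0 ≤ t1 := (min_le_left _ _).trans (le_max_left _ _)
  have a0 : Jh M (t0 • U) (t0 • U) ≤ t0 ^ 2 * q := by
    refine (D.Jd_down hM0 hU ht0.le (min_le_left _ _)).trans ?_
    have : t0 * J ≤ q := by
      have := (mul_le_mul_of_nonneg_right (min_le_right 1 (q / (2 * J))) h.le)
      refine this.trans ?_
      rw [div_mul_eq_mul_div, div_le_iff₀ (by positivity)]; nlinarith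
    rw [← hJ]
    nlinarith [mul_le_mul_of_nonneg_left this (sq_nonneg t0)]
  have a1 : t1 ^ 2 * q ≤ Jh M (t1 • U) (t1 • U) := by
    refine le_trans ?_ (D.Jd_up hM0 hU (le_max_left _ _))
    have : q ≤ t1 * J := by
      have := (mul_le_mul_of_nonneg_right (le_max_right 1 (2 * q / J)) h.le)
      refine le_trans ?_ this
      rw [div_mul_cancel₀ _ h.ne']; linarith
    rw [← hJ]
    nlinarith [mul_le_mul_of_nonneg_left this (sq_nonneg t1)]
  have hc : ContinuousOn (fun t : ℝ => Jh M (t • U) (t • U) - t ^ 2 * q) (Set.Icc t0 t1) :=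
    ((D.Jd_cont1 hM0 hU).sub (by fun_prop)).continuousOn
  obtain ⟨t, ht, hz⟩ := intermediate_value_Icc ht01 hc (show (0:ℝ) ∈ _ from ⟨by linarith, by linarith⟩)
  have htp : 0 < t := ht0.trans_le ht.1
  refine ⟨t, htp, (H1 Ω).smul_mem _ hU, ?_, ?_⟩
  · rw [qq_smul]; positivity
  · rw [qq_smul]; simp only at hz; linarith

lemma Dom.Neh_max (D : Dom Ω) (hM0 : 0 ≤ M) {U : HH Ω} (hU : U ∈ Neh Ω ε b M) {t : ℝ} (ht : 0 ≤ t) : II ε b M (t • U) ≤ II ε b M U := by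
  have := D.JH_scale hM0 hU.1 ht
  rw [← hU.2.2] at this
  rw [II, II, qq_smul]; nlinarith

lemma Dom.Neh_AR (D : Dom Ω) (hM0 : 0 ≤ M) {U : HH Ω} (hU : U ∈ Neh Ω ε b M) : qq ε b U ≤ 6 * II ε b M U := by
  have := D.JH_AR hM0 hU.1
  rw [← hU.2.2] at this
  rw [II]; nlinarith

lemma Dom.JH_tendsto (D : Dom Ω) (hM0 : 0 ≤ M) {W : ℕ → HH Ω} {Z : HH Ω} (hW : ∀ n, W n ∈ H1 Ω) (hZ : Z ∈ H1 Ω) {R : ℝ}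
    (hR : ∀ n, ‖W n‖ ≤ R) (h : Tendsto (fun n => (W n).fst) atTop (𝓝 Z.fst)) (t : ℝ) :
    Tendsto (fun n => JH M (t • W n)) atTop (𝓝 (JH M (t • Z))) := by
  obtain ⟨K, hK, hl⟩ := D.JH_lip hM0
  rw [tendsto_iff_norm_sub_tendsto_zero] at h ⊢
  have h2 : Tendsto (fun n => K * ((‖t • Z‖ ^ 2 + (|t| * R) ^ 2) * (|t| * ‖(W n).fst - Z.fst‖))) atTop (𝓝 0) := by
    simpa using ((h.const_mul |t|).const_mul (‖t • Z‖ ^ 2 + (|t| * R) ^ 2)).const_mul K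
  refine squeeze_zero (fun n => norm_nonneg _) (fun n => ?_) h2
  refine (hl _ ((H1 Ω).smul_mem t hZ) _ ((H1 Ω).smul_mem t (hW n))).trans ?_
  have e : ‖(t • W n).fst - (t • Z).fst‖ = |t| * ‖(W n).fst - Z.fst‖ := by
    rw [WithLp.smul_fst, WithLp.smul_fst, ← smul_sub, norm_smul, Real.norm_eq_abs]
  rw [e]
  have : ‖t • W n‖ ≤ |t| * R := by
    rw [norm_smul, Real.norm_eq_abs]; exact mul_le_mul_of_nonneg_left (hR n) (abs_nonneg t)
  gcongr

lemma Dom.minimizer (D : Dom Ω) (hε : 0 < ε) (hb : 0 < b) (hM0 : 0 ≤ M) (hne : (Neh Ω ε b M).Nonempty) :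
    ∃ U ∈ Neh Ω ε b M, ∀ V ∈ Neh Ω ε b M, II ε b M U ≤ II ε b M V := by
  obtain ⟨c, hc, hcl⟩ := D.Neh_lower hε hb hM0
  have hα : 0 < min ε b := lt_min hε hb
  set S := Set.image (II ε b M) (Neh Ω ε b M)
  have hSn : S.Nonempty := hne.image _
  have hSb : BddBelow S := ⟨0, by
    rintro _ ⟨U, hU, rfl⟩
    linarith [D.Neh_AR hM0 hU, hU.2.1]⟩
  obtain ⟨s, hs1, hs2, hs3⟩ := exists_seq_tendsto_sInf hSn hSb
  choose W hW hWs using hs3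
  set m := sInf S
  have hIm : Tendsto (fun n => II ε b M (W n)) atTop (𝓝 m) := by simpa [hWs] using hs2
  obtain ⟨R, hR⟩ : ∃ R, ∀ n, ‖W n‖ ≤ R := by
    obtain ⟨B, hB⟩ := hIm.bddAbove_range
    refine ⟨√(6 * B / min ε b), fun n => Real.le_sqrt_of_sq_le ?_⟩
    rw [le_div_iff₀ hα]
    linarith [D.Neh_AR hM0 (hW n), qq_lower (ε := ε) (b := b) (W n), hB ⟨n, rfl⟩]
  obtain ⟨Z, hZ, k, hk, hw, hf⟩ := D.compact (fun n => (hW n).1) hR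
  have hIk := hIm.comp hk.tendsto_atTop
  have hJ := fun t => D.JH_tendsto hM0 (fun n => (hW (k n)).1) hZ (fun n => hR (k n)) hf t
  have key : ∀ t : ℝ, 0 ≤ t → II ε b M (t • Z) ≤ m := fun t ht => by
    obtain ⟨Z', hZ'⟩ := BB_rep (ε := ε) (b := b) Z
    have h1 : Tendsto (fun n => t ^ 2 * (2 * BB ε b Z (W (k n)) - qq ε b Z) / 2 - JH M (t • W (k n))) atTop
        (𝓝 (t ^ 2 * (2 * BB ε b Z Z - qq ε b Z) / 2 - JH M (t • Z))) := by
      refine Tendsto.sub (((((?_ : Tendsto _ _ _).const_mul 2).sub_const _).const_mul _).div_const _) (hJ t)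
      simp only [hZ']; exact hw Z'
    have h2 := le_of_tendsto_of_tendsto' h1 hIk fun n => by
      refine le_trans ?_ (D.Neh_max hM0 (hW (k n)) ht)
      rw [II, qq_smul]
      have : 0 ≤ qq ε b (W (k n) + (-1:ℝ) • Z) := qq_nonneg hε hb _
      rw [qq_add, qq_smul, BB_smul_right, BB_symm] at this
      have : 2 * BB ε b Z (W (k n)) - qq ε b Z ≤ qq ε b (W (k n)) := by linarith
      nlinarith [mul_le_mul_of_nonneg_left this (sq_nonneg t)]
    refine le_trans (le_of_eq ?_) h2
    rw [II, qq_smul, qq]; ring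
  have hJpos : 0 < Jh M Z Z := by
    refine lt_of_le_of_ne (Jd_nonneg hM0 Z) fun h0 => ?_
    have h3 : ∀ t : ℝ, 0 ≤ t → t ^ 2 * c / 2 ≤ m := fun t ht => by
      have h1 := (hJ t).const_sub (t ^ 2 * c / 2)
      rw [D.Jd_zero hM0 hZ h0.symm ht, sub_zero] at h1
      refine le_of_tendsto_of_tendsto' h1 hIk fun n => ?_
      refine le_trans ?_ (D.Neh_max hM0 (hW (k n)) ht)
      rw [II, qq_smul]
      nlinarith [mul_le_mul_of_nonneg_left (hcl _ (hW (k n))) (sq_nonneg t)]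
    have hm0 : 0 ≤ m := by have := h3 0 le_rfl; simpa using this
    have := h3 √(2 * (m + 1) / c) (Real.sqrt_nonneg _)
    rw [Real.sq_sqrt (by positivity)] at this
    field_simp at this
    linarith
  obtain ⟨t, ht, hN⟩ := D.fiber hε hb hM0 hZ hJpos
  exact ⟨_, hN, fun V hV => (key t ht.le).trans (csInf_le hSb ⟨V, hV, rfl⟩)⟩

lemma Dom.crit_le (D : Dom Ω) (hM0 : 0 ≤ M) {U : HH Ω} (hU : U ∈ Neh Ω ε b M)
    (hmin : ∀ V ∈ Neh Ω ε b M, II ε b M U ≤ II ε b M V) {Φ : HH Ω} (hΦ : Φ ∈ H1 Ω) : Jh M U Φ ≤ BB ε b U Φ := by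
  have hUH := hU.1
  have hmem : ∀ t s : ℝ, t • U + s • Φ ∈ H1 Ω := fun t s => (H1 Ω).add_mem ((H1 Ω).smul_mem _ hUH) ((H1 Ω).smul_mem _ hΦ)
  have hq := hU.2.1
  have step : ∀ e : ℝ, 0 < e → e < 1 → ∃ t s : ℝ, |t - 1| ≤ e ∧ 0 < s ∧ s ≤ e ∧ 0 ≤ t * BB ε b U Φ + t * s * qq ε b Φ / 2 - Jh M (t • U) Φ := by
    intro e he he1
    have hcont : ∀ t : ℝ, Continuous fun s : ℝ => Jh M (t • U + (t * s) • Φ) (t • U + (t * s) • Φ) - t ^ 2 * (qq ε b U + 2 * s * BB ε b U Φ + s ^ 2 * qq ε b Φ) := fun t => by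
      have := (D.Jd_cont hM0 hUH hΦ).comp (by fun_prop : Continuous fun s : ℝ => (t, t * s))
      exact this.sub (by fun_prop)
    have p1 : (0:ℝ) < Jh M ((1 + e) • U + ((1 + e) * 0) • Φ) ((1 + e) • U + ((1 + e) * 0) • Φ) - (1 + e) ^ 2 * (qq ε b U + 2 * 0 * BB ε b U Φ + 0 ^ 2 * qq ε b Φ) := by
      have := D.Jd_up hM0 hUH (by linarith : (1:ℝ) ≤ 1 + e)
      simp only [mul_zero, zero_smul, add_zero, zero_mul]
      rw [← hU.2.2] at this
      have h2 : 0 < (1 + e) ^ 2 * e * qq ε b U := by positivity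
      nlinarith
    have p2 : Jh M ((1 - e) • U + ((1 - e) * 0) • Φ) ((1 - e) • U + ((1 - e) * 0) • Φ) - (1 - e) ^ 2 * (qq ε b U + 2 * 0 * BB ε b U Φ + 0 ^ 2 * qq ε b Φ) < 0 := by
      have := D.Jd_down hM0 hUH (by linarith : (0:ℝ) ≤ 1 - e) (by linarith)
      simp only [mul_zero, zero_smul, add_zero, zero_mul]
      rw [← hU.2.2] at this
      have h3 : 0 < 1 - e := by linarith
      have h2 : 0 < (1 - e) ^ 2 * e * qq ε b U := by positivity
      nlinarith
    have p3 : (0:ℝ) < qq ε b U + 2 * 0 * BB ε b U Φ + 0 ^ 2 * qq ε b Φ := by simpa using hq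
    have ev1 := (hcont (1 + e)).continuousAt.eventually_const_lt p1
    have ev2 := (hcont (1 - e)).continuousAt.eventually_lt_const p2
    have ev3 := (by fun_prop : Continuous fun s : ℝ => qq ε b U + 2 * s * BB ε b U Φ + s ^ 2 * qq ε b Φ).continuousAt.eventually_const_lt p3
    have ev4 : ∀ᶠ s in 𝓝[>] (0:ℝ), 0 < s ∧ s < e := by
      filter_upwards [self_mem_nhdsWithin, Ioo_mem_nhdsGT he] with s h1 h2 using ⟨h1, h2.2⟩
    obtain ⟨s, ⟨⟨h1, h2⟩, h3⟩, hs0, hse⟩ := (((ev1.and ev2).and ev3).filter_mono nhdsWithin_le_nhds |>.and ev4).exists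
    have hqW : ∀ t : ℝ, qq ε b (t • U + (t * s) • Φ) = t ^ 2 * (qq ε b U + 2 * s * BB ε b U Φ + s ^ 2 * qq ε b Φ) := fun t => by
      rw [qq_add, qq_smul, qq_smul, BB_smul_left, BB_smul_right]; ring
    have hc : Continuous fun t : ℝ => Jh M (t • U + (t * s) • Φ) (t • U + (t * s) • Φ) - t ^ 2 * (qq ε b U + 2 * s * BB ε b U Φ + s ^ 2 * qq ε b Φ) := by
      have := (D.Jd_cont hM0 hUH hΦ).comp (by fun_prop : Continuous fun t : ℝ => (t, t * s))
      exact this.sub (by fun_prop)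
    obtain ⟨t, ht, hz⟩ := intermediate_value_Icc (by linarith : 1 - e ≤ 1 + e) hc.continuousOn (show (0:ℝ) ∈ _ from ⟨h2.le, h1.le⟩)
    have htp : 0 < t := by linarith [ht.1]
    have hN : t • U + (t * s) • Φ ∈ Neh Ω ε b M := by
      refine ⟨hmem _ _, ?_, ?_⟩
      · rw [hqW]; positivity
      · rw [hqW]; simp only at hz; linarith
    have i1 := hmin _ hN
    have i2 := D.Neh_max hM0 hU htp.le
    have i3 := D.JH_convex hM0 ((H1 Ω).smul_mem t hUH) (hmem t (t * s))
    rw [add_sub_cancel_left, Jh_smul] at i3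
    simp only [II, hqW] at i1
    simp only [II, qq_smul] at i2
    refine ⟨t, s, abs_le.2 ⟨by linarith [ht.1], by linarith [ht.2]⟩, hs0, hse.le, ?_⟩
    have hts : 0 < t * s := by positivity
    have : 0 ≤ (t * s) * (t * BB ε b U Φ + t * s * qq ε b Φ / 2 - Jh M (t • U) Φ) := by nlinarith
    exact nonneg_of_mul_nonneg_right this hts
  choose t s h1 h2 h3 h4 using fun n : ℕ => step (1 / ((n:ℝ) + 2)) (by positivity) (by rw [div_lt_one (by positivity)]; linarith [(Nat.cast_nonneg n : (0:ℝ) ≤ n)])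
  have h0 : Tendsto (fun n : ℕ => 1 / ((n:ℝ) + 2)) atTop (𝓝 0) := by
    have := (tendsto_one_div_add_atTop_nhds_zero_nat (𝕜 := ℝ)).comp (tendsto_add_atTop_nat 1)
    refine this.congr fun n => ?_
    simp [Function.comp_def]; ring
  have ht : Tendsto t atTop (𝓝 1) := by
    rw [tendsto_iff_norm_sub_tendsto_zero]
    exact squeeze_zero (fun n => norm_nonneg _) (fun n => h1 n) h0
  have hs : Tendsto s atTop (𝓝 0) := squeeze_zero (fun n => (h2 n).le) h3 h0
  have hJ : Tendsto (fun n => Jh M (t n • U) Φ) atTop (𝓝 (Jh M U Φ)) := by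
    have h5 := ((D.Jh_cont1 hM0 hUH Φ).tendsto 1).comp ht
    rw [one_smul] at h5; exact h5
  have := ge_of_tendsto' (((ht.mul_const (BB ε b U Φ)).add (((ht.mul hs).mul_const (qq ε b Φ)).div_const 2)).sub hJ) h4
  simp at this; linarith

lemma Dom.crit (D : Dom Ω) (hM0 : 0 ≤ M) {U : HH Ω} (hU : U ∈ Neh Ω ε b M)
    (hmin : ∀ V ∈ Neh Ω ε b M, II ε b M U ≤ II ε b M V) {Φ : HH Ω} (hΦ : Φ ∈ H1 Ω) : BB ε b U Φ = Jh M U Φ := by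
  have h1 := D.crit_le hM0 hU hmin hΦ
  have h2 := D.crit_le hM0 hU hmin ((H1 Ω).smul_mem (-1:ℝ) hΦ)
  rw [Jh_smul, BB_smul_right] at h2
  linarith

end NehSec


noncomputable section LevelSec

variable {Ω : Set E2} {ε b M : ℝ}

def bmp : ContDiffBump (0 : E2) := ⟨1/2, 1, by norm_num, by norm_num⟩

lemma vol_cb (x : E2) {s : ℝ} (hs : 0 ≤ s) : volume.real (Metric.closedBall x s) = s ^ 2 * Real.pi := by
  rw [measureReal_def, EuclideanSpace.volume_closedBall_fin_two, ENNReal.toReal_mul, ENNReal.toReal_pow, ENNReal.toReal_ofReal hs]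
  simp [Real.pi_pos.le]

lemma int_le_ball (hb : IsBounded Ω) (x : E2) {s c : ℝ} (hs : 0 ≤ s) (hc : 0 ≤ c) {f : E2 → ℝ} (h0 : ∀ x, 0 ≤ f x)
    (h1 : ∀ x, f x ≤ c) (h2 : ∀ y, y ∉ Metric.closedBall x s → f y = 0) : ∫ y in Ω, f y ≤ c * (s ^ 2 * Real.pi) := by
  haveI := fin_meas hb
  have hi : Integrable ((Metric.closedBall x s).indicator fun _ => c) (mu Ω) :=
    (integrable_const c).indicator Metric.isClosed_closedBall.measurableSet
  have : ∫ y in Ω, f y ≤ ∫ y in Ω, (Metric.closedBall x s).indicator (fun _ => c) y := by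
    refine integral_mono_of_nonneg (Eventually.of_forall h0) hi (Eventually.of_forall fun y => ?_)
    by_cases hy : y ∈ Metric.closedBall x s
    · simp only [Set.indicator_of_mem hy]; exact h1 y
    · simp only [Set.indicator_of_notMem hy]; exact (h2 y hy).le
  refine this.trans ?_
  rw [integral_indicator_const _ Metric.isClosed_closedBall.measurableSet, smul_eq_mul, mul_comm]
  refine mul_le_mul_of_nonneg_left ?_ hc
  rw [← vol_cb x hs, measureReal_def, measureReal_def]
  exact ENNReal.toReal_mono measure_closedBall_lt_top.ne (Measure.restrict_apply_le _ _)

lemma bmp_grad : ∃ C : ℝ, 0 ≤ C ∧ ∀ x, ‖fderiv ℝ bmp x‖ ≤ C := by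
  have hc : HasCompactSupport (fderiv ℝ bmp) := (bmp.hasCompactSupport).fderiv ℝ
  obtain ⟨C, hC⟩ := hc.exists_bound_of_continuous ((bmp.contDiff (n := 1)).continuous_fderiv (by norm_num))
  exact ⟨C, (norm_nonneg _).trans (hC 0), hC⟩

lemma Dom.level (D : Dom Ω) (hb : 0 < b) (hne : Ω.Nonempty) : ∃ C0 ε1 : ℝ, 0 < C0 ∧ 0 < ε1 ∧ ∀ ε, 0 < ε → ε < ε1 → ∀ M, 0 ≤ M →
    ∃ U ∈ H1 Ω, (∀ Φ ∈ H1 Ω, BB ε b U Φ = Jh M U Φ) ∧ 0 < qq ε b U ∧ qq ε b U ≤ C0 * ε := by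
  obtain ⟨x0, hx0⟩ := hne
  obtain ⟨r, hr, hball⟩ := Metric.isOpen_iff.1 D.o x0 hx0
  obtain ⟨C, hC0, hC⟩ := bmp_grad
  set a1 : ℝ := (C ^ 2 + b) * Real.pi with ha1
  have hpi := Real.pi_pos
  have ha1p : 0 < a1 := by positivity
  refine ⟨6 * ((12 * a1 / Real.pi) ^ 2 * a1 / 2), r ^ 2, by positivity, by positivity, fun ε hε hε1 M hM0 => ?_⟩
  haveI := fin_meas D.b
  set s := √ε
  have hs : 0 < s := Real.sqrt_pos.2 hε
  have hs2 : s ^ 2 = ε := Real.sq_sqrt hε.le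
  have hsr : s < r := by rw [← Real.sqrt_sq hr.le]; exact Real.sqrt_lt_sqrt hε.le hε1
  set ζ : E2 → ℝ := fun x => bmp (s⁻¹ • (x - x0)) with hζ
  have hζ1 : ContDiff ℝ 1 ζ := bmp.contDiff.comp (by fun_prop)
  have hgrad : ∀ x, ‖gradient ζ x‖ = ‖fderiv ℝ bmp (s⁻¹ • (x - x0))‖ * s⁻¹ := fun x => by
    have h1 : HasFDerivAt (fun x : E2 => s⁻¹ • (x - x0)) (s⁻¹ • ContinuousLinearMap.id ℝ E2) x :=
      ((hasFDerivAt_id x).sub_const x0).const_smul s⁻¹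
    have h2 := (((bmp.contDiff (n := 1)).differentiable (by norm_num)) (s⁻¹ • (x - x0))).hasFDerivAt.comp x h1
    have h3 : fderiv ℝ ζ x = s⁻¹ • fderiv ℝ bmp (s⁻¹ • (x - x0)) := by
      refine h2.fderiv.trans ?_
      ext v; simp
    rw [gradient, LinearIsometryEquiv.norm_map, h3, norm_smul, Real.norm_eq_abs, abs_of_pos (inv_pos.2 hs), mul_comm]
  have hsc : ∀ x, x ∉ Metric.closedBall x0 s → s⁻¹ • (x - x0) ∉ Metric.closedBall (0:E2) 1 := fun x hx => by
    rw [Metric.mem_closedBall, dist_eq_norm, not_le] at *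
    rw [sub_zero, norm_smul, Real.norm_eq_abs, abs_of_pos (inv_pos.2 hs), lt_inv_mul_iff₀ hs]; simpa using hx
  have hts : tsupport bmp = Metric.closedBall (0:E2) 1 := bmp.tsupport_eq
  obtain ⟨V, hV⟩ := exists_rep D.b hζ1
  have hA : qq ε b V ≤ a1 * ε := by
    have e1 : ‖V.snd‖ ^ 2 ≤ (C * s⁻¹) ^ 2 * (s ^ 2 * Real.pi) := by
      rw [Lp_norm_sq]
      have : ∫ x in Ω, ‖V.snd x‖ ^ 2 = ∫ x in Ω, ‖gradient ζ x‖ ^ 2 := integral_congr_ae (hV.hG.mono fun x hx => by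
        have hx : V.snd x = gradient ζ x := hx
        simp only [hx])
      rw [this]
      refine int_le_ball D.b x0 hs.le (by positivity) (fun x => by positivity) (fun x => ?_) (fun x hx => ?_)
      · rw [hgrad]; gcongr; exact hC _
      · have : fderiv ℝ bmp (s⁻¹ • (x - x0)) = 0 := by
          by_contra h
          exact hsc x hx (hts ▸ support_fderiv_subset ℝ h)
        rw [hgrad, this]; simp
    have e2 : ‖V.fst‖ ^ 2 ≤ 1 * (s ^ 2 * Real.pi) := by
      rw [Lp_norm_sq]
      have : ∫ x in Ω, ‖V.fst x‖ ^ 2 = ∫ x in Ω, ‖ζ x‖ ^ 2 := integral_congr_ae (hV.hu.mono fun x hx => by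
        have hx : V.fst x = ζ x := hx
        simp only [hx])
      rw [this]
      refine int_le_ball D.b x0 hs.le (by positivity) (fun x => by positivity) (fun x => ?_) (fun x hx => ?_)
      · rw [Real.norm_eq_abs, abs_of_nonneg bmp.nonneg]
        exact pow_le_one₀ bmp.nonneg bmp.le_one
      · have : ζ x = 0 := by
          by_contra h
          exact hsc x hx (hts ▸ subset_tsupport _ h)
        rw [this]; simp
    rw [qq_eq]
    calc _ ≤ ε * ((C * s⁻¹) ^ 2 * (s ^ 2 * Real.pi)) + b * (1 * (s ^ 2 * Real.pi)) := by gcongr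
      _ = a1 * ε := by
        rw [mul_pow, inv_pow, hs2, ha1]; field_simp
  have hB : ∀ t : ℝ, 0 ≤ t → t ^ 3 * Real.pi * ε / 24 ≤ JH M (t • V) := fun t ht => by
    have hm : MeasurableSet (Metric.closedBall x0 (s / 2)) := Metric.isClosed_closedBall.measurableSet
    have e1 : ∫ y in Ω, (Metric.closedBall x0 (s / 2)).indicator (fun _ => t ^ 3 / 6) y ≤ JH M (t • V) := by
      refine integral_mono_ae ((integrable_const _).indicator hm) (D.JH_int hM0 ((H1 Ω).smul_mem t hV.mem)) ?_
      filter_upwards [uu_smul t V, hV.hu] with y h1 h2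
      by_cases hy : y ∈ Metric.closedBall x0 (s / 2)
      · rw [Set.indicator_of_mem hy, h1, h2]
        have : ζ y = 1 := by
          refine bmp.one_of_mem_closedBall ?_
          rw [Metric.mem_closedBall, dist_eq_norm] at *
          rw [sub_zero, norm_smul, Real.norm_eq_abs, abs_of_pos (inv_pos.2 hs), inv_mul_le_iff₀ hs]
          show _ ≤ s * (1/2); linarith
        have h3 := HM_ge hM0 (t * ζ y)
        rw [this, mul_one, max_eq_left ht] at h3
        rw [this, mul_one]; exact h3
      · rw [Set.indicator_of_notMem hy]; exact HM_nonneg hM0 _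
    rw [integral_indicator_const _ hm, smul_eq_mul, measureReal_restrict_apply hm, Set.inter_eq_left.2, vol_cb x0 (by positivity), div_pow, hs2] at e1
    · linarith
    · exact (Metric.closedBall_subset_ball (by linarith)).trans hball
  have hJ : 0 < Jh M V V := by
    have h1 := hB 1 (by norm_num)
    rw [one_smul] at h1
    have h2 := D.JH_AR hM0 hV.mem
    have : 0 < 1 ^ 3 * Real.pi * ε / 24 := by positivity
    linarith
  obtain ⟨t, ht, htN⟩ := D.fiber hε hb hM0 hV.mem hJ
  obtain ⟨U, hU, hmin⟩ := D.minimizer hε hb hM0 ⟨_, htN⟩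
  refine ⟨U, hU.1, fun Φ hΦ => D.crit hM0 hU hmin hΦ, hU.2.1, ?_⟩
  have h1 := hmin _ htN
  have h2 := D.Neh_AR hM0 hU
  have h3 : II ε b M (t • V) ≤ (12 * a1 / Real.pi) ^ 2 * a1 / 2 * ε := by
    rw [II, qq_smul]
    have h4 := hB t ht.le
    have h5 : t ^ 2 * qq ε b V ≤ t ^ 2 * (a1 * ε) := by gcongr
    have h6 : t ^ 2 * a1 / 2 - t ^ 3 * Real.pi / 24 ≤ (12 * a1 / Real.pi) ^ 2 * a1 / 2 := by
      rcases le_total t (12 * a1 / Real.pi) with h | h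
      · have : t ^ 2 ≤ (12 * a1 / Real.pi) ^ 2 := by gcongr
        have h7 : 0 ≤ t ^ 3 * Real.pi / 24 := by positivity
        nlinarith
      · rw [div_le_iff₀ hpi] at h
        have h7 : 0 ≤ (12 * a1 / Real.pi) ^ 2 * a1 / 2 := by positivity
        nlinarith [mul_le_mul_of_nonneg_left h (sq_nonneg t)]
    nlinarith [mul_le_mul_of_nonneg_right h6 hε.le]
  nlinarith

/-- the weak solution is nonnegative -/
lemma Dom.nonneg (D : Dom Ω) (hε : 0 < ε) (hb : 0 < b) (hM0 : 0 ≤ M) {U : HH Ω} (hU : U ∈ H1 Ω) (hw : ∀ Φ ∈ H1 Ω, BB ε b U Φ = Jh M U Φ) :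
    ∀ᵐ x ∂mu Ω, 0 ≤ uu U x := by
  haveI := fin_meas D.b
  obtain ⟨V, φ, hV, hVt⟩ := H1_approx hU
  set δ : ℕ → ℝ := fun n => 1 / ((n:ℝ) + 1)
  have hδ : ∀ n, 0 < δ n := fun n => by positivity
  have hpos : ∀ n x, 0 < φ n x ^ 2 + δ n ^ 2 := fun n x => by have := hδ n; positivity
  set ψ : ℕ → E2 → ℝ := fun n x => √(φ n x ^ 2 + δ n ^ 2) with hψ
  have hψp : ∀ n x, 0 < ψ n x := fun n x => Real.sqrt_pos.2 (hpos n x)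
  have hψsq : ∀ n x, ψ n x ^ 2 = φ n x ^ 2 + δ n ^ 2 := fun n x => Real.sq_sqrt (hpos n x).le
  have hψ1 : ∀ n, ContDiff ℝ 1 (ψ n) := fun n => (((hV n).c1.pow 2).add contDiff_const).sqrt fun x => (hpos n x).ne'
  have hgr : ∀ n x, ‖gradient (ψ n) x‖ ≤ ‖gradient (φ n) x‖ := fun n x => by
    have h1 := gradient_mul' (hψ1 n) (hψ1 n) x
    have h2 : (fun x => ψ n x * ψ n x) = fun x => φ n x * φ n x + δ n ^ 2 := by
      ext y; rw [← sq, hψsq, sq (φ n y)]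
    rw [h2, gradient_add' ((hV n).c1.mul (hV n).c1) contDiff_const, gradient_mul' (hV n).c1 (hV n).c1] at h1
    have h3 : gradient (fun _ : E2 => δ n ^ 2) x = 0 := by simp [gradient]
    rw [h3, add_zero, ← two_smul ℝ, ← two_smul ℝ] at h1
    have h4 : φ n x • gradient (φ n) x = ψ n x • gradient (ψ n) x := smul_right_injective _ (two_ne_zero (α := ℝ)) h1
    have h5 := congrArg norm h4
    rw [norm_smul, norm_smul, Real.norm_eq_abs, Real.norm_eq_abs, abs_of_pos (hψp n x)] at h5
    have h6 : |φ n x| ≤ ψ n x := by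
      rw [← Real.sqrt_sq_eq_abs]; exact Real.sqrt_le_sqrt (by nlinarith [sq_nonneg (δ n)])
    have := mul_le_mul_of_nonneg_right h6 (norm_nonneg (gradient (φ n) x))
    rw [h5] at this
    exact le_of_mul_le_mul_left this (hψp n x)
  choose P hP using fun n => exists_rep D.b (hψ1 n)
  have hqP : ∀ n, qq ε b (P n) ≤ qq ε b (V n) + b * (δ n ^ 2 * (mu Ω).real Set.univ) := fun n => by
    have e1 : ‖(P n).snd‖ ^ 2 ≤ ‖(V n).snd‖ ^ 2 := by
      rw [Lp_norm_sq, Lp_norm_sq]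
      refine integral_mono_ae ((GG_memLp (P n)).integrable_norm_pow (by norm_num)) ((GG_memLp (V n)).integrable_norm_pow (by norm_num)) ?_
      filter_upwards [(hP n).hG, (hV n).hG] with x h1 h2
      have h1 : (P n).snd x = gradient (ψ n) x := h1
      have h2 : (V n).snd x = gradient (φ n) x := h2
      simp only [h1, h2]
      have := hgr n x
      gcongr
    have e2 : ‖(P n).fst‖ ^ 2 = ‖(V n).fst‖ ^ 2 + δ n ^ 2 * (mu Ω).real Set.univ := by
      rw [Lp_norm_sq, Lp_norm_sq]
      have : ∫ x in Ω, δ n ^ 2 = δ n ^ 2 * (mu Ω).real Set.univ := by rw [integral_const, smul_eq_mul, mul_comm]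
      rw [← this, ← integral_add (show Integrable (fun x => ‖(V n).fst x‖ ^ 2) (mu Ω) from (uu_memLp (V n)).integrable_norm_pow (by norm_num)) (integrable_const _)]
      refine integral_congr_ae ?_
      filter_upwards [(hP n).hu, (hV n).hu] with x h1 h2
      have h1 : (P n).fst x = ψ n x := h1
      have h2 : (V n).fst x = φ n x := h2
      simp only [h1, h2, Real.norm_eq_abs, sq_abs]
      exact hψsq n x
    rw [qq_eq, qq_eq, e2]
    nlinarith [mul_le_mul_of_nonneg_left e1 hε.le]
  have hQ : ∀ W ∈ H1 Ω, qq ε b (W + (-1:ℝ) • U) = qq ε b W - 2 * Jh M U W + qq ε b U := fun W hW => by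
    rw [qq_add, BB_smul_right, qq_smul, BB_symm, hw W hW]; ring
  have hcmp : ∀ n, qq ε b (P n + (-1:ℝ) • U) ≤ qq ε b (V n + (-1:ℝ) • U) + b * (δ n ^ 2 * (mu Ω).real Set.univ) := fun n => by
    rw [hQ _ (hP n).mem, hQ _ (hV n).mem]
    have : Jh M U (V n) ≤ Jh M U (P n) := by
      refine integral_mono_ae (D.Jh_int hM0 hU _) (D.Jh_int hM0 hU _) ?_
      filter_upwards [(hP n).hu, (hV n).hu] with x h1 h2
      rw [h1, h2]
      refine mul_le_mul_of_nonneg_left ?_ (hM_nonneg hM0 _)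
      refine (le_abs_self _).trans ?_
      rw [← Real.sqrt_sq_eq_abs]; exact Real.sqrt_le_sqrt (by nlinarith [sq_nonneg (δ n)])
    linarith [hqP n]
  have hlim : Tendsto (fun n => qq ε b (V n + (-1:ℝ) • U) + b * (δ n ^ 2 * (mu Ω).real Set.univ)) atTop (𝓝 0) := by
    have hd : Tendsto δ atTop (𝓝 0) := tendsto_one_div_add_atTop_nhds_zero_nat
    have h1 : Tendsto (fun n => V n + (-1:ℝ) • U) atTop (𝓝 0) := by
      have := hVt.add_const ((-1:ℝ) • U)
      simpa using this
    have h2 : Tendsto (fun n => qq ε b (V n + (-1:ℝ) • U)) atTop (𝓝 0) := by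
      have hup : ∀ W : HH Ω, qq ε b W ≤ (ε + b) * ‖W‖ ^ 2 := fun W => by
        rw [qq_eq, HH_norm_sq]; nlinarith [mul_nonneg hε.le (sq_nonneg ‖W.fst‖), mul_nonneg hb.le (sq_nonneg ‖W.snd‖)]
      refine squeeze_zero (fun n => qq_nonneg hε hb _) (fun n => hup _) ?_
      have := (h1.norm.pow 2).const_mul (ε + b)
      simpa using this
    have h3 := ((hd.pow 2).mul_const ((mu Ω).real Set.univ)).const_mul b
    simpa using h2.add h3
  have hneg : ∫ x in Ω, max (-uu U x) 0 ^ 2 ≤ 0 := by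
    have hlim2 := hlim.const_mul b⁻¹
    rw [mul_zero] at hlim2
    refine ge_of_tendsto' hlim2 fun n => ?_
    have h1 : b * ‖(P n + (-1:ℝ) • U).fst‖ ^ 2 ≤ qq ε b (P n + (-1:ℝ) • U) := by
      rw [qq_eq]; nlinarith [mul_nonneg hε.le (sq_nonneg ‖(P n + (-1:ℝ) • U).snd‖)]
    have h2 : ∫ x in Ω, max (-uu U x) 0 ^ 2 ≤ ‖(P n + (-1:ℝ) • U).fst‖ ^ 2 := by
      rw [Lp_norm_sq]
      refine integral_mono_of_nonneg (Eventually.of_forall fun x => by positivity) ((uu_memLp (P n + (-1:ℝ) • U)).integrable_norm_pow (by norm_num)) ?_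
      filter_upwards [(hP n).hu, uu_add (P n) ((-1:ℝ) • U), uu_smul (-1) U] with x g1 g2 g3
      have g4 : (P n + (-1:ℝ) • U).fst x = ψ n x - uu U x := by
        refine Eq.trans (show _ = uu (P n + (-1:ℝ) • U) x from rfl) ?_
        rw [g2, g1, g3]; ring
      simp only [g4, Real.norm_eq_abs, sq_abs]
      have := hψp n x
      rcases le_total (-uu U x) 0 with h | h
      · rw [max_eq_right h, zero_pow two_ne_zero]; positivity
      · rw [max_eq_left h]; nlinarith
    rw [← mul_comm, ← div_eq_mul_inv, le_div_iff₀ hb]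
    nlinarith [hcmp n]
  have hitg : Integrable (fun x => max (-uu U x) 0 ^ 2) (mu Ω) := by
    refine ((uu_memLp U).integrable_norm_pow (by norm_num : (2:ℕ) ≠ 0)).mono' ?_ (Eventually.of_forall fun x => ?_)
    · exact (((uu_sm U).measurable.neg.max measurable_const).pow_const 2).aestronglyMeasurable
    · rw [Real.norm_eq_abs, abs_of_nonneg (by positivity), Real.norm_eq_abs, sq_abs]
      rcases le_total (-uu U x) 0 with h | h
      · rw [max_eq_right h, zero_pow two_ne_zero]; positivity
      · rw [max_eq_left h]; nlinarith
  have hz := le_antisymm hneg (integral_nonneg fun x => by positivity)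
  rw [integral_eq_zero_iff_of_nonneg (fun x => by positivity) hitg] at hz
  filter_upwards [hz] with x hx
  have : max (-uu U x) 0 = 0 := by simpa using hx
  linarith [max_eq_right_iff.1 this]

end LevelSec


noncomputable section RegSec

variable {Ω : Set E2} {x0 : E2}

lemma lincomb3 {c1 c2 c3 C a v w q : ℝ} (h1 : 0 ≤ c1) (h2 : 0 ≤ c2) (h3 : 0 ≤ c3) (h : c1 + c2 + c3 ≤ C) (ha : 0 ≤ a) (hv : 0 ≤ v)
    (hw : 0 ≤ w) (hq : 0 ≤ q) : (c1 * a + c2 * v + c3 * w) * q ≤ (C * a + C * v + C * w) * q := by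
  have e1 : c1 * a ≤ C * a := mul_le_mul_of_nonneg_right (by linarith) ha
  have e2 : c2 * v ≤ C * v := mul_le_mul_of_nonneg_right (by linarith) hv
  have e3 : c3 * w ≤ C * w := mul_le_mul_of_nonneg_right (by linarith) hw
  exact mul_le_mul_of_nonneg_right (by linarith) hq

namespace Patch
variable (P : Patch Ω x0)

/-- admissible pair of points -/
structure Adm (x y : E2) : Prop where
  hx : x ∈ Ω
  hxt : x ∈ tsupport P.η
  hy : y ∈ closure Ω
  hyb : y ∈ Metric.ball x0 P.r
  ne : x ≠ y

lemma geo : ∃ R : ℝ, 1 ≤ R ∧ ∀ x y, P.Adm x y → 0 < ‖x - y‖ ∧ 0 < ‖P.S x - y‖ ∧ ‖x - y‖ ≤ R ∧ ‖P.S x - y‖ ≤ R ∧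
    ‖P.S x - y‖⁻¹ ≤ P.L * ‖x - y‖⁻¹ ∧ ‖P.S x - y‖ ^ (-(3/2) : ℝ) ≤ P.L ^ (3/2 : ℝ) * ‖x - y‖ ^ (-(3/2) : ℝ) ∧
    ‖x - y‖⁻¹ ≤ R * ‖x - y‖ ^ (-(3/2) : ℝ) ∧ ‖x - y‖ ≤ P.L * ‖P.S x - y‖ := by
  obtain ⟨M1, hM1⟩ := P.hηc.isCompact.exists_bound_of_continuousOn (f := fun x : E2 => x) continuous_id.continuousOn
  obtain ⟨M2, hM2⟩ := P.hηc.isCompact.exists_bound_of_continuousOn (f := P.S) P.hS1.continuous.continuousOn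
  refine ⟨max 1 (max (M1 + (‖x0‖ + P.r)) (M2 + (‖x0‖ + P.r))), le_max_left _ _, fun x y h => ?_⟩
  set R := max 1 (max (M1 + (‖x0‖ + P.r)) (M2 + (‖x0‖ + P.r))) with hR
  have h1R : 1 ≤ R := le_max_left _ _
  have ht : 0 < ‖x - y‖ := norm_pos_iff.2 (sub_ne_zero.2 h.ne)
  have hL := P.hL x h.hx h.hxt y h.hy h.hyb
  have hs : 0 < ‖P.S x - y‖ := pos_of_mul_pos_right (ht.trans_le hL) P.hL0.le
  have hyn : ‖y‖ ≤ ‖x0‖ + P.r := by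
    have h2 := h.hyb
    rw [Metric.mem_ball, dist_eq_norm] at h2
    have : y = x0 + (y - x0) := by abel
    calc ‖y‖ = ‖x0 + (y - x0)‖ := by rw [← this]
      _ ≤ _ := (norm_add_le _ _).trans (by linarith)
  have htR : ‖x - y‖ ≤ R := (norm_sub_le _ _).trans
    ((add_le_add (hM1 x h.hxt) hyn).trans ((le_max_left _ _).trans (le_max_right _ _)))
  have hsR : ‖P.S x - y‖ ≤ R := (norm_sub_le _ _).trans
    ((add_le_add (hM2 x h.hxt) hyn).trans ((le_max_right _ _).trans (le_max_right _ _)))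
  refine ⟨ht, hs, htR, hsR, ?_, P.inv_S (by norm_num) h.hx h.hxt h.hy h.hyb h.ne, ?_, hL⟩
  · have := P.inv_S (s := 1) (by norm_num) h.hx h.hxt h.hy h.hyb h.ne
    rwa [Real.rpow_one, Real.rpow_neg_one, Real.rpow_neg_one] at this
  · have e : ‖x - y‖⁻¹ = ‖x - y‖ ^ (1/2 : ℝ) * ‖x - y‖ ^ (-(3/2) : ℝ) := by
      rw [← Real.rpow_add ht, ← Real.rpow_neg_one]; norm_num
    rw [e]
    gcongr
    calc ‖x - y‖ ^ (1/2 : ℝ) ≤ R ^ (1/2 : ℝ) := by gcongr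
      _ ≤ R ^ (1:ℝ) := Real.rpow_le_rpow_of_exponent_le h1R (by norm_num)
      _ = R := Real.rpow_one _

/-- kernel of the representation -/
def Fk (d : ℝ) (y x : E2) (a : ℝ) (v w : E2) : ℝ :=
  a * (Lg d (x - y) + P.σ * Lg d (P.S x - y)) - P.σ * ⟪v, Cm (fderiv ℝ P.S x) (pk d (P.S x - y))⟫
    - ⟪w, Xf P.σ P.S d y x⟫

/-- its `y` derivative -/
def Fd (d : ℝ) (y x : E2) (a : ℝ) (v w : E2) : E2 →L[ℝ] ℝ :=
  -(a • innerSL ℝ (pk d (x - y) + P.σ • pk d (P.S x - y)))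
    + P.σ • (innerSL ℝ v).comp ((Cm (fderiv ℝ P.S x)).comp (Dpk d (P.S x - y)))
    + (innerSL ℝ w).comp (Dpk d (x - y) + P.σ • (tf (fderiv ℝ P.S x)).comp (Dpk d (P.S x - y)))

lemma Fk_hasFDerivAt {d : ℝ} (hd : 0 < d) (y x : E2) (a : ℝ) (v w : E2) :
    HasFDerivAt (fun y => P.Fk d y x a v w) (P.Fd d y x a v w) y := by
  have h0 : ∀ z : E2, HasFDerivAt (fun y : E2 => z - y) (-ContinuousLinearMap.id ℝ E2) y := fun z =>
    (hasFDerivAt_id y).const_sub z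
  have hl : ∀ z : E2, HasFDerivAt (fun y : E2 => Lg d (z - y)) ((innerSL ℝ (pk d (z - y))).comp (-ContinuousLinearMap.id ℝ E2)) y :=
    fun z => HasFDerivAt.comp (g := Lg d) (f := fun y => z - y) y (Lg_hasFDerivAt hd (z - y)) (h0 z)
  have hp : ∀ z : E2, HasFDerivAt (fun y : E2 => pk d (z - y)) ((Dpk d (z - y)).comp (-ContinuousLinearMap.id ℝ E2)) y :=
    fun z => HasFDerivAt.comp (g := pk d) (f := fun y => z - y) y (pk_hasFDerivAt hd (z - y)) (h0 z)
  have hc : ∀ (T : E2 →L[ℝ] E2) (u : E2), HasFDerivAt (fun y : E2 => ⟪u, T (pk d (P.S x - y))⟫)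
      (((innerSL ℝ u).comp T).comp ((Dpk d (P.S x - y)).comp (-ContinuousLinearMap.id ℝ E2))) y :=
    fun T u => ((innerSL ℝ u).comp T).hasFDerivAt.comp y (hp (P.S x))
  have hc1 : HasFDerivAt (fun y : E2 => ⟪w, pk d (x - y)⟫)
      ((innerSL ℝ w).comp ((Dpk d (x - y)).comp (-ContinuousLinearMap.id ℝ E2))) y :=
    (innerSL ℝ w).hasFDerivAt.comp y (hp x)
  have h := ((((hl x).add ((hl (P.S x)).const_mul P.σ)).const_mul a).sub ((hc (Cm (fderiv ℝ P.S x)) v).const_mul P.σ)).sub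
    (hc1.add ((hc (tf (fderiv ℝ P.S x)) w).const_mul P.σ))
  have e : (fun y => P.Fk d y x a v w) = fun y => a * (Lg d (x - y) + P.σ * Lg d (P.S x - y)) - P.σ * ⟪v, Cm (fderiv ℝ P.S x) (pk d (P.S x - y))⟫
    - (⟪w, pk d (x - y)⟫ + P.σ * ⟪w, tf (fderiv ℝ P.S x) (pk d (P.S x - y))⟫) := by
    funext y
    rw [Fk, Xf, inner_add_right, inner_smul_right]
  rw [e]
  refine h.congr_fderiv ?_
  ext z
  simp [Fd, inner_add_right, inner_add_left, inner_smul_left, inner_smul_right]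
  ring

lemma Fd_bound : ∃ C : ℝ, 0 ≤ C ∧ ∀ x y, P.Adm x y → ∀ a v w, (w ≠ 0 → P.r ≤ ‖x - y‖) → ∀ d, 0 ≤ d →
    ‖P.Fd d y x a v w‖ ≤ C * ‖x - y‖⁻¹ * (|a| + ‖v‖ + ‖w‖) ∧
    ‖P.Fd d y x a v w - P.Fd 0 y x a v w‖ ≤ C * √d * ‖x - y‖ ^ (-(3/2) : ℝ) * (|a| + ‖v‖ + ‖w‖) := by
  obtain ⟨R, hR1, hR⟩ := P.geo
  obtain ⟨M, hM0, hM⟩ := P.tf_bound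
  have hL := P.hL0
  have hr := P.hr
  set L' := P.L ^ (3/2 : ℝ) with hL'
  have hL'0 : 0 < L' := by positivity
  set C1 := (1 + P.L) + 3 * P.L * P.L + (3 * P.r⁻¹ + M * (3 * P.L * P.L * P.r⁻¹)) with hC1
  set C2 := (1 + L') + 5 * P.L * L' + (5 * P.r⁻¹ + M * (5 * P.L * L' * P.r⁻¹)) with hC2
  refine ⟨C1 + C2, by positivity, fun x y h a v w hw d hd => ?_⟩
  obtain ⟨ht, hs, htR, hsR, i1, i2, i3, i4⟩ := hR x y h
  have hz : x - y ≠ 0 := norm_pos_iff.1 ht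
  have hz' : P.S x - y ≠ 0 := norm_pos_iff.1 hs
  have hCm := P.hC x h.hx h.hxt y h.hy h.hyb
  have hT := hM x h.hxt
  have hσ := P.hσ
  set t := ‖x - y‖
  set s := ‖P.S x - y‖
  set t3 := t ^ (-(3/2) : ℝ)
  set s3 := s ^ (-(3/2) : ℝ)
  have ht3 : 0 < t3 := by positivity
  have hs3 : 0 < s3 := by positivity
  -- generic
  have gen : ∀ (p1 p2 : E2) (D1 D2 : E2 →L[ℝ] E2) (α1 α2 β1 β2 : ℝ), ‖p1‖ ≤ α1 → ‖p2‖ ≤ α2 → s * ‖D2‖ ≤ β2 →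
      (w ≠ 0 → ‖D1‖ ≤ β1) → (w ≠ 0 → ‖D2‖ ≤ P.L * P.r⁻¹ * β2) → 0 ≤ β1 →
      ‖-(a • innerSL ℝ (p1 + P.σ • p2))
    + P.σ • (innerSL ℝ v).comp ((Cm (fderiv ℝ P.S x)).comp D2)
    + (innerSL ℝ w).comp (D1 + P.σ • (tf (fderiv ℝ P.S x)).comp D2)‖ ≤ |a| * (α1 + α2) + ‖v‖ * (P.L * β2) + ‖w‖ * (β1 + M * (P.L * P.r⁻¹ * β2)) := by
    intro p1 p2 D1 D2 α1 α2 β1 β2 h1 h2 h3 h4 h5 h6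
    have hβ2 : 0 ≤ β2 := (by positivity : 0 ≤ s * ‖D2‖).trans h3
    refine (norm_add_le _ _).trans (add_le_add ((norm_add_le _ _).trans (add_le_add ?_ ?_)) ?_)
    · rw [norm_neg, norm_smul, innerSL_apply_norm, Real.norm_eq_abs]
      gcongr
      refine (norm_add_le _ _).trans (add_le_add h1 ?_)
      rw [norm_smul, Real.norm_eq_abs]
      nlinarith [norm_nonneg p2]
    · rw [norm_smul, Real.norm_eq_abs]
      calc |P.σ| * ‖(innerSL ℝ v).comp ((Cm (fderiv ℝ P.S x)).comp D2)‖ ≤ |P.σ| * (‖v‖ * (‖Cm (fderiv ℝ P.S x)‖ * ‖D2‖)) := by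
            gcongr
            refine (ContinuousLinearMap.opNorm_comp_le _ _).trans ?_
            rw [innerSL_apply_norm]
            gcongr
            exact ContinuousLinearMap.opNorm_comp_le _ _
        _ = ‖v‖ * ((|P.σ| * ‖Cm (fderiv ℝ P.S x)‖) * ‖D2‖) := by ring
        _ ≤ ‖v‖ * ((P.L * s) * ‖D2‖) := by gcongr
        _ = ‖v‖ * (P.L * (s * ‖D2‖)) := by ring
        _ ≤ _ := by gcongr
    · refine (ContinuousLinearMap.opNorm_comp_le _ _).trans ?_
      rw [innerSL_apply_norm]
      by_cases hw0 : w = 0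
      · simp [hw0]
      gcongr
      refine (norm_add_le _ _).trans (add_le_add (h4 hw0) ?_)
      rw [norm_smul, Real.norm_eq_abs]
      calc |P.σ| * ‖(tf (fderiv ℝ P.S x)).comp D2‖ ≤ 1 * (M * (P.L * P.r⁻¹ * β2)) := by
            gcongr
            refine (ContinuousLinearMap.opNorm_comp_le _ _).trans ?_
            gcongr
            exact h5 hw0
        _ = _ := one_mul _
  have hsr : w ≠ 0 → s⁻¹ ≤ P.L * P.r⁻¹ := fun hw0 => i1.trans (by gcongr; exact hw hw0)
  have htr : w ≠ 0 → t⁻¹ ≤ P.r⁻¹ := fun hw0 => by gcongr; exact hw hw0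
  have ha := abs_nonneg a
  have hv := norm_nonneg v
  have hw' := norm_nonneg w
  constructor
  · have g := gen (pk d (x - y)) (pk d (P.S x - y)) (Dpk d (x - y)) (Dpk d (P.S x - y)) t⁻¹ (P.L * t⁻¹) (3 * P.r⁻¹ * t⁻¹) (3 * (P.L * t⁻¹))
      (pk_norm_le _ _) ((pk_norm_le _ _).trans i1) ?_ ?_ ?_ (by positivity)
    · refine g.trans ?_
      have : |a| * (t⁻¹ + P.L * t⁻¹) + ‖v‖ * (P.L * (3 * (P.L * t⁻¹))) + ‖w‖ * (3 * P.r⁻¹ * t⁻¹ + M * (P.L * P.r⁻¹ * (3 * (P.L * t⁻¹))))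
        = ((1 + P.L) * |a| + (3 * P.L * P.L) * ‖v‖ + (3 * P.r⁻¹ + M * (3 * P.L * P.L * P.r⁻¹)) * ‖w‖) * t⁻¹ := by ring
      rw [this]
      have hC2' : 0 ≤ C2 := by positivity
      calc _ ≤ ((C1 + C2) * |a| + (C1 + C2) * ‖v‖ + (C1 + C2) * ‖w‖) * t⁻¹ := by
            exact lincomb3 (by positivity) (by positivity) (by positivity) (by linarith) ha hv hw' (by positivity)
        _ = _ := by ring
    · calc s * ‖Dpk d (P.S x - y)‖ ≤ s * (3 * (s ^ 2)⁻¹) := by gcongr; exact Dpk_norm_le _ _ hz'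
        _ = 3 * s⁻¹ := by field_simp
        _ ≤ _ := by gcongr
    · intro hw0
      calc ‖Dpk d (x - y)‖ ≤ 3 * (t ^ 2)⁻¹ := Dpk_norm_le _ _ hz
        _ = 3 * t⁻¹ * t⁻¹ := by rw [sq, mul_inv]; ring
        _ ≤ _ := by gcongr; exact hw hw0
    · intro hw0
      calc ‖Dpk d (P.S x - y)‖ ≤ 3 * (s ^ 2)⁻¹ := Dpk_norm_le _ _ hz'
        _ = s⁻¹ * (3 * s⁻¹) := by rw [sq, mul_inv]; ring
        _ ≤ _ := by gcongr; exact hsr hw0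
  · have e : P.Fd d y x a v w - P.Fd 0 y x a v w = -(a • innerSL ℝ ((pk d (x - y) - pk 0 (x - y)) + P.σ • (pk d (P.S x - y) - pk 0 (P.S x - y))))
    + P.σ • (innerSL ℝ v).comp ((Cm (fderiv ℝ P.S x)).comp (Dpk d (P.S x - y) - Dpk 0 (P.S x - y)))
    + (innerSL ℝ w).comp ((Dpk d (x - y) - Dpk 0 (x - y)) + P.σ • (tf (fderiv ℝ P.S x)).comp (Dpk d (P.S x - y) - Dpk 0 (P.S x - y))) := by
      ext z
      simp [Fd, inner_add_right, inner_add_left, inner_smul_left, inner_smul_right, inner_sub_left, inner_sub_right]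
      ring
    rw [e]
    have hd' : 0 ≤ √d := Real.sqrt_nonneg d
    have g := gen (pk d (x - y) - pk 0 (x - y)) (pk d (P.S x - y) - pk 0 (P.S x - y)) (Dpk d (x - y) - Dpk 0 (x - y)) (Dpk d (P.S x - y) - Dpk 0 (P.S x - y))
      (√d * t3) (√d * (L' * t3)) (P.r⁻¹ * (5 * (√d * t3))) (5 * (√d * (L' * t3)))
      (pk_diff_le hd _) ((pk_diff_le hd _).trans (by gcongr)) ?_ ?_ ?_ (by positivity)
    · refine g.trans ?_
      have : |a| * (√d * t3 + √d * (L' * t3)) + ‖v‖ * (P.L * (5 * (√d * (L' * t3)))) + ‖w‖ * (P.r⁻¹ * (5 * (√d * t3)) + M * (P.L * P.r⁻¹ * (5 * (√d * (L' * t3)))))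
        = ((1 + L') * |a| + (5 * P.L * L') * ‖v‖ + (5 * P.r⁻¹ + M * (5 * P.L * L' * P.r⁻¹)) * ‖w‖) * (√d * t3) := by ring
      rw [this]
      have hC2' : 0 ≤ C1 := by positivity
      calc _ ≤ ((C1 + C2) * |a| + (C1 + C2) * ‖v‖ + (C1 + C2) * ‖w‖) * (√d * t3) := by
            exact lincomb3 (by positivity) (by positivity) (by positivity) (by linarith) ha hv hw' (by positivity)
        _ = _ := by ring
    · exact (Dpk_diff_le hd _ hz').trans (by gcongr)
    · intro hw0
      have := Dpk_diff_le hd _ hz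
      calc ‖Dpk d (x - y) - Dpk 0 (x - y)‖ = t⁻¹ * (t * ‖Dpk d (x - y) - Dpk 0 (x - y)‖) := by field_simp
        _ ≤ P.r⁻¹ * (5 * (√d * t3)) := by gcongr; exact hw hw0
    · intro hw0
      have := Dpk_diff_le hd _ hz'
      calc ‖Dpk d (P.S x - y) - Dpk 0 (P.S x - y)‖ = s⁻¹ * (s * ‖Dpk d (P.S x - y) - Dpk 0 (P.S x - y)‖) := by field_simp
        _ ≤ (P.L * P.r⁻¹) * (5 * (√d * s3)) := by gcongr; exact hsr hw0
        _ ≤ _ := by gcongr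

lemma Fk_diff : ∃ C : ℝ, 0 ≤ C ∧ ∀ x y, P.Adm x y → ∀ a v w, ∀ d, 0 ≤ d → d ≤ 1 →
    |P.Fk d y x a v w - P.Fk 0 y x a v w| ≤ C * √d * ‖x - y‖ ^ (-(3/2) : ℝ) * (|a| + ‖v‖ + ‖w‖) := by
  obtain ⟨R, hR1, hR⟩ := P.geo
  obtain ⟨CX, hCX0, hX⟩ := P.Xf_bounds
  have hL := P.hL0
  set C := (1 + P.L) * R + P.L * (P.L * R) + CX with hC
  refine ⟨C, by positivity, fun x y h a v w d hd hd1 => ?_⟩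
  obtain ⟨ht, hs, htR, hsR, i1, i2, i3, i4⟩ := hR x y h
  have hz : x - y ≠ 0 := norm_pos_iff.1 ht
  have hz' : P.S x - y ≠ 0 := norm_pos_iff.1 hs
  have hCm := P.hC x h.hx h.hxt y h.hy h.hyb
  have hXx := (hX x h.hx h.hxt y h.hy h.hyb h.ne d hd).2
  have hσ := P.hσ
  have hdd : d ≤ √d := by
    have := Real.sqrt_le_one.2 hd1
    nlinarith [Real.sq_sqrt hd, Real.sqrt_nonneg d]
  set t := ‖x - y‖
  set s := ‖P.S x - y‖
  set t3 := t ^ (-(3/2) : ℝ)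
  have ht3 : 0 < t3 := by positivity
  have e : P.Fk d y x a v w - P.Fk 0 y x a v w = a * ((Lg d (x - y) - Lg 0 (x - y)) + P.σ * (Lg d (P.S x - y) - Lg 0 (P.S x - y)))
    - P.σ * ⟪v, Cm (fderiv ℝ P.S x) (pk d (P.S x - y) - pk 0 (P.S x - y))⟫ - ⟪w, Xf P.σ P.S d y x - Xf P.σ P.S 0 y x⟫ := by
    simp only [Fk, map_sub, inner_sub_right]; ring
  rw [e]
  have hdt : d * t⁻¹ ≤ √d * (R * t3) := by gcongr
  have hds : d * s⁻¹ ≤ √d * (P.L * (R * t3)) := by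
    gcongr
    exact i1.trans (by gcongr)
  have b1 : |a * ((Lg d (x - y) - Lg 0 (x - y)) + P.σ * (Lg d (P.S x - y) - Lg 0 (P.S x - y)))| ≤ |a| * (√d * (R * t3) + √d * (P.L * (R * t3))) := by
    rw [abs_mul]
    gcongr
    refine (abs_add_le _ _).trans (add_le_add ((Lg_diff_le hd _ hz).trans hdt) ?_)
    rw [abs_mul]
    have := (Lg_diff_le hd _ hz').trans hds
    calc _ ≤ 1 * |Lg d (P.S x - y) - Lg 0 (P.S x - y)| := by gcongr
      _ ≤ _ := by rwa [one_mul]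
  have b2 : |P.σ * ⟪v, Cm (fderiv ℝ P.S x) (pk d (P.S x - y) - pk 0 (P.S x - y))⟫| ≤ ‖v‖ * (P.L * (√d * (P.L * (R * t3)))) := by
    rw [abs_mul]
    calc _ ≤ |P.σ| * (‖v‖ * (‖Cm (fderiv ℝ P.S x)‖ * ‖pk d (P.S x - y) - pk 0 (P.S x - y)‖)) := by
          gcongr
          refine (abs_real_inner_le_norm _ _).trans ?_
          gcongr
          exact ContinuousLinearMap.le_opNorm _ _
      _ = ‖v‖ * ((|P.σ| * ‖Cm (fderiv ℝ P.S x)‖) * ‖pk d (P.S x - y) - pk 0 (P.S x - y)‖) := by ring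
      _ ≤ ‖v‖ * ((P.L * s) * ‖pk d (P.S x - y) - pk 0 (P.S x - y)‖) := by gcongr
      _ = ‖v‖ * (P.L * (s * ‖pk d (P.S x - y) - pk 0 (P.S x - y)‖)) := by ring
      _ ≤ _ := mul_le_mul_of_nonneg_left (mul_le_mul_of_nonneg_left ((pk_diff_le' hd _).trans hds) hL.le) (norm_nonneg v)
  have b3 : |⟪w, Xf P.σ P.S d y x - Xf P.σ P.S 0 y x⟫| ≤ ‖w‖ * (CX * √d * t3) := (abs_real_inner_le_norm _ _).trans (by gcongr)
  refine (abs_sub _ _).trans ((add_le_add ((abs_sub _ _).trans (add_le_add b1 b2)) b3).trans ?_)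
  have : |a| * (√d * (R * t3) + √d * (P.L * (R * t3))) + ‖v‖ * (P.L * (√d * (P.L * (R * t3)))) + ‖w‖ * (CX * √d * t3)
      = ((1 + P.L) * R * |a| + P.L * (P.L * R) * ‖v‖ + CX * ‖w‖) * (√d * t3) := by ring
  rw [this]
  have hd' : 0 ≤ √d := Real.sqrt_nonneg d
  calc _ ≤ (C * |a| + C * ‖v‖ + C * ‖w‖) * (√d * t3) := by
        exact lincomb3 (by positivity) (by positivity) (by positivity) le_rfl (abs_nonneg a) (norm_nonneg _) (norm_nonneg _) (by positivity)
    _ = _ := by ring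

lemma Fk_bound : ∃ C : ℝ, 0 ≤ C ∧ ∀ x y, P.Adm x y → ∀ a v w, (w ≠ 0 → P.r ≤ ‖x - y‖) →
    |P.Fk 0 y x a v w| ≤ C * (|a| * (1 + |Real.log ‖x - y‖|) + ‖v‖ + ‖w‖) := by
  obtain ⟨R, hR1, hR⟩ := P.geo
  obtain ⟨CX, hCX0, hX⟩ := P.Xf_bounds
  have hL := P.hL0
  have hr := P.hr
  set C := (R + P.L + 2) + P.L + CX * P.r⁻¹ with hC
  refine ⟨C, by positivity, fun x y h a v w hw => ?_⟩
  obtain ⟨ht, hs, htR, hsR, i1, i2, i3, i4⟩ := hR x y h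
  have hz : x - y ≠ 0 := norm_pos_iff.1 ht
  have hz' : P.S x - y ≠ 0 := norm_pos_iff.1 hs
  have hCm := P.hC x h.hx h.hxt y h.hy h.hyb
  have hXx := (hX x h.hx h.hxt y h.hy h.hyb h.ne 0 le_rfl).1
  have hσ := P.hσ
  have hlg : ∀ z : E2, Lg 0 z = Real.log ‖z‖ := by
    intro z; rw [Lg, nn_zero, Real.log_pow]; push_cast; ring
  have hls : |Real.log ‖P.S x - y‖| ≤ R + P.L + |Real.log ‖x - y‖| := by
    rw [abs_le]
    constructor
    · have h1 : Real.log ‖x - y‖ ≤ Real.log P.L + Real.log ‖P.S x - y‖ := by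
        rw [← Real.log_mul hL.ne' hs.ne']
        exact Real.log_le_log ht i4
      have h2 := Real.log_le_sub_one_of_pos hL
      have h3 := neg_abs_le (Real.log ‖x - y‖)
      linarith
    · have h1 := Real.log_le_sub_one_of_pos hs
      have := abs_nonneg (Real.log ‖x - y‖)
      linarith
  set t := ‖x - y‖
  set s := ‖P.S x - y‖
  have hlt := abs_nonneg (Real.log t)
  have b1 : |a * (Lg 0 (x - y) + P.σ * Lg 0 (P.S x - y))| ≤ |a| * (|Real.log t| + (R + P.L + |Real.log t|)) := by
    rw [abs_mul, hlg, hlg]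
    gcongr
    refine (abs_add_le _ _).trans (add_le_add le_rfl ?_)
    rw [abs_mul]
    calc _ ≤ 1 * |Real.log s| := by gcongr
      _ ≤ _ := by rwa [one_mul]
  have b2 : |P.σ * ⟪v, Cm (fderiv ℝ P.S x) (pk 0 (P.S x - y))⟫| ≤ ‖v‖ * P.L := by
    rw [abs_mul]
    calc _ ≤ |P.σ| * (‖v‖ * (‖Cm (fderiv ℝ P.S x)‖ * ‖pk 0 (P.S x - y)‖)) := by
          gcongr
          refine (abs_real_inner_le_norm _ _).trans ?_
          gcongr
          exact ContinuousLinearMap.le_opNorm _ _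
      _ = ‖v‖ * ((|P.σ| * ‖Cm (fderiv ℝ P.S x)‖) * ‖pk 0 (P.S x - y)‖) := by ring
      _ ≤ ‖v‖ * ((P.L * s) * s⁻¹) := by gcongr; exact pk_norm_le _ _
      _ = _ := by field_simp
  have b3 : |⟪w, Xf P.σ P.S 0 y x⟫| ≤ ‖w‖ * (CX * P.r⁻¹) := by
    by_cases hw0 : w = 0
    · simp [hw0]
    refine (abs_real_inner_le_norm _ _).trans ?_
    rw [Real.rpow_neg_one] at hXx
    have : t⁻¹ ≤ P.r⁻¹ := by gcongr; exact hw hw0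
    gcongr
    exact hXx.trans (by gcongr)
  refine (abs_sub _ _).trans ((add_le_add ((abs_sub _ _).trans (add_le_add b1 b2)) b3).trans ?_)
  have h1 : 0 ≤ CX * P.r⁻¹ := by positivity
  calc |a| * (|Real.log t| + (R + P.L + |Real.log t|)) + ‖v‖ * P.L + ‖w‖ * (CX * P.r⁻¹)
      ≤ |a| * (C * (1 + |Real.log t|)) + ‖v‖ * C + ‖w‖ * C := by
        gcongr
        · nlinarith
        · linarith
        · linarith
    _ = _ := by ring

end Patch
end RegSec


noncomputable section RegSec2

variable {Ω : Set E2} {x0 : E2}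

lemma Dpk_meas (d : ℝ) : Measurable (Dpk d) := by
  unfold Dpk
  have h1 : Measurable (fun z => (nn d z)⁻¹) := (nn_contDiff d (n := 0)).continuous.measurable.inv
  have h2 : Continuous (fun z : E2 => (innerSL ℝ z).smulRight z) := by fun_prop
  exact (h1.smul_const _).sub (((h1.pow_const 2).const_mul 2).smul h2.measurable)

lemma Dpk_cont {d : ℝ} (hd : 0 < d) : Continuous (Dpk d) := by
  have : Dpk d = fderiv ℝ (pk d) := by
    funext z; exact (pk_hasFDerivAt hd z).fderiv.symm
  rw [this]
  exact (pk_contDiff hd (n := 1)).continuous_fderiv (by norm_num)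

lemma Lg_meas (d : ℝ) : Measurable (Lg d) := by
  unfold Lg
  exact ((nn_contDiff d (n := 0)).continuous.measurable.log).const_mul _

def Wt (f : E2 → ℝ) (G : E2 → E2) (u : E2 → ℝ) (x : E2) : ℝ≥0∞ := ‖f x‖ₑ + (‖G x‖ₑ + ‖u x‖ₑ)

lemma Wt_meas {f : E2 → ℝ} {G : E2 → E2} {u : E2 → ℝ} (hf : Measurable f) (hG : Measurable G) (hu : Measurable u) :
    Measurable (Wt f G u) := hf.enorm.add (hG.enorm.add hu.enorm)

namespace Patch
variable (P : Patch Ω x0) (f : E2 → ℝ) (G : E2 → E2) (u : E2 → ℝ)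

def cA (x : E2) : ℝ := - (f x * P.η x) + ⟪G x, gradient P.η x⟫
def cV (x : E2) : E2 := P.η x • G x
def cW (x : E2) : E2 := u x • gradient P.η x
def FK (d : ℝ) (y x : E2) : ℝ := P.Fk d y x (P.cA f G x) (P.cV G x) (P.cW u x)
def FD (d : ℝ) (y x : E2) : E2 →L[ℝ] ℝ := P.Fd d y x (P.cA f G x) (P.cV G x) (P.cW u x)

lemma grad_out {x : E2} (hx : x ∉ tsupport P.η) : gradient P.η x = 0 := by
  have := P.Tv_zero 0 1 hx
  simpa [Tv] using this

lemma grad_in {x : E2} (hx : x ∈ Metric.ball x0 (2 * P.r)) : gradient P.η x = 0 := by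
  have : P.η =ᶠ[𝓝 x] fun _ => (1:ℝ) := by
    filter_upwards [Metric.isOpen_ball.mem_nhds hx] with z hz using P.hη1 z hz
  unfold gradient
  rw [this.fderiv_eq]; simp

lemma cW_far {x y : E2} (hy : y ∈ Metric.ball x0 P.r) (h : P.cW u x ≠ 0) : P.r ≤ ‖x - y‖ := by
  by_contra! hlt
  apply h
  rw [cW, P.grad_in, smul_zero]
  rw [Metric.mem_ball, dist_eq_norm] at *
  calc ‖x - x0‖ = ‖(x - y) + (y - x0)‖ := by congr 1; abel
    _ ≤ _ := norm_add_le _ _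
    _ < _ := by linarith

lemma coef_out {x : E2} (hx : x ∉ tsupport P.η) : P.cA f G x = 0 ∧ P.cV G x = 0 ∧ P.cW u x = 0 := by
  simp [cA, cV, cW, P.grad_out hx, image_eq_zero_of_notMem_tsupport hx]

lemma FK_out (d : ℝ) (y : E2) {x : E2} (hx : x ∉ tsupport P.η) : P.FK f G u d y x = 0 := by
  obtain ⟨h1, h2, h3⟩ := P.coef_out f G u hx
  simp [FK, Fk, h1, h2, h3]

lemma FD_out (d : ℝ) (y : E2) {x : E2} (hx : x ∉ tsupport P.η) : P.FD f G u d y x = 0 := by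
  obtain ⟨h1, h2, h3⟩ := P.coef_out f G u hx
  simp [FD, Fd, h1, h2, h3]

lemma eta_bound : ∃ B : ℝ, 0 ≤ B ∧ ∀ x, |P.η x| ≤ B ∧ ‖gradient P.η x‖ ≤ B := by
  obtain ⟨B, hB, h⟩ := P.Tv_bound
  refine ⟨B, hB, fun x => ⟨?_, ?_⟩⟩
  · have := h (ee 0) 0 x
    have e : ‖(ee 0 : E2)‖ = 1 := by simp [ee]
    simpa [Tv, norm_smul, e] using this
  · simpa [Tv] using h 0 1 x

lemma coef_bound : ∃ B : ℝ, 0 ≤ B ∧ ∀ (f : E2 → ℝ) (G : E2 → E2) (u : E2 → ℝ) x, |P.cA f G x| ≤ B * (|f x| + ‖G x‖) ∧ ‖P.cV G x‖ ≤ B * ‖G x‖ ∧ ‖P.cW u x‖ ≤ B * |u x| := by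
  obtain ⟨B, hB, h⟩ := P.eta_bound
  refine ⟨B, hB, fun f G u x => ⟨?_, ?_, ?_⟩⟩
  · refine (abs_add_le _ _).trans ?_
    rw [abs_neg, abs_mul, mul_add]
    refine add_le_add ?_ ((abs_real_inner_le_norm _ _).trans ?_)
    · rw [mul_comm]; gcongr; exact (h x).1
    · rw [mul_comm]; gcongr; exact (h x).2
  · rw [cV, norm_smul]; gcongr; exact (h x).1
  · rw [cW, norm_smul, mul_comm]; gcongr
    · exact (h x).2
    · exact le_of_eq (Real.norm_eq_abs _)

lemma coef_sum : ∃ B : ℝ, 0 ≤ B ∧ ∀ (f : E2 → ℝ) (G : E2 → E2) (u : E2 → ℝ) x, |P.cA f G x| + ‖P.cV G x‖ + ‖P.cW u x‖ ≤ B * (|f x| + (‖G x‖ + |u x|)) := by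
  obtain ⟨B, hB, h⟩ := P.coef_bound
  refine ⟨2 * B, by positivity, fun f G u x => ?_⟩
  obtain ⟨h1, h2, h3⟩ := h f G u x
  nlinarith [mul_nonneg hB (abs_nonneg (f x)), mul_nonneg hB (abs_nonneg (u x))]

lemma Wt_eq (x : E2) : Wt f G u x = ENNReal.ofReal (|f x| + (‖G x‖ + |u x|)) := by
  rw [Wt, ENNReal.ofReal_add (by positivity) (by positivity), ENNReal.ofReal_add (by positivity) (by positivity),
    ← Real.norm_eq_abs, ← Real.norm_eq_abs, ofReal_norm, ofReal_norm, ofReal_norm]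

lemma F_bound : ∃ C : ℝ≥0∞, C ≠ ⊤ ∧ ∀ (f : E2 → ℝ) (G : E2 → E2) (u : E2 → ℝ), ∀ y ∈ closure Ω, y ∈ Metric.ball x0 P.r → ∀ x ∈ Ω, x ≠ y → ∀ d : ℝ, 0 ≤ d → d ≤ 1 →
    ‖P.FD f G u d y x‖ₑ ≤ C * (kk 1 x y * Wt f G u x) ∧
    ‖P.FD f G u d y x - P.FD f G u 0 y x‖ₑ ≤ C * ENNReal.ofReal (√d) * (kk (3/2) x y * Wt f G u x) ∧
    ‖P.FK f G u d y x - P.FK f G u 0 y x‖ₑ ≤ C * ENNReal.ofReal (√d) * (kk (3/2) x y * Wt f G u x) := by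
  obtain ⟨C1, hC1, h1⟩ := P.Fd_bound
  obtain ⟨C2, hC2, h2⟩ := P.Fk_diff
  obtain ⟨B, hB, h3⟩ := P.coef_sum
  refine ⟨ENNReal.ofReal ((C1 + C2) * B), ENNReal.ofReal_ne_top, fun f G u y hy hyb x hx hxy d hd hd1 => ?_⟩
  by_cases hxt : x ∈ tsupport P.η
  swap
  · rw [P.FD_out f G u _ _ hxt, P.FD_out f G u _ _ hxt, P.FK_out f G u _ _ hxt, P.FK_out f G u _ _ hxt, sub_self, sub_self, enorm_zero (E := ℝ), ← ofReal_norm, norm_zero, ENNReal.ofReal_zero]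
    exact ⟨zero_le, zero_le, zero_le⟩
  have adm : P.Adm x y := ⟨hx, hxt, hy, hyb, hxy⟩
  have h3' := h3 f G u x
  obtain ⟨e1, e2⟩ := h1 x y adm (P.cA f G x) (P.cV G x) (P.cW u x) (P.cW_far u hyb) d hd
  have e3 := h2 x y adm (P.cA f G x) (P.cV G x) (P.cW u x) d hd hd1
  have hC12 : C1 ≤ C1 + C2 := by linarith
  have hC12' : C2 ≤ C1 + C2 := by linarith
  refine ⟨?_, ?_, ?_⟩
  · rw [Wt_eq, kk, ← ENNReal.ofReal_mul (by positivity), ← ENNReal.ofReal_mul (by positivity), ← ofReal_norm]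
    apply ENNReal.ofReal_le_ofReal
    calc ‖P.FD f G u d y x‖ ≤ C1 * ‖x - y‖⁻¹ * (|P.cA f G x| + ‖P.cV G x‖ + ‖P.cW u x‖) := e1
      _ ≤ (C1 + C2) * ‖x - y‖⁻¹ * (B * (|f x| + (‖G x‖ + |u x|))) := by gcongr
      _ = _ := by rw [Real.rpow_neg_one]; ring
  · rw [Wt_eq, kk, ← ENNReal.ofReal_mul (by positivity), ← ENNReal.ofReal_mul (by positivity), ← ENNReal.ofReal_mul (by positivity), ← ofReal_norm]
    apply ENNReal.ofReal_le_ofReal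
    calc ‖P.FD f G u d y x - P.FD f G u 0 y x‖ ≤ C1 * √d * ‖x - y‖ ^ (-(3/2) : ℝ) * (|P.cA f G x| + ‖P.cV G x‖ + ‖P.cW u x‖) := e2
      _ ≤ (C1 + C2) * √d * ‖x - y‖ ^ (-(3/2) : ℝ) * (B * (|f x| + (‖G x‖ + |u x|))) := by gcongr
      _ = _ := by ring
  · rw [Wt_eq, kk, ← ENNReal.ofReal_mul (by positivity), ← ENNReal.ofReal_mul (by positivity), ← ENNReal.ofReal_mul (by positivity), ← ofReal_norm]
    apply ENNReal.ofReal_le_ofReal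
    calc ‖P.FK f G u d y x - P.FK f G u 0 y x‖ ≤ C2 * √d * ‖x - y‖ ^ (-(3/2) : ℝ) * (|P.cA f G x| + ‖P.cV G x‖ + ‖P.cW u x‖) := e3
      _ ≤ (C1 + C2) * √d * ‖x - y‖ ^ (-(3/2) : ℝ) * (B * (|f x| + (‖G x‖ + |u x|))) := by gcongr
      _ = _ := by ring

variable {f G u}
lemma cA_meas (hf : Measurable f) (hG : Measurable G) : Measurable (P.cA f G) :=
  ((hf.mul P.hη.continuous.measurable).neg).add (hG.inner (gradient_cont P.hη).measurable)
lemma cV_meas (hG : Measurable G) : Measurable (P.cV G) := P.hη.continuous.measurable.smul hG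
lemma cW_meas (hu : Measurable u) : Measurable (P.cW u) := hu.smul (gradient_cont P.hη).measurable

lemma Cm_cont : Continuous (fun x => Cm (fderiv ℝ P.S x)) := (Cm_contDiff P.hA).continuous
lemma tf_cont : Continuous (fun x => tf (fderiv ℝ P.S x)) := (tf_contDiff P.hA).continuous

lemma FK_meas (hf : Measurable f) (hG : Measurable G) (hu : Measurable u) (d : ℝ) (y : E2) :
    Measurable (P.FK f G u d y) := by
  have hT : Continuous (fun p : (E2 →L[ℝ] E2) × E2 => p.1 p.2) := by fun_prop
  have hS := P.hS1.continuous.measurable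
  have m1 : Measurable (fun x : E2 => Lg d (x - y)) := (Lg_meas d).comp (measurable_id.sub_const y)
  have m2 : Measurable (fun x : E2 => Lg d (P.S x - y)) := (Lg_meas d).comp (hS.sub_const y)
  have m3 : Measurable (fun x : E2 => pk d (P.S x - y)) := (pk_meas d).comp (hS.sub_const y)
  have m4 : Measurable (fun x : E2 => Cm (fderiv ℝ P.S x) (pk d (P.S x - y))) :=
    hT.measurable.comp (P.Cm_cont.measurable.prodMk m3)
  exact (((P.cA_meas hf hG).mul (m1.add (m2.const_mul _))).sub (((P.cV_meas hG).inner m4).const_mul _)).sub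
    ((P.cW_meas hu).inner (P.Xf_meas1 d y))

lemma comp_meas1 (σ : ℝ) {p q : E2 → E2} (hp : Measurable p) (hq : Measurable q) {a : E2 → ℝ} (ha : Measurable a) :
    Measurable (fun x => -(a x • innerSL ℝ (p x + σ • q x))) := by
  have hc : Continuous (fun z : ℝ × E2 × E2 => -(z.1 • innerSL ℝ (z.2.1 + σ • z.2.2))) := by fun_prop
  exact (hc.comp_stronglyMeasurable (ha.stronglyMeasurable.prodMk (hp.stronglyMeasurable.prodMk hq.stronglyMeasurable))).measurable

lemma comp_meas2 (σ : ℝ) {v : E2 → E2} (hv : Measurable v) {A D : E2 → (E2 →L[ℝ] E2)} (hA : Measurable A) (hD : Measurable D) :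
    Measurable (fun x => σ • (innerSL ℝ (v x)).comp ((A x).comp (D x))) := by
  have hc : Continuous (fun z : E2 × (E2 →L[ℝ] E2) × (E2 →L[ℝ] E2) => σ • (innerSL ℝ z.1).comp (z.2.1.comp z.2.2)) := by fun_prop
  exact (hc.comp_stronglyMeasurable (hv.stronglyMeasurable.prodMk (hA.stronglyMeasurable.prodMk hD.stronglyMeasurable))).measurable

lemma comp_meas3 (σ : ℝ) {v : E2 → E2} (hv : Measurable v) {A D D1 : E2 → (E2 →L[ℝ] E2)} (hA : Measurable A) (hD : Measurable D)
    (hD1 : Measurable D1) : Measurable (fun x => (innerSL ℝ (v x)).comp (D1 x + σ • (A x).comp (D x))) := by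
  have hc : Continuous (fun z : E2 × (E2 →L[ℝ] E2) × (E2 →L[ℝ] E2) × (E2 →L[ℝ] E2) =>
    (innerSL ℝ z.1).comp (z.2.2.2 + σ • (z.2.1.comp z.2.2.1))) := by fun_prop
  exact (hc.comp_stronglyMeasurable (hv.stronglyMeasurable.prodMk (hA.stronglyMeasurable.prodMk (hD.stronglyMeasurable.prodMk hD1.stronglyMeasurable)))).measurable

lemma FD_meas (hf : Measurable f) (hG : Measurable G) (hu : Measurable u) (d : ℝ) (y : E2) :
    Measurable (P.FD f G u d y) := by
  have hS := P.hS1.continuous.measurable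
  have m1 : Measurable (fun x : E2 => pk d (x - y)) := (pk_meas d).comp (measurable_id.sub_const y)
  have m3 : Measurable (fun x : E2 => pk d (P.S x - y)) := (pk_meas d).comp (hS.sub_const y)
  have m5 : Measurable (fun x : E2 => Dpk d (x - y)) := (Dpk_meas d).comp (measurable_id.sub_const y)
  have m6 : Measurable (fun x : E2 => Dpk d (P.S x - y)) := (Dpk_meas d).comp (hS.sub_const y)
  have n1 := comp_meas1 P.σ m1 m3 (P.cA_meas hf hG)
  have n2 := comp_meas2 P.σ (P.cV_meas hG) P.Cm_cont.measurable m6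
  have n3 := comp_meas3 P.σ (P.cW_meas hu) P.tf_cont.measurable m6 m5
  exact (n1.add n2).add n3

/-- crude bound for fixed positive `d` -/
lemma FD_crude {d : ℝ} (hd : 0 < d) : ∃ C : ℝ, 0 ≤ C ∧ ∀ (f : E2 → ℝ) (G : E2 → E2) (u : E2 → ℝ) y x,
    ‖P.FD f G u d y x‖ ≤ C * (|f x| + (‖G x‖ + |u x|)) := by
  obtain ⟨B, hB, h3⟩ := P.coef_sum
  obtain ⟨M, hM0, hM⟩ := P.tf_bound
  obtain ⟨M2, hM2⟩ := P.hηc.isCompact.exists_bound_of_continuousOn P.Cm_cont.continuousOn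
  set N := max M2 0
  have hN : 0 ≤ N := le_max_right _ _
  set c2 := 3 * (d ^ 2)⁻¹
  have hc2 : 0 ≤ c2 := by positivity
  set C := (d⁻¹ + d⁻¹) + N * c2 + (c2 + M * c2) with hC
  have hC0 : 0 ≤ C := by positivity
  refine ⟨C * B, by positivity, fun f G u y x => ?_⟩
  by_cases hxt : x ∈ tsupport P.η
  swap
  · rw [P.FD_out f G u _ _ hxt, norm_zero]; positivity
  have hσ := P.hσ
  have hNx : ‖Cm (fderiv ℝ P.S x)‖ ≤ N := (hM2 x hxt).trans (le_max_left _ _)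
  have b1 : ‖-(P.cA f G x • innerSL ℝ (pk d (x - y) + P.σ • pk d (P.S x - y)))‖ ≤ |P.cA f G x| * (d⁻¹ + d⁻¹) := by
    rw [norm_neg, norm_smul, innerSL_apply_norm, Real.norm_eq_abs]
    gcongr
    refine (norm_add_le _ _).trans (add_le_add (pk_norm_le_const hd _) ?_)
    rw [norm_smul, Real.norm_eq_abs]
    have := pk_norm_le_const hd (P.S x - y)
    nlinarith [norm_nonneg (pk d (P.S x - y)), abs_nonneg P.σ]
  have b2 : ‖P.σ • (innerSL ℝ (P.cV G x)).comp ((Cm (fderiv ℝ P.S x)).comp (Dpk d (P.S x - y)))‖ ≤ ‖P.cV G x‖ * (N * c2) := by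
    rw [norm_smul, Real.norm_eq_abs]
    calc _ ≤ 1 * (‖P.cV G x‖ * (N * c2)) := by
          gcongr
          refine (ContinuousLinearMap.opNorm_comp_le _ _).trans ?_
          rw [innerSL_apply_norm]
          gcongr
          refine (ContinuousLinearMap.opNorm_comp_le _ _).trans ?_
          gcongr
          exact Dpk_norm_le_const hd _
      _ = _ := one_mul _
  have b3 : ‖(innerSL ℝ (P.cW u x)).comp (Dpk d (x - y) + P.σ • (tf (fderiv ℝ P.S x)).comp (Dpk d (P.S x - y)))‖ ≤ ‖P.cW u x‖ * (c2 + M * c2) := by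
    refine (ContinuousLinearMap.opNorm_comp_le _ _).trans ?_
    rw [innerSL_apply_norm]
    gcongr
    refine (norm_add_le _ _).trans (add_le_add (Dpk_norm_le_const hd _) ?_)
    rw [norm_smul, Real.norm_eq_abs]
    calc _ ≤ 1 * (M * c2) := by
          gcongr
          refine (ContinuousLinearMap.opNorm_comp_le _ _).trans ?_
          gcongr
          · exact hM x hxt
          · exact Dpk_norm_le_const hd _
      _ = _ := one_mul _
  calc ‖P.FD f G u d y x‖ ≤ |P.cA f G x| * (d⁻¹ + d⁻¹) + ‖P.cV G x‖ * (N * c2) + ‖P.cW u x‖ * (c2 + M * c2) :=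
        (norm_add_le _ _).trans (add_le_add ((norm_add_le _ _).trans (add_le_add b1 b2)) b3)
    _ = ((d⁻¹ + d⁻¹) * |P.cA f G x| + (N * c2) * ‖P.cV G x‖ + (c2 + M * c2) * ‖P.cW u x‖) * 1 := by ring
    _ ≤ (C * |P.cA f G x| + C * ‖P.cV G x‖ + C * ‖P.cW u x‖) * 1 :=
        lincomb3 (by positivity) (by positivity) (by positivity) le_rfl (abs_nonneg _) (norm_nonneg _) (norm_nonneg _) zero_le_one
    _ = C * (|P.cA f G x| + ‖P.cV G x‖ + ‖P.cW u x‖) := by ring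
    _ ≤ C * (B * (|f x| + (‖G x‖ + |u x|))) := by gcongr; exact h3 f G u x
    _ = _ := by ring

end Patch
end RegSec2


noncomputable section RegSec3

variable {Ω : Set E2} {x0 : E2}

structure Dat (Ω : Set E2) (f : E2 → ℝ) (G : E2 → E2) (u : E2 → ℝ) : Prop where
  hf : Measurable f
  hG : Measurable G
  hu : Measurable u
  W2 : ∫⁻ x in Ω, Wt f G u x ^ 2 ≠ ⊤

variable {f : E2 → ℝ} {G : E2 → E2} {u : E2 → ℝ}

lemma Dat.Wm (T : Dat Ω f G u) : Measurable (Wt f G u) := Wt_meas T.hf T.hG T.hu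

lemma Dat.W1 (T : Dat Ω f G u) (hb : IsBounded Ω) : ∫⁻ x in Ω, Wt f G u x ≠ ⊤ := by
  have h := cs_lintegral (μ := mu Ω) (f := fun _ => 1) (g := Wt f G u) aemeasurable_const T.Wm.aemeasurable
  simp only [one_mul, one_pow, lintegral_one] at h
  haveI : IsFiniteMeasure (mu Ω) := fin_meas hb
  intro h2
  have h3 : ∫⁻ x, Wt f G u x ∂(mu Ω) = ⊤ := h2
  rw [h3] at h
  have : (mu Ω) Set.univ * ∫⁻ x, Wt f G u x ^ 2 ∂(mu Ω) < ⊤ := ENNReal.mul_lt_top (measure_lt_top _ _) T.W2.lt_top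
  exact absurd (h.trans_lt this) (by simp)

lemma Dat.Wint (T : Dat Ω f G u) (hb : IsBounded Ω) : Integrable (fun x => |f x| + (‖G x‖ + |u x|)) (mu Ω) := by
  have hm : Measurable (fun x => |f x| + (‖G x‖ + |u x|)) := (T.hf.norm.add (T.hG.norm.add T.hu.norm))
  refine ⟨hm.aestronglyMeasurable, ?_⟩
  rw [hasFiniteIntegral_iff_ofReal (Eventually.of_forall fun x => by positivity)]
  refine lt_of_eq_of_lt ?_ (T.W1 hb).lt_top
  exact lintegral_congr fun x => (Patch.Wt_eq f G u x).symm

def good (Ω : Set E2) (f : E2 → ℝ) (G : E2 → E2) (u : E2 → ℝ) (y : E2) : Prop :=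
  ∫⁻ x in Ω, kk 1 x y * Wt f G u x ≠ ⊤ ∧ ∫⁻ x in Ω, kk (3/2) x y * Wt f G u x ≠ ⊤

lemma Dat.pot_meas (T : Dat Ω f G u) (s : ℝ) : Measurable (fun y => ∫⁻ x in Ω, kk s x y * Wt f G u x) :=
    Measurable.lintegral_prod_left' (f := fun p : E2 × E2 => kk s p.1 p.2 * Wt f G u p.1)
      ((kk_meas s).mul (T.Wm.comp measurable_fst))

lemma Dat.pot_fin (T : Dat Ω f G u) (hb : IsBounded Ω) {s : ℝ} (h0 : 0 < s) (hs : s < 2) :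
    ∫⁻ y in Ω, (∫⁻ x in Ω, kk s x y * Wt f G u x) ^ 2 ≠ ⊤ := by
  obtain ⟨K, hK, hk⟩ := kk_bound hb h0 hs
  refine ne_top_of_le_ne_top ?_ (pot_schur (μ := mu Ω) h0 T.Wm.aemeasurable hk)
  exact ENNReal.mul_ne_top (by finiteness) T.W2

lemma Dat.good_ae (T : Dat Ω f G u) (hb : IsBounded Ω) : ∀ᵐ y ∂(mu Ω), good Ω f G u y := by
  have key : ∀ s : ℝ, 0 < s → s < 2 → ∀ᵐ y ∂(mu Ω), ∫⁻ x in Ω, kk s x y * Wt f G u x ≠ ⊤ := by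
    intro s h0 hs
    filter_upwards [ae_lt_top ((T.pot_meas s).pow_const 2) (T.pot_fin hb h0 hs)] with y hy
    intro h
    rw [h] at hy
    simp at hy
  filter_upwards [key 1 one_pos (by norm_num), key (3/2) (by norm_num) (by norm_num)] with y h1 h2 using ⟨h1, h2⟩

namespace Patch
variable (P : Patch Ω x0)

def R0 (f : E2 → ℝ) (G : E2 → E2) (u : E2 → ℝ) (d : ℝ) (y : E2) : ℝ := ∫ x in Ω, P.FK f G u d y x
def R1 (f : E2 → ℝ) (G : E2 → E2) (u : E2 → ℝ) (d : ℝ) (y : E2) : E2 →L[ℝ] ℝ := ∫ x in Ω, P.FD f G u d y x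

lemma FK_crude {d : ℝ} (hd : 0 < d) (y : E2) : ∃ C : ℝ, 0 ≤ C ∧ ∀ (f : E2 → ℝ) (G : E2 → E2) (u : E2 → ℝ) x,
    ‖P.FK f G u d y x‖ ≤ C * (|f x| + (‖G x‖ + |u x|)) := by
  obtain ⟨B, hB, h3⟩ := P.coef_sum
  have hS := P.hS1.continuous
  have hC := P.Cm_cont
  have hp := (pk_contDiff hd (n := 0)).continuous
  have hl := (Lg_contDiff hd (n := 0)).continuous
  have c1 : Continuous (fun x => Lg d (x - y) + P.σ * Lg d (P.S x - y)) := by fun_prop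
  have c2 : Continuous (fun x => Cm (fderiv ℝ P.S x) (pk d (P.S x - y))) := by fun_prop
  have c3 : Continuous (fun x => Xf P.σ P.S d y x) := (Xf_contDiff P.σ P.hS2 hd y).continuous
  have c4 : Continuous (fun x => |Lg d (x - y) + P.σ * Lg d (P.S x - y)| + ‖Cm (fderiv ℝ P.S x) (pk d (P.S x - y))‖ + ‖Xf P.σ P.S d y x‖) :=
    (c1.abs.add c2.norm).add c3.norm
  obtain ⟨M, hM⟩ := P.hηc.isCompact.exists_bound_of_continuousOn c4.continuousOn
  have hM0 : 0 ≤ max M 0 := le_max_right _ _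
  refine ⟨max M 0 * B, by positivity, fun f G u x => ?_⟩
  by_cases hxt : x ∈ tsupport P.η
  swap
  · rw [P.FK_out f G u _ _ hxt, norm_zero]; positivity
  have hMx := (le_abs_self _).trans ((hM x hxt).trans (le_max_left M 0))
  have hn1 := abs_nonneg (Lg d (x - y) + P.σ * Lg d (P.S x - y))
  have hn2 := norm_nonneg (Cm (fderiv ℝ P.S x) (pk d (P.S x - y)))
  have hn3 := norm_nonneg (Xf P.σ P.S d y x)
  have b1 : |P.cA f G x * (Lg d (x - y) + P.σ * Lg d (P.S x - y))| ≤ |P.cA f G x| * max M 0 := by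
    rw [abs_mul]; gcongr; linarith
  have b2 : |P.σ * ⟪P.cV G x, Cm (fderiv ℝ P.S x) (pk d (P.S x - y))⟫| ≤ ‖P.cV G x‖ * max M 0 := by
    rw [abs_mul]
    calc _ ≤ 1 * (‖P.cV G x‖ * max M 0) := by
          gcongr
          · exact P.hσ
          · exact (abs_real_inner_le_norm _ _).trans (by gcongr; linarith)
      _ = _ := one_mul _
  have b3 : |⟪P.cW u x, Xf P.σ P.S d y x⟫| ≤ ‖P.cW u x‖ * max M 0 :=
    (abs_real_inner_le_norm _ _).trans (by gcongr; linarith)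
  calc ‖P.FK f G u d y x‖ ≤ |P.cA f G x| * max M 0 + ‖P.cV G x‖ * max M 0 + ‖P.cW u x‖ * max M 0 :=
        (abs_sub _ _).trans (add_le_add ((abs_sub _ _).trans (add_le_add b1 b2)) b3)
    _ = max M 0 * (|P.cA f G x| + ‖P.cV G x‖ + ‖P.cW u x‖) := by ring
    _ ≤ max M 0 * (B * (|f x| + (‖G x‖ + |u x|))) := by gcongr; exact h3 f G u x
    _ = _ := by ring

variable {P}
lemma FK_int_pos (T : Dat Ω f G u) (hb : IsBounded Ω) {d : ℝ} (hd : 0 < d) (y : E2) : Integrable (P.FK f G u d y) (mu Ω) := by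
  obtain ⟨C, hC, h⟩ := P.FK_crude hd y
  exact ((T.Wint hb).const_mul C).mono' (P.FK_meas T.hf T.hG T.hu d y).aestronglyMeasurable (Eventually.of_forall fun x => h f G u x)

lemma FD_int_pos (T : Dat Ω f G u) (hb : IsBounded Ω) {d : ℝ} (hd : 0 < d) (y : E2) : Integrable (P.FD f G u d y) (mu Ω) := by
  obtain ⟨C, hC, h⟩ := P.FD_crude hd
  exact ((T.Wint hb).const_mul C).mono' (P.FD_meas T.hf T.hG T.hu d y).aestronglyMeasurable (Eventually.of_forall fun x => h f G u y x)

lemma R0_hasFDerivAt (T : Dat Ω f G u) (hb : IsBounded Ω) {d : ℝ} (hd : 0 < d) (y : E2) :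
    HasFDerivAt (P.R0 f G u d) (P.R1 f G u d y) y := by
  obtain ⟨C, hC, h⟩ := P.FD_crude hd
  exact hasFDerivAt_integral_of_dominated_of_fderiv_le (s := Set.univ) (bound := fun x => C * (|f x| + (‖G x‖ + |u x|)))
    univ_mem (Eventually.of_forall fun y => (P.FK_meas T.hf T.hG T.hu d y).aestronglyMeasurable) (FK_int_pos T hb hd y)
    (P.FD_meas T.hf T.hG T.hu d y).aestronglyMeasurable (Eventually.of_forall fun x y _ => h f G u y x) ((T.Wint hb).const_mul C)
    (Eventually.of_forall fun x y _ => P.Fk_hasFDerivAt hd y x _ _ _)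

lemma clm_cc {F : Type*} [NormedAddCommGroup F] [NormedSpace ℝ F] (A : E2 →L[ℝ] F) {X : E2 → (E2 →L[ℝ] E2)} (hX : Continuous X) :
    Continuous (fun y => A.comp (X y)) := continuous_const.clm_comp hX

lemma clm_cs {F : Type*} [NormedAddCommGroup F] [NormedSpace ℝ F] (c : ℝ) {X : E2 → (E2 →L[ℝ] F)} (hX : Continuous X) :
    Continuous (fun y => c • X y) := (continuous_const_smul c).comp hX

lemma FD_cont {d : ℝ} (hd : 0 < d) (x : E2) : Continuous (fun y => P.FD f G u d y x) := by
  have hp := (pk_contDiff hd (n := 0)).continuous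
  have hD := Dpk_cont hd
  unfold FD Fd
  have c1 : Continuous (fun y => pk d (x - y) + P.σ • pk d (P.S x - y)) := by fun_prop
  have c2 : Continuous (fun y => Dpk d (x - y)) := by fun_prop
  have c3 : Continuous (fun y => Dpk d (P.S x - y)) := by fun_prop
  have t3 : Continuous (fun y => Dpk d (x - y) + P.σ • (tf (fderiv ℝ P.S x)).comp (Dpk d (P.S x - y))) :=
    c2.add (clm_cs _ (clm_cc _ c3))
  exact ((clm_cs _ ((innerSL ℝ (E := E2)).continuous.comp c1)).neg.add (clm_cs _ (clm_cc _ (clm_cc _ c3)))).add (clm_cc _ t3)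

lemma R1_cont (T : Dat Ω f G u) (hb : IsBounded Ω) {d : ℝ} (hd : 0 < d) : Continuous (P.R1 f G u d) := by
  obtain ⟨C, hC, h⟩ := P.FD_crude hd
  exact continuous_of_dominated (bound := fun x => C * (|f x| + (‖G x‖ + |u x|)))
    (fun y => (P.FD_meas T.hf T.hG T.hu d y).aestronglyMeasurable) (fun y => Eventually.of_forall fun x => h f G u y x)
    ((T.Wint hb).const_mul C) (Eventually.of_forall fun x => FD_cont hd x)

lemma R0_C1 (T : Dat Ω f G u) (hb : IsBounded Ω) {d : ℝ} (hd : 0 < d) : ContDiff ℝ 1 (P.R0 f G u d) := by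
  rw [contDiff_one_iff_fderiv]
  refine ⟨fun y => (R0_hasFDerivAt T hb hd y).differentiableAt, ?_⟩
  have : fderiv ℝ (P.R0 f G u d) = P.R1 f G u d := funext fun y => (R0_hasFDerivAt T hb hd y).fderiv
  rw [this]
  exact R1_cont T hb hd

lemma FK_int0 (T : Dat Ω f G u) (ho : IsOpen Ω) (hb : IsBounded Ω) {y : E2} (hy : y ∈ closure Ω) (hyb : y ∈ Metric.ball x0 P.r)
    (hg : good Ω f G u y) : Integrable (P.FK f G u 0 y) (mu Ω) := by
  obtain ⟨C, hC0, hC⟩ := P.F_bound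
  have h1 : Integrable (fun x => P.FK f G u 1 y x - P.FK f G u 0 y x) (mu Ω) := by
    refine ⟨((P.FK_meas T.hf T.hG T.hu 1 y).sub (P.FK_meas T.hf T.hG T.hu 0 y)).aestronglyMeasurable, ?_⟩
    refine lt_of_le_of_lt (lintegral_mono_ae (g := fun x => (C * ENNReal.ofReal (√1)) * (kk (3/2) x y * Wt f G u x)) ?_) ?_
    · filter_upwards [ae_restrict_mem ho.measurableSet, ae_ne y] with x hx hxy
      exact (hC f G u y hy hyb x hx hxy 1 zero_le_one le_rfl).2.2
    · rw [lintegral_const_mul' _ _ (by finiteness)]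
      exact ENNReal.mul_lt_top (by finiteness) hg.2.lt_top
  have h2 := (FK_int_pos (P := P) T hb one_pos y).sub h1
  exact h2.congr (Eventually.of_forall fun x => by simp)

lemma FD_int0 (T : Dat Ω f G u) (ho : IsOpen Ω) {y : E2} (hy : y ∈ closure Ω) (hyb : y ∈ Metric.ball x0 P.r)
    (hg : good Ω f G u y) : Integrable (P.FD f G u 0 y) (mu Ω) := by
  obtain ⟨C, hC0, hC⟩ := P.F_bound
  refine ⟨(P.FD_meas T.hf T.hG T.hu 0 y).aestronglyMeasurable, ?_⟩
  refine lt_of_le_of_lt (lintegral_mono_ae (g := fun x => C * (kk 1 x y * Wt f G u x)) ?_) ?_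
  · filter_upwards [ae_restrict_mem ho.measurableSet, ae_ne y] with x hx hxy
    exact (hC f G u y hy hyb x hx hxy 0 le_rfl zero_le_one).1
  · rw [lintegral_const_mul' _ _ (by finiteness)]
    exact ENNReal.mul_lt_top (by finiteness) hg.1.lt_top

variable (P)
lemma R_bound (ho : IsOpen Ω) (hb : IsBounded Ω) : ∃ C : ℝ≥0∞, C ≠ ⊤ ∧ ∀ (f : E2 → ℝ) (G : E2 → E2) (u : E2 → ℝ), Dat Ω f G u →
    ∀ y ∈ closure Ω, y ∈ Metric.ball x0 P.r → good Ω f G u y →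
    ‖P.R1 f G u 0 y‖ₑ ≤ C * ∫⁻ x in Ω, kk 1 x y * Wt f G u x ∧ ∀ d : ℝ, 0 < d → d ≤ 1 →
    ‖P.R1 f G u d y - P.R1 f G u 0 y‖ₑ ≤ C * ENNReal.ofReal (√d) * ∫⁻ x in Ω, kk (3/2) x y * Wt f G u x ∧
    ‖P.R0 f G u d y - P.R0 f G u 0 y‖ₑ ≤ C * ENNReal.ofReal (√d) * ∫⁻ x in Ω, kk (3/2) x y * Wt f G u x := by
  obtain ⟨C, hC0, hC⟩ := P.F_bound
  refine ⟨C, hC0, fun f G u T y hy hyb hg => ⟨?_, fun d hd hd1 => ⟨?_, ?_⟩⟩⟩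
  · rw [R1, ← lintegral_const_mul' _ _ hC0]
    refine (enorm_integral_le_lintegral_enorm _).trans (lintegral_mono_ae ?_)
    filter_upwards [ae_restrict_mem ho.measurableSet, ae_ne y] with x hx hxy
    exact (hC f G u y hy hyb x hx hxy 0 le_rfl zero_le_one).1
  · rw [R1, R1, ← integral_sub (FD_int_pos T hb hd y) (FD_int0 T ho hy hyb hg), ← lintegral_const_mul' _ _ (by finiteness)]
    refine (enorm_integral_le_lintegral_enorm _).trans (lintegral_mono_ae ?_)
    filter_upwards [ae_restrict_mem ho.measurableSet, ae_ne y] with x hx hxy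
    exact (hC f G u y hy hyb x hx hxy d hd.le hd1).2.1
  · rw [R0, R0, ← integral_sub (FK_int_pos T hb hd y) (FK_int0 T ho hb hy hyb hg), ← lintegral_const_mul' _ _ (by finiteness)]
    refine (enorm_integral_le_lintegral_enorm _).trans (lintegral_mono_ae ?_)
    filter_upwards [ae_restrict_mem ho.measurableSet, ae_ne y] with x hx hxy
    exact (hC f G u y hy hyb x hx hxy d hd.le hd1).2.2

/-- with the weak equation, the two representations agree for positive `d` -/
lemma TT_eq_R0 (hb : IsBounded Ω) {U : HH Ω} (T : Dat Ω f (GG U) (uu U))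
    (hw : ∀ φ : E2 → ℝ, ContDiff ℝ 1 φ → ∫ x in Ω, ⟪GG U x, gradient φ x⟫ = ∫ x in Ω, f x * φ x) {d : ℝ} (hd : 0 < d) (y : E2) :
    P.TT d U y = P.R0 f (GG U) (uu U) d y := by
  set N : E2 → ℝ := fun x => Lg d (x - y) + P.σ * Lg d (P.S x - y) with hN
  have hNc : ContDiff ℝ 1 N := ((Lg_contDiff hd).comp (contDiff_id.sub contDiff_const)).add
    (contDiff_const.mul ((Lg_contDiff hd).comp (P.hS1.sub contDiff_const)))
  have hNg : ∀ x, gradient N x = Xf P.σ P.S d y x - P.σ • Cm (fderiv ℝ P.S x) (pk d (P.S x - y)) := by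
    intro x
    have h1 : HasFDerivAt (fun x => Lg d (x - y)) ((innerSL ℝ (pk d (x - y))).comp (ContinuousLinearMap.id ℝ E2)) x :=
      HasFDerivAt.comp (g := Lg d) (f := fun x => x - y) x (Lg_hasFDerivAt hd (x - y)) ((hasFDerivAt_id x).sub_const y)
    have h2 : HasFDerivAt (fun x => Lg d (P.S x - y)) ((innerSL ℝ (pk d (P.S x - y))).comp (fderiv ℝ P.S x)) x :=
      HasFDerivAt.comp (g := Lg d) (f := fun x => P.S x - y) x (Lg_hasFDerivAt hd (P.S x - y))
        (((P.hS1.differentiable (by norm_num) x).hasFDerivAt).sub_const y)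
    have h3 := (h1.add (h2.const_mul P.σ)).fderiv
    refine ext_inner_right ℝ fun z => ?_
    have e : ⟪gradient N x, z⟫ = fderiv ℝ N x z := by
      rw [gradient, InnerProductSpace.toDual_symm_apply]
    rw [e, hN]
    erw [h3]
    have htf : tf (fderiv ℝ P.S x) = ContinuousLinearMap.adjoint (fderiv ℝ P.S x) + Cm (fderiv ℝ P.S x) := by
      simp only [tf, Cm]; abel
    rw [Xf, htf]
    simp only [_root_.add_apply, smul_add, inner_add_left, inner_sub_left, inner_smul_left, ContinuousLinearMap.adjoint_inner_left,
      ContinuousLinearMap.comp_apply, _root_.smul_apply, innerSL_apply_apply, ContinuousLinearMap.id_apply, smul_eq_mul]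
    simp
    ring
  have h := hw (fun x => P.η x * N x) (P.hη.mul hNc)
  have hc : ∀ x, P.FK f (GG U) (uu U) d y x = - ⟪P.Tv (GG U x) (uu U x) x, Xf P.σ P.S d y x⟫ +
      (⟪GG U x, gradient (fun x => P.η x * N x) x⟫ - f x * (P.η x * N x)) := by
    intro x
    rw [gradient_mul' P.hη hNc, hNg, FK, Fk, Tv, cA, cV, cW]
    simp only [inner_add_left, inner_add_right, inner_sub_right, inner_smul_left, inner_smul_right, hN]
    simp
    ring
  have hUm := GG_memLp U
  have hG1 : Integrable (GG U) (mu Ω) := (T.Wint hb).mono' T.hG.aestronglyMeasurable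
    (Eventually.of_forall fun x => by have := abs_nonneg (f x); have := abs_nonneg (uu U x); linarith)
  have hf1 : Integrable f (mu Ω) := (T.Wint hb).mono' T.hf.aestronglyMeasurable
    (Eventually.of_forall fun x => by rw [Real.norm_eq_abs]; have := norm_nonneg (GG U x); have := abs_nonneg (uu U x); linarith)
  have hηN : ContDiff ℝ 1 (fun x => P.η x * N x) := P.hη.mul hNc
  have hcs : HasCompactSupport (fun x => P.η x * N x) := P.hηc.mul_right
  obtain ⟨B1, hB1⟩ := hcs.exists_bound_of_continuous hηN.continuous
  have hcs2 : HasCompactSupport (gradient (fun x => P.η x * N x)) := by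
    refine (hcs.fderiv ℝ).mono' ?_
    intro x hx
    refine subset_closure ?_
    intro h0
    apply hx
    unfold gradient
    rw [h0, map_zero]
  obtain ⟨B2, hB2⟩ := hcs2.exists_bound_of_continuous (gradient_cont hηN)
  have i1 : Integrable (fun x => ⟪GG U x, gradient (fun x => P.η x * N x) x⟫) (mu Ω) := by
    refine (hG1.norm.mul_const B2).mono' (T.hG.inner (gradient_cont hηN).measurable).aestronglyMeasurable (Eventually.of_forall fun x => ?_)
    exact (norm_inner_le_norm _ _).trans (by gcongr; exact hB2 x)
  have i2 : Integrable (fun x => f x * (P.η x * N x)) (mu Ω) := by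
    refine (hf1.norm.mul_const B1).mono' (T.hf.mul hηN.continuous.measurable).aestronglyMeasurable (Eventually.of_forall fun x => ?_)
    rw [norm_mul]; gcongr; exact hB1 x
  have i3 : Integrable (fun x => ⟪P.Tv (GG U x) (uu U x) x, Xf P.σ P.S d y x⟫) (mu Ω) := by
    have := ((FK_int_pos (P := P) T hb hd y).sub (i1.sub i2)).neg
    refine this.congr (Eventually.of_forall fun x => ?_)
    simp only [Pi.neg_apply, Pi.sub_apply]
    rw [hc]; ring
  rw [TT, R0]
  simp_rw [hc]
  have i3' : Integrable (fun x => -⟪P.Tv (GG U x) (uu U x) x, Xf P.σ P.S d y x⟫) (mu Ω) := i3.neg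
  have i12 : Integrable (fun x => ⟪GG U x, gradient (fun x => P.η x * N x) x⟫ - f x * (P.η x * N x)) (mu Ω) := i1.sub i2
  rw [integral_add i3' i12, integral_neg, integral_sub i1 i2, h]
  ring

lemma rep0 (ho : IsOpen Ω) (hb : IsBounded Ω) {U : HH Ω} (hU : U ∈ H1 Ω) (T : Dat Ω f (GG U) (uu U))
    (hw : ∀ φ : E2 → ℝ, ContDiff ℝ 1 φ → ∫ x in Ω, ⟪GG U x, gradient φ x⟫ = ∫ x in Ω, f x * φ x) :
    ∀ᵐ y ∂(mu Ω), y ∈ Metric.ball x0 P.r → c0 * uu U y = P.R0 f (GG U) (uu U) 0 y := by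
  obtain ⟨C, hC0, hC⟩ := P.TT_bound ho
  obtain ⟨C', hC0', hC'⟩ := P.R_bound ho hb
  filter_upwards [P.rep ho hb hU, ae_restrict_mem ho.measurableSet, T.good_ae hb, good_ae hb one_pos (by norm_num) U,
    good_ae hb (by norm_num : (0:ℝ) < 3/2) (by norm_num) U] with y h1 hy hg h3 h4 hyb
  rw [h1 hyb]
  have hyc := subset_closure hy
  have hs : Tendsto (fun n : ℕ => ENNReal.ofReal (√(1 / ((n:ℝ) + 1)))) atTop (𝓝 0) := by
    have := ((Real.continuous_sqrt.tendsto 0).comp (tendsto_one_div_add_atTop_nhds_zero_nat (𝕜 := ℝ)))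
    rw [Real.sqrt_zero] at this
    have h2 := (ENNReal.continuous_ofReal.tendsto 0).comp this
    rw [ENNReal.ofReal_zero] at h2; exact h2
  have hpos : ∀ n : ℕ, (0:ℝ) < 1 / ((n:ℝ) + 1) := fun n => by positivity
  have hle : ∀ n : ℕ, 1 / ((n:ℝ) + 1) ≤ (1:ℝ) := fun n => by
    rw [div_le_one (by positivity)]; have : (0:ℝ) ≤ n := by positivity
    linarith
  have t1 : Tendsto (fun n : ℕ => P.TT (1 / ((n:ℝ) + 1)) U y) atTop (𝓝 (P.TT 0 U y)) := by
    rw [tendsto_iff_edist_tendsto_0]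
    have := ENNReal.Tendsto.mul_const (b := ∫⁻ x in Ω, kk (3/2) x y * gg U x) (ENNReal.Tendsto.const_mul (a := C) hs (Or.inr hC0)) (Or.inr h4)
    rw [mul_zero, zero_mul] at this
    exact tendsto_of_tendsto_of_tendsto_of_le_of_le tendsto_const_nhds this (fun _ => zero_le)
      (fun n => by rw [edist_eq_enorm_sub]; exact (hC y hyc hyb _ (hpos n).le U U h3).2.1)
  have t2 : Tendsto (fun n : ℕ => P.R0 f (GG U) (uu U) (1 / ((n:ℝ) + 1)) y) atTop (𝓝 (P.R0 f (GG U) (uu U) 0 y)) := by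
    rw [tendsto_iff_edist_tendsto_0]
    have := ENNReal.Tendsto.mul_const (b := ∫⁻ x in Ω, kk (3/2) x y * Wt f (GG U) (uu U) x) (ENNReal.Tendsto.const_mul (a := C') hs (Or.inr hC0')) (Or.inr hg.2)
    rw [mul_zero, zero_mul] at this
    exact tendsto_of_tendsto_of_tendsto_of_le_of_le tendsto_const_nhds this (fun _ => zero_le)
      (fun n => by rw [edist_eq_enorm_sub]; exact ((hC' f _ _ T y hyc hyb hg).2 _ (hpos n) (hle n)).2)
  refine tendsto_nhds_unique t1 (t2.congr fun n => ?_)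
  rw [P.TT_eq_R0 hb T hw (hpos n)]

end Patch
end RegSec3


noncomputable section RegSec4

variable {Ω : Set E2} {x0 : E2} {f : E2 → ℝ} {G : E2 → E2} {u : E2 → ℝ}

lemma ibp {φ ψ : E2 → ℝ} (hφ : ContDiff ℝ 1 φ) (hψ : ContDiff ℝ 1 ψ) (hc : HasCompactSupport ψ) (hs : tsupport ψ ⊆ Ω) (v : E2) :
    ∫ x in Ω, (φ x * fderiv ℝ ψ x v + fderiv ℝ φ x v * ψ x) = 0 := by
  have h := int_fderiv_zero (hφ.mul hψ) (hc.mul_left) v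
  rw [← h, setIntegral_eq_integral_of_forall_compl_eq_zero]
  · refine integral_congr_ae (Eventually.of_forall fun x => ?_)
    have := fderiv_mul (hφ.differentiable (by norm_num) x) (hψ.differentiable (by norm_num) x)
    have e : fderiv ℝ (fun x => φ x * ψ x) x v = φ x * fderiv ℝ ψ x v + fderiv ℝ φ x v * ψ x := by
      erw [this]; simp; ring
    exact e.symm
  · intro x hx
    have hx' : x ∉ tsupport ψ := fun h => hx (hs h)
    rw [image_eq_zero_of_notMem_tsupport hx', fderiv_of_notMem_tsupport ℝ hx']
    simp

lemma weak_deriv (hb : IsBounded Ω) {U : HH Ω} (hU : U ∈ H1 Ω) {ψ : E2 → ℝ} (hψ : ContDiff ℝ 1 ψ) (hc : HasCompactSupport ψ)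
    (hs : tsupport ψ ⊆ Ω) (v : E2) : (∫ x in Ω, uu U x * fderiv ℝ ψ x v) + ∫ x in Ω, ⟪GG U x, v⟫ * ψ x = 0 := by
  have c1 : Continuous (fun x => fderiv ℝ ψ x v) := (hψ.continuous_fderiv (by norm_num)).clm_apply continuous_const
  have c2 : Continuous (fun x => ψ x • v) := hψ.continuous.smul continuous_const
  obtain ⟨V, hV1, hV2⟩ := exists_HH (cont_memLp hb c1) (cont_memLp hb c2)
  have key : ∀ W : HH Ω, ⟪W, V⟫ = (∫ x in Ω, uu W x * fderiv ℝ ψ x v) + ∫ x in Ω, ⟪GG W x, v⟫ * ψ x := by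
    intro W
    rw [HH_inner]
    congr 1
    · refine integral_congr_ae ?_
      filter_upwards [hV1] with x hx; rw [hx]
    · refine integral_congr_ae ?_
      filter_upwards [hV2] with x hx; rw [hx, inner_smul_right, mul_comm]
  rw [← key]
  have : H1 Ω ≤ (C1sub Ω).topologicalClosure := le_rfl
  refine closure_minimal (t := {W : HH Ω | ⟪W, V⟫ = 0}) ?_ (isClosed_eq (by fun_prop) continuous_const) hU
  rintro W ⟨φ, hφ⟩
  show ⟪W, V⟫ = 0
  rw [key, ← integral_add, ← ibp hφ.c1 hψ hc hs v]
  · refine integral_congr_ae ?_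
    filter_upwards [hφ.hu, hφ.hG] with x h1 h2
    rw [h1, h2, gr_inner]
  · exact (uu_memLp W).integrable_mul (cont_memLp hb c1)
  · have := (GG_memLp W).norm
    refine Integrable.mono' (((this.integrable_mul (cont_memLp hb hψ.continuous).norm)).const_mul ‖v‖)
      (((GG_sm W).measurable.inner measurable_const).mul hψ.continuous.measurable).aestronglyMeasurable (Eventually.of_forall fun x => ?_)
    rw [norm_mul]
    simp only [Pi.mul_apply]
    calc _ ≤ (‖GG W x‖ * ‖v‖) * ‖ψ x‖ := by gcongr; exact norm_inner_le_norm _ _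
      _ = _ := by ring

def Ph (Ω : Set E2) (f : E2 → ℝ) (G : E2 → E2) (u : E2 → ℝ) (s : ℝ) (y : E2) : ℝ := (∫⁻ x in Ω, kk s x y * Wt f G u x).toReal

lemma Dat.Ph_int (T : Dat Ω f G u) (hb : IsBounded Ω) {s : ℝ} (h0 : 0 < s) (hs : s < 2) : Integrable (Ph Ω f G u s) (mu Ω) := by
  haveI : IsFiniteMeasure (mu Ω) := fin_meas hb
  have : MemLp (Ph Ω f G u s) 2 (mu Ω) := by
    refine ⟨(T.pot_meas s).ennreal_toReal.aestronglyMeasurable, ?_⟩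
    rw [eLpNorm_lt_top_iff_lintegral_rpow_enorm_lt_top (by norm_num) (by norm_num)]
    refine lt_of_le_of_lt (lintegral_mono fun y => ?_) (T.pot_fin hb h0 hs).lt_top
    rw [← ENNReal.rpow_natCast]
    norm_num
    rw [Ph, ← ofReal_norm, Real.norm_eq_abs, abs_of_nonneg ENNReal.toReal_nonneg]
    gcongr
    exact ENNReal.ofReal_toReal_le
  exact this.integrable (by norm_num)

lemma Ph_nonneg (s : ℝ) (y : E2) : 0 ≤ Ph Ω f G u s y := ENNReal.toReal_nonneg

lemma sqrt_seq : Tendsto (fun n : ℕ => √(1 / ((n:ℝ) + 1))) atTop (𝓝 0) := by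
  have := ((Real.continuous_sqrt.tendsto 0).comp (tendsto_one_div_add_atTop_nhds_zero_nat (𝕜 := ℝ)))
  rw [Real.sqrt_zero] at this
  exact this

lemma seq_pos (n : ℕ) : (0:ℝ) < 1 / ((n:ℝ) + 1) := by positivity
lemma seq_le (n : ℕ) : 1 / ((n:ℝ) + 1) ≤ (1:ℝ) := by
  rw [div_le_one (by positivity)]; have : (0:ℝ) ≤ n := by positivity
  linarith

namespace Patch
variable (P : Patch Ω x0)

lemma R_bdR (ho : IsOpen Ω) (hb : IsBounded Ω) : ∃ C : ℝ, 0 ≤ C ∧ ∀ (f : E2 → ℝ) (G : E2 → E2) (u : E2 → ℝ), Dat Ω f G u →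
    ∀ y ∈ closure Ω, y ∈ Metric.ball x0 P.r → good Ω f G u y →
    ‖P.R1 f G u 0 y‖ ≤ C * Ph Ω f G u 1 y ∧ ∀ d : ℝ, 0 < d → d ≤ 1 →
    ‖P.R1 f G u d y - P.R1 f G u 0 y‖ ≤ C * √d * Ph Ω f G u (3/2) y ∧
    |P.R0 f G u d y - P.R0 f G u 0 y| ≤ C * √d * Ph Ω f G u (3/2) y := by
  obtain ⟨C, hC0, hC⟩ := P.R_bound ho hb
  have cv : ∀ {F : Type} [NormedAddCommGroup F] (z : F) (d : ℝ), 0 ≤ d → ∀ A : ℝ≥0∞, A ≠ ⊤ → ‖z‖ₑ ≤ C * ENNReal.ofReal d * A →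
      ‖z‖ ≤ C.toReal * d * A.toReal := by
    intro F _ z d hd A hA h
    have := ENNReal.toReal_mono (by finiteness) h
    rwa [toReal_enorm, ENNReal.toReal_mul, ENNReal.toReal_mul, ENNReal.toReal_ofReal hd] at this
  refine ⟨C.toReal, ENNReal.toReal_nonneg, fun f G u T y hy hyb hg => ⟨?_, fun d hd hd1 => ⟨?_, ?_⟩⟩⟩
  · have := cv _ 1 zero_le_one _ hg.1 (by simpa using (hC f G u T y hy hyb hg).1)
    simpa [Ph] using this
  · exact cv _ _ (Real.sqrt_nonneg d) _ hg.2 ((hC f G u T y hy hyb hg).2 d hd hd1).1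
  · exact cv _ _ (Real.sqrt_nonneg d) _ hg.2 ((hC f G u T y hy hyb hg).2 d hd hd1).2

lemma lim_aux {F : Type*} [NormedAddCommGroup F] {C p : ℝ} {A : ℕ → F} {B : F} (h : ∀ n : ℕ, ‖A n - B‖ ≤ C * √(1 / ((n:ℝ) + 1)) * p) :
    Tendsto A atTop (𝓝 B) := by
  rw [tendsto_iff_norm_sub_tendsto_zero]
  have := (sqrt_seq.const_mul C).mul_const p
  rw [mul_zero, zero_mul] at this
  exact tendsto_of_tendsto_of_tendsto_of_le_of_le tendsto_const_nhds this (fun _ => norm_nonneg _) h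

/-- passing to the limit in an integral against a bounded test function supported in the ball -/
lemma lim_int (ho : IsOpen Ω) {A : ℕ → E2 → ℝ} {B : E2 → ℝ} {p q ψ : E2 → ℝ} {C b : ℝ} {V : Set E2} (hC : 0 ≤ C)
    (hA : ∀ n, Measurable (A n)) (hψ : Measurable ψ) (hψb : ∀ x, |ψ x| ≤ b) (hψs : ∀ x, x ∉ V → ψ x = 0)
    (hp : Integrable p (mu Ω)) (hp0 : ∀ x, 0 ≤ p x) (hq : Integrable q (mu Ω))
    (h : ∀ᵐ y ∂(mu Ω), y ∈ V → |B y| ≤ q y ∧ ∀ n : ℕ, |A n y - B y| ≤ C * √(1 / ((n:ℝ) + 1)) * p y) :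
    Integrable (fun y => B y * ψ y) (mu Ω) ∧ Tendsto (fun n => ∫ y in Ω, A n y * ψ y) atTop (𝓝 (∫ y in Ω, B y * ψ y)) := by
  have hl : ∀ᵐ y ∂(mu Ω), Tendsto (fun n => A n y * ψ y) atTop (𝓝 (B y * ψ y)) := by
    filter_upwards [h] with y hy
    by_cases hyV : y ∈ V
    · exact (lim_aux (hy hyV).2).mul_const _
    · simp [hψs y hyV]
  constructor
  · refine Integrable.mono' (hq.norm.mul_const b) (aestronglyMeasurable_of_tendsto_ae atTop (fun n => ((hA n).mul hψ).aestronglyMeasurable) hl) ?_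
    filter_upwards [h] with y hy
    have hb0 : 0 ≤ b := (abs_nonneg _).trans (hψb y)
    by_cases hyV : y ∈ V
    · rw [norm_mul]; gcongr
      · exact (hy hyV).1.trans (le_abs_self _)
      · exact hψb y
    · simp only [hψs y hyV, mul_zero, norm_zero]; positivity
  · refine tendsto_integral_of_dominated_convergence (fun y => (C * p y + ‖q y‖) * b) (fun n => ((hA n).mul hψ).aestronglyMeasurable)
      (((hp.const_mul C).add hq.norm).mul_const b) (fun n => ?_) hl
    filter_upwards [h] with y hy
    have hb0 : 0 ≤ b := (abs_nonneg _).trans (hψb y)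
    have hpy := hp0 y
    by_cases hyV : y ∈ V
    · obtain ⟨h1, h2⟩ := hy hyV
      have h3 : |A n y| ≤ C * p y + ‖q y‖ := by
        have h4 : C * √(1 / ((n:ℝ) + 1)) * p y ≤ C * 1 * p y := by
          gcongr
          exact Real.sqrt_le_one.2 (seq_le n)
        calc |A n y| = |(A n y - B y) + B y| := by ring_nf
          _ ≤ |A n y - B y| + |B y| := abs_add_le _ _
          _ ≤ C * p y + ‖q y‖ := by
            have := h2 n; have := h1.trans (le_abs_self (q y)); rw [Real.norm_eq_abs]; linarith
      rw [norm_mul]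
      exact mul_le_mul h3 (hψb y) (abs_nonneg _) (by positivity)
    · simp only [hψs y hyV, mul_zero, norm_zero]; positivity

lemma grad0 (ho : IsOpen Ω) (hb : IsBounded Ω) {U : HH Ω} (hU : U ∈ H1 Ω) (T : Dat Ω f (GG U) (uu U))
    (hw : ∀ φ : E2 → ℝ, ContDiff ℝ 1 φ → ∫ x in Ω, ⟪GG U x, gradient φ x⟫ = ∫ x in Ω, f x * φ x) :
    ∀ᵐ y ∂(mu Ω), y ∈ Metric.ball x0 P.r → c0 • innerSL ℝ (GG U y) = P.R1 f (GG U) (uu U) 0 y := by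
  haveI : IsFiniteMeasure (mu Ω) := fin_meas hb
  obtain ⟨C, hC0, hC⟩ := P.R_bdR ho hb
  have hbd : ∀ᵐ y ∂(mu Ω), y ∈ Metric.ball x0 P.r → (|c0 * uu U y| ≤ |c0 * uu U y| ∧ ∀ n : ℕ,
      |P.R0 f (GG U) (uu U) (1 / ((n:ℝ) + 1)) y - c0 * uu U y| ≤ C * √(1 / ((n:ℝ) + 1)) * Ph Ω f (GG U) (uu U) (3/2) y) ∧
      ∀ v, |P.R1 f (GG U) (uu U) 0 y v| ≤ C * Ph Ω f (GG U) (uu U) 1 y * ‖v‖ ∧ ∀ n : ℕ,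
      |P.R1 f (GG U) (uu U) (1 / ((n:ℝ) + 1)) y v - P.R1 f (GG U) (uu U) 0 y v| ≤ (C * ‖v‖) * √(1 / ((n:ℝ) + 1)) * Ph Ω f (GG U) (uu U) (3/2) y := by
    filter_upwards [P.rep0 ho hb hU T hw, ae_restrict_mem ho.measurableSet, T.good_ae hb] with y h1 hy hg hyb
    obtain ⟨a1, a2⟩ := hC _ _ _ T y (subset_closure hy) hyb hg
    refine ⟨⟨le_rfl, fun n => ?_⟩, fun v => ⟨?_, fun n => ?_⟩⟩
    · rw [h1 hyb]; exact (a2 _ (seq_pos n) (seq_le n)).2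
    · exact (ContinuousLinearMap.le_opNorm (P.R1 f (GG U) (uu U) 0 y) v).trans (by gcongr)
    · rw [← Real.norm_eq_abs, ← _root_.sub_apply]
      refine (ContinuousLinearMap.le_opNorm (P.R1 f (GG U) (uu U) (1 / ((n:ℝ) + 1)) y - P.R1 f (GG U) (uu U) 0 y) v).trans ?_
      calc _ ≤ (C * √(1 / ((n:ℝ) + 1)) * Ph Ω f (GG U) (uu U) (3/2) y) * ‖v‖ := by gcongr; exact (a2 _ (seq_pos n) (seq_le n)).1
        _ = _ := by ring
  have hu1 : Integrable (uu U) (mu Ω) := (uu_memLp U).integrable (by norm_num)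
  have hG1 : Integrable (GG U) (mu Ω) := (GG_memLp U).integrable (by norm_num)
  have key : ∀ v : E2, ∀ᵐ y ∂(mu Ω), y ∈ Metric.ball x0 P.r → c0 * ⟪GG U y, v⟫ - P.R1 f (GG U) (uu U) 0 y v = 0 := by
    intro v
    have hO : IsOpen (Ω ∩ Metric.ball x0 P.r) := ho.inter Metric.isOpen_ball
    have hGv : Integrable (fun y => ⟪GG U y, v⟫) (mu Ω) := by simpa [real_inner_comm] using hG1.const_inner (𝕜 := ℝ) v
    -- the function is integrable near the set
    have hm1 : ∀ n : ℕ, Measurable (fun y => P.R1 f (GG U) (uu U) (1 / ((n:ℝ) + 1)) y v) := fun n =>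
      ((R1_cont T hb (seq_pos n)).clm_apply continuous_const).measurable
    have hlb := lim_int ho (V := Metric.ball x0 P.r) (ψ := (Metric.ball x0 P.r).indicator 1) (b := 1) (mul_nonneg hC0 (norm_nonneg v)) hm1
      (measurable_one.indicator Metric.isOpen_ball.measurableSet) (fun x => by
        by_cases h : x ∈ Metric.ball x0 P.r <;> simp [h]) (fun x hx => by simp only [Set.indicator_of_notMem hx])
      (T.Ph_int hb (by norm_num) (by norm_num)) (fun x => Ph_nonneg _ _) (((T.Ph_int hb one_pos (by norm_num)).const_mul C).mul_const ‖v‖)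
      (hbd.mono fun y hy hyb => (hy hyb).2 v)
    have hli : IntegrableOn (fun y => c0 * ⟪GG U y, v⟫ - P.R1 f (GG U) (uu U) 0 y v) (Ω ∩ Metric.ball x0 P.r) := by
      have h1 : IntegrableOn (fun y => P.R1 f (GG U) (uu U) 0 y v) (Ω ∩ Metric.ball x0 P.r) := by
        have h2 : IntegrableOn (fun y => P.R1 f (GG U) (uu U) 0 y v * (Metric.ball x0 P.r).indicator 1 y) (Ω ∩ Metric.ball x0 P.r) :=
          IntegrableOn.mono_set hlb.1 Set.inter_subset_left
        refine h2.congr_fun (fun y hy => ?_) hO.measurableSet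
        simp [Set.indicator_of_mem hy.2]
      exact (IntegrableOn.mono_set (hGv.const_mul c0) Set.inter_subset_left).sub h1
    have h0 := hO.ae_eq_zero_of_integral_contDiff_smul_eq_zero hli.locallyIntegrableOn ?_
    · filter_upwards [ae_restrict_of_ae h0, ae_restrict_mem ho.measurableSet] with y hy hyo hyb using hy ⟨hyo, hyb⟩
    intro ψ hψ hψc hψs
    have hψ1 : ContDiff ℝ 1 ψ := hψ.of_le (by exact_mod_cast le_top)
    have hψO : tsupport ψ ⊆ Ω := hψs.trans Set.inter_subset_left
    have c1 : Continuous (fun x => fderiv ℝ ψ x v) := (hψ1.continuous_fderiv (by norm_num)).clm_apply continuous_const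
    obtain ⟨b1, hb1⟩ := hψc.exists_bound_of_continuous hψ1.continuous
    obtain ⟨b2, hb2⟩ := (hψc.fderiv_apply ℝ v).exists_bound_of_continuous c1
    have l1 := lim_int ho (V := Metric.ball x0 P.r) (ψ := ψ) (mul_nonneg hC0 (norm_nonneg v)) hm1 hψ1.continuous.measurable hb1
      (fun x hx => image_eq_zero_of_notMem_tsupport fun h => hx (hψs h).2)
      (T.Ph_int hb (by norm_num) (by norm_num)) (fun x => Ph_nonneg _ _) (((T.Ph_int hb one_pos (by norm_num)).const_mul C).mul_const ‖v‖)
      (hbd.mono fun y hy hyb => (hy hyb).2 v)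
    have l2 := lim_int ho (V := Metric.ball x0 P.r) (ψ := fun x => fderiv ℝ ψ x v) hC0 (fun n => (R0_C1 (P := P) T hb (seq_pos n)).continuous.measurable)
      c1.measurable hb2
      (fun x hx => by rw [fderiv_of_notMem_tsupport ℝ fun h => hx (hψs h).2]; rfl)
      (T.Ph_int hb (by norm_num) (by norm_num)) (fun x => Ph_nonneg _ _) ((hu1.const_mul c0).abs)
      (hbd.mono fun y hy hyb => (hy hyb).1)
    have hsum : ∀ n : ℕ, (∫ y in Ω, P.R0 f (GG U) (uu U) (1 / ((n:ℝ) + 1)) y * fderiv ℝ ψ y v) +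
        ∫ y in Ω, P.R1 f (GG U) (uu U) (1 / ((n:ℝ) + 1)) y v * ψ y = 0 := by
      intro n
      have h := ibp (R0_C1 (P := P) T hb (seq_pos n)) hψ1 hψc hψO v
      have e : ∀ y, fderiv ℝ (P.R0 f (GG U) (uu U) (1 / ((n:ℝ) + 1))) y = P.R1 f (GG U) (uu U) (1 / ((n:ℝ) + 1)) y :=
        fun y => (R0_hasFDerivAt T hb (seq_pos n) y).fderiv
      simp only [e] at h
      rw [← h, integral_add]
      · exact Continuous.integrable_of_hasCompactSupport ((R0_C1 T hb (seq_pos n)).continuous.mul c1) (hψc.fderiv_apply ℝ v).mul_left |>.restrict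
      · exact Continuous.integrable_of_hasCompactSupport (((R1_cont T hb (seq_pos n)).clm_apply continuous_const).mul hψ1.continuous) hψc.mul_left |>.restrict
    have hz := tendsto_nhds_unique ((l2.2.add l1.2).congr hsum) tendsto_const_nhds
    have hwd := weak_deriv hb hU hψ1 hψc hψO v
    have e1 : ∫ y in Ω, c0 * uu U y * fderiv ℝ ψ y v = c0 * ∫ y in Ω, uu U y * fderiv ℝ ψ y v := by
      rw [← integral_const_mul]; congr 1; ext y; ring
    rw [← setIntegral_eq_integral_of_forall_compl_eq_zero (s := Ω)
      (fun x hx => by rw [image_eq_zero_of_notMem_tsupport fun h => hx (hψO h), zero_smul])]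
    have i1 : Integrable (fun y => ⟪GG U y, v⟫ * ψ y) (mu Ω) := hGv.mul_bdd (c := b1) hψ1.continuous.aestronglyMeasurable (Eventually.of_forall hb1)
    have e2 : ∫ y in Ω, ψ y • (c0 * ⟪GG U y, v⟫ - P.R1 f (GG U) (uu U) 0 y v) = c0 * (∫ y in Ω, ⟪GG U y, v⟫ * ψ y) -
        ∫ y in Ω, P.R1 f (GG U) (uu U) 0 y v * ψ y := by
      rw [← integral_const_mul, ← integral_sub (i1.const_mul c0) l1.1]; congr 1; ext y; rw [smul_eq_mul]; ring
    rw [e2]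
    rw [e1] at hz
    linear_combination c0 * hwd - hz
  filter_upwards [key (ee 0), key (ee 1)] with y h0 h1 hyb
  refine ContinuousLinearMap.ext fun w => ?_
  have h0 := h0 hyb
  have h1 := h1 hyb
  rw [eq2 w, map_add, map_add, map_smul, map_smul, map_smul, map_smul]
  simp only [_root_.smul_apply, innerSL_apply_apply, smul_eq_mul]
  linear_combination w 0 * h0 + w 1 * h1

end Patch
end RegSec4


noncomputable section SupSec

variable {Ω : Set E2} {x0 : E2} {ε b M : ℝ}

def ff (M ε b : ℝ) (U : HH Ω) (x : E2) : ℝ := (hM M (uu U x) - b * uu U x) / ε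

lemma ff_meas (U : HH Ω) : Measurable (ff M ε b U) :=
  (((hM_cont M).measurable.comp (uu_sm U).measurable).sub ((uu_sm U).measurable.const_mul b)).div_const ε

lemma Dom.dat (D : Dom Ω) (hε : 0 < ε) (hb : 0 < b) (hM0 : 0 ≤ M) {U : HH Ω} (hU : U ∈ H1 Ω) : Dat Ω (ff M ε b U) (GG U) (uu U) := by
  refine ⟨ff_meas U, (GG_sm U).measurable, (uu_sm U).measurable, ?_⟩
  obtain ⟨K, hK, h4⟩ := D.L4_bound
  set A := ENNReal.ofReal (kf M / ε)
  set B := ENNReal.ofReal (b / ε)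
  have hm := (uu_sm U).measurable.enorm
  have hkf := kf_half hM0
  have hk : 0 ≤ kf M := by linarith
  have h : ∀ x, Wt (ff M ε b U) (GG U) (uu U) x ^ 2 ≤ 2 * (2 * (A ^ 2 * ‖uu U x‖ₑ ^ 4 + B ^ 2 * ‖uu U x‖ₑ ^ 2) + gg U x ^ 2) := by
    intro x
    refine (add_sq_le' _ _).trans ?_
    gcongr
    · have h1 : ‖ff M ε b U x‖ₑ ≤ A * ‖uu U x‖ₑ ^ 2 + B * ‖uu U x‖ₑ := by
        rw [← ofReal_norm, ← ofReal_norm, ← ENNReal.ofReal_pow (norm_nonneg _), ← ENNReal.ofReal_mul (by positivity),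
          ← ENNReal.ofReal_mul (by positivity), ← ENNReal.ofReal_add (by positivity) (by positivity)]
        apply ENNReal.ofReal_le_ofReal
        rw [ff, norm_div, Real.norm_of_nonneg hε.le, Real.norm_eq_abs, Real.norm_eq_abs, sq_abs]
        have := (abs_sub (hM M (uu U x)) (b * uu U x))
        rw [abs_mul, abs_of_pos hb, abs_of_nonneg (hM_nonneg hM0 _)] at this
        have h2 := hM_le_sq hM0 (uu U x)
        rw [div_mul_eq_mul_div, div_mul_eq_mul_div, ← add_div]
        gcongr; linarith
      calc ‖ff M ε b U x‖ₑ ^ 2 ≤ (A * ‖uu U x‖ₑ ^ 2 + B * ‖uu U x‖ₑ) ^ 2 := by gcongr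
        _ ≤ 2 * ((A * ‖uu U x‖ₑ ^ 2) ^ 2 + (B * ‖uu U x‖ₑ) ^ 2) := add_sq_le' _ _
        _ = _ := by ring
    · exact le_rfl
  refine ne_top_of_le_ne_top ?_ (lintegral_mono h)
  have hgm := gg_meas U
  rw [lintegral_const_mul' _ _ (by norm_num), lintegral_add_left (by fun_prop), lintegral_const_mul' _ _ (by norm_num), lintegral_add_left (by fun_prop),
    lintegral_const_mul' _ _ (by finiteness), lintegral_const_mul' _ _ (by finiteness)]
  have e1 : ∫⁻ x in Ω, ‖uu U x‖ₑ ^ 4 ≠ ⊤ := ne_top_of_le_ne_top (by finiteness) (h4 U hU)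
  have e2 : ∫⁻ x in Ω, ‖uu U x‖ₑ ^ 2 ≠ ⊤ := ne_top_of_le_ne_top (by finiteness) (uu_sq U)
  have e3 : ∫⁻ x in Ω, gg U x ^ 2 ≠ ⊤ := ne_top_of_le_ne_top (by finiteness) (gg_sq U)
  finiteness

lemma Dom.hw (D : Dom Ω) (hε : 0 < ε) (hM0 : 0 ≤ M) {U : HH Ω} (hU : U ∈ H1 Ω) (hw : ∀ Φ ∈ H1 Ω, BB ε b U Φ = Jh M U Φ)
    (φ : E2 → ℝ) (hφ : ContDiff ℝ 1 φ) : ∫ x in Ω, ⟪GG U x, gradient φ x⟫ = ∫ x in Ω, ff M ε b U x * φ x := by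
  obtain ⟨V, hV⟩ := exists_rep D.b hφ
  have h := hw V hV.mem
  rw [BB, Jh, L2.inner_def, L2.inner_def] at h
  have e1 : ∫ x in Ω, ⟪U.snd x, V.snd x⟫ = ∫ x in Ω, ⟪GG U x, gradient φ x⟫ := by
    refine integral_congr_ae ?_
    filter_upwards [hV.hG] with x hx
    have hx' : V.snd x = gradient φ x := hx
    rw [hx']; rfl
  have e2 : ∫ x in Ω, ⟪U.fst x, V.fst x⟫ = ∫ x in Ω, uu U x * uu V x := by
    refine integral_congr_ae (Eventually.of_forall fun x => ?_)
    simp only [RCLike.inner_apply, conj_trivial]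
    exact mul_comm _ _
  rw [e1, e2] at h
  have e3 : ∫ x in Ω, ff M ε b U x * φ x = (1 / ε) * ((∫ x in Ω, hM M (uu U x) * uu V x) - b * ∫ x in Ω, uu U x * uu V x) := by
    have i2 : Integrable (fun x => uu U x * uu V x) (mu Ω) := (uu_memLp U).integrable_mul (uu_memLp V)
    rw [← integral_const_mul b, ← integral_sub (D.Jh_int hM0 hU V) (i2.const_mul b), ← integral_const_mul]
    refine integral_congr_ae ?_
    filter_upwards [hV.hu] with x hx
    rw [hx, ff]; ring
  rw [e3, ← h]; field_simp; ring

lemma young_log {h l : ℝ} (hh : 0 ≤ h) : h * l ≤ Real.exp l + h * Real.log (1 + h) := by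
  have h1 : Real.exp l = (1 + h) * Real.exp (l - Real.log (1 + h)) := by
    rw [Real.exp_sub, Real.exp_log (by linarith)]; field_simp
  have h2 := Real.add_one_le_exp (l - Real.log (1 + h))
  have h3 := Real.exp_pos (l - Real.log (1 + h))
  nlinarith

lemma sup_pt (hε : 0 < ε) (hb : 0 < b) {h u g l : ℝ} (hh : 0 ≤ h) (hu : 0 ≤ u) (hg : 0 ≤ g) (hl : 1 ≤ l) (hlog : Real.log (1 + h) ≤ u) :
    (|(h - b * u) / ε| + g) * l + g + u ≤ ((1 + b) / ε + 2) * (3 * Real.exp l + (h * u + u ^ 2 + g ^ 2)) := by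
  have hE : l ^ 2 / 2 ≤ Real.exp l := by have := Real.quadratic_le_exp_of_nonneg (by linarith : 0 ≤ l); linarith
  have hE1 : 1 ≤ Real.exp l := Real.one_le_exp (by linarith)
  have y := young_log (l := l) hh
  have y2 : h * l ≤ Real.exp l + h * u := by nlinarith
  have hub : u * l ≤ u ^ 2 + Real.exp l := by nlinarith [sq_nonneg (u - l), sq_nonneg u]
  have hgb : g * l ≤ g ^ 2 + Real.exp l := by nlinarith [sq_nonneg (g - l), sq_nonneg g]
  have hf : |(h - b * u) / ε| * l ≤ (1 + b) / ε * (3 * Real.exp l + (h * u + u ^ 2 + g ^ 2)) := by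
    rw [abs_div, abs_of_pos hε, div_mul_eq_mul_div, div_mul_eq_mul_div]
    have h1 : |h - b * u| ≤ h + b * u := by
      rw [abs_le]; constructor <;> nlinarith
    refine div_le_div_of_nonneg_right ?_ hε.le
    have h2 : |h - b * u| * l ≤ (h + b * u) * l := by gcongr
    nlinarith [mul_nonneg hh hu, sq_nonneg u, sq_nonneg g, mul_le_mul_of_nonneg_left hub hb.le, mul_nonneg hb.le (mul_nonneg hh hu), mul_nonneg hb.le (sq_nonneg g)]
  nlinarith [mul_nonneg hh hu, sq_nonneg u, sq_nonneg g, sq_nonneg (u - 1), sq_nonneg (g - 1)]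

lemma exp_log_le {r : ℝ} (hr : 0 < r) : Real.exp (1 + |Real.log r|) ≤ 3 * (r + r⁻¹) := by
  rw [Real.exp_add]
  have h1 := Real.exp_one_lt_d9
  have h2 : Real.exp |Real.log r| ≤ r + r⁻¹ := by
    have := inv_pos.2 hr
    rcases abs_cases (Real.log r) with ⟨h, _⟩ | ⟨h, _⟩
    · rw [h, Real.exp_log hr]; linarith
    · rw [h, Real.exp_neg, Real.exp_log hr]; linarith
  have := Real.exp_pos |Real.log r|
  nlinarith

lemma exp_log_int (hb : IsBounded Ω) (ho : IsOpen Ω) : ∃ K : ℝ≥0∞, K ≠ ⊤ ∧ ∀ y ∈ closure Ω, ∫⁻ x in Ω, ENNReal.ofReal (Real.exp (1 + |Real.log ‖x - y‖|)) ≤ K := by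
  obtain ⟨K, hK, hk⟩ := kk_bound hb one_pos (by norm_num)
  have hv := hb.measure_lt_top (μ := volume)
  refine ⟨3 * (ENNReal.ofReal (Metric.diam (closure Ω)) * volume Ω + K), by finiteness, fun y hy => ?_⟩
  calc _ ≤ ∫⁻ x in Ω, 3 * (ENNReal.ofReal (Metric.diam (closure Ω)) + kk 1 x y) := by
        refine lintegral_mono_ae ?_
        filter_upwards [ae_restrict_mem ho.measurableSet, Patch.ae_ne y] with x hx hxy
        have hr : 0 < ‖x - y‖ := norm_pos_iff.2 (sub_ne_zero.2 hxy)
        rw [kk, ← ENNReal.ofReal_add Metric.diam_nonneg (by positivity), show (3:ℝ≥0∞) = ENNReal.ofReal 3 by norm_num, ← ENNReal.ofReal_mul (by norm_num), Real.rpow_neg_one]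
        apply ENNReal.ofReal_le_ofReal
        refine (exp_log_le hr).trans ?_
        have := Metric.dist_le_diam_of_mem hb.closure (subset_closure hx) hy
        rw [dist_eq_norm] at this
        gcongr
    _ = 3 * (ENNReal.ofReal (Metric.diam (closure Ω)) * volume Ω + ∫⁻ x in Ω, kk 1 x y) := by
        rw [lintegral_const_mul' _ _ (by norm_num), lintegral_add_left measurable_const, lintegral_const, Measure.restrict_apply_univ]
    _ ≤ _ := by gcongr; exact hk y

lemma Patch.sup_loc (P : Patch Ω x0) (D : Dom Ω) (hε : 0 < ε) (hb : 0 < b) (C1 : ℝ) : ∃ B : ℝ, ∀ M, 0 ≤ M → ∀ U ∈ H1 Ω,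
    (∀ Φ ∈ H1 Ω, BB ε b U Φ = Jh M U Φ) → qq ε b U ≤ C1 → ∀ᵐ y ∂mu Ω, y ∈ Metric.ball x0 P.r → |uu U y| ≤ B := by
  obtain ⟨C, hC, hF⟩ := P.Fk_bound
  obtain ⟨B, hB, hco⟩ := P.coef_bound
  obtain ⟨K, hK, hk⟩ := exp_log_int D.b D.o
  have hc := c0_pos
  set A : ℝ := C * B * ((1 + b) / ε + 2) with hA
  have hA0 : 0 ≤ A := by positivity
  set Q : ℝ≥0∞ := ENNReal.ofReal A * (3 * K + ENNReal.ofReal (C1 + C1 / b + C1 / ε)) with hQ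
  have hQt : Q ≠ ⊤ := by finiteness
  refine ⟨c0⁻¹ * Q.toReal, fun M hM0 U hU hw hq => ?_⟩
  have T := D.dat (M := M) hε hb hM0 hU
  have iU := (uu_memLp U).integrable_sq
  have iG : Integrable (fun x => ‖GG U x‖ ^ 2) (mu Ω) := (GG_memLp U).norm.integrable_sq
  have iJ := D.Jh_int hM0 hU U
  have hn := D.nonneg hε hb hM0 hU hw
  have hE : ∫⁻ x in Ω, ENNReal.ofReal (hM M (uu U x) * uu U x + uu U x ^ 2 + ‖GG U x‖ ^ 2) ≤ ENNReal.ofReal (C1 + C1 / b + C1 / ε) := by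
    have i123 : Integrable (fun x => hM M (uu U x) * uu U x + uu U x ^ 2 + ‖GG U x‖ ^ 2) (mu Ω) := (iJ.add iU).add iG
    rw [← ofReal_integral_eq_lintegral_ofReal i123]
    · apply ENNReal.ofReal_le_ofReal
      have e : ∫ x in Ω, (hM M (uu U x) * uu U x + uu U x ^ 2 + ‖GG U x‖ ^ 2) = qq ε b U + ‖U.fst‖ ^ 2 + ‖U.snd‖ ^ 2 := by
        have a1 : ∫ x in Ω, hM M (uu U x) * uu U x = qq ε b U := (hw U hU).symm
        have a2 : ∫ x in Ω, uu U x ^ 2 = ‖U.fst‖ ^ 2 := by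
          rw [Lp_norm_sq]; simp only [Real.norm_eq_abs, sq_abs]; rfl
        have a3 : ∫ x in Ω, ‖GG U x‖ ^ 2 = ‖U.snd‖ ^ 2 := by rw [Lp_norm_sq]; rfl
        have i12 : Integrable (fun x => hM M (uu U x) * uu U x + uu U x ^ 2) (mu Ω) := iJ.add iU
        rw [integral_add i12 iG, integral_add iJ iU, a1, a2, a3]
      refine e.le.trans ?_
      have q1 := qq_eq (ε := ε) (b := b) U
      have n1 := sq_nonneg ‖U.fst‖
      have n2 := sq_nonneg ‖U.snd‖
      have s1 : ‖U.fst‖ ^ 2 ≤ C1 / b := by rw [le_div_iff₀ hb]; nlinarith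
      have s2 : ‖U.snd‖ ^ 2 ≤ C1 / ε := by rw [le_div_iff₀ hε]; nlinarith
      linarith
    · filter_upwards [hn] with x hx
      have := hM_nonneg hM0 (uu U x)
      simp only [Pi.zero_apply]; positivity
  filter_upwards [P.rep0 D.o D.b hU T (D.hw hε hM0 hU hw), ae_restrict_mem D.o.measurableSet] with y h1 hy hyb
  have h2 : ‖c0 * uu U y‖ₑ ≤ Q := by
    rw [h1 hyb, Patch.R0]
    refine (enorm_integral_le_lintegral_enorm _).trans ?_
    calc _ ≤ ∫⁻ x in Ω, ENNReal.ofReal A * (3 * ENNReal.ofReal (Real.exp (1 + |Real.log ‖x - y‖|)) + ENNReal.ofReal (hM M (uu U x) * uu U x + uu U x ^ 2 + ‖GG U x‖ ^ 2)) := by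
          refine lintegral_mono_ae ?_
          filter_upwards [ae_restrict_mem D.o.measurableSet, Patch.ae_ne y, hn] with x hx hxy hux
          by_cases hxt : x ∈ tsupport P.η
          swap
          · rw [P.FK_out _ _ _ _ _ hxt, enorm_zero (E := ℝ)]; exact zero_le
          have hh := hM_nonneg hM0 (uu U x)
          have hE0 := Real.exp_pos (1 + |Real.log ‖x - y‖|)
          rw [show (3:ℝ≥0∞) = ENNReal.ofReal 3 by norm_num, ← ENNReal.ofReal_mul (by norm_num), ← ENNReal.ofReal_add (by positivity) (by positivity), ← ENNReal.ofReal_mul hA0, ← ofReal_norm]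
          apply ENNReal.ofReal_le_ofReal
          obtain ⟨b1, b2, b3⟩ := hco (ff M ε b U) (GG U) (uu U) x
          have := sup_pt hε hb hh hux (norm_nonneg (GG U x)) (by have := abs_nonneg (Real.log ‖x - y‖); linarith : 1 ≤ 1 + |Real.log ‖x - y‖|) (hM_log hM0 hux)
          calc ‖P.FK (ff M ε b U) (GG U) (uu U) 0 y x‖ ≤ C * (|P.cA (ff M ε b U) (GG U) x| * (1 + |Real.log ‖x - y‖|) + ‖P.cV (GG U) x‖ + ‖P.cW (uu U) x‖) :=
                hF x y ⟨hx, hxt, subset_closure hy, hyb, hxy⟩ _ _ _ (P.cW_far _ hyb)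
            _ ≤ C * ((B * (|ff M ε b U x| + ‖GG U x‖)) * (1 + |Real.log ‖x - y‖|) + B * ‖GG U x‖ + B * |uu U x|) := by gcongr
            _ = C * B * ((|ff M ε b U x| + ‖GG U x‖) * (1 + |Real.log ‖x - y‖|) + ‖GG U x‖ + uu U x) := by rw [abs_of_nonneg hux]; ring
            _ ≤ C * B * (((1 + b) / ε + 2) * (3 * Real.exp (1 + |Real.log ‖x - y‖|) + (hM M (uu U x) * uu U x + uu U x ^ 2 + ‖GG U x‖ ^ 2))) := by
                gcongr; exact this
            _ = _ := by rw [hA]; ring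
      _ ≤ Q := by
          have hm : Measurable (fun x => ENNReal.ofReal (Real.exp (1 + |Real.log ‖x - y‖|))) := by
            have : Measurable (fun x : E2 => ‖x - y‖) := by fun_prop
            exact (Real.measurable_exp.comp (measurable_const.add (Real.measurable_log.comp this).abs)).ennreal_ofReal
          rw [lintegral_const_mul' _ _ (by finiteness), lintegral_add_left (hm.const_mul 3), lintegral_const_mul' _ _ (by norm_num)]
          rw [hQ]; gcongr
          exact hk y (subset_closure hy)
  have h3 := ENNReal.toReal_mono hQt h2
  rw [toReal_enorm, norm_mul, Real.norm_of_nonneg hc.le, Real.norm_eq_abs] at h3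
  rw [← div_eq_inv_mul, le_div_iff₀ hc]
  linarith

lemma Dom.sup_bound (D : Dom Ω) (hε : 0 < ε) (hb : 0 < b) (C1 : ℝ) : ∃ B : ℝ, 0 ≤ B ∧ ∀ M, 0 ≤ M → ∀ U ∈ H1 Ω,
    (∀ Φ ∈ H1 Ω, BB ε b U Φ = Jh M U Φ) → qq ε b U ≤ C1 → ∀ᵐ y ∂mu Ω, |uu U y| ≤ B := by
  obtain ⟨Pt, t, ht⟩ := D.cover
  choose B hB using fun x => (Pt x).sup_loc D hε hb C1
  have hs : ∀ x ∈ t, B x ≤ ∑ x ∈ t, |B x| := fun x hx => (le_abs_self _).trans (Finset.single_le_sum (f := fun x => |B x|) (fun _ _ => abs_nonneg _) hx)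
  refine ⟨∑ x ∈ t, |B x|, by positivity, fun M hM0 U hU hw hq => ?_⟩
  have h : ∀ᵐ y ∂mu Ω, ∀ x ∈ t, y ∈ Metric.ball (x : E2) (Pt x).r → |uu U y| ≤ B x := by
    rw [Filter.eventually_all_finset]
    exact fun x _ => hB x M hM0 U hU hw hq
  filter_upwards [h, ae_restrict_mem D.o.measurableSet] with y hy hyo
  obtain ⟨x, hx, hyx⟩ := ht y (subset_closure hyo)
  exact (hy x hx (Metric.ball_subset_ball (Pt x).hrr hyx)).trans (hs x hx)

end SupSec


noncomputable section BootSec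

variable {Ω : Set E2} {x0 : E2} {f : E2 → ℝ} {U : HH Ω}

structure WSol (Ω : Set E2) (f : E2 → ℝ) (U : HH Ω) : Prop where
  hU : U ∈ H1 Ω
  T : Dat Ω f (GG U) (uu U)
  hw : ∀ φ : E2 → ℝ, ContDiff ℝ 1 φ → ∫ x in Ω, ⟪GG U x, gradient φ x⟫ = ∫ x in Ω, f x * φ x

lemma Dom.grad_bound (D : Dom Ω) (S : WSol Ω f U) : ∃ K : ℝ≥0∞, K ≠ ⊤ ∧ ∀ᵐ y ∂mu Ω, ‖GG U y‖ₑ ≤ K * ∫⁻ x in Ω, kk 1 x y * Wt f (GG U) (uu U) x := by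
  obtain ⟨Pt, t, ht⟩ := D.cover
  choose C hC0 hC using fun x => (Pt x).R_bound D.o D.b
  have hc := c0_pos
  have h : ∀ᵐ y ∂mu Ω, ∀ x ∈ t, y ∈ Metric.ball (x : E2) (Pt x).r → c0 • innerSL ℝ (GG U y) = (Pt x).R1 f (GG U) (uu U) 0 y := by
    rw [Filter.eventually_all_finset]
    exact fun x _ => (Pt x).grad0 D.o D.b S.hU S.T S.hw
  refine ⟨∑ x ∈ t, ‖c0⁻¹‖ₑ * C x, ENNReal.sum_ne_top.2 fun x _ => ENNReal.mul_ne_top enorm_ne_top (hC0 x), ?_⟩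
  filter_upwards [h, ae_restrict_mem D.o.measurableSet, S.T.good_ae D.b] with y hy hyo hg
  obtain ⟨x, hx, hyx⟩ := ht y (subset_closure hyo)
  have hyr := Metric.ball_subset_ball (Pt x).hrr hyx
  have h1 := (hC x f _ _ S.T y (subset_closure hyo) hyr hg).1
  rw [← hy x hx hyr, enorm_smul] at h1
  have h2 : ‖innerSL ℝ (GG U y)‖ₑ = ‖GG U y‖ₑ := by
    rw [← ofReal_norm, ← ofReal_norm, innerSL_apply_norm]
  rw [h2] at h1
  calc ‖GG U y‖ₑ = ‖c0⁻¹‖ₑ * (‖c0‖ₑ * ‖GG U y‖ₑ) := by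
        rw [← mul_assoc, ← enorm_mul, inv_mul_cancel₀ hc.ne']; simp
    _ ≤ ‖c0⁻¹‖ₑ * (C x * ∫⁻ x in Ω, kk 1 x y * Wt f (GG U) (uu U) x) := by gcongr
    _ = (‖c0⁻¹‖ₑ * C x) * ∫⁻ x in Ω, kk 1 x y * Wt f (GG U) (uu U) x := by ring
    _ ≤ _ := by gcongr; exact Finset.single_le_sum (f := fun x => ‖c0⁻¹‖ₑ * C x) (fun _ _ => zero_le) hx

lemma add_four_le (a b : ℝ≥0∞) : (a + b) ^ 4 ≤ 8 * (a ^ 4 + b ^ 4) := by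
  calc (a + b) ^ 4 = ((a + b) ^ 2) ^ 2 := by ring
    _ ≤ (2 * (a ^ 2 + b ^ 2)) ^ 2 := by gcongr; exact add_sq_le' a b
    _ = 4 * (a ^ 2 + b ^ 2) ^ 2 := by ring
    _ ≤ 4 * (2 * ((a ^ 2) ^ 2 + (b ^ 2) ^ 2)) := by gcongr; exact add_sq_le' _ _
    _ = _ := by ring

lemma Dom.W_bdd (D : Dom Ω) (S : WSol Ω f U) {A : ℝ≥0∞} (hA : A ≠ ⊤) (hfu : ∀ᵐ y ∂mu Ω, ‖f y‖ₑ + ‖uu U y‖ₑ ≤ A) :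
    ∃ A' : ℝ≥0∞, A' ≠ ⊤ ∧ ∀ᵐ y ∂mu Ω, Wt f (GG U) (uu U) y ≤ A' := by
  obtain ⟨K, hK, hG⟩ := D.grad_bound S
  obtain ⟨K2, hK2, hk2⟩ := kk_bound D.b (by norm_num : (0:ℝ) < 4/3) (by norm_num : (4/3:ℝ) < 2)
  have hv := D.b.measure_lt_top (μ := volume)
  have hW : ∀ᵐ y ∂mu Ω, Wt f (GG U) (uu U) y ≤ A + K * ∫⁻ x in Ω, kk 1 x y * Wt f (GG U) (uu U) x := by
    filter_upwards [hG, hfu] with y h1 h2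
    calc Wt f (GG U) (uu U) y = (‖f y‖ₑ + ‖uu U y‖ₑ) + ‖GG U y‖ₑ := by rw [Wt]; ring
      _ ≤ _ := add_le_add h2 h1
  have h4 : ∫⁻ x in Ω, Wt f (GG U) (uu U) x ^ 4 ≠ ⊤ := by
    have h : ∫⁻ x in Ω, Wt f (GG U) (uu U) x ^ 4 ≤ ∫⁻ y in Ω, 8 * (A ^ 4 + K ^ 4 * (∫⁻ x in Ω, kk 1 x y * Wt f (GG U) (uu U) x) ^ 4) := by
      refine lintegral_mono_ae ?_
      filter_upwards [hW] with y hy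
      rw [← mul_pow]
      exact (pow_le_pow_left' hy 4).trans (add_four_le _ _)
    refine ne_top_of_le_ne_top ?_ h
    rw [lintegral_const_mul' _ _ (by norm_num), lintegral_add_left measurable_const, lintegral_const_mul' _ _ (by finiteness), lintegral_const, Measure.restrict_apply_univ]
    have := ne_top_of_le_ne_top (ENNReal.mul_ne_top (by finiteness) (ENNReal.pow_ne_top S.T.W2)) (pot_L2L4 (μ := mu Ω) S.T.Wm.aemeasurable hk2)
    finiteness
  refine ⟨A + K * (1 + K2 ^ 3 * ∫⁻ x in Ω, Wt f (GG U) (uu U) x ^ 4), by finiteness, ?_⟩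
  filter_upwards [hW] with y hy
  refine hy.trans ?_
  gcongr
  have h5 := pot_L4Linf (μ := mu Ω) S.T.Wm.aemeasurable hk2 y
  rcases le_total (∫⁻ x in Ω, kk 1 x y * Wt f (GG U) (uu U) x) 1 with h6 | h6
  · exact h6.trans le_self_add
  · exact (le_self_pow h6 (by norm_num)).trans (h5.trans le_add_self)

lemma pot_bdd (hb : IsBounded Ω) {W : E2 → ℝ≥0∞} {A : ℝ≥0∞} (hA : A ≠ ⊤) (h : ∀ᵐ y ∂mu Ω, W y ≤ A) {s : ℝ} (h0 : 0 < s) (hs : s < 2) :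
    ∃ K : ℝ≥0∞, K ≠ ⊤ ∧ ∀ y, ∫⁻ x in Ω, kk s x y * W x ≤ K := by
  obtain ⟨K, hK, hk⟩ := kk_bound hb h0 hs
  refine ⟨K * A, by finiteness, fun y => ?_⟩
  calc _ ≤ ∫⁻ x in Ω, kk s x y * A := lintegral_mono_ae (h.mono fun x hx => by gcongr)
    _ = (∫⁻ x in Ω, kk s x y) * A := lintegral_mul_const' _ _ hA
    _ ≤ K * A := by gcongr; exact hk y

namespace Patch
variable (P : Patch Ω x0)

structure Unif (P : Patch Ω x0) (f : E2 → ℝ) (G : E2 → E2) (u : E2 → ℝ) (C : ℝ) : Prop where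
  C0 : 0 ≤ C
  h1 : ∀ y ∈ closure Ω, y ∈ Metric.ball x0 P.r → ∀ d : ℝ, 0 < d → d ≤ 1 → ‖P.R1 f G u d y - P.R1 f G u 0 y‖ ≤ C * √d
  h0 : ∀ y ∈ closure Ω, y ∈ Metric.ball x0 P.r → ∀ d : ℝ, 0 < d → d ≤ 1 → |P.R0 f G u d y - P.R0 f G u 0 y| ≤ C * √d

variable {G : E2 → E2} {u : E2 → ℝ}

lemma unif (D : Dom Ω) (T : Dat Ω f G u) {A : ℝ≥0∞} (hA : A ≠ ⊤) (h : ∀ᵐ y ∂mu Ω, Wt f G u y ≤ A) : ∃ C, P.Unif f G u C := by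
  obtain ⟨K1, hK1, hk1⟩ := pot_bdd D.b hA h one_pos (by norm_num : (1:ℝ) < 2)
  obtain ⟨K2, hK2, hk2⟩ := pot_bdd D.b hA h (by norm_num : (0:ℝ) < 3/2) (by norm_num : (3/2:ℝ) < 2)
  obtain ⟨C, hC, hR⟩ := P.R_bdR D.o D.b
  have hg : ∀ y, good Ω f G u y := fun y => ⟨ne_top_of_le_ne_top hK1 (hk1 y), ne_top_of_le_ne_top hK2 (hk2 y)⟩
  have hP : ∀ y, Ph Ω f G u (3/2) y ≤ K2.toReal := fun y => ENNReal.toReal_mono hK2 (hk2 y)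
  refine ⟨C * K2.toReal, by positivity, fun y hy hyb d hd hd1 => ?_, fun y hy hyb d hd hd1 => ?_⟩
  · refine ((hR f G u T y hy hyb (hg y)).2 d hd hd1).1.trans ?_
    calc _ ≤ C * √d * K2.toReal := by gcongr; exact hP y
      _ = _ := by ring
  · refine ((hR f G u T y hy hyb (hg y)).2 d hd hd1).2.trans ?_
    calc _ ≤ C * √d * K2.toReal := by gcongr; exact hP y
      _ = _ := by ring

lemma cont_of_seq {F : Type*} [NormedAddCommGroup F] {A : ℕ → E2 → F} {B : E2 → F} {s : Set E2} {C : ℝ} (hA : ∀ n, Continuous (A n))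
    (h : ∀ y ∈ s, ∀ n : ℕ, ‖A n y - B y‖ ≤ C * √(1 / ((n:ℝ) + 1))) : ContinuousOn B s := by
  have hu : TendstoUniformlyOn A B atTop s := by
    rw [Metric.tendstoUniformlyOn_iff]
    intro e he
    have := sqrt_seq.const_mul C
    rw [mul_zero] at this
    filter_upwards [this.eventually (gt_mem_nhds he)] with n hn y hy
    rw [dist_comm, dist_eq_norm]
    exact (h y hy n).trans_lt hn
  exact hu.continuousOn (Frequently.of_forall fun n => (hA n).continuousOn)

variable {P} {C : ℝ}
lemma Unif.c0 (V : P.Unif f G u C) (D : Dom Ω) (T : Dat Ω f G u) : ContinuousOn (P.R0 f G u 0) (closure Ω ∩ Metric.ball x0 P.r) :=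
  cont_of_seq (A := fun n => P.R0 f G u (1 / ((n:ℝ) + 1))) (fun n => (R0_C1 T D.b (seq_pos n)).continuous)
    (fun y hy n => V.h0 y hy.1 hy.2 _ (seq_pos n) (seq_le n))

lemma Unif.c1 (V : P.Unif f G u C) (D : Dom Ω) (T : Dat Ω f G u) : ContinuousOn (P.R1 f G u 0) (closure Ω ∩ Metric.ball x0 P.r) :=
  cont_of_seq (A := fun n => P.R1 f G u (1 / ((n:ℝ) + 1))) (fun n => (R1_cont T D.b (seq_pos n)))
    (fun y hy n => V.h1 y hy.1 hy.2 _ (seq_pos n) (seq_le n))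

lemma Unif.lip (V : P.Unif f G u C) (D : Dom Ω) (T : Dat Ω f G u) {d : ℝ} (hd : 0 < d) (hd1 : d ≤ 1) {x y : E2} (hx : x ∈ closure Ω) (hxb : x ∈ Metric.ball x0 P.r')
    (hy : y ∈ closure Ω) (hyb : y ∈ Metric.ball x0 P.r') : |(P.R0 f G u d x - P.R0 f G u 0 x) - (P.R0 f G u d y - P.R0 f G u 0 y)| ≤ P.L * (C * √d) * ‖x - y‖ := by
  have hsub := Metric.ball_subset_ball (x := x0) P.hrr
  have h : ∀ n : ℕ, |(P.R0 f G u d x - P.R0 f G u (1 / ((n:ℝ) + 1)) x) - (P.R0 f G u d y - P.R0 f G u (1 / ((n:ℝ) + 1)) y)| ≤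
      P.L * (C * √d + C * √(1 / ((n:ℝ) + 1))) * ‖x - y‖ := by
    intro n
    have c1 := (R0_C1 (P := P) T D.b hd).sub (R0_C1 (P := P) T D.b (seq_pos n))
    refine P.qc (fun z => P.R0 f G u d z - P.R0 f G u (1 / ((n:ℝ) + 1)) z) c1 _ ?_ x hx hxb y hy hyb
    intro z hz hzb
    have e : fderiv ℝ (fun z => P.R0 f G u d z - P.R0 f G u (1 / ((n:ℝ) + 1)) z) z = P.R1 f G u d z - P.R1 f G u (1 / ((n:ℝ) + 1)) z :=
      ((R0_hasFDerivAt T D.b hd z).sub (R0_hasFDerivAt T D.b (seq_pos n) z)).fderiv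
    rw [e, ← sub_sub_sub_cancel_right _ _ (P.R1 f G u 0 z)]
    exact (norm_sub_le _ _).trans (add_le_add (V.h1 z hz hzb d hd hd1) (V.h1 z hz hzb _ (seq_pos n) (seq_le n)))
  have lim : ∀ z ∈ closure Ω, z ∈ Metric.ball x0 P.r' → Tendsto (fun n : ℕ => P.R0 f G u (1 / ((n:ℝ) + 1)) z) atTop (𝓝 (P.R0 f G u 0 z)) := fun z hz hzb =>
    lim_aux (C := C) (p := 1) fun n => by rw [mul_one]; exact V.h0 z hz (hsub hzb) _ (seq_pos n) (seq_le n)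
  have l1 := ((tendsto_const_nhds (x := P.R0 f G u d x)).sub (lim x hx hxb)).sub ((tendsto_const_nhds (x := P.R0 f G u d y)).sub (lim y hy hyb))
  have l2 := (((sqrt_seq.const_mul C).const_add (C * √d)).const_mul P.L).mul_const ‖x - y‖
  rw [mul_zero, add_zero] at l2
  exact le_of_tendsto_of_tendsto' l1.abs l2 h

lemma Unif.deriv (V : P.Unif f G u C) (D : Dom Ω) (T : Dat Ω f G u) {y : E2} (hy : y ∈ closure Ω) (hyb : y ∈ Metric.ball x0 P.r') :
    HasFDerivWithinAt (P.R0 f G u 0) (P.R1 f G u 0 y) (closure Ω) y := by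
  have hyr := Metric.ball_subset_ball (x := x0) P.hrr hyb
  have hL := P.hL0
  have hC := V.C0
  rw [hasFDerivWithinAt_iff_isLittleO, Asymptotics.isLittleO_iff]
  intro c hc
  obtain ⟨n, hn⟩ : ∃ n : ℕ, (P.L * C + C) * √(1 / ((n:ℝ) + 1)) < c / 2 := by
    have := sqrt_seq.const_mul (P.L * C + C)
    rw [mul_zero] at this
    exact (this.eventually (gt_mem_nhds (by positivity : 0 < c / 2))).exists
  have hd := (R0_hasFDerivAt (P := P) T D.b (seq_pos n) y).hasFDerivWithinAt (s := closure Ω)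
  rw [hasFDerivWithinAt_iff_isLittleO, Asymptotics.isLittleO_iff] at hd
  filter_upwards [hd (by positivity : 0 < c / 2), self_mem_nhdsWithin, mem_nhdsWithin_of_mem_nhds (Metric.isOpen_ball.mem_nhds hyb)] with x h1 hx hxb
  have h2 := V.lip D T (seq_pos n) (seq_le n) hx hxb hy hyb
  have h3 := ContinuousLinearMap.le_of_opNorm_le _ (V.h1 y hy hyr _ (seq_pos n) (seq_le n)) (x - y)
  rw [Real.norm_eq_abs] at *
  rw [_root_.sub_apply] at h3
  set a := P.R0 f G u (1 / ((n:ℝ) + 1)) x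
  set a' := P.R0 f G u (1 / ((n:ℝ) + 1)) y
  set b := P.R1 f G u (1 / ((n:ℝ) + 1)) y (x - y)
  have h4 : ((P.L * C + C) * √(1 / ((n:ℝ) + 1))) * ‖x - y‖ ≤ c / 2 * ‖x - y‖ := by gcongr
  rw [abs_le] at *
  constructor <;> nlinarith [h1.1, h1.2, h2.1, h2.2, h3.1, h3.2]

end Patch
end BootSec


noncomputable section GlobC1Sec

variable {Ω : Set E2} {x0 : E2} {f : E2 → ℝ} {U : HH Ω}

lemma eq_of_ae {F : Type*} [NormedAddCommGroup F] {g h : E2 → F} {B : Set E2} (ho : IsOpen Ω) (hB : IsOpen B)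
    (hg : ContinuousOn g (closure Ω ∩ B)) (hh : ContinuousOn h (closure Ω ∩ B)) (he : ∀ᵐ y ∂mu Ω, y ∈ B → g y = h y) :
    ∀ y ∈ closure Ω, y ∈ B → g y = h y := by
  intro y hy hyB
  by_contra hne
  have hc : ContinuousWithinAt (fun y => g y - h y) (closure Ω ∩ B) y := (hg.sub hh) y ⟨hy, hyB⟩
  have h1 : ∀ᶠ z in 𝓝[closure Ω ∩ B] y, g z - h z ≠ 0 := hc.eventually_ne (sub_ne_zero.2 hne)
  rw [eventually_nhdsWithin_iff] at h1
  obtain ⟨V, hV, hVo, hyV⟩ := eventually_nhds_iff.1 h1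
  have hne : (V ∩ B ∩ Ω).Nonempty := by
    rw [mem_closure_iff] at hy
    exact hy (V ∩ B) (hVo.inter hB) ⟨hyV, hyB⟩
  have hpos : 0 < volume (V ∩ B ∩ Ω) := ((hVo.inter hB).inter ho).measure_pos _ hne
  rw [mu, ae_restrict_iff' ho.measurableSet] at he
  refine hpos.ne' (measure_mono_null ?_ he)
  intro z hz
  simp only [Set.mem_compl_iff, Set.mem_setOf_eq]
  exact fun hh => hV z hz.1.1 ⟨subset_closure hz.2, hz.1.2⟩ (sub_eq_zero.2 (hh hz.2 hz.1.2))

lemma Dom.uniq (D : Dom Ω) : UniqueDiffOn ℝ (closure Ω) := by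
  intro x hx
  by_cases hxo : x ∈ Ω
  · exact (D.o.uniqueDiffWithinAt hxo).mono subset_closure
  have hxf : x ∈ frontier Ω := by rw [D.o.frontier_eq]; exact ⟨hx, hxo⟩
  obtain ⟨V, g, h⟩ := D.bd x hxf
  obtain ⟨c⟩ := exists_chart D.o hxf h
  set s : Set E2 := Metric.ball 0 c.ρ ∩ {p | p 1 < 0} with hs
  have hc1 : Continuous (fun p : E2 => p 1) := by fun_prop
  have hso : IsOpen s := Metric.isOpen_ball.inter (isOpen_lt hc1 continuous_const)
  have hcv : Convex ℝ s := (convex_ball _ _).inter (convex_halfSpace_lt (f := fun p : E2 => p 1) ⟨fun _ _ => rfl, fun _ _ => rfl⟩ 0)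
  have h0 : (0:E2) ∈ closure s := by
    rw [Metric.mem_closure_iff]
    intro e he
    have hm : 0 < min e c.ρ := lt_min he c.hρ
    have hn : ‖(-(min e c.ρ / 2)) • ee 1‖ = min e c.ρ / 2 := by
      rw [norm_smul, Real.norm_eq_abs, abs_neg, abs_of_pos (by positivity)]; simp [ee]
    refine ⟨(-(min e c.ρ / 2)) • ee 1, ⟨?_, ?_⟩, ?_⟩
    · rw [mem_ball_zero_iff, hn]; linarith [min_le_right e c.ρ]
    · simp [ee]; exact ⟨he, c.hρ⟩
    · rw [dist_comm, dist_zero_right, hn]; linarith [min_le_left e c.ρ]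
  have hne : (interior s).Nonempty := by
    rw [hso.interior_eq]; exact closure_nonempty_iff.1 ⟨_, h0⟩
  have hU := uniqueDiffWithinAt_convex hcv hne h0
  have hΨ0 : c.Ψ 0 = x := by rw [← c.Θ0]; exact c.right x (Metric.mem_ball_self c.hρ)
  have hd : HasFDerivAt c.Ψ (fderiv ℝ c.Ψ 0) 0 := (c.hΨ.differentiable (by norm_num) 0).hasFDerivAt
  have hsurj : Function.Surjective (fderiv ℝ c.Ψ 0) := by
    have h1 : HasFDerivAt (fun z => c.Ψ (c.Θ z)) ((fderiv ℝ c.Ψ 0).comp (fderiv ℝ c.Θ x)) x := by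
      refine HasFDerivAt.comp x ?_ (c.hΘ.differentiable (by norm_num) x).hasFDerivAt
      rw [c.Θ0]; exact hd
    have h2 : HasFDerivAt (fun z => c.Ψ (c.Θ z)) (ContinuousLinearMap.id ℝ E2) x := by
      refine (hasFDerivAt_id x).congr_of_eventuallyEq ?_
      filter_upwards [Metric.isOpen_ball.mem_nhds (Metric.mem_ball_self c.hρ)] with z hz
      exact c.right z hz
    intro v
    refine ⟨fderiv ℝ c.Θ x v, ?_⟩
    have := congrArg (fun T => T v) (h1.unique h2)
    simpa using this
  have := hd.hasFDerivWithinAt (s := s) |>.uniqueDiffWithinAt hU hsurj.denseRange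
  rw [hΨ0] at this
  refine this.mono ?_
  rintro _ ⟨p, hp, rfl⟩
  exact subset_closure ((c.mem p hp.1).2 hp.2)

/-- the classical representative of a weak solution -/
structure CRep (Ω : Set E2) (f : E2 → ℝ) (U : HH Ω) (w : E2 → ℝ) : Prop where
  gd : ∀ y, good Ω f (GG U) (uu U) y
  c1 : ContDiffOn ℝ 1 w (closure Ω)
  ae0 : ∀ᵐ y ∂mu Ω, w y = uu U y
  ae1 : ∀ᵐ y ∂mu Ω, fderivWithin ℝ w (closure Ω) y = innerSL ℝ (GG U y)
  rep : ∀ x0 (P : Patch Ω x0), ∀ y ∈ closure Ω, y ∈ Metric.ball x0 P.r' → fderivWithin ℝ w (closure Ω) y = c0⁻¹ • P.R1 f (GG U) (uu U) 0 y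

lemma Dom.exists_C1 (D : Dom Ω) (S : WSol Ω f U) {A : ℝ≥0∞} (hA : A ≠ ⊤) (hfu : ∀ᵐ y ∂mu Ω, ‖f y‖ₑ + ‖uu U y‖ₑ ≤ A) :
    ∃ w, CRep Ω f U w := by
  classical
  obtain ⟨A', hA', hW⟩ := D.W_bdd S hA hfu
  have hc := c0_pos
  let Pt : ∀ x : closure Ω, Patch Ω x.1 := fun x => (exists_patch D.o D.b D.bd x.2).some
  let w : E2 → ℝ := fun y => if h : y ∈ closure Ω then c0⁻¹ * (Pt ⟨y, h⟩).R0 f (GG U) (uu U) 0 y else 0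
  have cmp : ∀ (x y : E2) (P : Patch Ω x) (Q : Patch Ω y) z, z ∈ closure Ω → z ∈ Metric.ball x P.r' → z ∈ Metric.ball y Q.r' →
      P.R0 f (GG U) (uu U) 0 z = Q.R0 f (GG U) (uu U) 0 z := by
    intro x y P Q z hz hx hy
    obtain ⟨C1, V1⟩ := P.unif D S.T hA' hW
    obtain ⟨C2, V2⟩ := Q.unif D S.T hA' hW
    have s1 := Metric.ball_subset_ball (x := x) P.hrr
    have s2 := Metric.ball_subset_ball (x := y) Q.hrr
    refine eq_of_ae D.o (Metric.isOpen_ball.inter Metric.isOpen_ball) ((V1.c0 D S.T).mono ?_) ((V2.c0 D S.T).mono ?_) ?_ z hz ⟨hx, hy⟩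
    · exact fun p hp => ⟨hp.1, s1 hp.2.1⟩
    · exact fun p hp => ⟨hp.1, s2 hp.2.2⟩
    · filter_upwards [P.rep0 D.o D.b S.hU S.T S.hw, Q.rep0 D.o D.b S.hU S.T S.hw] with p h1 h2 hp
      rw [← h1 (s1 hp.1), ← h2 (s2 hp.2)]
  have hwP : ∀ (x : E2) (P : Patch Ω x) z, z ∈ closure Ω → z ∈ Metric.ball x P.r' → w z = c0⁻¹ * P.R0 f (GG U) (uu U) 0 z := by
    intro x P z hz hzb
    simp only [w, hz, dif_pos]
    rw [cmp _ _ (Pt ⟨z, hz⟩) P z hz (Metric.mem_ball_self (Pt ⟨z, hz⟩).hr') hzb]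
  have hder : ∀ (x : E2) (P : Patch Ω x) z, z ∈ closure Ω → z ∈ Metric.ball x P.r' → HasFDerivWithinAt w (c0⁻¹ • P.R1 f (GG U) (uu U) 0 z) (closure Ω) z := by
    intro x P z hz hzb
    obtain ⟨C, V⟩ := P.unif D S.T hA' hW
    have h1 := (V.deriv D S.T hz hzb).const_smul c0⁻¹
    refine h1.congr_of_eventuallyEq ?_ ?_
    · filter_upwards [self_mem_nhdsWithin, mem_nhdsWithin_of_mem_nhds (Metric.isOpen_ball.mem_nhds hzb)] with p hp hpb
      exact hwP x P p hp hpb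
    · exact hwP x P z hz hzb
  have hrep : ∀ x0 (P : Patch Ω x0), ∀ y ∈ closure Ω, y ∈ Metric.ball x0 P.r' → fderivWithin ℝ w (closure Ω) y = c0⁻¹ • P.R1 f (GG U) (uu U) 0 y :=
    fun x P y hy hyb => (hder x P y hy hyb).fderivWithin (D.uniq y hy)
  obtain ⟨Qt, t, ht⟩ := D.cover
  obtain ⟨K1, hK1, hk1⟩ := pot_bdd D.b hA' hW one_pos (by norm_num : (1:ℝ) < 2)
  obtain ⟨K2, hK2, hk2⟩ := pot_bdd D.b hA' hW (by norm_num : (0:ℝ) < 3/2) (by norm_num : (3/2:ℝ) < 2)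
  refine ⟨w, fun y => ⟨ne_top_of_le_ne_top hK1 (hk1 y), ne_top_of_le_ne_top hK2 (hk2 y)⟩, ?_, ?_, ?_, hrep⟩
  · rw [show (1 : WithTop ℕ∞) = 0 + 1 by norm_num, contDiffOn_succ_iff_fderivWithin D.uniq]
    refine ⟨fun y hy => (hder y (Pt ⟨y, hy⟩) y hy (Metric.mem_ball_self (Pt ⟨y, hy⟩).hr')).differentiableWithinAt, by simp, ?_⟩
    rw [contDiffOn_zero]
    intro y hy
    set P := Pt ⟨y, hy⟩
    obtain ⟨C, V⟩ := P.unif D S.T hA' hW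
    have hyb : y ∈ Metric.ball y P.r' := Metric.mem_ball_self P.hr'
    have h1 := (V.c1 D S.T) y ⟨hy, Metric.ball_subset_ball P.hrr hyb⟩
    have h2 : ContinuousWithinAt (P.R1 f (GG U) (uu U) 0) (closure Ω) y :=
      (continuousWithinAt_inter (Metric.isOpen_ball.mem_nhds (Metric.ball_subset_ball P.hrr hyb))).1 h1
    refine (h2.const_smul c0⁻¹).congr_of_eventuallyEq ?_ (hrep y P y hy hyb)
    filter_upwards [self_mem_nhdsWithin, mem_nhdsWithin_of_mem_nhds (Metric.isOpen_ball.mem_nhds hyb)] with p hp hpb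
    exact hrep y P p hp hpb
  · have h : ∀ᵐ y ∂mu Ω, ∀ x ∈ t, y ∈ Metric.ball (x : E2) (Qt x).r → c0 * (uu U y) = (Qt x).R0 f (GG U) (uu U) 0 y := by
      rw [Filter.eventually_all_finset]
      exact fun x _ => (Qt x).rep0 D.o D.b S.hU S.T S.hw
    filter_upwards [h, ae_restrict_mem D.o.measurableSet] with y hy hyo
    obtain ⟨x, hx, hyx⟩ := ht y (subset_closure hyo)
    rw [hwP x (Qt x) y (subset_closure hyo) hyx, ← hy x hx (Metric.ball_subset_ball (Qt x).hrr hyx), inv_mul_cancel_left₀ hc.ne']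
  · have h : ∀ᵐ y ∂mu Ω, ∀ x ∈ t, y ∈ Metric.ball (x : E2) (Qt x).r → c0 • innerSL ℝ (GG U y) = (Qt x).R1 f (GG U) (uu U) 0 y := by
      rw [Filter.eventually_all_finset]
      exact fun x _ => (Qt x).grad0 D.o D.b S.hU S.T S.hw
    filter_upwards [h, ae_restrict_mem D.o.measurableSet] with y hy hyo
    obtain ⟨x, hx, hyx⟩ := ht y (subset_closure hyo)
    rw [hrep x (Qt x) y (subset_closure hyo) hyx, ← hy x hx (Metric.ball_subset_ball (Qt x).hrr hyx), inv_smul_smul₀ hc.ne']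

end GlobC1Sec


noncomputable section C2Sec

variable {Ω : Set E2} {x0 : E2} {f : E2 → ℝ} {U : HH Ω}

lemma near_conv {h k : E2 → ℝ} (hh : ContDiff ℝ 1 h) (hc : HasCompactSupport h) (hk : LocallyIntegrable (fun z => k (-z)) volume) :
    ContDiff ℝ 1 (fun y => ∫ x, h x * k (x - y)) ∧ ∀ y, Integrable (fun x => h x * k (x - y)) := by
  have e : ∀ y : E2, (fun x => h x * k (x - y)) = fun x => ContinuousLinearMap.mul ℝ ℝ (h x) ((fun z => k (-z)) (y - x)) := by
    intro y; funext x; simp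
  refine ⟨?_, fun y => ?_⟩
  · have := hc.contDiff_convolution_left (n := 1) (ContinuousLinearMap.mul ℝ ℝ) hh hk
    have e' : (fun y => ∫ x, h x * k (x - y)) = convolution h (fun z => k (-z)) (ContinuousLinearMap.mul ℝ ℝ) volume := by
      funext y; rw [e y]; rfl
    rw [e']; exact this
  · rw [e y]
    exact hc.convolutionExists_left (ContinuousLinearMap.mul ℝ ℝ) hh.continuous hk y

lemma cut_kernel {k : E2 → ℝ} (hk : ∀ z, z ≠ 0 → ContDiffAt ℝ 1 k z) {r R : ℝ} (hr : 0 < r) (hR : 0 < R) :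
    ∃ K : E2 → ℝ, ContDiff ℝ 1 K ∧ HasCompactSupport K ∧ ∀ z, r ≤ ‖z‖ → ‖z‖ ≤ R → K z = k (-z) := by
  let b1 : ContDiffBump (0:E2) := ⟨R, R + 1, hR, by linarith⟩
  let b2 : ContDiffBump (0:E2) := ⟨r / 2, r, by linarith, by linarith⟩
  refine ⟨fun z => b1 z * ((1 - b2 z) * k (-z)), ?_, b1.hasCompactSupport.mul_right, ?_⟩
  · rw [contDiff_iff_contDiffAt]
    intro z
    by_cases hz : z = 0
    · subst hz
      refine contDiffAt_const (c := (0:ℝ)) |>.congr_of_eventuallyEq ?_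
      filter_upwards [Metric.closedBall_mem_nhds (0:E2) (by linarith : 0 < r / 2)] with p hp
      rw [b2.one_of_mem_closedBall hp]; simp
    · exact b1.contDiffAt.mul ((contDiffAt_const.sub b2.contDiffAt).mul ((hk (-z) (neg_ne_zero.2 hz)).comp z contDiffAt_id.neg))
  · intro z h1 h2
    have e1 : b1 z = 1 := b1.one_of_mem_closedBall (by simpa using h2)
    have e2 : b2 z = 0 := b2.zero_of_le_dist (by simpa using h1)
    simp [e1, e2]

lemma far_conv (ho : IsOpen Ω) (hb : IsBounded Ω) {r : ℝ} (hr : 0 < r) {w k : E2 → ℝ} (hw : Integrable w (mu Ω)) (hw0 : ∀ x ∈ Metric.ball x0 (2 * r), w x = 0)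
    (hk : ∀ z, z ≠ 0 → ContDiffAt ℝ 1 k z) :
    ContDiffOn ℝ 1 (fun y => ∫ x in Ω, w x * k (x - y)) (Metric.ball x0 r) ∧ ∀ y ∈ Metric.ball x0 r, Integrable (fun x => w x * k (x - y)) (mu Ω) := by
  obtain ⟨R, hR⟩ := hb.subset_ball x0
  have hRp : 0 < |R| + r := by positivity
  obtain ⟨K, hK, hKc, hKe⟩ := cut_kernel hk hr hRp
  have hL : LocallyIntegrable (Ω.indicator w) volume := by
    refine Integrable.locallyIntegrable ?_
    rw [integrable_indicator_iff ho.measurableSet]; exact hw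
  have e : ∀ y ∈ Metric.ball x0 r, (Ω.indicator fun x => w x * k (x - y)) = fun x => ContinuousLinearMap.mul ℝ ℝ (Ω.indicator w x) (K (y - x)) := by
    intro y hy
    funext x
    by_cases hx : x ∈ Ω
    · rw [Set.indicator_of_mem hx, Set.indicator_of_mem hx, ContinuousLinearMap.mul_apply']
      by_cases hx2 : x ∈ Metric.ball x0 (2 * r)
      · rw [hw0 x hx2, zero_mul, zero_mul]
      · rw [hKe, neg_sub]
        · rw [Metric.mem_ball] at *
          have := dist_triangle_left x x0 y
          rw [← dist_eq_norm]; push Not at hx2; linarith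
        · have h1 := Metric.mem_ball.1 (hR hx)
          rw [Metric.mem_ball] at hy
          have := dist_triangle_right y x x0
          rw [← dist_eq_norm]; linarith [le_abs_self R]
    · simp [hx]
  refine ⟨?_, fun y hy => ?_⟩
  · have := hKc.contDiff_convolution_right (n := 1) (ContinuousLinearMap.mul ℝ ℝ) hL hK
    refine (this.contDiffOn (s := Metric.ball x0 r)).congr fun y hy => ?_
    rw [← integral_indicator ho.measurableSet, e y hy]; rfl
  · rw [mu, ← IntegrableOn, ← integrable_indicator_iff ho.measurableSet, e y hy]
    exact hKc.convolutionExists_right (ContinuousLinearMap.mul ℝ ℝ) hL hK.continuous y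

lemma pk_li (v : E2) : LocallyIntegrable (fun z => ⟪pk 0 (-z), v⟫) volume := by
  rw [locallyIntegrable_iff]
  intro k hk
  obtain ⟨K, hK, h⟩ := kk_bound hk.isBounded one_pos (by norm_num : (1:ℝ) < 2)
  refine ⟨?_, ?_⟩
  · have : Measurable (fun z : E2 => ⟪pk 0 (-z), v⟫) := by
      unfold pk
      have h1 : Measurable (nn 0) := (nn_contDiff 0 (n := 0)).continuous.measurable
      have h2 : Measurable fun z : E2 => (nn 0 (-z))⁻¹ := (h1.comp measurable_neg).inv
      exact (h2.smul measurable_neg).inner measurable_const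
    exact this.aestronglyMeasurable
  · refine lt_of_le_of_lt (lintegral_mono (g := fun z => kk 1 z 0 * ‖v‖ₑ) fun z => ?_) ?_
    · simp only [kk]
      rw [sub_zero, Real.rpow_neg_one, ← ofReal_norm, ← ofReal_norm, ← ENNReal.ofReal_mul (by positivity)]
      refine ENNReal.ofReal_le_ofReal ((norm_inner_le_norm _ _).trans ?_)
      gcongr
      simpa using pk_norm_le 0 (-z)
    · rw [lintegral_mul_const' _ _ enorm_ne_top]
      exact ENNReal.mul_lt_top (lt_of_le_of_lt (h 0) hK.lt_top) enorm_lt_top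

lemma pk_cda {z : E2} (hz : z ≠ 0) : ContDiffAt ℝ 1 (pk 0) z := by
  unfold pk
  exact ((nn_contDiff 0).contDiffAt.inv (nn_pos' 0 hz).ne').smul contDiffAt_id

lemma Dpk_cda {z : E2} (hz : z ≠ 0) (v : E2) : ContDiffAt ℝ 1 (fun z => Dpk 0 z v) z := by
  simp only [Dpk_apply]
  have h1 : ContDiffAt ℝ 1 (fun z => (nn 0 z)⁻¹) z := (nn_contDiff 0).contDiffAt.inv (nn_pos' 0 hz).ne'
  exact (h1.smul contDiffAt_const).sub (((contDiffAt_const.mul (h1.pow 2)).mul (contDiffAt_id.inner ℝ contDiffAt_const)).smul contDiffAt_id)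

lemma CRep.c2 {w : E2 → ℝ} (R : CRep Ω f U w) (D : Dom Ω) (S : WSol Ω f U) {F : ℝ → ℝ} (hF : ContDiff ℝ 1 F) (hfF : ∀ᵐ y ∂mu Ω, f y = F (w y)) :
    ContDiffOn ℝ 2 w Ω := by
  have key : ∀ x0 ∈ Ω, ∃ s, IsOpen s ∧ x0 ∈ s ∧ s ⊆ Ω ∧ ContDiffOn ℝ 1 (fderiv ℝ w) s := by
    intro x0 hx0
    obtain ⟨P⟩ := exists_patch D.o D.b D.bd (subset_closure hx0)
    obtain ⟨hσ, hsup⟩ := P.int_tsupp hx0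
    obtain ⟨B, hB, hη⟩ := P.eta_bound
    have hr := P.hr
    have hW := S.T.Wint D.b
    have hgm : Measurable (gradient P.η) := (gradient_cont P.hη).measurable
    refine ⟨Ω ∩ Metric.ball x0 P.r', D.o.inter Metric.isOpen_ball, ⟨hx0, Metric.mem_ball_self P.hr'⟩, Set.inter_subset_left, ?_⟩
    have hfw : ∀ y ∈ Ω ∩ Metric.ball x0 P.r', fderiv ℝ w y = c0⁻¹ • P.R1 f (GG U) (uu U) 0 y := fun y hy => by
      rw [← R.rep x0 P y (subset_closure hy.1) hy.2]
      exact (fderivWithin_of_mem_nhds (mem_of_superset (D.o.mem_nhds hy.1) subset_closure)).symm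
    refine ContDiffOn.congr ?_ hfw
    refine ContDiffOn.const_smul _ ?_
    rw [contDiffOn_clm_apply]
    intro v
    set h : E2 → ℝ := fun x => P.η x * F (w x) with hh
    have hh1 : ContDiff ℝ 1 h := by
      rw [contDiff_iff_contDiffAt]
      intro x
      by_cases hx : x ∈ tsupport h
      swap
      · exact contDiffAt_const (c := (0:ℝ)) |>.congr_of_eventuallyEq (notMem_tsupport_iff_eventuallyEq.1 hx)
      have hx' : x ∈ Ω := hsup (tsupport_mul_subset_left hx)
      have hw1 : ContDiffAt ℝ 1 w x := R.c1.contDiffAt (mem_of_superset (D.o.mem_nhds hx') subset_closure)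
      exact P.hη.contDiffAt.mul (hF.contDiffAt.comp x hw1)
    have hhc : HasCompactSupport h := P.hηc.mul_right
    obtain ⟨n1, n2⟩ := near_conv (k := fun z => ⟪pk 0 z, v⟫) hh1 hhc (pk_li v)
    have iG : Integrable (fun x => ⟪GG U x, gradient P.η x⟫) (mu Ω) := by
      refine (hW.const_mul B).mono' (S.T.hG.inner hgm).aestronglyMeasurable (ae_of_all _ fun x => ?_)
      refine (norm_inner_le_norm _ _).trans ?_
      nlinarith [(hη x).2, norm_nonneg (GG U x), abs_nonneg (f x), abs_nonneg (uu U x), mul_nonneg hB (abs_nonneg (f x)), mul_nonneg hB (abs_nonneg (uu U x)), mul_le_mul_of_nonneg_left (hη x).2 (norm_nonneg (GG U x))]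
    have iW : ∀ i, Integrable (fun x => P.cW (uu U) x i) (mu Ω) := by
      intro i
      have hm : Measurable (fun x => P.cW (uu U) x i) := by
        have h1 : Measurable (P.cW (uu U)) := S.T.hu.smul hgm
        have h2 : Continuous (fun z : E2 => z i) := by fun_prop
        exact h2.measurable.comp h1
      refine (hW.const_mul B).mono' hm.aestronglyMeasurable (ae_of_all _ fun x => ?_)
      refine (PiLp.norm_apply_le _ i).trans ?_
      rw [Patch.cW, norm_smul, Real.norm_eq_abs]
      nlinarith [(hη x).2, norm_nonneg (GG U x), abs_nonneg (f x), abs_nonneg (uu U x), mul_nonneg hB (abs_nonneg (f x)), mul_nonneg hB (norm_nonneg (GG U x)), mul_le_mul_of_nonneg_left (hη x).2 (abs_nonneg (uu U x))]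
    obtain ⟨g1, g2⟩ := far_conv D.o D.b (x0 := x0) hr (k := fun z => ⟪pk 0 z, v⟫) iG (fun x hx => by rw [P.grad_in hx, inner_zero_right]) (fun z hz => (pk_cda hz).inner ℝ contDiffAt_const)
    have wf := fun i => far_conv D.o D.b (x0 := x0) hr (k := fun z => (Dpk 0 z v) i) (iW i) (fun x hx => by rw [Patch.cW, P.grad_in hx, smul_zero]; rfl)
      (fun z hz => (EuclideanSpace.proj i : E2 →L[ℝ] ℝ).contDiff.contDiffAt.comp z (Dpk_cda hz v))
    have hsub : Ω ∩ Metric.ball x0 P.r' ⊆ Metric.ball x0 P.r := fun y hy => Metric.ball_subset_ball P.hrr hy.2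
    refine ((((n1.contDiffOn (s := Metric.ball x0 P.r)).sub g1).add ((wf 0).1.add (wf 1).1)).mono hsub).congr fun y hy => ?_
    have hyr := hsub hy
    rw [Patch.R1, ContinuousLinearMap.integral_apply (P.FD_int0 S.T D.o (subset_closure hy.1) hyr (R.gd y))]
    have e1 : ∫ x, h x * ⟪pk 0 (x - y), v⟫ = ∫ x in Ω, h x * ⟪pk 0 (x - y), v⟫ := by
      rw [setIntegral_eq_integral_of_forall_compl_eq_zero]
      intro x hx
      rw [hh]; simp only
      rw [image_eq_zero_of_notMem_tsupport (fun hx' => hx (hsup hx')), zero_mul, zero_mul]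
    have i1 : Integrable (fun x => h x * ⟪pk 0 (x - y), v⟫) (mu Ω) := (n2 y).integrableOn
    have i2 := g2 y hyr
    have i12 : Integrable (fun x => h x * ⟪pk 0 (x - y), v⟫ - ⟪GG U x, gradient P.η x⟫ * ⟪pk 0 (x - y), v⟫) (mu Ω) := i1.sub i2
    have i3 := (wf 0).2 y hyr
    have i4 := (wf 1).2 y hyr
    have i34 : Integrable (fun x => P.cW (uu U) x 0 * (Dpk 0 (x - y) v) 0 + P.cW (uu U) x 1 * (Dpk 0 (x - y) v) 1) (mu Ω) := i3.add i4
    simp only [Pi.add_apply, Pi.sub_apply]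
    rw [e1, ← mu, ← integral_sub i1 i2, ← integral_add i3 i4, ← integral_add i12 i34]
    refine integral_congr_ae ?_
    filter_upwards [hfF] with x hx
    simp only [Patch.FD, Patch.Fd, hσ, Patch.cA, hx, hh]
    simp [inner2]
    ring
  rw [show (2 : WithTop ℕ∞) = 1 + 1 by norm_num, contDiffOn_succ_iff_fderiv_of_isOpen D.o]
  refine ⟨?_, by simp, ?_⟩
  · exact (R.c1.mono subset_closure).differentiableOn (by norm_num)
  · intro x hx
    obtain ⟨s, hs, hxs, hsΩ, h⟩ := key x hx
    exact ((h x hxs).contDiffAt (hs.mem_nhds hxs)).contDiffWithinAt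

end C2Sec


noncomputable section EqSec

variable {Ω : Set E2} {x0 : E2} {f : E2 → ℝ} {U : HH Ω} {w : E2 → ℝ}

lemma ext_cont (ho : IsOpen Ω) {φ h : E2 → ℝ} (hφ : Continuous φ) (ht : tsupport φ ⊆ Ω) (hh : ContinuousOn h Ω) : Continuous (fun x => φ x * h x) := by
  refine continuous_of_tsupport fun x hx => ?_
  have hx' := ht (tsupport_mul_subset_left hx)
  exact hφ.continuousAt.mul (hh.continuousAt (ho.mem_nhds hx'))

lemma ext_c1 (ho : IsOpen Ω) {φ h : E2 → ℝ} (hφ : ContDiff ℝ 1 φ) (ht : tsupport φ ⊆ Ω) (hh : ContDiffOn ℝ 1 h Ω) : ContDiff ℝ 1 (fun x => φ x * h x) := by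
  rw [contDiff_iff_contDiffAt]
  intro x
  by_cases hx : x ∈ tsupport (fun x => φ x * h x)
  · have hx' := ht (tsupport_mul_subset_left hx)
    exact hφ.contDiffAt.mul (hh.contDiffAt (ho.mem_nhds hx'))
  · exact contDiffAt_const (c := (0:ℝ)) |>.congr_of_eventuallyEq (notMem_tsupport_iff_eventuallyEq.1 hx)

lemma d_c1 (ho : IsOpen Ω) (hw : ContDiffOn ℝ 2 w Ω) (v : E2) : ContDiffOn ℝ 1 (fun y => fderiv ℝ w y v) Ω :=
  (hw.fderiv_of_isOpen ho (by norm_num : (1:WithTop ℕ∞) + 1 ≤ 2)).clm_apply contDiffOn_const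

lemma lap_cont (ho : IsOpen Ω) (hw : ContDiffOn ℝ 2 w Ω) : ContinuousOn (lap w) Ω := by
  unfold lap
  refine continuousOn_finsetSum _ fun i _ => ?_
  exact ((d_c1 ho hw (ee i)).continuousOn_fderiv_of_isOpen ho (by norm_num)).clm_apply continuousOn_const

lemma green_cc (ho : IsOpen Ω) (hw : ContDiffOn ℝ 2 w Ω) {φ : E2 → ℝ} (hφ : ContDiff ℝ 1 φ) (hc : HasCompactSupport φ) (ht : tsupport φ ⊆ Ω) :
    ∫ x in Ω, (φ x * lap w x + fderiv ℝ w x (gradient φ x)) = 0 := by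
  have hψ := fun i => ext_c1 ho hφ ht (d_c1 ho hw (ee i))
  have hψc : ∀ i, HasCompactSupport (fun x => φ x * fderiv ℝ w x (ee i)) := fun i => hc.mul_right
  have hi : ∀ i, Integrable (fun x => fderiv ℝ (fun x => φ x * fderiv ℝ w x (ee i)) x (ee i)) := fun i =>
    (((hψ i).continuous_fderiv (by norm_num)).clm_apply continuous_const).integrable_of_hasCompactSupport ((hψc i).fderiv_apply ℝ (ee i))
  have h0 : ∫ x, (fderiv ℝ (fun x => φ x * fderiv ℝ w x (ee 0)) x (ee 0) + fderiv ℝ (fun x => φ x * fderiv ℝ w x (ee 1)) x (ee 1)) = 0 := by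
    rw [integral_add (hi 0) (hi 1), int_fderiv_zero (hψ 0) (hψc 0), int_fderiv_zero (hψ 1) (hψc 1), add_zero]
  rw [← setIntegral_eq_integral_of_forall_compl_eq_zero (s := Ω)] at h0
  · rw [← h0]
    refine setIntegral_congr_fun ho.measurableSet fun x hx => ?_
    have e : ∀ i, fderiv ℝ (fun x => φ x * fderiv ℝ w x (ee i)) x (ee i) = φ x * fderiv ℝ (fun y => fderiv ℝ w y (ee i)) x (ee i) + fderiv ℝ w x (ee i) * fderiv ℝ φ x (ee i) := by
      intro i
      have h1 := (hφ.differentiable (by norm_num) x).hasFDerivAt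
      have h2 := (((d_c1 ho hw (ee i)).contDiffAt (ho.mem_nhds hx)).differentiableAt (by norm_num)).hasFDerivAt
      have h3 : HasFDerivAt (fun x => φ x * fderiv ℝ w x (ee i)) _ x := h1.mul h2
      rw [h3.fderiv]; simp
    have e2 : ∀ i, (gradient φ x) i = fderiv ℝ φ x (ee i) := by
      intro i; rw [← gr_inner, EuclideanSpace.inner_single_right]; simp
    show φ x * lap w x + fderiv ℝ w x (gradient φ x) = _
    rw [e 0, e 1, fderiv_apply_eq, e2, e2, lap, Fin.sum_univ_two]
    ring
  · intro x hx
    have hn : ∀ i, x ∉ tsupport (fun x => φ x * fderiv ℝ w x (ee i)) := fun i h => hx (ht (tsupport_mul_subset_left h))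
    rw [fderiv_of_notMem_tsupport ℝ (hn 0), fderiv_of_notMem_tsupport ℝ (hn 1)]; simp

lemma CRep.fw (R : CRep Ω f U w) (D : Dom Ω) {x : E2} (hx : x ∈ Ω) : fderivWithin ℝ w (closure Ω) x = fderiv ℝ w x :=
  fderivWithin_of_mem_nhds (mem_of_superset (D.o.mem_nhds hx) subset_closure)

lemma CRep.weak (R : CRep Ω f U w) (D : Dom Ω) (S : WSol Ω f U) {F : ℝ → ℝ} (hfF : ∀ᵐ y ∂mu Ω, f y = F (w y)) {φ : E2 → ℝ} (hφ : ContDiff ℝ 1 φ) :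
    ∫ x in Ω, fderivWithin ℝ w (closure Ω) x (gradient φ x) = ∫ x in Ω, F (w x) * φ x := by
  have h := S.hw φ hφ
  have e1 : ∫ x in Ω, fderivWithin ℝ w (closure Ω) x (gradient φ x) = ∫ x in Ω, ⟪GG U x, gradient φ x⟫ := by
    refine integral_congr_ae ?_
    filter_upwards [R.ae1] with x hx
    rw [hx]; simp
  rw [e1, h]
  refine integral_congr_ae ?_
  filter_upwards [hfF] with x hx
  rw [hx]

lemma CRep.eqn (R : CRep Ω f U w) (D : Dom Ω) (S : WSol Ω f U) {F : ℝ → ℝ} (hF : ContDiff ℝ 1 F) (hfF : ∀ᵐ y ∂mu Ω, f y = F (w y)) :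
    ∀ x ∈ Ω, lap w x = - F (w x) := by
  have hw := R.c2 D S hF hfF
  have hlc := lap_cont D.o hw
  have hFc : ContinuousOn (fun x => F (w x)) Ω := hF.continuous.comp_continuousOn (R.c1.continuousOn.mono subset_closure)
  have hc : ContinuousOn (fun x => lap w x + F (w x)) Ω := hlc.add hFc
  have key : ∀ᵐ x, x ∈ Ω → lap w x + F (w x) = 0 := by
    refine D.o.ae_eq_zero_of_integral_contDiff_smul_eq_zero (hc.locallyIntegrableOn D.o.measurableSet) ?_
    intro φ hφ hcs ht
    have hφ1 : ContDiff ℝ 1 φ := hφ.of_le (by exact_mod_cast le_top)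
    have i1 : Integrable (fun x => φ x * lap w x) := (ext_cont D.o hφ.continuous ht hlc).integrable_of_hasCompactSupport hcs.mul_right
    have i2 : Integrable (fun x => φ x * F (w x)) := (ext_cont D.o hφ.continuous ht hFc).integrable_of_hasCompactSupport hcs.mul_right
    have g := green_cc D.o hw hφ1 hcs ht
    have wk := R.weak D S hfF hφ1
    have e : ∫ x in Ω, fderivWithin ℝ w (closure Ω) x (gradient φ x) = ∫ x in Ω, fderiv ℝ w x (gradient φ x) :=
      setIntegral_congr_fun D.o.measurableSet fun x hx => by rw [R.fw D hx]
    have i3 : IntegrableOn (fun x => fderiv ℝ w x (gradient φ x)) Ω := by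
      have hm : IntegrableOn (fun x => ⟪GG U x, gradient φ x⟫) Ω := by
        obtain ⟨B, hB⟩ := (gradient_cont hφ1).bounded_above_of_compact_support (by
          refine (hcs.fderiv ℝ).mono fun x hx => ?_
          simp only [Function.mem_support, gradient] at *
          intro h; apply hx; rw [h]; simp)
        refine ((S.T.Wint D.b).const_mul B).mono' (S.T.hG.inner (gradient_cont hφ1).measurable).aestronglyMeasurable (ae_of_all _ fun x => ?_)
        refine (norm_inner_le_norm _ _).trans ?_
        have hB0 := (norm_nonneg _).trans (hB x)
        nlinarith [mul_le_mul_of_nonneg_left (hB x) (norm_nonneg (GG U x)), mul_nonneg hB0 (abs_nonneg (f x)), mul_nonneg hB0 (abs_nonneg (uu U x))]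
      refine hm.congr ?_
      filter_upwards [R.ae1, ae_restrict_mem D.o.measurableSet] with x hx hxo
      rw [← R.fw D hxo, hx]; simp
    rw [integral_add i1.integrableOn i3, ← e, wk] at g
    have hz : ∫ x, φ x • (lap w x + F (w x)) = ∫ x in Ω, φ x • (lap w x + F (w x)) := by
      rw [setIntegral_eq_integral_of_forall_compl_eq_zero]
      intro x hx
      rw [image_eq_zero_of_notMem_tsupport (fun h => hx (ht h)), zero_smul]
    rw [hz]
    simp only [smul_eq_mul, mul_add]
    rw [integral_add i1.integrableOn i2.integrableOn, ← g]
    simp only [mul_comm]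
  have := eq_of_ae (g := fun x => lap w x + F (w x)) (h := fun _ => (0:ℝ)) D.o D.o (hc.mono Set.inter_subset_right) continuousOn_const (ae_restrict_of_ae key)
  intro x hx
  have h := this x (subset_closure hx) hx
  linarith

end EqSec


noncomputable section MaxSec

variable {Ω : Set E2} {w : E2 → ℝ}

lemma second_test {φ φ' : ℝ → ℝ} {d : ℝ} (hm : IsLocalMin φ 0) (h1 : ∀ᶠ t in 𝓝 0, HasDerivAt φ (φ' t) t) (h2 : HasDerivAt φ' d 0) : 0 ≤ d := by
  by_contra! hd
  have e1 : deriv (fun t => -φ t) =ᶠ[𝓝 0] fun t => -φ' t := by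
    filter_upwards [h1] with t ht using ht.neg.deriv
  have h3 : deriv (deriv (fun t => -φ t)) 0 = -d := by rw [e1.deriv_eq]; exact h2.neg.deriv
  have h4 : deriv (fun t => -φ t) 0 = 0 := hm.neg.deriv_eq_zero
  have h5 : IsLocalMin (fun t => -φ t) 0 := isLocalMin_of_deriv_deriv_pos (by rw [h3]; linarith) h4 h1.self_of_nhds.neg.continuousAt
  have h6 : φ =ᶠ[𝓝 0] fun _ => φ 0 := by
    filter_upwards [hm, h5] with t a b
    linarith
  have h7 : φ' =ᶠ[𝓝 0] fun _ => 0 := by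
    filter_upwards [h1, h6.eventuallyEq_nhds] with t a b
    rw [← a.deriv, b.deriv_eq]; simp
  have := h7.deriv_eq
  rw [h2.deriv] at this
  simp at this
  linarith

lemma lap_at_min (ho : IsOpen Ω) (hw : ContDiffOn ℝ 2 w Ω) {p q : E2} (hq : q ∈ Ω) {α c : ℝ}
    (hm : IsLocalMin (fun x => w x - c * Real.exp (-α * ‖x - p‖ ^ 2)) q) :
    c * (Real.exp (-α * ‖q - p‖ ^ 2) * (4 * α ^ 2 * ‖q - p‖ ^ 2 - 4 * α)) ≤ lap w q := by
  set E := Real.exp (-α * ‖q - p‖ ^ 2) with hE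
  have key : ∀ i : Fin 2, c * (E * (4 * α ^ 2 * (q - p) i ^ 2 - 2 * α)) ≤ fderiv ℝ (fun y => fderiv ℝ w y (ee i)) q (ee i) := by
    intro i
    set yi := (q - p) i with hyi
    have hline : ∀ t : ℝ, HasDerivAt (fun t : ℝ => q + t • ee i) (ee i) t := fun t => by
      simpa using ((hasDerivAt_id t).smul_const (ee i)).const_add q
    have hlc : Continuous (fun t : ℝ => q + t • ee i) := by fun_prop
    have hl0 : Tendsto (fun t : ℝ => q + t • ee i) (𝓝 0) (𝓝 q) := by simpa using hlc.tendsto 0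
    have hnorm : ∀ t : ℝ, ‖q + t • ee i - p‖ ^ 2 = ‖q - p‖ ^ 2 + 2 * t * yi + t ^ 2 := by
      intro t
      rw [show q + t • ee i - p = (q - p) + t • ee i by abel, norm_add_sq_real, inner_smul_right, EuclideanSpace.inner_single_right, norm_smul]
      simp [hyi]; ring
    have hex : ∀ t : ℝ, HasDerivAt (fun t : ℝ => Real.exp (-α * ‖q + t • ee i - p‖ ^ 2)) (Real.exp (-α * (‖q - p‖ ^ 2 + 2 * t * yi + t ^ 2)) * (-α * (2 * yi + 2 * t))) t := by
      intro t
      simp only [hnorm]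
      have : HasDerivAt (fun t : ℝ => -α * (‖q - p‖ ^ 2 + 2 * t * yi + t ^ 2)) (-α * (2 * yi + 2 * t)) t := by
        refine (((((hasDerivAt_id t).const_mul 2).mul_const yi).const_add (‖q - p‖ ^ 2)).add ((hasDerivAt_id t).pow 2)).const_mul (-α) |>.congr_deriv ?_
        simp
      exact this.exp
    have hex2 : HasDerivAt (fun t : ℝ => Real.exp (-α * (‖q - p‖ ^ 2 + 2 * t * yi + t ^ 2)) * (-α * (2 * yi + 2 * t))) (E * (4 * α ^ 2 * yi ^ 2 - 2 * α)) 0 := by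
      have h1 : HasDerivAt (fun t : ℝ => Real.exp (-α * (‖q - p‖ ^ 2 + 2 * t * yi + t ^ 2))) (E * (-α * (2 * yi))) 0 := by
        have := hex 0
        simp only [hnorm] at this
        refine this.congr_deriv ?_
        simp [hE]
      have h2 : HasDerivAt (fun t : ℝ => -α * (2 * yi + 2 * t)) (-α * 2) 0 := by
        refine (((hasDerivAt_id (0:ℝ)).const_mul 2).const_add (2 * yi)).const_mul (-α) |>.congr_deriv ?_
        simp
      refine (h1.mul h2).congr_deriv ?_
      simp [hE]; ring
    have hwd : ∀ᶠ t in 𝓝 (0:ℝ), HasDerivAt (fun t : ℝ => w (q + t • ee i)) (fderiv ℝ w (q + t • ee i) (ee i)) t := by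
      filter_upwards [hl0.eventually (ho.mem_nhds hq)] with t ht
      have : HasFDerivAt w (fderiv ℝ w (q + t • ee i)) (q + t • ee i) := ((hw.contDiffAt (ho.mem_nhds ht)).differentiableAt (by norm_num)).hasFDerivAt
      exact this.comp_hasDerivAt t (hline t)
    have hwd2 : HasDerivAt (fun t : ℝ => fderiv ℝ w (q + t • ee i) (ee i)) (fderiv ℝ (fun y => fderiv ℝ w y (ee i)) q (ee i)) 0 := by
      have : HasFDerivAt (fun y => fderiv ℝ w y (ee i)) (fderiv ℝ (fun y => fderiv ℝ w y (ee i)) q) (q + (0:ℝ) • ee i) := by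
        rw [zero_smul, add_zero]
        exact (((d_c1 ho hw (ee i)).contDiffAt (ho.mem_nhds hq)).differentiableAt (by norm_num)).hasFDerivAt
      exact this.comp_hasDerivAt 0 (hline 0)
    have hmin : IsLocalMin (fun t : ℝ => w (q + t • ee i) - c * Real.exp (-α * ‖q + t • ee i - p‖ ^ 2)) 0 := by
      have := hl0.eventually hm
      filter_upwards [this] with t ht
      simpa using ht
    have := second_test hmin (hwd.mono fun t ht => ht.sub ((hex t).const_mul c)) (hwd2.sub (hex2.const_mul c))
    linarith
  have k0 := key 0
  have k1 := key 1
  have hn : ‖q - p‖ ^ 2 = (q - p) 0 ^ 2 + (q - p) 1 ^ 2 := by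
    rw [EuclideanSpace.norm_sq_eq, Fin.sum_univ_two, Real.norm_eq_abs, Real.norm_eq_abs, sq_abs, sq_abs]
  rw [lap, Fin.sum_univ_two]
  refine le_trans (le_of_eq ?_) (add_le_add k0 k1)
  rw [hn]; ring

lemma barrier (ho : IsOpen Ω) (hw : ContDiffOn ℝ 2 w Ω) (h0 : ∀ x ∈ Ω, 0 ≤ w x) {l : ℝ} (hl : 0 ≤ l) (hlap : ∀ x ∈ Ω, lap w x ≤ l * w x)
    {p : E2} {ρ R : ℝ} (hρ : 0 < ρ) (hR : Metric.closedBall p R ⊆ Ω) (hpos : ∀ x ∈ Metric.closedBall p ρ, x ∈ Ω → 0 < w x) :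
    ∀ x ∈ Metric.ball p R, 0 < w x := by
  intro x hx
  have hxΩ := hR (Metric.ball_subset_closedBall hx)
  by_cases hxρ : x ∈ Metric.closedBall p ρ
  · exact hpos x hxρ hxΩ
  rw [Metric.mem_closedBall, not_le, dist_eq_norm] at hxρ
  rw [Metric.mem_ball, dist_eq_norm] at hx
  have hρR : ρ < R := hxρ.trans hx
  have hcont : ContinuousOn w Ω := hw.continuousOn
  have hsub : Metric.closedBall p ρ ⊆ Ω := (Metric.closedBall_subset_closedBall hρR.le).trans hR
  obtain ⟨z, hz, hzm⟩ := (isCompact_closedBall p ρ).exists_isMinOn ⟨p, Metric.mem_closedBall_self hρ.le⟩ (hcont.mono hsub)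
  have hm := hpos z hz (hsub hz)
  set m := w z with hmd
  obtain ⟨α, hα, hα2⟩ : ∃ α : ℝ, 0 < α ∧ l < 4 * α ^ 2 * ρ ^ 2 - 4 * α := by
    refine ⟨(l + 2) / ρ ^ 2 + (l + 1), by positivity, ?_⟩
    set s := (l + 2) / ρ ^ 2 with hs
    have e : s * ρ ^ 2 = l + 2 := by rw [hs]; field_simp
    have hs0 : 0 ≤ s := by positivity
    nlinarith [mul_nonneg (add_nonneg hs0 (by linarith : 0 ≤ l + 1)) (mul_nonneg (by linarith : 0 ≤ l + 1) (sq_nonneg ρ)), mul_nonneg (add_nonneg hs0 (by linarith : 0 ≤ l + 1)) hl]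
  set C := Real.exp (-α * R ^ 2) with hC
  set g : E2 → ℝ := fun x => w x - m * Real.exp (-α * ‖x - p‖ ^ 2) with hg
  set K : Set E2 := Metric.closedBall p R \ Metric.ball p ρ with hK
  have hKc : IsCompact K := (isCompact_closedBall p R).diff Metric.isOpen_ball
  have hKΩ : K ⊆ Ω := Set.diff_subset.trans hR
  have hgc : ContinuousOn g K := (hcont.mono hKΩ).sub (by fun_prop)
  have hxK : x ∈ K := ⟨by rw [Metric.mem_closedBall, dist_eq_norm]; exact hx.le, by rw [Metric.mem_ball, dist_eq_norm]; linarith⟩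
  obtain ⟨q, hqK, hqm⟩ := hKc.exists_isMinOn ⟨x, hxK⟩ hgc
  have hqΩ := hKΩ hqK
  have q1 : ‖q - p‖ ≤ R := by rw [← dist_eq_norm]; exact hqK.1
  have q2 : ρ ≤ ‖q - p‖ := by rw [← dist_eq_norm]; exact not_lt.1 hqK.2
  have main : -(m * C) ≤ g q := by
    rcases eq_or_lt_of_le q2 with h | h
    · have hqz : q ∈ Metric.closedBall p ρ := by rw [Metric.mem_closedBall, dist_eq_norm, ← h]
      have h3 : m ≤ w q := hzm hqz
      have h4 : Real.exp (-α * ‖q - p‖ ^ 2) ≤ 1 := Real.exp_le_one_iff.2 (by nlinarith [sq_nonneg ‖q - p‖])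
      have : 0 < m * C := mul_pos hm (Real.exp_pos _)
      simp only [hg]; nlinarith
    rcases eq_or_lt_of_le q1 with h' | h'
    · simp only [hg]; rw [h']; linarith [h0 q hqΩ]
    by_contra! hlt
    have hloc : IsLocalMin g q := by
      have hnb : Metric.ball p R ∩ (Metric.closedBall p ρ)ᶜ ∈ 𝓝 q := (Metric.isOpen_ball.inter Metric.isClosed_closedBall.isOpen_compl).mem_nhds
        ⟨by rwa [Metric.mem_ball, dist_eq_norm], by rw [Set.mem_compl_iff, Metric.mem_closedBall, dist_eq_norm]; linarith⟩
      filter_upwards [hnb] with y hy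
      exact hqm ⟨Metric.ball_subset_closedBall hy.1, fun h => hy.2 (Metric.ball_subset_closedBall h)⟩
    have h5 := lap_at_min ho hw hqΩ hloc
    have h6 := hlap q hqΩ
    simp only [hg] at hlt
    set E := Real.exp (-α * ‖q - p‖ ^ 2) with hE
    have hEp : 0 < E := Real.exp_pos _
    have hCp : 0 < C := Real.exp_pos _
    have h7 : w q ≤ m * E := by nlinarith [mul_pos hm hCp]
    have h8 : l < 4 * α ^ 2 * ‖q - p‖ ^ 2 - 4 * α := by
      have : ρ ^ 2 ≤ ‖q - p‖ ^ 2 := by gcongr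
      nlinarith [mul_le_mul_of_nonneg_left this (by positivity : 0 ≤ 4 * α ^ 2)]
    have h9 : m * E * l < m * E * (4 * α ^ 2 * ‖q - p‖ ^ 2 - 4 * α) := mul_lt_mul_of_pos_left h8 (mul_pos hm hEp)
    nlinarith [mul_le_mul_of_nonneg_left h7 hl]
  have hxg : g q ≤ g x := hqm hxK
  have hEx : C < Real.exp (-α * ‖x - p‖ ^ 2) := by
    rw [hC, Real.exp_lt_exp]
    have : ‖x - p‖ ^ 2 < R ^ 2 := by gcongr
    nlinarith
  have h10 : g x = w x - m * Real.exp (-α * ‖x - p‖ ^ 2) := rfl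
  nlinarith [mul_lt_mul_of_pos_left hEx hm]

lemma strong_max (ho : IsOpen Ω) (hcn : IsConnected Ω) (hw : ContDiffOn ℝ 2 w Ω) (h0 : ∀ x ∈ Ω, 0 ≤ w x) {l : ℝ} (hl : 0 ≤ l) (hlap : ∀ x ∈ Ω, lap w x ≤ l * w x)
    (hne : ∃ x ∈ Ω, w x ≠ 0) : ∀ x ∈ Ω, 0 < w x := by
  have hA : IsOpen (Ω ∩ {x | 0 < w x}) := hw.continuousOn.isOpen_inter_preimage ho isOpen_Ioi
  obtain ⟨x1, hx1, hx1n⟩ := hne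
  have hsub : Ω ⊆ Ω ∩ {x | 0 < w x} := by
    refine hcn.isPreconnected.subset_of_closure_inter_subset hA ⟨x1, hx1, hx1, lt_of_le_of_ne (h0 x1 hx1) (Ne.symm hx1n)⟩ ?_
    rintro z ⟨hzc, hz⟩
    refine ⟨hz, ?_⟩
    obtain ⟨δ, hδ, hball⟩ := Metric.isOpen_iff.1 ho z hz
    obtain ⟨p, hp, hpz⟩ := Metric.mem_closure_iff.1 hzc (δ / 4) (by linarith)
    obtain ⟨ρ, hρ, hpρ⟩ := Metric.isOpen_iff.1 hA p hp
    refine barrier ho hw h0 hl hlap (p := p) (ρ := ρ / 2) (R := δ / 2) (by linarith) ?_ ?_ z ?_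
    · intro y hy
      apply hball
      rw [Metric.mem_closedBall] at hy
      rw [Metric.mem_ball]
      linarith [dist_triangle y p z, dist_comm p z]
    · intro y hy _
      refine (hpρ ?_).2
      rw [Metric.mem_closedBall] at hy
      rw [Metric.mem_ball]; linarith
    · rw [Metric.mem_ball]; linarith
  exact fun x hx => (hsub hx).2

end MaxSec


noncomputable section NeuSec

variable {Ω : Set E2} {f : E2 → ℝ} {U : HH Ω} {w : E2 → ℝ}

def lam (n : ℕ) : ℝ := 1 / ((n : ℝ) + 1)
lemma lam_pos (n : ℕ) : 0 < lam n := by unfold lam; positivity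
lemma lam_lim : Tendsto lam atTop (𝓝 0) := tendsto_one_div_add_atTop_nhds_zero_nat

lemma blow {E : Type*} [NormedAddCommGroup E] [NormedSpace ℝ E] (ho : IsOpen Ω) (hb : IsBounded Ω) {y : E2} {W : Set E2} {g : E2 → ℝ}
    (hy : y ∈ closure Ω) (h : IsC2LocalDefining Ω y W g) (hgy : g y = 0) {κ : E2 → E →L[ℝ] ℝ} (hκ : ContinuousOn κ (closure Ω)) {V : E2 → E} (hV : Continuous V) (hc : HasCompactSupport V) :
    Tendsto (fun n => ∫ z, Set.indicator ((fun z => y + lam n • z) ⁻¹' Ω) (fun z => κ (y + lam n • z) (V z)) z) atTop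
      (𝓝 (∫ z, Set.indicator {z | fderiv ℝ g y z < 0} (fun z => κ y (V z)) z)) := by
  obtain ⟨hW, hyW, hg2, hgr, hWΩ⟩ := h
  set m := fderiv ℝ g y with hm
  have hm0 : m ≠ 0 := by
    intro h0; apply hgr y hyW; rw [gradient, ← hm, h0]; simp
  have hgd : HasFDerivAt g m y := ((hg2.contDiffAt (hW.mem_nhds hyW)).differentiableAt (by norm_num)).hasFDerivAt
  obtain ⟨C, hC⟩ := hb.isCompact_closure.exists_bound_of_continuousOn hκ
  have cn : ∀ n, Continuous (fun z : E2 => y + lam n • z) := fun n => by fun_prop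
  refine tendsto_integral_of_dominated_convergence (fun z => C * ‖V z‖) ?_ ?_ ?_ ?_
  · intro n
    have hms : IsOpen ((fun z : E2 => y + lam n • z) ⁻¹' Ω) := ho.preimage (cn n)
    rw [aestronglyMeasurable_indicator_iff hms.measurableSet]
    refine ContinuousOn.aestronglyMeasurable ?_ hms.measurableSet
    exact (hκ.comp (cn n).continuousOn (fun z hz => subset_closure hz)).clm_apply hV.continuousOn
  · exact ((continuous_const.mul hV.norm).integrable_of_hasCompactSupport hc.norm.mul_left)
  · intro n
    refine ae_of_all _ fun z => ?_
    have hC0 : 0 ≤ C := (norm_nonneg _).trans (hC y hy)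
    by_cases hz : z ∈ (fun z : E2 => y + lam n • z) ⁻¹' Ω
    · rw [Set.indicator_of_mem hz]
      exact ((κ _).le_opNorm _).trans (mul_le_mul_of_nonneg_right (hC _ (subset_closure hz)) (norm_nonneg _))
    · rw [Set.indicator_of_notMem hz, norm_zero]; positivity
  · have hker : volume ((LinearMap.ker (m : E2 →ₗ[ℝ] ℝ) : Submodule ℝ E2) : Set E2) = 0 := by
      refine Measure.addHaar_submodule _ _ ?_
      intro ht
      rw [LinearMap.ker_eq_top] at ht
      apply hm0; ext z; exact congrArg (fun l => l z) ht
    filter_upwards [compl_mem_ae_iff.2 hker] with z hz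
    have hz' : m z ≠ 0 := fun h => hz h
    have hl : Tendsto (fun n => y + lam n • z) atTop (𝓝 y) := by
      have := (lam_lim.smul_const z).const_add y
      simpa using this
    have hlW : ∀ᶠ n in atTop, y + lam n • z ∈ W := hl.eventually (hW.mem_nhds hyW)
    have hq : Tendsto (fun n => (lam n)⁻¹ * g (y + lam n • z)) atTop (𝓝 (m z)) := by
      have h1 : HasDerivAt (fun t : ℝ => g (y + t • z)) (m z) 0 := by
        have h2 : HasDerivAt (fun t : ℝ => y + t • z) z 0 := by
          simpa using ((hasDerivAt_id (0:ℝ)).smul_const z).const_add y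
        have h3 : HasFDerivAt g m (y + (0:ℝ) • z) := by simpa using hgd
        exact h3.comp_hasDerivAt (0:ℝ) h2
      have h4 := h1.tendsto_slope_zero
      have h5 : Tendsto lam atTop (𝓝[≠] 0) := tendsto_nhdsWithin_iff.2 ⟨lam_lim, Eventually.of_forall fun n => (lam_pos n).ne'⟩
      have := h4.comp h5
      simpa [Function.comp_def, hgy] using this
    have hΩ : ∀ n, y + lam n • z ∈ W → (y + lam n • z ∈ Ω ↔ (lam n)⁻¹ * g (y + lam n • z) < 0) := by
      intro n hn
      have e : y + lam n • z ∈ Ω ∩ W ↔ y + lam n • z ∈ {y ∈ W | g y < 0} := by rw [hWΩ]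
      have hp := inv_pos.2 (lam_pos n)
      constructor
      · intro h; exact mul_neg_of_pos_of_neg hp (e.1 ⟨h, hn⟩).2
      · intro h; exact (e.2 ⟨hn, (mul_neg_iff.1 h).elim (fun a => a.2) (fun a => absurd a.1 hp.le.not_gt)⟩).1
    rcases lt_or_gt_of_ne hz' with hlt | hgt
    · rw [Set.indicator_of_mem (by exact hlt)]
      have hev : ∀ᶠ n in atTop, y + lam n • z ∈ Ω := by
        filter_upwards [hlW, hq.eventually_lt_const hlt] with n a b using (hΩ n a).2 b
      have hk : Tendsto (fun n => κ (y + lam n • z)) atTop (𝓝 (κ y)) := by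
        refine (hκ y hy).tendsto.comp (tendsto_nhdsWithin_iff.2 ⟨hl, ?_⟩)
        filter_upwards [hev] with n a using subset_closure a
      refine (((ContinuousLinearMap.apply ℝ ℝ (V z)).continuous.tendsto (κ y)).comp hk).congr' ?_
      filter_upwards [hev] with n a
      rw [Set.indicator_of_mem (by exact a)]; rfl
    · rw [Set.indicator_of_notMem (by exact hgt.le.not_gt)]
      refine tendsto_const_nhds.congr' ?_
      filter_upwards [hlW, hq.eventually_const_lt hgt] with n a b
      rw [Set.indicator_of_notMem]
      exact fun h => b.le.not_gt ((hΩ n a).1 h)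

lemma gradient_scale {Φ : E2 → ℝ} (hΦ : ContDiff ℝ 1 Φ) (y : E2) (l : ℝ) (x : E2) :
    gradient (fun x => Φ (l • (x - y))) x = l • gradient Φ (l • (x - y)) := by
  have h1 : HasFDerivAt (fun x : E2 => l • (x - y)) (l • ContinuousLinearMap.id ℝ E2) x := ((hasFDerivAt_id x).sub_const y).const_smul l
  have h2 := (hΦ.differentiable (by norm_num) (l • (x - y))).hasFDerivAt.comp x h1
  refine ext_inner_right ℝ fun v => ?_
  rw [gr_inner, inner_smul_left, gr_inner]
  rw [show (fun x => Φ (l • (x - y))) = Φ ∘ fun x => l • (x - y) from rfl, h2.fderiv]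
  simp

lemma int_scale (y : E2) {l : ℝ} (H : E2 → ℝ) : ∫ z, H (y + l • z) = |(l ^ 2)⁻¹| * ∫ x, H x := by
  have := Measure.integral_comp_smul (volume : Measure E2) (fun z => H (y + z)) l
  rw [this, integral_add_left_eq_self]
  simp

lemma CRep.half (R : CRep Ω f U w) (D : Dom Ω) (S : WSol Ω f U) {F : ℝ → ℝ} (hF : Continuous F) (hfF : ∀ᵐ y ∂mu Ω, f y = F (w y))
    {y : E2} (hy : y ∈ frontier Ω) {W : Set E2} {g : E2 → ℝ} (h : IsC2LocalDefining Ω y W g) (hgy : g y = 0) {Φ : E2 → ℝ} (hΦ : ContDiff ℝ 1 Φ) (hc : HasCompactSupport Φ) :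
    ∫ z, Set.indicator {z | fderiv ℝ g y z < 0} (fun z => fderivWithin ℝ w (closure Ω) y (gradient Φ z)) z = 0 := by
  have hy' := frontier_subset_closure hy
  have hX : ContinuousOn (fun x => fderivWithin ℝ w (closure Ω) x) (closure Ω) := R.c1.continuousOn_fderivWithin D.uniq (by norm_num)
  have hgc : HasCompactSupport (gradient Φ) := by
    refine (hc.fderiv ℝ).mono fun x hx => ?_
    simp only [Function.mem_support, gradient] at *
    intro h; apply hx; rw [h]; simp
  have l1 := blow D.o D.b hy' h hgy hX (gradient_cont hΦ) hgc
  have hk : ContinuousOn (fun x => F (w x) • ContinuousLinearMap.id ℝ ℝ) (closure Ω) := (hF.comp_continuousOn R.c1.continuousOn).smul continuousOn_const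
  have l2 := lam_lim.mul (blow D.o D.b hy' h hgy hk hΦ.continuous hc)
  rw [zero_mul] at l2
  refine tendsto_nhds_unique l1 (l2.congr fun n => ?_)
  have hl := lam_pos n
  have wk := R.weak D S hfF (φ := fun x => Φ ((lam n)⁻¹ • (x - y))) (hΦ.comp (by fun_prop))
  rw [← integral_indicator D.o.measurableSet, ← integral_indicator D.o.measurableSet] at wk
  have e : ∀ z : E2, (lam n)⁻¹ • (y + lam n • z - y) = z := fun z => by
    rw [add_sub_cancel_left, smul_smul, inv_mul_cancel₀ hl.ne', one_smul]
  have s1 := int_scale y (l := lam n) (Set.indicator Ω fun x => fderivWithin ℝ w (closure Ω) x (gradient (fun x => Φ ((lam n)⁻¹ • (x - y))) x))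
  have s2 := int_scale y (l := lam n) (Set.indicator Ω fun x => F (w x) * Φ ((lam n)⁻¹ • (x - y)))
  rw [← wk, ← s1] at s2
  have r1 : ∀ z, Set.indicator ((fun z => y + lam n • z) ⁻¹' Ω) (fun z => fderivWithin ℝ w (closure Ω) (y + lam n • z) (gradient Φ z)) z
      = lam n * Set.indicator Ω (fun x => fderivWithin ℝ w (closure Ω) x (gradient (fun x => Φ ((lam n)⁻¹ • (x - y))) x)) (y + lam n • z) := by
    intro z
    by_cases hz : y + lam n • z ∈ Ω
    · rw [Set.indicator_of_mem (by exact hz), Set.indicator_of_mem hz, gradient_scale hΦ, e, map_smul, smul_eq_mul, mul_inv_cancel_left₀ hl.ne']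
    · rw [Set.indicator_of_notMem (by exact hz), Set.indicator_of_notMem hz, mul_zero]
  have r2 : ∀ z, Set.indicator ((fun z => y + lam n • z) ⁻¹' Ω) (fun z => (F (w (y + lam n • z)) • ContinuousLinearMap.id ℝ ℝ) (Φ z)) z
      = Set.indicator Ω (fun x => F (w x) * Φ ((lam n)⁻¹ • (x - y))) (y + lam n • z) := by
    intro z
    by_cases hz : y + lam n • z ∈ Ω
    · rw [Set.indicator_of_mem (by exact hz), Set.indicator_of_mem hz, e]; simp
    · rw [Set.indicator_of_notMem (by exact hz), Set.indicator_of_notMem hz]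
  simp only [r1, r2]
  rw [integral_const_mul, s2]

def b1 (t : ℝ) : ℝ := Real.smoothTransition (t + 2)
def bb (t : ℝ) : ℝ := b1 t * Real.smoothTransition (2 - t)
lemma b1_cd : ContDiff ℝ ∞ b1 := Real.smoothTransition.contDiff.comp (by fun_prop)
lemma bb_cd : ContDiff ℝ ∞ bb := b1_cd.mul (Real.smoothTransition.contDiff.comp (by fun_prop))
lemma b1_d0 (t : ℝ) : 0 ≤ deriv b1 t := by
  refine Monotone.deriv_nonneg ?_
  intro s t h; exact Real.smoothTransition.monotone (by linarith)
lemma bb_nonneg (t : ℝ) : 0 ≤ bb t := mul_nonneg (Real.smoothTransition.nonneg _) (Real.smoothTransition.nonneg _)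
lemma bb_zero : bb 0 = 1 := by
  unfold bb b1; rw [Real.smoothTransition.one_of_one_le (by norm_num), Real.smoothTransition.one_of_one_le (by norm_num), one_mul]
lemma bb_supp : HasCompactSupport bb := by
  refine HasCompactSupport.intro (isCompact_Icc (a := (-2:ℝ)) (b := 2)) fun x hx => ?_
  rw [Set.mem_Icc, not_and_or, not_le, not_le] at hx
  unfold bb b1
  rcases hx with h | h
  · rw [Real.smoothTransition.zero_of_nonpos (by linarith), zero_mul]
  · rw [Real.smoothTransition.zero_of_nonpos (x := 2 - x) (by linarith), mul_zero]
lemma b1_d1 {t : ℝ} (h : -1 < t) : deriv b1 t = 0 := by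
  have : b1 =ᶠ[𝓝 t] fun _ => 1 := by
    filter_upwards [lt_mem_nhds h] with s hs
    exact Real.smoothTransition.one_of_one_le (by linarith)
  rw [this.deriv_eq]; simp
lemma b1_supp : HasCompactSupport (deriv b1) := by
  refine HasCompactSupport.intro (isCompact_Icc (a := (-2:ℝ)) (b := 2)) fun x hx => ?_
  rw [Set.mem_Icc, not_and_or, not_le, not_le] at hx
  rcases hx with h | h
  · have : b1 =ᶠ[𝓝 x] fun _ => 0 := by
      filter_upwards [gt_mem_nhds h] with s hs
      exact Real.smoothTransition.zero_of_nonpos (by linarith)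
    rw [this.deriv_eq]; simp
  · exact b1_d1 (by linarith)
lemma bb_d {t : ℝ} (h : t < 0) : deriv bb t = deriv b1 t := by
  have : bb =ᶠ[𝓝 t] b1 := by
    filter_upwards [gt_mem_nhds h] with s hs
    unfold bb; rw [Real.smoothTransition.one_of_one_le (x := 2 - s) (by linarith), mul_one]
  exact this.deriv_eq

lemma half_test {m : E2 →L[ℝ] ℝ} {v : E2} (hv : m v ≠ 0) : ∃ Φ : E2 → ℝ, ContDiff ℝ 1 Φ ∧ HasCompactSupport Φ ∧
    ∫ z, Set.indicator {z | m z < 0} (fun z => fderiv ℝ Φ z v) z ≠ 0 := by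
  set s : E2 →L[ℝ] ℝ := innerSL ℝ (JJ v) with hs
  have hsv : s v = 0 := by simp [hs, inner2]; ring
  have hv0 : v ≠ 0 := by rintro rfl; simp at hv
  let L : E2 →ₗ[ℝ] ℝ × ℝ := (s : E2 →ₗ[ℝ] ℝ).prod (m : E2 →ₗ[ℝ] ℝ)
  have hL : LinearMap.ker L = ⊥ := by
    rw [LinearMap.ker_eq_bot']
    intro z hz
    have h1 : s z = 0 := congrArg Prod.fst hz
    have h2 : m z = 0 := congrArg Prod.snd hz
    have h3 : ⟪v, v⟫ • z = ⟪v, z⟫ • v := by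
      have : - v 1 * z 0 + v 0 * z 1 = 0 := by simpa [hs, inner2] using h1
      rw [inner2, inner2]
      refine ext2 ?_ ?_
      · simp; linear_combination (- v 1) * this
      · simp; linear_combination (v 0) * this
    have h4 : ⟪v, z⟫ * m v = 0 := by
      have := congrArg m h3
      simpa [h2] using this.symm
    have h5 : ⟪v, z⟫ = 0 := (mul_eq_zero.1 h4).resolve_right hv
    rw [h5, zero_smul] at h3
    exact (smul_eq_zero.1 h3).resolve_left (inner_self_ne_zero.2 hv0)
  have hemb : Topology.IsClosedEmbedding (fun z => (s z, m z)) := LinearMap.isClosedEmbedding_of_injective hL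
  have cs : ∀ β : ℝ → ℝ, HasCompactSupport β → HasCompactSupport (fun z => bb (s z) * β (m z)) := by
    intro β hβ
    have : HasCompactSupport (fun p : ℝ × ℝ => bb p.1 * β p.2) := by
      refine HasCompactSupport.intro (bb_supp.isCompact.prod hβ.isCompact) fun p hp => ?_
      rw [Set.mem_prod, not_and_or] at hp
      rcases hp with h | h
      · rw [image_eq_zero_of_notMem_tsupport h, zero_mul]
      · rw [image_eq_zero_of_notMem_tsupport h, mul_zero]
    have h := HasCompactSupport.comp_isClosedEmbedding this hemb
    exact h
  have c1 : ContDiff ℝ 1 bb := bb_cd.of_le (by exact_mod_cast le_top)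
  refine ⟨fun z => bb (s z) * bb (m z), (c1.comp s.contDiff).mul (c1.comp m.contDiff), cs bb bb_supp, ?_⟩
  have hd : ∀ z, fderiv ℝ (fun z => bb (s z) * bb (m z)) z v = bb (s z) * (deriv bb (m z) * m v) := by
    intro z
    have h1 := ((c1.differentiable (by norm_num) (s z)).hasDerivAt).comp_hasFDerivAt z s.hasFDerivAt
    have h2 := ((c1.differentiable (by norm_num) (m z)).hasDerivAt).comp_hasFDerivAt z m.hasFDerivAt
    have h3 := HasFDerivAt.mul h1 h2
    have h4 := h3.fderiv
    change fderiv ℝ (fun z => bb (s z) * bb (m z)) z = _ at h4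
    rw [h4]; simp [hsv]
  have he : ∀ z, Set.indicator {z | m z < 0} (fun z => fderiv ℝ (fun z => bb (s z) * bb (m z)) z v) z = m v * (bb (s z) * deriv b1 (m z)) := by
    intro z
    by_cases hz : m z < 0
    · rw [Set.indicator_of_mem (by exact hz), hd, bb_d hz]; ring
    · rw [Set.indicator_of_notMem (by exact hz), b1_d1 (by linarith)]; ring
  simp only [he]
  rw [integral_const_mul]
  refine mul_ne_zero hv (ne_of_gt ?_)
  obtain ⟨t, -, ht⟩ := exists_deriv_eq_slope b1 (by norm_num : (-2:ℝ) < -1) b1_cd.continuous.continuousOn (b1_cd.differentiable (by simp)).differentiableOn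
  have ht1 : deriv b1 t ≠ 0 := by
    rw [ht]; unfold b1
    rw [Real.smoothTransition.one_of_one_le (by norm_num), Real.smoothTransition.zero_of_nonpos (by norm_num)]; norm_num
  have hcd : Continuous (deriv b1) := b1_cd.continuous_deriv (by simp)
  have hcont : Continuous (fun z => bb (s z) * deriv b1 (m z)) := (bb_cd.continuous.comp s.continuous).mul (hcd.comp m.continuous)
  refine hcont.integral_pos_of_hasCompactSupport_nonneg_nonzero (x := (t / m v) • v) (cs _ b1_supp) (fun z => mul_nonneg (bb_nonneg _) (b1_d0 _)) ?_
  rw [map_smul, map_smul, hsv, smul_zero, bb_zero, smul_eq_mul, div_mul_cancel₀ _ hv, one_mul]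
  exact ht1

lemma CRep.neumann (R : CRep Ω f U w) (D : Dom Ω) (S : WSol Ω f U) {F : ℝ → ℝ} (hF : Continuous F) (hfF : ∀ᵐ y ∂mu Ω, f y = F (w y))
    {y : E2} (hy : y ∈ frontier Ω) {W : Set E2} {g : E2 → ℝ} (h : IsC2LocalDefining Ω y W g) :
    fderivWithin ℝ w (closure Ω) y (gradient g y) = 0 := by
  have hgy : g y = 0 := defining_zero D.o hy h
  set X := fderivWithin ℝ w (closure Ω) y with hX
  set v := (InnerProductSpace.toDual ℝ E2).symm X with hv
  have e : ∀ z, X z = ⟪v, z⟫ := fun z => by rw [hv, InnerProductSpace.toDual_symm_apply]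
  by_contra hne
  have hmv : fderiv ℝ g y v ≠ 0 := by
    rw [← gr_inner, real_inner_comm, ← e]; exact hne
  obtain ⟨Φ, h1, h2, h3⟩ := half_test hmv
  apply h3
  have h4 := R.half D S hF hfF hy h hgy h1 h2
  have h5 : (fun z => X (gradient Φ z)) = fun z => fderiv ℝ Φ z v := by
    ext z; rw [e, real_inner_comm, gr_inner]
  rw [← hX, h5] at h4
  exact h4

end NeuSec


noncomputable section FinalSec

lemma lap_const {Ω : Set E2} (ho : IsOpen Ω) {w : E2 → ℝ} {c : ℝ} (hc : ∀ x ∈ Ω, w x = c) {x : E2} (hx : x ∈ Ω) : lap w x = 0 := by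
  have h0 : ∀ y ∈ Ω, fderiv ℝ w y = 0 := by
    intro y hy
    have : w =ᶠ[𝓝 y] fun _ => c := by filter_upwards [ho.mem_nhds hy] with z hz using hc z hz
    rw [this.fderiv_eq]; simp
  unfold lap
  refine Finset.sum_eq_zero fun i _ => ?_
  have : (fun y => fderiv ℝ w y (EuclideanSpace.single i (1 : ℝ))) =ᶠ[𝓝 x] fun _ => 0 := by
    filter_upwards [ho.mem_nhds hx] with z hz
    rw [h0 z hz]; simp
  rw [this.fderiv_eq]; simp

theorem main_thm (Ω : Set E2) (D : Dom Ω) (hΩ_conn : IsConnected Ω) (a : ℝ) (ha : 1 < a) :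
    ∃ ε₀ : ℝ, 0 < ε₀ ∧ ∀ ε : ℝ, 0 < ε → ε < ε₀ →
      ∃ u : E2 → ℝ,
        ContDiffOn ℝ 2 u Ω ∧ ContDiffOn ℝ 1 u (closure Ω) ∧
        (∀ x ∈ Ω, -(ε * lap u x) = Real.exp (u x) - 1 - a * u x) ∧
        (∀ x ∈ Ω, 0 < u x) ∧
        (∀ x ∈ frontier Ω, ∀ U g, IsC2LocalDefining Ω x U g →
          fderivWithin ℝ u (closure Ω) x (gradient g x) = 0) ∧
        ¬ ∃ c : ℝ, ∀ x ∈ Ω, u x = c := by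
  have hb : 0 < a - 1 := by linarith
  obtain ⟨C0, ε1, hC0, hε1, hlev⟩ := D.level hb hΩ_conn.nonempty
  have hlog : 0 < Real.log a := Real.log_pos ha
  have hvol : 0 < volume.real Ω := ENNReal.toReal_pos (D.o.measure_pos volume hΩ_conn.nonempty).ne' D.b.measure_lt_top.ne
  set κ := (a - 1) * (Real.log a ^ 2 * volume.real Ω) with hκ
  have hκ0 : 0 < κ := by positivity
  refine ⟨min ε1 (κ / C0), lt_min hε1 (by positivity), fun ε hε hlt => ?_⟩
  obtain ⟨B, hB0, hB⟩ := D.sup_bound hε hb (C0 * ε)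
  obtain ⟨U, hU, hw, hq0, hq⟩ := hlev ε hε (hlt.trans_le (min_le_left _ _)) B hB0
  have hbd := hB B hB0 U hU hw hq
  have hnn := D.nonneg hε hb hB0 hU hw
  let F : ℝ → ℝ := fun t => (Real.exp t - 1 - a * t) / ε
  have hF : ContDiff ℝ 1 F := by fun_prop
  have hfu : ∀ᵐ y ∂mu Ω, ff B ε (a - 1) U y = F (uu U y) := by
    filter_upwards [hbd, hnn] with y h1 h2
    simp only [ff, F]
    rw [hM_eq h2 ((le_abs_self _).trans h1)]; ring
  have S : WSol Ω (ff B ε (a - 1) U) U := ⟨hU, D.dat hε hb hB0 hU, D.hw hε hB0 hU hw⟩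
  obtain ⟨K, hK⟩ := (isCompact_Icc (a := -B) (b := B)).exists_bound_of_continuousOn hF.continuous.continuousOn
  obtain ⟨w, R⟩ := D.exists_C1 S (A := ENNReal.ofReal K + ENNReal.ofReal B) (by simp) (by
    filter_upwards [hbd, hfu] with y h1 h2
    rw [h2, ← ofReal_norm, ← ofReal_norm]
    exact add_le_add (ENNReal.ofReal_le_ofReal (hK _ (abs_le.1 h1))) (ENNReal.ofReal_le_ofReal h1))
  have hfF : ∀ᵐ y ∂mu Ω, ff B ε (a - 1) U y = F (w y) := by
    filter_upwards [hfu, R.ae0] with y h1 h2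
    rw [h1, h2]
  have hc2 := R.c2 D S hF hfF
  have heq := R.eqn D S hF hfF
  have hcw : ContinuousOn w (closure Ω) := R.c1.continuousOn
  have hw0 : ∀ x ∈ Ω, 0 ≤ w x := by
    intro x hx
    have := eq_of_ae (g := w) (h := fun x => |w x|) D.o isOpen_univ (hcw.mono Set.inter_subset_left) (hcw.abs.mono Set.inter_subset_left) (by
      filter_upwards [hnn, R.ae0] with y h1 h2 _
      rw [h2, abs_of_nonneg h1]) x (subset_closure hx) trivial
    rw [this]; exact abs_nonneg _
  have hpos : ∀ x ∈ Ω, 0 < w x := by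
    refine strong_max D.o hΩ_conn hc2 hw0 (l := (a - 1) / ε) (by positivity) ?_ ?_
    · intro x hx
      rw [heq x hx, div_mul_eq_mul_div, ← neg_div]
      refine div_le_div_of_nonneg_right ?_ hε.le
      linarith [Real.add_one_le_exp (w x)]
    · by_contra! hz
      have h0 : qq ε (a - 1) U = 0 := by
        rw [show qq ε (a - 1) U = BB ε (a - 1) U U from rfl, hw U hU, Jh]
        refine integral_eq_zero_of_ae ?_
        filter_upwards [R.ae0, ae_restrict_mem D.o.measurableSet] with x h1 h2
        rw [← h1, hz x h2]; simp
      linarith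
  refine ⟨w, hc2, R.c1, ?_, hpos, fun x hx W g h => R.neumann D S hF.continuous hfF hx h, ?_⟩
  · intro x hx
    rw [heq x hx]; simp only [F]; field_simp
  · rintro ⟨c, hc⟩
    obtain ⟨x, hx⟩ := hΩ_conn.nonempty
    have hc0 : 0 < c := by rw [← hc x hx]; exact hpos x hx
    have h1 := heq x hx
    rw [lap_const D.o hc hx, hc x hx] at h1
    have h2 : Real.exp c - 1 - a * c = 0 := by
      have : F c = 0 := by linarith
      exact (div_eq_zero_iff.1 this).resolve_right hε.ne'
    have h3 : Real.log a ≤ c := by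
      by_contra! h
      have h4 : Real.exp c < a := by rw [← Real.exp_log (by linarith : 0 < a)]; exact Real.exp_lt_exp.2 h
      have h5 := mul_le_mul_of_nonneg_left (Real.add_one_le_exp (-c)) (Real.exp_pos c).le
      rw [← Real.exp_add, add_neg_cancel, Real.exp_zero] at h5
      nlinarith [mul_lt_mul_of_pos_right h4 hc0]
    have h6 : ‖U.fst‖ ^ 2 = c ^ 2 * volume.real Ω := by
      rw [← real_inner_self_eq_norm_sq, L2.inner_def]
      have : ∫ y in Ω, ⟪U.fst y, U.fst y⟫ = ∫ y in Ω, c ^ 2 := by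
        refine integral_congr_ae ?_
        filter_upwards [R.ae0, ae_restrict_mem D.o.measurableSet] with y a1 a2
        rw [hc y a2] at a1
        rw [show U.fst y = c from a1.symm]; simp [sq]
      rw [this]; simp [mul_comm]
    have h7 := qq_eq (ε := ε) (b := a - 1) U
    rw [h6] at h7
    have h8 : κ ≤ C0 * ε := by
      have : Real.log a ^ 2 * volume.real Ω ≤ c ^ 2 * volume.real Ω := by gcongr
      have := mul_le_mul_of_nonneg_left this hb.le
      have h9 : 0 ≤ ε * ‖U.snd‖ ^ 2 := by positivity
      linarith
    have h9 := hlt.trans_le (min_le_right _ _)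
    rw [lt_div_iff₀ hC0] at h9
    linarith

end FinalSec

end Grp8

/-- For `a > 1` and a bounded connected open `Ω ⊆ ℝ²` with `C²` boundary,
there is `ε₀ > 0` such that for every `0 < ε < ε₀` the Neumann problem
`-εΔu = e^u - 1 - a u` in `Ω`, `u > 0` in `Ω`, `∂_ν u = 0` on `∂Ω`, admits a nonconstant
classical solution (of class `C²` in `Ω` and `C¹` up to the boundary; the Neumann
condition says that the derivative of `u` in the direction of the outward normal — the
gradient of any local defining function — vanishes). -/
theorem stmt_6 (Ω : Set (EuclideanSpace ℝ (Fin 2))) (hΩ_open : IsOpen Ω)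
    (hΩ_bdd : IsBounded Ω) (hΩ_conn : IsConnected Ω)
    (hΩ_bdy : ∀ x ∈ frontier Ω, ∃ U g, IsC2LocalDefining Ω x U g)
    (a : ℝ) (ha : 1 < a) :
    ∃ ε₀ : ℝ, 0 < ε₀ ∧ ∀ ε : ℝ, 0 < ε → ε < ε₀ →
      ∃ u : EuclideanSpace ℝ (Fin 2) → ℝ,
        ContDiffOn ℝ 2 u Ω ∧ ContDiffOn ℝ 1 u (closure Ω) ∧
        (∀ x ∈ Ω, -(ε * lap u x) = Real.exp (u x) - 1 - a * u x) ∧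
        (∀ x ∈ Ω, 0 < u x) ∧
        (∀ x ∈ frontier Ω, ∀ U g, IsC2LocalDefining Ω x U g →
          fderivWithin ℝ u (closure Ω) x (gradient g x) = 0) ∧
        ¬ ∃ c : ℝ, ∀ x ∈ Ω, u x = c := by
  exact main_thm Ω ⟨hΩ_open, hΩ_bdd, hΩ_bdy⟩ hΩ_conn a ha
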